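/- (Finite speed of disturbance for the Schrödinger equation with harmonic potential.) Let d ≥ 1, λ ∈ ℝ, and let v : ℝ → 𝒮(ℝ^d; ℂ) be a map into the Schwartz space, smooth as a curve in Schwartz space, satisfying ∂_t v(t,x) = i · (Δ_x v(t,x) − |x|² v(t,x) + λ |v(t,x)|^{4/d} v(t,x)) for all (t,x) ∈ ℝ × ℝ^d. Let A, B ⊆ ℝ^d be nonempty sets with dist(A,B) > 0. Then for every t ≥ 0, ‖v(t)‖_{L²(B)} ≤ (2 t sup_{s ∈ [0,t]} ‖∇v(s)‖_{L²(ℝ^d)}) / dist(A,B) + ‖v(0)‖_{L²(ℝ^d ∖ A)}. -/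

import Mathlib

open MeasureTheory Filter
open scoped RealInnerProductSpace

noncomputable section

abbrev Ed (d : ℕ) : Type := EuclideanSpace ℝ (Fin d)

/-- The `i`-th standard basis vector of `ℝ^d`. -/
def stdBasis {d : ℕ} (i : Fin d) : Ed d := EuclideanSpace.single i 1

/-- The `i`-th spatial partial derivative. -/
def pd {d : ℕ} (f : Ed d → ℂ) (i : Fin d) (x : Ed d) : ℂ :=
  fderiv ℝ f x (stdBasis i)

/-- The spatial Laplacian. -/
def lap {d : ℕ} (f : Ed d → ℂ) (x : Ed d) : ℂ :=
  ∑ i, pd (pd f i) i x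

/-- Squared (Euclidean) pointwise norm of the spatial gradient. -/
def gradNormSq {d : ℕ} (f : Ed d → ℂ) (x : Ed d) : ℝ :=
  ∑ i, ‖pd f i x‖ ^ 2

/-- `L²` norm of `f` restricted to a set `s`. -/
def L2On {d : ℕ} (s : Set (Ed d)) (f : Ed d → ℂ) : ℝ :=
  (∫ x in s, ‖f x‖ ^ 2) ^ (1/2 : ℝ)

/-- `L²` norm of `f` on all of `ℝ^d`. -/
def L2 {d : ℕ} (f : Ed d → ℂ) : ℝ :=
  (∫ x, ‖f x‖ ^ 2) ^ (1/2 : ℝ)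

/-- `L²` norm of the spatial gradient of `f`. -/
def gradL2 {d : ℕ} (f : Ed d → ℂ) : ℝ :=
  (∫ x, gradNormSq f x) ^ (1/2 : ℝ)

/-- Distance between two sets. -/
def setDist {d : ℕ} (A B : Set (Ed d)) : ℝ :=
  sInf (Set.image2 dist A B)

/-- A Schwartz solution of the linear Schrödinger equation:
smooth in time-space and `∂ₜ u = i Δ u`. -/
def IsLinSchrodSol (d : ℕ) (u : ℝ → SchwartzMap (Ed d) ℂ) : Prop :=
  ContDiff ℝ (⊤ : ℕ∞) (fun p : ℝ × Ed d => u p.1 p.2) ∧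
  ∀ t x, deriv (fun s => u s x) t = Complex.I * lap (u t) x

/-- A Schwartz solution of the nonlinear Schrödinger equation with parameters `lam, σ`:
smooth in time-space and `∂ₜ u = i (Δ u + lam |u|^σ u)`. -/
def IsNLSSol (d : ℕ) (lam σ : ℝ) (u : ℝ → SchwartzMap (Ed d) ℂ) : Prop :=
  ContDiff ℝ (⊤ : ℕ∞) (fun p : ℝ × Ed d => u p.1 p.2) ∧
  ∀ t x, deriv (fun s => u s x) t =
    Complex.I * (lap (u t) x + ((lam * ‖u t x‖ ^ σ : ℝ) : ℂ) * u t x)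

namespace HS

/-- differentiate a compactly supported weighted integral in time -/
theorem hasDerivAt_cpt {d : ℕ} (k : Ed d → ℝ) (hk : Continuous k) (hks : HasCompactSupport k)
    (G : ℝ → Ed d → ℝ) (hG : ContDiff ℝ 1 (fun p : ℝ × Ed d => G p.1 p.2)) (t : ℝ) :
    HasDerivAt (fun t => ∫ x, k x * G t x) (∫ x, k x * deriv (fun s => G s x) t) t := by
  have hGx : ∀ s x, HasDerivAt (fun s => G s x)
      (fderiv ℝ (fun p : ℝ × Ed d => G p.1 p.2) (s, x) (1, 0)) s := by
    intro s x
    have h1 : HasFDerivAt (fun p : ℝ × Ed d => G p.1 p.2) _ (s, x) :=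
      (hG.differentiable (by simp) (s, x)).hasFDerivAt
    have h2 : HasDerivAt (fun s : ℝ => (s, x)) (1, 0) s :=
      (hasDerivAt_id s).prodMk (hasDerivAt_const s x)
    exact h1.comp_hasDerivAt s h2
  have hcont : Continuous (fun p : ℝ × Ed d => deriv (fun s => G s p.2) p.1) := by
    have h3 : (fun p : ℝ × Ed d => deriv (fun s => G s p.2) p.1) = fun p : ℝ × Ed d =>
        fderiv ℝ (fun p : ℝ × Ed d => G p.1 p.2) p (1, 0) := by
      funext p; exact (hGx p.1 p.2).deriv
    rw [h3]
    exact (hG.continuous_fderiv (by simp)).clm_apply continuous_const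
  have hGc : ∀ s, Continuous (G s) := fun s => hG.continuous.comp (by fun_prop : Continuous fun x : Ed d => (s, x))
  obtain ⟨C, hC⟩ := ((isCompact_Icc (a := t - 1) (b := t + 1)).prod hks).exists_bound_of_continuousOn
    (f := fun p : ℝ × Ed d => deriv (fun s => G s p.2) p.1) hcont.continuousOn
  refine (hasDerivAt_integral_of_dominated_loc_of_deriv_le (s := Set.Icc (t - 1) (t + 1))
    (bound := fun x => ‖k x‖ * C) (F' := fun s x => k x * deriv (fun s => G s x) s)
    (Icc_mem_nhds (by linarith) (by linarith)) ?_ ?_ ?_ ?_ ?_ ?_).2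
  · exact Eventually.of_forall fun s => (hk.mul (hGc s)).aestronglyMeasurable
  · exact (hk.mul (hGc t)).integrable_of_hasCompactSupport hks.mul_right
  · exact (hk.mul (hcont.comp (by fun_prop : Continuous fun x : Ed d => (t, x)))).aestronglyMeasurable
  · refine Eventually.of_forall fun x s hs => ?_
    rw [norm_mul]
    by_cases hx : x ∈ tsupport k
    · exact mul_le_mul_of_nonneg_left (hC (s, x) ⟨hs, hx⟩) (norm_nonneg _)
    · rw [image_eq_zero_of_notMem_tsupport hx]; simp
  · exact (hk.norm.mul continuous_const).integrable_of_hasCompactSupport hks.norm.mul_right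
  · refine Eventually.of_forall fun x s hs => ?_
    exact ((hGx s x).deriv ▸ hGx s x).const_mul (k x)

/-- square of Lipschitz compactly supported is Lipschitz -/
theorem lip_sq {d : ℕ} {θ : Ed d → ℝ} {L : NNReal} (hθ : LipschitzWith L θ)
    (hs : HasCompactSupport θ) : ∃ L' : NNReal, LipschitzWith L' (fun x => θ x ^ 2) := by
  obtain ⟨C, hC⟩ := hs.exists_bound_of_continuous hθ.continuous
  have hC0 : 0 ≤ C := (norm_nonneg _).trans (hC 0)
  refine ⟨Real.toNNReal (2 * C * L), LipschitzWith.of_dist_le_mul fun x y => ?_⟩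
  rw [Real.coe_toNNReal _ (by positivity)]
  have h1 := hθ.dist_le_mul x y
  rw [Real.dist_eq] at h1 ⊢
  have : θ x ^ 2 - θ y ^ 2 = (θ x + θ y) * (θ x - θ y) := by ring
  rw [this, abs_mul]
  have h2 : |θ x + θ y| ≤ 2 * C := by
    have := abs_add_le (θ x) (θ y); have := hC x; have := hC y
    simp only [Real.norm_eq_abs] at *; linarith
  calc _ ≤ 2 * C * (L * dist x y) := mul_le_mul h2 h1 (abs_nonneg _) (by positivity)
    _ = _ := by ring

theorem ibp_lip {d : ℕ} {θ : Ed d → ℝ} {L : NNReal} (hθ : LipschitzWith L θ)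
    (hs : HasCompactSupport θ) (g : Ed d → ℝ) (hg : ContDiff ℝ 1 g) (e : Ed d) :
    ∫ x, θ x ^ 2 * fderiv ℝ g x e = - ∫ x, 2 * θ x * lineDeriv ℝ θ x e * g x := by
  obtain ⟨L', hL'⟩ := lip_sq hθ hs
  obtain ⟨R, hR⟩ := (hs.isCompact.isBounded).subset_closedBall (0 : Ed d)
  let R' := max R 1
  have hR' : 0 < R' := lt_of_lt_of_le one_pos (le_max_right _ _)
  let χ : ContDiffBump (0 : Ed d) := ⟨R' + 1, R' + 2, by positivity, by linarith⟩
  have hχ : ∀ x ∈ tsupport θ, (fun y => χ y * g y) =ᶠ[nhds x] g := by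
    intro x hx
    have hx' : x ∈ Metric.ball (0 : Ed d) (R' + 1) := by
      have := hR hx
      simp only [Metric.mem_closedBall, dist_zero_right, Metric.mem_ball] at *
      have := le_max_left R 1
      change _ < R' + 1
      linarith
    filter_upwards [Metric.isOpen_ball.mem_nhds hx'] with y hy
    rw [χ.one_of_mem_closedBall (Metric.ball_subset_closedBall hy), one_mul]
  have hχg : ContDiff ℝ 1 (fun y => χ y * g y) := χ.contDiff.mul hg
  have hcs : HasCompactSupport (fun y => χ y * g y) := χ.hasCompactSupport.mul_right
  obtain ⟨D, hD⟩ := hχg.lipschitzWith_of_hasCompactSupport hcs (by simp)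
  have key := hL'.integral_lineDeriv_mul_eq (μ := volume) hD hcs e
  have e1 : ∫ x, lineDeriv ℝ (fun x => θ x ^ 2) x e * (χ x * g x)
      = ∫ x, 2 * θ x * lineDeriv ℝ θ x e * g x := by
    refine integral_congr_ae ?_
    filter_upwards [hθ.ae_differentiableAt] with x hx
    have h1 : lineDeriv ℝ (fun x => θ x ^ 2) x e = 2 * θ x * lineDeriv ℝ θ x e := by
      have h2 := hx.hasFDerivAt.pow 2
      rw [h2.hasLineDerivAt e |>.lineDeriv, (hx.hasFDerivAt.hasLineDerivAt e).lineDeriv]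
      simp
    rw [h1]
    by_cases hx' : x ∈ tsupport θ
    · rw [(hχ x hx').eq_of_nhds]
    · rw [image_eq_zero_of_notMem_tsupport hx']; simp
  have e2 : ∫ x, lineDeriv ℝ (fun y => χ y * g y) x (-e) * θ x ^ 2
      = - ∫ x, θ x ^ 2 * fderiv ℝ g x e := by
    rw [← integral_neg]
    refine integral_congr_ae (Eventually.of_forall fun x => ?_)
    simp only
    by_cases hx' : x ∈ tsupport θ
    · rw [(((hχg.differentiable (by simp)) x).hasFDerivAt.hasLineDerivAt (-e)).lineDeriv,
        (hχ x hx').fderiv_eq]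
      simp; ring
    · rw [image_eq_zero_of_notMem_tsupport hx']; simp
  rw [e1, e2] at key
  linarith

end HS

namespace HS
open Complex ComplexConjugate

theorem pd_contDiff {d : ℕ} {f : Ed d → ℂ} (hf : ContDiff ℝ (⊤ : ℕ∞) f) (i : Fin d) :
    ContDiff ℝ (⊤ : ℕ∞) (pd f i) := by
  unfold pd
  exact (hf.fderiv_right (m := (⊤ : ℕ∞)) (by simp)).clm_apply contDiff_const

theorem im_fderiv {d : ℕ} {f : Ed d → ℂ} (hf : ContDiff ℝ (⊤ : ℕ∞) f) (i : Fin d) (x : Ed d) :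
    fderiv ℝ (fun x => (conj (f x) * pd f i x).im) x (stdBasis i)
      = (conj (f x) * pd (pd f i) i x).im := by
  have h1 : HasFDerivAt f (fderiv ℝ f x) x := (hf.differentiable (by simp) x).hasFDerivAt
  have h2 : HasFDerivAt (pd f i) (fderiv ℝ (pd f i) x) x :=
    ((pd_contDiff hf i).differentiable (by simp) x).hasFDerivAt
  have h3 : HasFDerivAt (fun x => conj (f x)) ((conjCLE : ℂ →L[ℝ] ℂ).comp (fderiv ℝ f x)) x :=
    (conjCLE : ℂ →L[ℝ] ℂ).hasFDerivAt.comp x h1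
  have h4 := imCLM.hasFDerivAt.comp x (h3.mul h2)
  have h5 : (fun x => (conj (f x) * pd f i x).im) = (imCLM ∘ ((fun x => conj (f x)) * pd f i)) := rfl
  rw [h5, h4.fderiv]
  simp only [ContinuousLinearMap.comp_apply, ContinuousLinearMap.add_apply,
    ContinuousLinearMap.smul_apply, smul_eq_mul, imCLM_apply, ContinuousLinearEquiv.coe_coe,
    conjCLE_apply]
  change (conj (f x) * pd (pd f i) i x + pd f i x * conj (pd f i x)).im = _
  rw [mul_conj]
  simp

theorem slice_contDiff {d : ℕ} {w : ℝ → Ed d → ℂ}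
    (hw : ContDiff ℝ (⊤ : ℕ∞) (fun p : ℝ × Ed d => w p.1 p.2)) (t : ℝ) :
    ContDiff ℝ (⊤ : ℕ∞) (w t) :=
  hw.comp (contDiff_prodMk_right t)

theorem time_hasDerivAt {d : ℕ} {w : ℝ → Ed d → ℂ}
    (hw : ContDiff ℝ (⊤ : ℕ∞) (fun p : ℝ × Ed d => w p.1 p.2)) (t : ℝ) (x : Ed d) :
    HasDerivAt (fun s => w s x) (deriv (fun s => w s x) t) t :=
  (((hw.comp (contDiff_prodMk_left x)).differentiable (by simp)) t).hasDerivAt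

theorem normsq_contDiff {d : ℕ} {w : ℝ → Ed d → ℂ}
    (hw : ContDiff ℝ (⊤ : ℕ∞) (fun p : ℝ × Ed d => w p.1 p.2)) :
    ContDiff ℝ 1 (fun p : ℝ × Ed d => (fun t x => ‖w t x‖ ^ 2) p.1 p.2) :=
  (hw.of_le (by exact_mod_cast le_top)).norm_sq ℝ

theorem normsq_deriv {d : ℕ} {w : ℝ → Ed d → ℂ}
    (hw : ContDiff ℝ (⊤ : ℕ∞) (fun p : ℝ × Ed d => w p.1 p.2)) (t : ℝ) (x : Ed d) :
    deriv (fun s => ‖w s x‖ ^ 2) t = 2 * (conj (w t x) * deriv (fun s => w s x) t).re := by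
  have h := (time_hasDerivAt hw t x).norm_sq
  rw [h.deriv]
  simp [Complex.inner, mul_comm]

/-- localized mass law -/
theorem LM {d : ℕ} {w : ℝ → Ed d → ℂ}
    (hw : ContDiff ℝ (⊤ : ℕ∞) (fun p : ℝ × Ed d => w p.1 p.2))
    {θ : Ed d → ℝ} {L : NNReal} (hθ : LipschitzWith L θ) (hs : HasCompactSupport θ)
    (t : ℝ) (r : Ed d → ℝ) (F : Ed d → ℂ) (hF : Continuous F)
    (heq : ∀ x, deriv (fun s => w s x) t = I * lap (w t) x + I * (r x : ℂ) * w t x + F x) :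
    HasDerivAt (fun t => ∫ x, θ x ^ 2 * ‖w t x‖ ^ 2)
      (4 * (∫ x, θ x * ∑ i, lineDeriv ℝ θ x (stdBasis i) * (conj (w t x) * pd (w t) i x).im)
        + 2 * ∫ x, θ x ^ 2 * (conj (w t x) * F x).re) t := by
  have hwt := slice_contDiff hw t
  have hk : Continuous (fun x => θ x ^ 2) := hθ.continuous.pow 2
  have hks : HasCompactSupport (fun x => θ x ^ 2) := by
    have : (fun x => θ x ^ 2) = fun x => θ x * θ x := by funext x; ring
    rw [this]; exact hs.mul_right
  have h := hasDerivAt_cpt _ hk hks (fun t x => ‖w t x‖ ^ 2) (normsq_contDiff hw) t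
  convert h using 1
  simp only [normsq_deriv hw]
  have hci : ∀ i, Continuous (fun x => (conj (w t x) * pd (pd (w t) i) i x).im) := fun i =>
    continuous_im.comp ((continuous_conj.comp hwt.continuous).mul
      (pd_contDiff (pd_contDiff hwt i) i).continuous)
  have hcF : Continuous (fun x => (conj (w t x) * F x).re) :=
    continuous_re.comp ((continuous_conj.comp hwt.continuous).mul hF)
  have hpt : ∀ x, θ x ^ 2 * (2 * (conj (w t x) * deriv (fun s => w s x) t).re)
      = (-2) * (∑ i, θ x ^ 2 * fderiv ℝ (fun x => (conj (w t x) * pd (w t) i x).im) x (stdBasis i))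
        + 2 * (θ x ^ 2 * (conj (w t x) * F x).re) := by
    intro x
    rw [heq x]
    simp only [im_fderiv hwt]
    rw [← Finset.mul_sum]
    have h1 : ∑ i, (conj (w t x) * pd (pd (w t) i) i x).im = (conj (w t x) * lap (w t) x).im := by
      unfold lap; rw [Finset.mul_sum, Complex.im_sum]
    rw [h1]
    simp
    ring
  have hint : ∀ i, Integrable (fun x => θ x ^ 2 *
      fderiv ℝ (fun x => (conj (w t x) * pd (w t) i x).im) x (stdBasis i)) := by
    intro i
    simp only [im_fderiv hwt]
    exact (hk.mul (hci i)).integrable_of_hasCompactSupport hks.mul_right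
  have hintF : Integrable (fun x => θ x ^ 2 * (conj (w t x) * F x).re) :=
    (hk.mul hcF).integrable_of_hasCompactSupport hks.mul_right
  rw [integral_congr_ae (Eventually.of_forall hpt), integral_add
    ((integrable_finset_sum _ fun i _ => hint i).const_mul _) (hintF.const_mul _),
    integral_const_mul, integral_const_mul, integral_finset_sum _ fun i _ => hint i]
  congr 1
  have hg : ∀ i, ContDiff ℝ 1 (fun x => (conj (w t x) * pd (w t) i x).im) := fun i =>
    (imCLM.contDiff.comp ((conjCLE.contDiff.comp hwt).mul (pd_contDiff hwt i))).of_le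
      (by exact_mod_cast le_top)
  simp only [fun i => ibp_lip hθ hs _ (hg i) (stdBasis i)]
  have hint2 : ∀ i, Integrable (fun x => 2 * θ x * lineDeriv ℝ θ x (stdBasis i) *
      (conj (w t x) * pd (w t) i x).im) := by
    intro i
    have h2 : Integrable (fun x => 2 * (θ x * (conj (w t x) * pd (w t) i x).im)) :=
      ((hθ.continuous.mul (hg i).continuous).integrable_of_hasCompactSupport hs.mul_right).const_mul 2
    have h3 := h2.bdd_mul (c := L * ‖(stdBasis i : Ed d)‖) (f := fun x => lineDeriv ℝ θ x (stdBasis i))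
      (hθ.locallyIntegrable_lineDeriv (stdBasis i)).aestronglyMeasurable
      (Eventually.of_forall fun x => norm_lineDeriv_le_of_lipschitz ℝ hθ)
    refine h3.congr (Eventually.of_forall fun x => ?_)
    simp only; ring
  rw [Finset.sum_neg_distrib, ← integral_finset_sum _ fun i _ => hint2 i]
  rw [← integral_const_mul, mul_neg, ← neg_mul, neg_neg, ← integral_const_mul]
  congr 1; funext x
  rw [Finset.mul_sum, Finset.mul_sum, Finset.mul_sum]
  refine Finset.sum_congr rfl fun i _ => ?_
  ring

end HS

namespace HS
open Complex ComplexConjugate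

/-- the exponent -/
abbrev sg (d : ℕ) : ℝ := (4 : ℝ) / d

/-- solutions of the equation, Schwartz at each time and jointly smooth -/
structure IsSol {d : ℕ} (lam : ℝ) (v : ℝ → SchwartzMap (Ed d) ℂ) : Prop where
  smooth : ContDiff ℝ (⊤ : ℕ∞) (fun p : ℝ × Ed d => v p.1 p.2)
  eq : ∀ t x, deriv (fun s => v s x) t =
      Complex.I * (lap (v t) x - ((‖x‖ ^ 2 : ℝ) : ℂ) * v t x +
        ((lam * ‖v t x‖ ^ sg d : ℝ) : ℂ) * v t x)

/-- mass -/
def M {d : ℕ} (u : SchwartzMap (Ed d) ℂ) : ℝ := ∫ x, ‖u x‖ ^ 2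
/-- variance -/
def V {d : ℕ} (u : SchwartzMap (Ed d) ℂ) : ℝ := ∫ x, ‖x‖ ^ 2 * ‖u x‖ ^ 2
/-- kinetic energy -/
def S2 {d : ℕ} (u : SchwartzMap (Ed d) ℂ) : ℝ := ∫ x, gradNormSq u x

theorem ode_sqrt {m m' : ℝ → ℝ} {s t c : ℝ} (hst : s ≤ t) (hm : ∀ τ ∈ Set.Icc s t, HasDerivAt m (m' τ) τ)
    (h0 : ∀ τ, 0 ≤ m τ) (hc : 0 ≤ c) (hb : ∀ τ ∈ Set.Icc s t, |m' τ| ≤ 2 * c * √(m τ)) :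
    |√(m t) - √(m s)| ≤ c * (t - s) := by
  have key : ∀ ε > 0, |√(m t + ε) - √(m s + ε)| ≤ c * (t - s) := by
    intro ε hε
    have hd : ∀ τ ∈ Set.Icc s t, HasDerivWithinAt (fun τ => √(m τ + ε))
        (m' τ / (2 * √(m τ + ε))) (Set.Icc s t) τ := by
      intro τ hτ
      have := h0 τ
      exact (((hm τ hτ).add_const ε).sqrt (by linarith)).hasDerivWithinAt
    have := norm_image_sub_le_of_norm_deriv_le_segment' (C := c) hd (fun τ hτ => ?_) t ⟨hst, le_rfl⟩
    · simpa [Real.norm_eq_abs] using this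
    · have h1 := hb τ ⟨hτ.1, hτ.2.le⟩
      have h2 := h0 τ
      have h3 : 0 < √(m τ + ε) := Real.sqrt_pos.2 (by linarith)
      have h4 : √(m τ) ≤ √(m τ + ε) := Real.sqrt_le_sqrt (by linarith)
      rw [Real.norm_eq_abs, abs_div, abs_of_pos (by positivity : 0 < 2 * √(m τ + ε)),
        div_le_iff₀ (by positivity)]
      calc _ ≤ 2 * c * √(m τ) := h1
        _ ≤ 2 * c * √(m τ + ε) := by gcongr
        _ = _ := by ring
  have hlim : Tendsto (fun ε : ℝ => |√(m t + ε) - √(m s + ε)|) (nhdsWithin 0 (Set.Ioi 0))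
      (nhds |√(m t + 0) - √(m s + 0)|) := by
    apply Tendsto.mono_left _ nhdsWithin_le_nhds
    have : Continuous (fun ε : ℝ => |√(m t + ε) - √(m s + ε)|) := by fun_prop
    exact this.tendsto 0
  simp only [add_zero] at hlim
  exact le_of_tendsto hlim (eventually_nhdsWithin_of_forall fun ε hε => key ε hε)

theorem lip_grad_sq {d : ℕ} {θ : Ed d → ℝ} {L : NNReal} (hθ : LipschitzWith L θ) :
    ∀ᵐ x : Ed d, ∑ i, (lineDeriv ℝ θ x (stdBasis i)) ^ 2 ≤ (L : ℝ) ^ 2 := by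
  filter_upwards [hθ.ae_differentiableAt] with x hx
  have h1 : ∀ i, lineDeriv ℝ θ x (stdBasis i) = fderiv ℝ θ x (stdBasis i) := fun i =>
    (hx.hasFDerivAt.hasLineDerivAt _).lineDeriv
  simp only [h1]
  set l := fderiv ℝ θ x
  set a : Ed d := WithLp.toLp 2 (fun i => l (stdBasis i)) with ha
  have h2 : l a = ∑ i, l (stdBasis i) ^ 2 := by
    have : a = ∑ i, l (stdBasis i) • stdBasis i := by
      ext j
      simp [ha, stdBasis, Pi.single_apply]
    rw [this, map_sum]
    refine Finset.sum_congr rfl fun i _ => ?_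
    rw [map_smul, smul_eq_mul, sq]
  have h3 : ‖a‖ ^ 2 = ∑ i, l (stdBasis i) ^ 2 := by
    rw [EuclideanSpace.norm_sq_eq]; simp [ha]
  have h4 : l a ≤ L * ‖a‖ := by
    calc l a ≤ ‖l a‖ := Real.le_norm_self _
      _ ≤ ‖l‖ * ‖a‖ := l.le_opNorm a
      _ ≤ L * ‖a‖ := by
        gcongr
        exact norm_fderiv_le_of_lipschitz ℝ hθ
  rw [← h3]; rw [h2, ← h3] at h4
  have h5 : ‖a‖ ≤ L := by
    by_contra hcon
    push Not at hcon
    have : (0:ℝ) ≤ L := L.2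
    nlinarith [norm_nonneg a]
  gcongr

/-- pointwise flux bound -/
theorem flux_pt {d : ℕ} {a : Fin d → ℝ} {L : ℝ} (hL : 0 ≤ L) (ha : ∑ i, a i ^ 2 ≤ L ^ 2)
    (z : ℂ) (b : Fin d → ℂ) :
    |∑ i, a i * (conj z * b i).im| ≤ L * ‖z‖ * √(∑ i, ‖b i‖ ^ 2) := by
  calc |∑ i, a i * (conj z * b i).im| ≤ ∑ i, |a i| * (‖z‖ * ‖b i‖) := by
        refine (Finset.abs_sum_le_sum_abs _ _).trans (Finset.sum_le_sum fun i _ => ?_)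
        rw [abs_mul]
        gcongr
        refine (abs_im_le_norm _).trans ?_
        rw [norm_mul, norm_conj]
    _ = ‖z‖ * ∑ i, |a i| * ‖b i‖ := by
        rw [Finset.mul_sum]; exact Finset.sum_congr rfl fun i _ => by ring
    _ ≤ ‖z‖ * (√(∑ i, |a i| ^ 2) * √(∑ i, ‖b i‖ ^ 2)) := by
        gcongr; exact Real.sum_mul_le_sqrt_mul_sqrt _ _ _
    _ ≤ ‖z‖ * (L * √(∑ i, ‖b i‖ ^ 2)) := by
        gcongr
        simp only [sq_abs]
        exact Real.sqrt_le_iff.2 ⟨hL, ha⟩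
    _ = _ := by ring

theorem gradNormSq_nonneg {d : ℕ} (f : Ed d → ℂ) (x : Ed d) : 0 ≤ gradNormSq f x :=
  Finset.sum_nonneg fun _ _ => by positivity

/-- Schwartz partial derivative -/
def D {d : ℕ} (i : Fin d) (u : SchwartzMap (Ed d) ℂ) : SchwartzMap (Ed d) ℂ :=
  LineDeriv.lineDerivOp (stdBasis i) u

theorem D_apply {d : ℕ} (i : Fin d) (u : SchwartzMap (Ed d) ℂ) (x : Ed d) :
    D i u x = pd u i x := by
  unfold D pd
  exact SchwartzMap.lineDerivOp_apply_eq_fderiv _ _ _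

theorem D_coe {d : ℕ} (i : Fin d) (u : SchwartzMap (Ed d) ℂ) : (D i u : Ed d → ℂ) = pd u i := by
  funext x; exact D_apply i u x

theorem int_sq {d : ℕ} (u : SchwartzMap (Ed d) ℂ) : Integrable (fun x => ‖u x‖ ^ 2) := by
  have := (u.memLp 2 (μ := volume)).integrable_norm_rpow (by simp) (by simp)
  simpa using this

theorem int_grad {d : ℕ} (u : SchwartzMap (Ed d) ℂ) : Integrable (fun x => gradNormSq u x) := by
  unfold gradNormSq
  refine integrable_finsetSum _ fun i _ => ?_
  rw [← D_coe]; exact int_sq _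

/-- Cauchy-Schwarz for integrals, square-root form -/
theorem cs_int {d : ℕ} {f g : Ed d → ℝ} (hfm : AEStronglyMeasurable f) (hgm : AEStronglyMeasurable g)
    (hf : Integrable (fun x => f x ^ 2))
    (hg : Integrable (fun x => g x ^ 2)) :
    Integrable (fun x => f x * g x) ∧ |∫ x, f x * g x| ≤ √(∫ x, f x ^ 2) * √(∫ x, g x ^ 2) := by
  have hf2 : MemLp f 2 := (memLp_two_iff_integrable_sq hfm).2 hf
  have hg2 : MemLp g 2 := (memLp_two_iff_integrable_sq hgm).2 hg
  refine ⟨hf2.integrable_mul hg2, ?_⟩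
  have h1 := integral_mul_norm_le_Lp_mul_Lq (μ := volume) (f := f) (g := g) (p := 2) (q := 2)
    Real.HolderConjugate.two_two (by simpa using hf2) (by simpa using hg2)
  calc |∫ x, f x * g x| ≤ ∫ x, ‖f x‖ * ‖g x‖ := by
        rw [← Real.norm_eq_abs]
        refine (norm_integral_le_integral_norm _).trans (le_of_eq ?_)
        simp
    _ ≤ _ := h1
    _ = _ := by simp [Real.sqrt_eq_rpow]

theorem sol_form {d : ℕ} {lam : ℝ} {v : ℝ → SchwartzMap (Ed d) ℂ} (hv : IsSol lam v) (t : ℝ) (x : Ed d) :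
    deriv (fun s => v s x) t = I * lap (v t) x +
      I * ((-‖x‖ ^ 2 + lam * ‖v t x‖ ^ sg d : ℝ) : ℂ) * v t x + 0 := by
  rw [hv.eq]; push_cast; ring

theorem int_cut {d : ℕ} {θ : Ed d → ℝ} {u : Ed d → ℂ} (hθ : Continuous θ) (hs : HasCompactSupport θ)
    (hu : Continuous u) : Integrable (fun x => θ x ^ 2 * ‖u x‖ ^ 2) := by
  have hc : Continuous (fun x => θ x * (θ x * ‖u x‖ ^ 2)) := by fun_prop
  have h := hc.integrable_of_hasCompactSupport (μ := volume) hs.mul_right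
  refine h.congr (Eventually.of_forall fun x => ?_)
  simp only []; ring

/-- localized transport estimate -/
theorem TL {d : ℕ} {lam : ℝ} {v : ℝ → SchwartzMap (Ed d) ℂ} (hv : IsSol lam v)
    {θ : Ed d → ℝ} {L : NNReal} (hθ : LipschitzWith L θ) (hs : HasCompactSupport θ)
    {s t S0 : ℝ} (hst : s ≤ t) (hS : ∀ τ ∈ Set.Icc s t, √(S2 (v τ)) ≤ S0) :
    |√(∫ x, θ x ^ 2 * ‖v t x‖ ^ 2) - √(∫ x, θ x ^ 2 * ‖v s x‖ ^ 2)| ≤ 2 * L * S0 * (t - s) := by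
  have hS0 : 0 ≤ S0 := (Real.sqrt_nonneg _).trans (hS s ⟨le_rfl, hst⟩)
  refine ode_sqrt (m := fun t => ∫ x, θ x ^ 2 * ‖v t x‖ ^ 2) hst (fun τ hτ => LM hv.smooth hθ hs τ
    (fun x => -‖x‖ ^ 2 + lam * ‖v τ x‖ ^ sg d) 0 continuous_const (fun x => sol_form hv τ x))
    (fun τ => integral_nonneg fun x => by positivity) (by positivity) (fun τ hτ => ?_)
  simp only [Pi.zero_apply, mul_zero, zero_re, integral_zero, add_zero]
  rw [abs_mul, abs_of_pos (by norm_num : (0:ℝ) < 4)]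
  set u := v τ
  have hu : Continuous u := u.continuous
  have hf : Integrable (fun x => (|θ x| * ‖u x‖) ^ 2) := by
    simp only [mul_pow, sq_abs]
    exact int_cut hθ.continuous hs hu
  have hgc : Continuous (fun x => √(gradNormSq u x)) := by
    unfold gradNormSq
    refine Real.continuous_sqrt.comp (continuous_finsetSum _ fun i _ => ?_)
    rw [← D_coe]; exact ((D i u).continuous.norm.pow 2)
  have hg : Integrable (fun x => (√(gradNormSq u x)) ^ 2) := by
    simp only [Real.sq_sqrt (gradNormSq_nonneg _ _)]; exact int_grad u
  obtain ⟨hi, hcs⟩ := cs_int (f := fun x => |θ x| * ‖u x‖) (g := fun x => √(gradNormSq u x)) (hθ.continuous.abs.mul hu.norm).aestronglyMeasurable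
    hgc.aestronglyMeasurable hf hg
  have h1 : |∫ x, θ x * ∑ i, lineDeriv ℝ θ x (stdBasis i) * (conj (u x) * pd u i x).im|
      ≤ L * ∫ x, (|θ x| * ‖u x‖) * √(gradNormSq u x) := by
    rw [← integral_const_mul, ← Real.norm_eq_abs]
    refine norm_integral_le_of_norm_le (hi.const_mul _) ?_
    filter_upwards [lip_grad_sq hθ] with x hx
    rw [norm_mul, Real.norm_eq_abs, Real.norm_eq_abs]
    have := flux_pt L.2 hx (u x) (fun i => pd u i x)
    calc |θ x| * _ ≤ |θ x| * (L * ‖u x‖ * √(∑ i, ‖pd u i x‖ ^ 2)) :=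
            mul_le_mul_of_nonneg_left this (abs_nonneg _)
      _ = _ := by unfold gradNormSq; ring
  have h2 := (le_abs_self _).trans hcs
  simp only [mul_pow, sq_abs, Real.sq_sqrt (gradNormSq_nonneg _ _)] at h2
  have h3 := hS τ hτ
  have h4 : √(∫ x, θ x ^ 2 * ‖u x‖ ^ 2) * √(S2 u) ≤ √(∫ x, θ x ^ 2 * ‖u x‖ ^ 2) * S0 := by gcongr
  unfold S2 at h4
  have h5 : L * ∫ x, (|θ x| * ‖u x‖) * √(gradNormSq u x) ≤
      L * (√(∫ x, θ x ^ 2 * ‖u x‖ ^ 2) * S0) := by gcongr; exact h2.trans h4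
  linarith

end HS

namespace HS
open Complex ComplexConjugate

/-- continuous functions of rapid decay -/
structure RD {d : ℕ} {E : Type} [NormedAddCommGroup E] (F : Ed d → E) : Prop where
  cont : Continuous F
  dec : ∀ k : ℕ, ∃ C, ∀ x, (1 + ‖x‖) ^ k * ‖F x‖ ≤ C

/-- continuous functions of polynomial growth -/
structure PG {d : ℕ} {E : Type} [NormedAddCommGroup E] (F : Ed d → E) : Prop where
  cont : Continuous F
  gr : ∃ k : ℕ, ∃ C, ∀ x, ‖F x‖ ≤ C * (1 + ‖x‖) ^ k

section
variable {d : ℕ} {E : Type} [NormedAddCommGroup E] {F G : Ed d → E}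

theorem RD.pg (h : RD F) : PG F := by
  obtain ⟨C, hC⟩ := h.dec 0
  exact ⟨h.cont, 0, C, fun x => by simpa using hC x⟩

theorem RD.of_le {E' : Type} [NormedAddCommGroup E'] {G : Ed d → E'} (h : RD F) (hG : Continuous G)
    (hle : ∀ x, ‖G x‖ ≤ ‖F x‖) : RD G := by
  refine ⟨hG, fun k => ?_⟩
  obtain ⟨C, hC⟩ := h.dec k
  refine ⟨C, fun x => le_trans ?_ (hC x)⟩
  have := hle x
  gcongr

theorem RD.add (h : RD F) (h' : RD G) : RD (fun x => F x + G x) := by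
  refine ⟨h.cont.add h'.cont, fun k => ?_⟩
  obtain ⟨C, hC⟩ := h.dec k
  obtain ⟨C', hC'⟩ := h'.dec k
  refine ⟨C + C', fun x => ?_⟩
  calc _ ≤ (1 + ‖x‖) ^ k * (‖F x‖ + ‖G x‖) := by gcongr; exact norm_add_le _ _
    _ ≤ _ := by rw [mul_add]; exact add_le_add (hC x) (hC' x)

theorem RD.neg (h : RD F) : RD (fun x => - F x) := h.of_le h.cont.neg fun x => by simp

theorem RD.sub (h : RD F) (h' : RD G) : RD (fun x => F x - G x) := by
  simpa [sub_eq_add_neg] using h.add h'.neg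

theorem RD.norm (h : RD F) : RD (fun x => ‖F x‖) := h.of_le h.cont.norm fun x => by simp

theorem PG.norm (h : PG F) : PG (fun x => ‖F x‖) := by
  obtain ⟨k, C, hC⟩ := h.gr
  exact ⟨h.cont.norm, k, C, fun x => by simpa using hC x⟩

theorem RD.zero : RD (fun _ : Ed d => (0 : E)) := ⟨continuous_const, fun k => ⟨0, fun x => by simp⟩⟩

theorem RD.sum {ι : Type} (s : Finset ι) {F : ι → Ed d → E} (h : ∀ i ∈ s, RD (F i)) :
    RD (fun x => ∑ i ∈ s, F i x) := by
  classical
  induction s using Finset.induction_on with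
  | empty => simpa using RD.zero
  | insert a s ha ih =>
    simp only [Finset.sum_insert ha]
    exact (h a (by simp)).add (ih fun i hi => h i (by simp [hi]))

theorem PG.const (c : E) : PG (fun _ : Ed d => c) :=
  ⟨continuous_const, 0, ‖c‖, fun x => by simp⟩

theorem PG.add (h : PG F) (h' : PG G) : PG (fun x => F x + G x) := by
  obtain ⟨k, C, hC⟩ := h.gr
  obtain ⟨k', C', hC'⟩ := h'.gr
  refine ⟨h.cont.add h'.cont, k + k', |C| + |C'|, fun x => (norm_add_le _ _).trans ?_⟩
  have h1 : (1:ℝ) ≤ 1 + ‖x‖ := by linarith [norm_nonneg x]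
  have e1 : (1 + ‖x‖) ^ k ≤ (1 + ‖x‖) ^ (k + k') := pow_le_pow_right₀ h1 (by omega)
  have e2 : (1 + ‖x‖) ^ k' ≤ (1 + ‖x‖) ^ (k + k') := pow_le_pow_right₀ h1 (by omega)
  rw [add_mul]
  refine add_le_add ((hC x).trans ?_) ((hC' x).trans ?_)
  · exact mul_le_mul (le_abs_self _) e1 (by positivity) (abs_nonneg _)
  · exact mul_le_mul (le_abs_self _) e2 (by positivity) (abs_nonneg _)

theorem PG.neg (h : PG F) : PG (fun x => - F x) := by
  obtain ⟨k, C, hC⟩ := h.gr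
  exact ⟨h.cont.neg, k, C, fun x => by simpa using hC x⟩

theorem PG.sub (h : PG F) (h' : PG G) : PG (fun x => F x - G x) := by
  simpa [sub_eq_add_neg] using h.add h'.neg

theorem RD.integrable (h : RD F) : Integrable F := by
  set r : ℕ := d + 1
  obtain ⟨C, hC⟩ := h.dec r
  have hi : Integrable (fun x : Ed d => (1 + ‖x‖) ^ (-(r : ℝ))) := by
    apply integrable_one_add_norm
    simp [r, Ed]
  refine (hi.const_mul C).mono' h.cont.aestronglyMeasurable (Eventually.of_forall fun x => ?_)
  have h1 : (0:ℝ) < 1 + ‖x‖ := by positivity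
  rw [Real.rpow_neg h1.le, Real.rpow_natCast, ← div_eq_mul_inv, le_div_iff₀ (by positivity), mul_comm]
  exact hC x

end

theorem RD.mul {d : ℕ} {R : Type} [NormedRing R] {F G : Ed d → R} (h : RD F) (h' : PG G) :
    RD (fun x => F x * G x) := by
  refine ⟨h.cont.mul h'.cont, fun k => ?_⟩
  obtain ⟨m, C, hC⟩ := h'.gr
  obtain ⟨C', hC'⟩ := h.dec (k + m)
  refine ⟨C' * |C|, fun x => ?_⟩
  calc (1 + ‖x‖) ^ k * ‖F x * G x‖ ≤ (1 + ‖x‖) ^ k * (‖F x‖ * (|C| * (1 + ‖x‖) ^ m)) := by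
        gcongr
        refine (norm_mul_le _ _).trans ?_
        gcongr
        refine (hC x).trans ?_
        gcongr; exact le_abs_self _
    _ = ((1 + ‖x‖) ^ (k + m) * ‖F x‖) * |C| := by rw [pow_add]; ring
    _ ≤ _ := by gcongr; exact hC' x

theorem PG.mul {d : ℕ} {R : Type} [NormedRing R] {F G : Ed d → R} (h : PG F) (h' : PG G) :
    PG (fun x => F x * G x) := by
  obtain ⟨k, C, hC⟩ := h.gr
  obtain ⟨k', C', hC'⟩ := h'.gr
  refine ⟨h.cont.mul h'.cont, k + k', |C| * |C'|, fun x => (norm_mul_le _ _).trans ?_⟩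
  calc ‖F x‖ * ‖G x‖ ≤ (|C| * (1 + ‖x‖) ^ k) * (|C'| * (1 + ‖x‖) ^ k') := by
        gcongr
        · exact (hC x).trans (by gcongr; exact le_abs_self _)
        · exact (hC' x).trans (by gcongr; exact le_abs_self _)
    _ = _ := by rw [pow_add]; ring

theorem PG.rmul {d : ℕ} {R : Type} [NormedCommRing R] {F G : Ed d → R} (h : PG F) (h' : RD G) :
    RD (fun x => F x * G x) := by
  simpa [mul_comm] using h'.mul h

theorem PG.pow {d : ℕ} {R : Type} [NormedRing R] {F : Ed d → R} (h : PG F) (n : ℕ) :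
    PG (fun x => F x ^ n) := by
  induction n with
  | zero => simpa using PG.const (1 : R)
  | succ n ih => simpa [pow_succ] using ih.mul h

theorem RD.pow {d : ℕ} {R : Type} [NormedRing R] {F : Ed d → R} (h : RD F) {n : ℕ} (hn : n ≠ 0) :
    RD (fun x => F x ^ n) := by
  obtain ⟨m, rfl⟩ := Nat.exists_eq_succ_of_ne_zero hn
  simpa [pow_succ'] using h.mul (h.pg.pow m)

theorem RD.rpow {d : ℕ} {F : Ed d → ℝ} (h : RD F) (h0 : ∀ x, 0 ≤ F x) {s : ℝ} (hs : 0 < s) :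
    RD (fun x => F x ^ s) := by
  refine ⟨h.cont.rpow_const fun x => Or.inr hs.le, fun k => ?_⟩
  obtain ⟨m, hm⟩ := exists_nat_ge (k / s)
  obtain ⟨C, hC⟩ := h.dec m
  refine ⟨|C| ^ s, fun x => ?_⟩
  have h1 : (1:ℝ) ≤ 1 + ‖x‖ := by linarith [norm_nonneg x]
  rw [Real.norm_of_nonneg (Real.rpow_nonneg (h0 x) _)]
  have hC' := hC x
  rw [Real.norm_of_nonneg (h0 x)] at hC'
  calc (1 + ‖x‖) ^ k * F x ^ s ≤ ((1 + ‖x‖) ^ m) ^ s * F x ^ s := by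
        gcongr
        · exact Real.rpow_nonneg (h0 x) _
        rw [← Real.rpow_natCast, ← Real.rpow_natCast, ← Real.rpow_mul (by linarith)]
        apply Real.rpow_le_rpow_of_exponent_le h1
        rw [div_le_iff₀ hs] at hm
        exact hm
    _ = ((1 + ‖x‖) ^ m * F x) ^ s := by rw [Real.mul_rpow (by positivity) (h0 x)]
    _ ≤ _ := by
        have := h0 x
        gcongr
        exact hC'.trans (le_abs_self _)

theorem PG.ofReal {d : ℕ} {F : Ed d → ℝ} (h : PG F) : PG (fun x => (F x : ℂ)) := by
  obtain ⟨k, C, hC⟩ := h.gr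
  exact ⟨continuous_ofReal.comp h.cont, k, C, fun x => by simpa using hC x⟩

theorem RD.ofReal {d : ℕ} {F : Ed d → ℝ} (h : RD F) : RD (fun x => (F x : ℂ)) :=
  h.of_le (continuous_ofReal.comp h.cont) fun x => by simp

theorem RD.conj {d : ℕ} {F : Ed d → ℂ} (h : RD F) : RD (fun x => conj (F x)) :=
  h.of_le (continuous_conj.comp h.cont) fun x => by simp

theorem RD.re {d : ℕ} {F : Ed d → ℂ} (h : RD F) : RD (fun x => (F x).re) :=
  h.of_le (continuous_re.comp h.cont) fun _ => abs_re_le_norm _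

theorem RD.im {d : ℕ} {F : Ed d → ℂ} (h : RD F) : RD (fun x => (F x).im) :=
  h.of_le (continuous_im.comp h.cont) fun _ => abs_im_le_norm _

theorem PG.coord {d : ℕ} (i : Fin d) : PG (fun x : Ed d => x i) :=
  ⟨by fun_prop, 1, 1, fun x => by
    have := PiLp.norm_apply_le x i
    simp only [one_mul, pow_one]; linarith⟩

theorem PG.nrm {d : ℕ} : PG (fun x : Ed d => ‖x‖) :=
  ⟨continuous_norm, 1, 1, fun x => by simp⟩

theorem SchwartzRD {d : ℕ} (u : SchwartzMap (Ed d) ℂ) : RD (fun x => u x) := by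
  refine ⟨u.continuous, fun k => ?_⟩
  refine ⟨2 ^ k * ((Finset.Iic (k, 0)).sup fun m => SchwartzMap.seminorm ℝ m.1 m.2) u, fun x => ?_⟩
  have := SchwartzMap.one_add_le_sup_seminorm_apply (𝕜 := ℝ) (m := (k, 0)) (k := k) (n := 0) le_rfl le_rfl u x
  simpa using this

theorem RD.smulR {d : ℕ} {F : Ed d → ℝ} {G : Ed d → ℂ} (h : PG F) (h' : RD G) :
    RD (fun x => F x • G x) := by
  simpa using h.ofReal.rmul h'

/-- real inner product of two complex-valued functions -/
def ip {d : ℕ} (u w : Ed d → ℂ) : ℝ := ∫ x, inner ℝ (u x) (w x)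

/-- L2 norm -/
def n2 {d : ℕ} (u : Ed d → ℂ) : ℝ := √(∫ x, ‖u x‖ ^ 2)

section
variable {d : ℕ} {u v w : Ed d → ℂ}

theorem RD.inner (hu : RD u) (hw : PG w) : RD (fun x => inner ℝ (u x) (w x)) := by
  have h := (hu.norm).mul hw.norm
  refine h.of_le (hu.cont.inner hw.cont) fun x => ?_
  rw [norm_mul, norm_norm, norm_norm]
  exact norm_inner_le_norm _ _

theorem ip_comm : ip u w = ip w u := by
  unfold ip; congr 1; funext x; exact real_inner_comm _ _

theorem ip_add_left (hu : RD u) (hv : RD v) (hw : RD w) :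
    ip (fun x => u x + v x) w = ip u w + ip v w := by
  unfold ip
  rw [← integral_add (hu.inner hw.pg).integrable (hv.inner hw.pg).integrable]
  simp [inner_add_left]

theorem ip_sub_left (hu : RD u) (hv : RD v) (hw : RD w) :
    ip (fun x => u x - v x) w = ip u w - ip v w := by
  unfold ip
  rw [← integral_sub (hu.inner hw.pg).integrable (hv.inner hw.pg).integrable]
  simp [inner_sub_left]

theorem ip_add_right (hu : RD u) (hv : RD v) (hw : RD w) :
    ip u (fun x => v x + w x) = ip u v + ip u w := by
  rw [ip_comm, ip_add_left hv hw hu, ip_comm, ip_comm (u := w)]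

theorem ip_sub_right (hu : RD u) (hv : RD v) (hw : RD w) :
    ip u (fun x => v x - w x) = ip u v - ip u w := by
  rw [ip_comm, ip_sub_left hv hw hu, ip_comm, ip_comm (u := w)]

theorem ip_smul_left (c : ℝ) : ip (fun x => (c : ℂ) * u x) w = c * ip u w := by
  unfold ip
  rw [← integral_const_mul]
  congr 1; funext x
  rw [← real_inner_smul_left]; simp

theorem ip_smul_right (c : ℝ) : ip u (fun x => (c : ℂ) * w x) = c * ip u w := by
  rw [ip_comm, ip_smul_left, ip_comm]

theorem inner_I (a b : ℂ) : inner ℝ (I * a) b = - inner ℝ a (I * b) := by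
  simp [Complex.inner]; ring

theorem ip_I_left : ip (fun x => I * u x) w = - ip u (fun x => I * w x) := by
  unfold ip; rw [← integral_neg]; congr 1; funext x; exact inner_I _ _

theorem ip_neg_left : ip (fun x => - u x) w = - ip u w := by
  unfold ip; rw [← integral_neg]; simp

theorem ip_neg_right : ip u (fun x => - w x) = - ip u w := by
  unfold ip; rw [← integral_neg]; simp

theorem ip_self : ip u u = ∫ x, ‖u x‖ ^ 2 := by
  unfold ip; congr 1; funext x; exact real_inner_self_eq_norm_sq _

theorem n2_sq : n2 u ^ 2 = ∫ x, ‖u x‖ ^ 2 := Real.sq_sqrt (integral_nonneg fun _ => by positivity)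

theorem n2_nonneg : 0 ≤ n2 u := Real.sqrt_nonneg _

theorem RD.sq_int (hu : RD u) : Integrable (fun x => ‖u x‖ ^ 2) := (hu.norm.pow two_ne_zero).integrable

theorem ip_le_n2 (hu : RD u) (hw : RD w) : |ip u w| ≤ n2 u * n2 w := by
  have h := cs_int (f := fun x => ‖u x‖) (g := fun x => ‖w x‖) hu.norm.cont.aestronglyMeasurable
    hw.norm.cont.aestronglyMeasurable hu.sq_int hw.sq_int
  refine le_trans ?_ ((le_abs_self _).trans h.2)
  rw [← Real.norm_eq_abs]
  refine norm_integral_le_of_norm_le h.1 (Eventually.of_forall fun x => norm_inner_le_norm _ _)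

theorem int_norm_mul_le (hu : RD u) (hw : RD w) : ∫ x, ‖u x‖ * ‖w x‖ ≤ n2 u * n2 w := by
  have h := cs_int (f := fun x => ‖u x‖) (g := fun x => ‖w x‖) hu.norm.cont.aestronglyMeasurable
    hw.norm.cont.aestronglyMeasurable hu.sq_int hw.sq_int
  exact (le_abs_self _).trans h.2

theorem n2_add_le (hu : RD u) (hw : RD w) : n2 (fun x => u x + w x) ≤ n2 u + n2 w := by
  refine abs_le_of_sq_le_sq' ?_ (add_nonneg n2_nonneg n2_nonneg) |>.2
  rw [n2_sq, ← ip_self, ip_add_left hu hw (hu.add hw), ip_add_right hu hu hw, ip_add_right hw hu hw,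
    ip_self, ip_self, ← n2_sq, ← n2_sq, ip_comm (u := w)]
  have := (le_abs_self _).trans (ip_le_n2 hu hw)
  nlinarith

theorem n2_neg : n2 (fun x => - u x) = n2 u := by simp [n2]

theorem n2_sub_le (hu : RD u) (hw : RD w) : n2 (fun x => u x - w x) ≤ n2 u + n2 w := by
  have := n2_add_le hu hw.neg
  rw [n2_neg] at this
  simpa [sub_eq_add_neg] using this

theorem n2_smul (c : ℂ) : n2 (fun x => c * u x) = ‖c‖ * n2 u := by
  unfold n2
  simp only [norm_mul, mul_pow]
  rw [integral_const_mul, Real.sqrt_mul (by positivity), Real.sqrt_sq (norm_nonneg _)]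

theorem n2_mono {u w : Ed d → ℂ} (hw : RD w) (h : ∀ x, ‖u x‖ ≤ ‖w x‖) : n2 u ≤ n2 w := by
  unfold n2
  apply Real.sqrt_le_sqrt
  refine integral_mono_of_nonneg (Eventually.of_forall fun x => by positivity) hw.sq_int
    (Eventually.of_forall fun x => ?_)
  have := h x
  simp only []; gcongr
end

end HS

namespace HS
open Complex ComplexConjugate

/-- Schwartz space -/
abbrev Sch (d : ℕ) := SchwartzMap (Ed d) ℂ

variable {d : ℕ}

/-- partial derivative as continuous linear map -/
def DL (i : Fin d) : Sch d →L[ℝ] Sch d := LineDeriv.lineDerivOpCLM ℝ (Sch d) (stdBasis i)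
theorem DL_eq (i : Fin d) (u : Sch d) : DL i u = D i u := rfl

theorem coord_tg (i : Fin d) : (fun x : Ed d => x i).HasTemperateGrowth :=
  (EuclideanSpace.proj i : Ed d →L[ℝ] ℝ).hasTemperateGrowth

/-- multiplication by a coordinate -/
def X (i : Fin d) : Sch d →L[ℝ] Sch d := SchwartzMap.smulLeftCLM ℂ (fun x : Ed d => x i)
theorem X_apply (i : Fin d) (u : Sch d) (x : Ed d) : X i u x = (x i : ℂ) * u x := by
  unfold X; rw [SchwartzMap.smulLeftCLM_apply_apply (coord_tg i)]; simp

/-- multiplication by the square of the norm -/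
def Q : Sch d →L[ℝ] Sch d := SchwartzMap.smulLeftCLM ℂ (fun x : Ed d => ‖x‖ ^ 2)
theorem Q_apply (u : Sch d) (x : Ed d) : Q u x = ((‖x‖ ^ 2 : ℝ) : ℂ) * u x := by
  unfold Q
  rw [SchwartzMap.smulLeftCLM_apply_apply (Function.hasTemperateGrowth_norm_sq (Ed d))]; simp

/-- Laplacian -/
def Lap : Sch d →L[ℝ] Sch d := ∑ i, (DL i).comp (DL i)
theorem Lap_eq (u : Sch d) : Lap u = ∑ i, D i (D i u) := by
  unfold Lap; simp [DL_eq]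

theorem sum_apply' {ι : Type} (s : Finset ι) (f : ι → Sch d) (x : Ed d) :
    (∑ i ∈ s, f i) x = ∑ i ∈ s, f i x := by
  classical
  induction s using Finset.induction_on with
  | empty => simp
  | insert a s ha ih => simp [Finset.sum_insert ha, ih]

theorem Lap_apply (u : Sch d) (x : Ed d) : Lap u x = lap u x := by
  rw [Lap_eq, sum_apply', lap]
  refine Finset.sum_congr rfl fun i _ => ?_
  rw [D_apply, D_coe]

/-- harmonic oscillator -/
def Hop : Sch d →L[ℝ] Sch d := Q - Lap
theorem Hop_eq (u : Sch d) : Hop u = Q u - Lap u := rfl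

/-- generator of dilations -/
def A : Sch d →L[ℝ] Sch d := (2 : ℝ) • (∑ i, (X i).comp (DL i)) + (d : ℝ) • ContinuousLinearMap.id ℝ _
theorem A_eq (u : Sch d) : A u = (2 : ℝ) • (∑ i, X i (D i u)) + (d : ℝ) • u := by
  unfold A; simp [DL_eq]

/-- multiplication by i -/
def J : Sch d →L[ℝ] Sch d := I • ContinuousLinearMap.id ℝ (Sch d)
theorem J_apply (u : Sch d) (x : Ed d) : J u x = I * u x := by
  unfold J; simp

theorem rd (u : Sch d) : RD u := SchwartzRD u

theorem D_X (i j : Fin d) (u : Sch d) : D i (X j u) = (if i = j then u else 0) + X j (D i u) := by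
  ext x
  rw [D_apply, pd]
  have h1 : (X j u : Ed d → ℂ) = fun x => (x j : ℝ) • u x := by
    funext x; rw [X_apply]; simp
  have h2 : HasFDerivAt (fun x : Ed d => x j) (EuclideanSpace.proj j : Ed d →L[ℝ] ℝ) x :=
    (EuclideanSpace.proj j : Ed d →L[ℝ] ℝ).hasFDerivAt
  have h3 := (h2.smul (u.hasFDerivAt x)).fderiv
  rw [h1]
  erw [h3]
  rw [add_apply]
  change _ = (if i = j then u else 0 : Sch d) x + (X j (D i u)) x
  rw [X_apply, D_apply, pd]
  simp only [smul_apply, ContinuousLinearMap.smulRight_apply]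
  rw [add_comm]
  congr 1
  · simp only [stdBasis]
    by_cases h : i = j
    · subst h; simp
    · have : ¬ (j = i) := fun h' => h h'.symm
      simp [h, this]

theorem D_comm (i j : Fin d) (u : Sch d) : D i (D j u) = D j (D i u) := by
  ext x
  rw [D_apply, D_apply, D_coe, D_coe, pd, pd]
  have hc : ContDiff ℝ 2 u := u.smooth 2
  have hs : IsSymmSndFDerivAt ℝ u x := hc.contDiffAt.isSymmSndFDerivAt (by simp)
  have h : ∀ i, HasFDerivAt (pd u i) ((ContinuousLinearMap.apply ℝ ℂ (stdBasis i)).comp (fderiv ℝ (fderiv ℝ u) x)) x := by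
    intro i
    exact (ContinuousLinearMap.apply ℝ ℂ (stdBasis i)).hasFDerivAt.comp x
      ((hc.fderiv_right (m := 1) (by norm_num)).differentiable (by norm_num) x).hasFDerivAt
  rw [(h i).fderiv, (h j).fderiv]
  exact hs _ _

theorem D_add (i : Fin d) (u w : Sch d) : D i (u + w) = D i u + D i w := map_add (DL i) u w
theorem D_sub (i : Fin d) (u w : Sch d) : D i (u - w) = D i u - D i w := map_sub (DL i) u w
theorem D_smul (i : Fin d) (c : ℝ) (u : Sch d) : D i (c • u) = c • D i u := map_smul (DL i) c u
theorem D_sum (i : Fin d) {ι : Type} (s : Finset ι) (f : ι → Sch d) :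
    D i (∑ j ∈ s, f j) = ∑ j ∈ s, D i (f j) := map_sum (DL i) f s

theorem D_J (i : Fin d) (u : Sch d) : D i (J u) = J (D i u) := by
  ext x
  rw [D_apply, J_apply, D_apply, pd, pd]
  have h1 : (J u : Ed d → ℂ) = fun x => I • u x := by funext x; rw [J_apply]; simp
  have h2 := (u.hasFDerivAt x).const_smul I
  rw [h1]; erw [h2.fderiv]; simp

theorem X_J (i : Fin d) (u : Sch d) : X i (J u) = J (X i u) := by
  ext x; simp only [X_apply, J_apply]; ring

theorem Q_J (u : Sch d) : Q (J u) = J (Q u) := by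
  ext x; simp only [Q_apply, J_apply]; ring

theorem J_J (u : Sch d) : J (J u) = - u := by
  ext x; simp only [J_apply, neg_apply]; rw [← mul_assoc]; simp

theorem Lap_J (u : Sch d) : Lap (J u) = J (Lap u) := by
  simp only [Lap_eq, D_J, map_sum]

theorem H_J (u : Sch d) : Hop (J u) = J (Hop u) := by
  simp only [Hop_eq, Lap_J, Q_J, map_sub]

theorem A_J (u : Sch d) : A (J u) = J (A u) := by
  simp only [A_eq, D_J, X_J, map_add, map_smul, map_sum]

theorem X_X (i j : Fin d) (u : Sch d) : X i (X j u) = X j (X i u) := by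
  ext x; simp only [X_apply]; ring

theorem Q_eq (u : Sch d) : Q u = ∑ i, X i (X i u) := by
  ext x
  rw [sum_apply', Q_apply, EuclideanSpace.norm_sq_eq]
  simp only [X_apply]
  push_cast
  rw [Finset.sum_mul]
  refine Finset.sum_congr rfl fun i _ => ?_
  simp only [Real.norm_eq_abs]
  have : ((|x i| : ℝ) : ℂ) ^ 2 = (x i : ℂ) ^ 2 := by exact_mod_cast sq_abs (x i)
  rw [this]; ring

theorem X_Q (i : Fin d) (u : Sch d) : X i (Q u) = Q (X i u) := by
  ext x; simp only [X_apply, Q_apply]; ring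

theorem D_Q (i : Fin d) (u : Sch d) : D i (Q u) = (2 : ℝ) • X i u + Q (D i u) := by
  rw [Q_eq, D_sum, Q_eq]
  have : ∀ j, D i (X j (X j u)) = (if i = j then (2 : ℝ) • X i u else 0) + X j (X j (D i u)) := by
    intro j
    rw [D_X, D_X, map_add]
    by_cases h : i = j
    · subst h; simp only [if_true, two_smul]; abel
    · simp [h]
  simp only [this, Finset.sum_add_distrib, Finset.sum_ite_eq, Finset.mem_univ, if_true]

theorem Lap_D (i : Fin d) (u : Sch d) : Lap (D i u) = D i (Lap u) := by
  simp only [Lap_eq, D_sum]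
  refine Finset.sum_congr rfl fun j _ => ?_
  rw [D_comm j i, D_comm j i]

theorem Lap_X (i : Fin d) (u : Sch d) : Lap (X i u) = (2 : ℝ) • D i u + X i (Lap u) := by
  simp only [Lap_eq, map_sum]
  have : ∀ j, D j (D j (X i u)) = (if j = i then (2 : ℝ) • D i u else 0) + X i (D j (D j u)) := by
    intro j
    rw [D_X, D_add, D_X]
    by_cases h : j = i
    · subst h; simp only [if_true, two_smul]; abel
    · simp only [h, if_false, zero_add]
      have : D j (0 : Sch d) = 0 := map_zero (DL j)
      rw [this, zero_add]
  simp only [this, Finset.sum_add_distrib, Finset.sum_ite_eq', Finset.mem_univ, if_true]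

theorem Lap_Q (u : Sch d) : Lap (Q u) = Q (Lap u) + (2 : ℝ) • A u := by
  rw [Lap_eq, Lap_eq, map_sum, A_eq]
  have : ∀ i, D i (D i (Q u)) = (2 : ℝ) • u + (4 : ℝ) • X i (D i u) + Q (D i (D i u)) := by
    intro i
    rw [D_Q, D_add, D_smul, D_X, D_Q, if_pos rfl]
    module
  simp only [this, Finset.sum_add_distrib, Finset.sum_const, Finset.card_univ, Fintype.card_fin,
    ← Finset.smul_sum]
  have e : (d • (2 : ℝ) • u) = ((2 : ℝ) * d) • u := by
    rw [← Nat.cast_smul_eq_nsmul ℝ, smul_smul, mul_comm]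
  rw [e]; module

theorem Lap_A (u : Sch d) : Lap (A u) = A (Lap u) + (4 : ℝ) • Lap u := by
  rw [A_eq, A_eq, map_add, map_smul, map_smul, map_sum]
  have : ∀ i, Lap (X i (D i u)) = (2 : ℝ) • D i (D i u) + X i (D i (Lap u)) := by
    intro i; rw [Lap_X, Lap_D]
  simp only [this, Finset.sum_add_distrib, ← Finset.smul_sum]
  rw [← Lap_eq]; module

theorem A_Q (u : Sch d) : A (Q u) = Q (A u) + (4 : ℝ) • Q u := by
  rw [A_eq, A_eq, map_add, map_smul, map_smul, map_sum]
  have : ∀ i, X i (D i (Q u)) = (2 : ℝ) • X i (X i u) + Q (X i (D i u)) := by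
    intro i; rw [D_Q, map_add, map_smul, X_Q]
  simp only [this, Finset.sum_add_distrib, ← Finset.smul_sum]
  rw [← Q_eq]; module

theorem H_Q (u : Sch d) : Hop (Q u) = Q (Hop u) - (2 : ℝ) • A u := by
  rw [Hop_eq, Hop_eq, Lap_Q, map_sub]; abel

theorem H_A (u : Sch d) : Hop (A u) = A (Hop u) - (4 : ℝ) • Lap u - (4 : ℝ) • Q u := by
  rw [Hop_eq, Hop_eq, Lap_A, map_sub, A_Q]; abel

theorem H_Lap (u : Sch d) : Hop (Lap u) = Lap (Hop u) - (2 : ℝ) • A u := by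
  rw [Hop_eq, Hop_eq, map_sub, Lap_Q]; abel

/-! inner products on Schwartz functions -/

theorem ipa (u v w : Sch d) : ip (u + v : Sch d) w = ip u w + ip v w := ip_add_left (rd u) (rd v) (rd w)
theorem ips (u v w : Sch d) : ip (u - v : Sch d) w = ip u w - ip v w := ip_sub_left (rd u) (rd v) (rd w)
theorem ipm (c : ℝ) (u w : Sch d) : ip (c • u : Sch d) w = c * ip u w := by
  rw [← ip_smul_left]; congr 1
theorem ipn (u w : Sch d) : ip (-u : Sch d) w = - ip u w := ip_neg_left
theorem ip_sumL {ι : Type} (s : Finset ι) (f : ι → Sch d) (w : Sch d) :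
    ip (∑ i ∈ s, f i : Sch d) w = ∑ i ∈ s, ip (f i) w := by
  classical
  induction s using Finset.induction_on with
  | empty => simp [ip]
  | insert a s ha ih => rw [Finset.sum_insert ha, Finset.sum_insert ha, ipa, ih]
theorem ipa' (u v w : Sch d) : ip w (u + v : Sch d) = ip w u + ip w v := by
  rw [ip_comm, ipa, ip_comm, ip_comm (u := v)]
theorem ips' (u v w : Sch d) : ip w (u - v : Sch d) = ip w u - ip w v := by
  rw [ip_comm, ips, ip_comm, ip_comm (u := v)]
theorem ipm' (c : ℝ) (u w : Sch d) : ip w (c • u : Sch d) = c * ip w u := by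
  rw [ip_comm, ipm, ip_comm]
theorem ipn' (u w : Sch d) : ip w (-u : Sch d) = - ip w u := ip_neg_right
theorem ip_sumR {ι : Type} (s : Finset ι) (f : ι → Sch d) (w : Sch d) :
    ip w (∑ i ∈ s, f i : Sch d) = ∑ i ∈ s, ip w (f i) := by
  rw [ip_comm, ip_sumL]; exact Finset.sum_congr rfl fun i _ => ip_comm

theorem ip_J (u w : Sch d) : ip (J u) w = - ip u (J w) := by
  have h1 : (J u : Ed d → ℂ) = fun x => I * u x := by funext x; exact J_apply u x
  have h2 : (J w : Ed d → ℂ) = fun x => I * w x := by funext x; exact J_apply w x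
  rw [h1, h2, ip_I_left]

theorem ip_D (i : Fin d) (u w : Sch d) : ip (D i u) w = - ip u (D i w) := by
  have := SchwartzMap.integral_bilinear_lineDerivOp_right_eq_neg_left (μ := volume) u w (innerSL ℝ : ℂ →L[ℝ] ℂ →L[ℝ] ℝ) (stdBasis i)
  have h2 : ∫ x, inner ℝ (u x) ((D i w) x) = -∫ x, inner ℝ ((D i u) x) (w x) := this
  unfold ip
  rw [h2, neg_neg]

theorem ip_X (i : Fin d) (u w : Sch d) : ip (X i u) w = ip u (X i w) := by
  unfold ip; congr 1; funext x
  simp only [X_apply]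
  have : ∀ z : ℂ, (x i : ℂ) * z = (x i) • z := fun z => by simp
  rw [this, this, real_inner_smul_left, real_inner_smul_right]

theorem ip_Q (u w : Sch d) : ip (Q u) w = ip u (Q w) := by
  unfold ip; congr 1; funext x
  simp only [Q_apply]
  have : ∀ z : ℂ, ((‖x‖ ^ 2 : ℝ) : ℂ) * z = (‖x‖ ^ 2) • z := fun z => by simp
  rw [this, this, real_inner_smul_left, real_inner_smul_right]

theorem ip_Lap (u w : Sch d) : ip (Lap u) w = ip u (Lap w) := by
  rw [Lap_eq, Lap_eq, ip_sumL, ip_sumR]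
  refine Finset.sum_congr rfl fun i _ => ?_
  rw [ip_D, ip_D, neg_neg]

theorem ip_H (u w : Sch d) : ip (Hop u) w = ip u (Hop w) := by
  rw [Hop_eq, Hop_eq, ips, ips', ip_Q, ip_Lap]

theorem ip_A (u w : Sch d) : ip (A u) w = - ip u (A w) := by
  rw [A_eq, A_eq, ipa, ipa', ipm, ipm, ipm', ipm', ip_sumL, ip_sumR]
  have : ∀ i, ip (X i (D i u)) w = - ip u w - ip u (X i (D i w)) := by
    intro i
    rw [ip_X, ip_D, D_X, if_pos rfl, ipa']; ring
  simp only [this, Finset.sum_sub_distrib, Finset.sum_const, Finset.card_univ, Fintype.card_fin, nsmul_eq_mul]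
  ring

theorem ip_J_self (u : Sch d) : ip u (J u) = 0 := by
  have := ip_J u u
  rw [ip_comm] at this; linarith

theorem ip_Lap_self (u : Sch d) : ip u (Lap u) = - S2 u := by
  rw [Lap_eq, ip_sumR, S2]
  unfold gradNormSq
  rw [integral_finsetSum _ (fun i _ => by rw [← D_coe]; exact int_sq _), ← Finset.sum_neg_distrib]
  refine Finset.sum_congr rfl fun i _ => ?_
  rw [ip_comm, ip_D, ip_self, D_coe]

theorem ip_Q_self (u : Sch d) : ip u (Q u) = V u := by
  unfold ip V; congr 1; funext x
  rw [Q_apply]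
  have : ∀ z : ℂ, ((‖x‖ ^ 2 : ℝ) : ℂ) * z = (‖x‖ ^ 2) • z := fun z => by simp
  rw [this, real_inner_smul_right, real_inner_self_eq_norm_sq]

theorem ip_H_self (u : Sch d) : ip u (Hop u) = S2 u + V u := by
  rw [Hop_eq, ips', ip_Q_self, ip_Lap_self]; ring

theorem ip_self_M (u : Sch d) : ip u u = M u := ip_self

end HS

namespace HS
open Complex ComplexConjugate
variable {d : ℕ}

/-- the nonlinearity -/
def fN (u : Ed d → ℂ) (x : Ed d) : ℂ := ((‖u x‖ ^ sg d : ℝ) : ℂ) * u x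
/-- the potential part of the energy -/
def PP (u : Ed d → ℂ) : ℝ := ∫ x, ‖u x‖ ^ (2 + sg d)
/-- the formal time derivative of `ip (v t) ψ` -/
def Gam (lam : ℝ) (ψ u : Sch d) : ℝ := ip u (J (Hop ψ)) + lam * ip (fun x => I * fN u x) ψ

theorem sg_nonneg : 0 ≤ sg d := by unfold sg; positivity

theorem fN_cont {u : Ed d → ℂ} (hu : Continuous u) : Continuous (fN u) :=
  (continuous_ofReal.comp (hu.norm.rpow_const fun _ => Or.inr sg_nonneg)).mul hu

theorem fN_norm (u : Ed d → ℂ) (x : Ed d) : ‖fN u x‖ = ‖u x‖ ^ sg d * ‖u x‖ := by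
  unfold fN; rw [norm_mul, Complex.norm_real, Real.norm_of_nonneg (by positivity)]

theorem fN_norm' (u : Ed d → ℂ) (x : Ed d) : ‖fN u x‖ = ‖u x‖ ^ (1 + sg d) := by
  rw [fN_norm, Real.rpow_add' (norm_nonneg _) (by have := sg_nonneg (d := d); positivity), Real.rpow_one, mul_comm]

theorem fN_rd {u : Ed d → ℂ} (hu : RD u) : RD (fN u) := by
  have h : RD (fun x => ‖u x‖ ^ (1 + sg d)) := hu.norm.rpow (fun _ => norm_nonneg _) (by have := sg_nonneg (d := d); positivity)
  exact h.of_le (fN_cont hu.cont) fun x => by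
    rw [fN_norm', Real.norm_of_nonneg (by positivity)]

theorem PP_rd {u : Ed d → ℂ} (hu : RD u) : RD (fun x => ‖u x‖ ^ (2 + sg d)) :=
  hu.norm.rpow (fun _ => norm_nonneg _) (by have := sg_nonneg (d := d); positivity)

theorem PP_nonneg (u : Ed d → ℂ) : 0 ≤ PP u := integral_nonneg fun _ => by positivity

/-- Lipschitz cutoff -/
def ct (R : ℝ) (x : Ed d) : ℝ := max 0 (1 - ‖x‖ / R)

theorem ct_nonneg (R : ℝ) (x : Ed d) : 0 ≤ ct R x := le_max_left _ _
theorem ct_le_one {R : ℝ} (hR : 0 < R) (x : Ed d) : ct R x ≤ 1 :=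
  max_le zero_le_one (by have : 0 ≤ ‖x‖ / R := by positivity
                         linarith)
theorem ct_lip {R : ℝ} (hR : 0 < R) : LipschitzWith (Real.toNNReal (1 / R)) (ct R : Ed d → ℝ) := by
  apply LipschitzWith.of_dist_le_mul
  intro x y
  rw [Real.coe_toNNReal _ (by positivity), Real.dist_eq]
  unfold ct
  rw [max_comm 0, max_comm 0]
  calc _ ≤ |(1 - ‖x‖ / R) - (1 - ‖y‖ / R)| := abs_max_sub_max_le_abs _ _ _
    _ = 1 / R * |‖y‖ - ‖x‖| := by
      rw [← abs_of_pos (by positivity : 0 < 1 / R), ← abs_mul]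
      congr 1; ring
    _ ≤ _ := by
      gcongr; rw [dist_comm, dist_eq_norm]; exact abs_norm_sub_norm_le y x
theorem ct_supp {R : ℝ} (hR : 0 < R) : HasCompactSupport (ct R : Ed d → ℝ) := by
  apply HasCompactSupport.of_support_subset_isCompact (isCompact_closedBall (0 : Ed d) R)
  intro x hx
  rw [Metric.mem_closedBall, dist_zero_right]
  by_contra h
  push Not at h
  apply hx
  unfold ct
  apply max_eq_left
  have : 1 ≤ ‖x‖ / R := (one_le_div hR).2 h.le
  linarith
theorem ct_cont {R : ℝ} : Continuous (ct R : Ed d → ℝ) := by unfold ct; fun_prop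
theorem ct_sq {R : ℝ} (hR : 0 < R) (x : Ed d) : |1 - ct R x ^ 2| ≤ 2 / R * ‖x‖ := by
  have h0 := ct_nonneg R x
  have h1 := ct_le_one hR x
  have h2 : 1 - ‖x‖ / R ≤ ct R x := le_max_right _ _
  rw [abs_of_nonneg (by nlinarith)]
  have h3 : 2 / R * ‖x‖ = 2 * (‖x‖ / R) := by ring
  rw [h3]
  nlinarith

theorem ct_int {R : ℝ} (hR : 0 < R) {g : Ed d → ℝ} (hg : RD g) :
    |(∫ x, ct R x ^ 2 * g x) - ∫ x, g x| ≤ 2 / R * ∫ x, ‖x‖ * |g x| := by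
  have hc : RD (fun x => ct R x ^ 2 * g x) := hg.of_le ((ct_cont.pow 2).mul hg.cont) fun x => by
    rw [norm_mul, norm_pow]
    have : ‖ct R x‖ ≤ 1 := by rw [Real.norm_of_nonneg (ct_nonneg R x)]; exact ct_le_one hR x
    calc _ ≤ 1 ^ 2 * ‖g x‖ := by gcongr
      _ = _ := by ring
  rw [← integral_sub hc.integrable hg.integrable, ← integral_const_mul]
  refine (abs_integral_le_integral_abs).trans (integral_mono ?_ ?_ ?_)
  · exact (hc.sub hg).norm.integrable
  · exact ((PG.nrm.rmul hg.norm).integrable).const_mul _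
  · intro x
    simp only []
    have : ct R x ^ 2 * g x - g x = -((1 - ct R x ^ 2) * g x) := by ring
    rw [this, abs_neg, abs_mul]
    calc _ ≤ 2 / R * ‖x‖ * |g x| := by gcongr; exact ct_sq hR x
      _ = _ := by ring

/-- limits of derivatives on an interval -/
theorem deriv_limit {a b : ℝ} {f f' : ℕ → ℝ → ℝ} {F g : ℝ → ℝ} {ε : ℕ → ℝ}
    (hf : ∀ n, ∀ t ∈ Set.Icc a b, HasDerivAt (f n) (f' n t) t)
    (hF : ∀ t ∈ Set.Icc a b, Tendsto (fun n => f n t) atTop (nhds (F t)))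
    (hg : ∀ n, ∀ t ∈ Set.Icc a b, |f' n t - g t| ≤ ε n) (hε : Tendsto ε atTop (nhds 0)) :
    ∀ t ∈ Set.Icc a b, HasDerivWithinAt F (g t) (Set.Icc a b) t := by
  have key : ∀ n, ∀ s ∈ Set.Icc a b, ∀ t ∈ Set.Icc a b,
      |(F s - f n s) - (F t - f n t)| ≤ ε n * |s - t| := by
    intro n s hs t ht
    have h1 : ∀ m, |(f m s - f n s) - (f m t - f n t)| ≤ (ε m + ε n) * |s - t| := by
      intro m
      have := (convex_Icc a b).norm_image_sub_le_of_norm_hasDerivWithin_le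
        (f := fun r => f m r - f n r) (f' := fun r => f' m r - f' n r) (C := ε m + ε n)
        (fun r hr => ((hf m r hr).sub (hf n r hr)).hasDerivWithinAt) (fun r hr => ?_) ht hs
      · simpa [Real.norm_eq_abs] using this
      · rw [Real.norm_eq_abs]
        have h2 := hg m r hr
        have h3 := hg n r hr
        rw [abs_le] at *
        constructor <;> linarith
    have h2 : Tendsto (fun m => |(f m s - f n s) - (f m t - f n t)|) atTop
        (nhds |(F s - f n s) - (F t - f n t)|) :=
      (((hF s hs).sub_const _).sub ((hF t ht).sub_const _)).abs
    have h3 : Tendsto (fun m => (ε m + ε n) * |s - t|) atTop (nhds ((0 + ε n) * |s - t|)) :=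
      (hε.add_const _).mul_const _
    simpa using le_of_tendsto_of_tendsto' h2 h3 h1
  intro t ht
  rw [hasDerivWithinAt_iff_isLittleO, Asymptotics.isLittleO_iff]
  intro c hc
  obtain ⟨n, hn⟩ := ((tendsto_order.1 hε).2 (c / 3) (by positivity)).exists
  have h1 := (hasDerivAt_iff_isLittleO.1 (hf n t ht))
  rw [Asymptotics.isLittleO_iff] at h1
  have h2 := nhdsWithin_le_nhds (s := Set.Icc a b) (h1 (by positivity : 0 < c / 3))
  filter_upwards [h2, self_mem_nhdsWithin] with s h3 hs
  have h4 := key n s hs t ht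
  have h5 := hg n t ht
  simp only [Real.norm_eq_abs, smul_eq_mul] at *
  have h6 : F s - F t - (s - t) * g t = ((F s - f n s) - (F t - f n t))
      + (f n s - f n t - (s - t) * f' n t) + (s - t) * (f' n t - g t) := by ring
  rw [h6]
  calc _ ≤ |(F s - f n s) - (F t - f n t)| + |f n s - f n t - (s - t) * f' n t| + |(s - t) * (f' n t - g t)| :=
        abs_add_three _ _ _
    _ ≤ c / 3 * |s - t| + c / 3 * |s - t| + |s - t| * (c / 3) := by
        rw [abs_mul]
        gcongr
        · exact h4.trans (by gcongr)
        · exact h5.trans hn.le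
    _ = _ := by ring

end HS

namespace HS
open Complex ComplexConjugate
variable {d : ℕ}

/-- Green vector field -/
def gi (u ψ : Sch d) (i : Fin d) (x : Ed d) : ℝ :=
  inner ℝ (I * pd u i x) (ψ x) - inner ℝ (I * u x) (pd ψ i x)

theorem sch_smooth (u : Sch d) : ContDiff ℝ (⊤ : ℕ∞) (fun x => u x) := u.smooth _

theorem gi_contDiff (u ψ : Sch d) (i : Fin d) : ContDiff ℝ 1 (gi u ψ i) := by
  have h1 : ContDiff ℝ (⊤ : ℕ∞) (fun x => I * pd u i x) := contDiff_const.mul (pd_contDiff (sch_smooth u) i)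
  have h2 : ContDiff ℝ (⊤ : ℕ∞) (fun x => I * u x) := contDiff_const.mul (sch_smooth u)
  exact ((h1.inner ℝ (sch_smooth ψ)).sub (h2.inner ℝ (pd_contDiff (sch_smooth ψ) i))).of_le (by exact_mod_cast le_top)

theorem gi_fderiv (u ψ : Sch d) (i : Fin d) (x : Ed d) : fderiv ℝ (gi u ψ i) x (stdBasis i)
    = inner ℝ (I * pd (pd u i) i x) (ψ x) - inner ℝ (I * u x) (pd (pd ψ i) i x) := by
  have hd : ∀ {f : Ed d → ℂ}, ContDiff ℝ (⊤ : ℕ∞) f → DifferentiableAt ℝ f x := fun h =>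
    h.differentiable (by simp) x
  have hI : ∀ {f : Ed d → ℂ}, ContDiff ℝ (⊤ : ℕ∞) f →
      fderiv ℝ (fun x => I * f x) x (stdBasis i) = I * pd f i x := by
    intro f hf
    rw [fderiv_const_mul (hd hf)]; rfl
  have h1 := pd_contDiff (sch_smooth u) i
  have h2 := pd_contDiff (sch_smooth ψ) i
  have e1 : ContDiff ℝ (⊤ : ℕ∞) (fun x => I * pd u i x) := contDiff_const.mul h1
  have e2 : ContDiff ℝ (⊤ : ℕ∞) (fun x => I * u x) := contDiff_const.mul (sch_smooth u)
  unfold gi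
  rw [fderiv_fun_sub ((hd e1).inner ℝ (hd (sch_smooth ψ))) ((hd e2).inner ℝ (hd h2)), sub_apply]
  rw [fderiv_inner_apply ℝ (hd e1) (hd (sch_smooth ψ)), fderiv_inner_apply ℝ (hd e2) (hd h2)]
  rw [hI h1, hI (sch_smooth u)]
  simp only [pd]
  ring

theorem lineDeriv_le {θ : Ed d → ℝ} {L : NNReal} (hθ : LipschitzWith L θ) (i : Fin d) (x : Ed d) :
    |lineDeriv ℝ θ x (stdBasis i)| ≤ L := by
  have := norm_lineDeriv_le_of_lipschitz ℝ (v := stdBasis i) (x₀ := x) hθ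
  simpa [stdBasis] using this

theorem S2_eq (u : Sch d) : S2 u = ∑ i, ∫ x, ‖D i u x‖ ^ 2 := by
  unfold S2 gradNormSq
  rw [integral_finsetSum _ fun i _ => ?_]
  · simp only [D_apply]
  · simp only [← D_apply]; exact int_sq _

theorem n2_D_le (u : Sch d) (i : Fin d) : n2 (D i u) ≤ √(S2 u) := by
  rw [S2_eq]
  refine Real.sqrt_le_sqrt (Finset.single_le_sum (f := fun i => ∫ x, ‖D i u x‖ ^ 2) (fun j _ => ?_) (Finset.mem_univ i))
  exact integral_nonneg fun _ => by positivity

theorem n2_M (u : Sch d) : n2 u = √(M u) := rfl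

/-- bound for the boundary term of Green's formula -/
theorem green_bd {R : ℝ} (hR : 0 < R) (u ψ : Sch d) (i : Fin d) :
    |∫ x, 2 * ct R x * lineDeriv ℝ (ct R) x (stdBasis i) * gi u ψ i x| ≤
      2 / R * (√(S2 u) * n2 ψ + √(M u) * n2 (D i ψ)) := by
  have hgb : ∀ x, |gi u ψ i x| ≤ ‖D i u x‖ * ‖ψ x‖ + ‖u x‖ * ‖D i ψ x‖ := by
    intro x
    unfold gi
    simp only [D_apply]
    refine (abs_sub _ _).trans (add_le_add ?_ ?_)
    · refine (abs_real_inner_le_norm _ _).trans (le_of_eq ?_); simp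
    · refine (abs_real_inner_le_norm _ _).trans (le_of_eq ?_); simp
  have hI : Integrable (fun x => ‖D i u x‖ * ‖ψ x‖ + ‖u x‖ * ‖D i ψ x‖) :=
    (((rd (D i u)).norm.mul (rd ψ).norm.pg).add ((rd u).norm.mul (rd (D i ψ)).norm.pg)).integrable
  calc _ ≤ ∫ x, |2 * ct R x * lineDeriv ℝ (ct R) x (stdBasis i) * gi u ψ i x| := abs_integral_le_integral_abs
    _ ≤ ∫ x, 2 / R * (‖D i u x‖ * ‖ψ x‖ + ‖u x‖ * ‖D i ψ x‖) := by
      refine integral_mono_of_nonneg (Eventually.of_forall fun x => abs_nonneg _) (hI.const_mul _)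
        (Eventually.of_forall fun x => ?_)
      simp only []
      have h1 := lineDeriv_le (ct_lip (d := d) hR) i x
      rw [Real.coe_toNNReal _ (by positivity)] at h1
      rw [abs_mul, abs_mul, abs_mul, abs_two, abs_of_nonneg (ct_nonneg R x)]
      calc _ ≤ 2 * 1 * (1 / R) * (‖D i u x‖ * ‖ψ x‖ + ‖u x‖ * ‖D i ψ x‖) := by
            gcongr
            · exact ct_le_one hR x
            · exact hgb x
        _ = _ := by ring
    _ = 2 / R * ((∫ x, ‖D i u x‖ * ‖ψ x‖) + ∫ x, ‖u x‖ * ‖D i ψ x‖) := by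
      rw [integral_const_mul, integral_add]
      · exact ((rd (D i u)).norm.mul (rd ψ).norm.pg).integrable
      · exact ((rd u).norm.mul (rd (D i ψ)).norm.pg).integrable
    _ ≤ _ := by
      gcongr
      · refine (int_norm_mul_le (rd (D i u)) (rd ψ)).trans ?_
        gcongr
        · exact n2_nonneg
        · exact n2_D_le u i
      · exact int_norm_mul_le (rd u) (rd (D i ψ))

theorem pow_le_one_add (z : ℂ) : ‖z‖ ^ (1 + sg d) ≤ 1 + ‖z‖ ^ (2 + sg d) := by
  have hs := sg_nonneg (d := d)
  rcases le_total ‖z‖ 1 with h | h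
  · have := Real.rpow_le_one (norm_nonneg z) h (by positivity : 0 ≤ 1 + sg d)
    have h2 : 0 ≤ ‖z‖ ^ (2 + sg d) := by positivity
    linarith
  · have := Real.rpow_le_rpow_of_exponent_le h (by linarith : 1 + sg d ≤ 2 + sg d)
    linarith

/-- integrating the nonlinearity against an RD bounded weight -/
theorem fN_int_le (u : Sch d) {k : Ed d → ℝ} (hk : RD k) {B : ℝ} (hB : ∀ x, |k x| ≤ B) :
    ∫ x, ‖fN u x‖ * |k x| ≤ (∫ x, |k x|) + B * PP u := by
  unfold PP
  simp only [← Real.norm_eq_abs] at hB ⊢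
  rw [← integral_const_mul, ← integral_add hk.norm.integrable ((PP_rd (rd u)).integrable.const_mul B)]
  refine integral_mono ((fN_rd (rd u)).norm.mul hk.norm.pg).integrable
    (hk.norm.integrable.add ((PP_rd (rd u)).integrable.const_mul B)) fun x => ?_
  simp only []
  rw [fN_norm']
  have h1 := pow_le_one_add (d := d) (u x)
  have h2 : 0 ≤ ‖u x‖ ^ (2 + sg d) := by positivity
  have h3 := hB x
  have h4 := norm_nonneg (k x)
  calc _ ≤ (1 + ‖u x‖ ^ (2 + sg d)) * ‖k x‖ := by gcongr
    _ = ‖k x‖ + ‖k x‖ * ‖u x‖ ^ (2 + sg d) := by ring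
    _ ≤ _ := by gcongr


/-- cutoff pairing: exact derivative -/
theorem cut_deriv {lam : ℝ} {v : ℝ → Sch d} (hv : IsSol lam v) (ψ : Sch d) {R : ℝ} (hR : 0 < R) (t : ℝ) :
    HasDerivAt (fun t => ∫ x, ct R x ^ 2 * inner ℝ (v t x) (ψ x))
      ((∑ i, -∫ x, 2 * ct R x * lineDeriv ℝ (ct R) x (stdBasis i) * gi (v t) ψ i x)
        + ∫ x, ct R x ^ 2 * (inner ℝ (v t x) (J (Hop ψ) x) + lam * inner ℝ (I * fN (v t) x) (ψ x))) t := by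
  have hG : ContDiff ℝ 1 (fun p : ℝ × Ed d => (inner ℝ (v p.1 p.2) (ψ p.2) : ℝ)) :=
    (hv.smooth.inner ℝ ((sch_smooth ψ).comp contDiff_snd)).of_le (by exact_mod_cast le_top)
  have hk : Continuous (fun x : Ed d => ct R x ^ 2) := ct_cont.pow 2
  have hks : HasCompactSupport (fun x : Ed d => ct R x ^ 2) := by
    have : (fun x : Ed d => ct R x ^ 2) = fun x => ct R x * ct R x := by funext x; ring
    rw [this]; exact (ct_supp hR).mul_right
  have h := hasDerivAt_cpt _ hk hks (fun t x => (inner ℝ (v t x) (ψ x) : ℝ)) hG t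
  convert h using 1
  have hd : ∀ x, deriv (fun s => (inner ℝ (v s x) (ψ x) : ℝ)) t
      = (∑ i, fderiv ℝ (gi (v t) ψ i) x (stdBasis i)) +
        (inner ℝ (v t x) (J (Hop ψ) x) + lam * inner ℝ (I * fN (v t) x) (ψ x)) := by
    intro x
    have h1 := (time_hasDerivAt (w := fun s x => v s x) hv.smooth t x).inner ℝ (hasDerivAt_const t (ψ x))
    rw [h1.deriv, hv.eq]
    simp only [gi_fderiv, inner_zero_right, zero_add, Finset.sum_sub_distrib, ← inner_sum, ← sum_inner, ← Finset.mul_sum]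
    rw [J_apply, Hop_eq]
    change _ = inner ℝ (I * lap (v t) x) (ψ x) - inner ℝ (I * v t x) (lap ψ x) + (inner ℝ (v t x) (I * (Q ψ x - Lap ψ x)) + lam * inner ℝ (I * fN (v t) x) (ψ x))
    rw [Q_apply, Lap_apply]
    unfold fN
    simp only [Complex.inner, mul_re, mul_im, add_re, add_im, sub_re, sub_im, conj_re, conj_im, map_mul, map_add, map_sub,
      I_re, I_im, ofReal_re, ofReal_im]
    ring
  simp only [hd, mul_add (ct R _ ^ 2) (∑ i, _), Finset.mul_sum]
  have hcs : ∀ {f : Ed d → ℝ}, Continuous f → Integrable (fun x => ct R x ^ 2 * f x) := fun hf =>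
    (hk.mul hf).integrable_of_hasCompactSupport hks.mul_right
  have hc1 : ∀ i, Continuous (fun x => fderiv ℝ (gi (v t) ψ i) x (stdBasis i)) := fun i =>
    ((gi_contDiff (v t) ψ i).continuous_fderiv (by simp)).clm_apply continuous_const
  have hc2 : Continuous (fun x => inner ℝ (v t x) (J (Hop ψ) x) + lam * inner ℝ (I * fN (v t) x) (ψ x)) :=
    ((v t).continuous.inner (J (Hop ψ)).continuous).add
      (continuous_const.mul ((continuous_const.mul (fN_cont (v t).continuous)).inner ψ.continuous))
  rw [integral_add (integrable_finsetSum _ fun i _ => hcs (hc1 i)) (hcs hc2), integral_finsetSum _ fun i _ => hcs (hc1 i)]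
  congr 1
  refine Finset.sum_congr rfl fun i _ => ?_
  rw [ibp_lip (ct_lip hR) (ct_supp hR) _ (gi_contDiff (v t) ψ i)]

theorem RD.bdd {E : Type} [NormedAddCommGroup E] {F : Ed d → E} (h : RD F) : ∃ B, 0 ≤ B ∧ ∀ x, ‖F x‖ ≤ B := by
  obtain ⟨C, hC⟩ := h.dec 0
  exact ⟨C, (norm_nonneg _).trans (by simpa using hC 0), fun x => by simpa using hC x⟩

/-- pairing law -/
theorem PL {lam : ℝ} {v : ℝ → Sch d} (hv : IsSol lam v) (ψ : Sch d) {a b M0 S0 P0 : ℝ}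
    (hM : ∀ t ∈ Set.Icc a b, M (v t) ≤ M0) (hS : ∀ t ∈ Set.Icc a b, S2 (v t) ≤ S0)
    (hP : ∀ t ∈ Set.Icc a b, PP (v t) ≤ P0) :
    ∀ t ∈ Set.Icc a b, HasDerivWithinAt (fun t => ip (v t) ψ) (Gam lam ψ (v t)) (Set.Icc a b) t := by
  have hrx : ∀ φ : Sch d, RD (fun x => ‖x‖ * ‖φ x‖) := fun φ => PG.nrm.rmul (rd φ).norm
  obtain ⟨B, hB0, hB⟩ := (hrx ψ).bdd
  set C1 : ℝ := ∑ i, 2 * (√S0 * n2 ψ + √M0 * n2 (D i ψ)) with hC1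
  set C2 : ℝ := 2 * (√M0 * √(∫ x, (‖x‖ * ‖J (Hop ψ) x‖) ^ 2) + |lam| * ((∫ x, ‖x‖ * ‖ψ x‖) + B * P0)) with hC2
  have hrg : ∀ u : Sch d, RD (fun x => inner ℝ (u x) (J (Hop ψ) x) + lam * inner ℝ (I * fN u x) (ψ x)) := by
    intro u
    refine ((rd u).inner (rd _).pg).add ((PG.const lam).rmul (RD.inner ?_ (rd ψ).pg))
    exact (PG.const I).rmul (fN_rd (rd u))
  have hGam : ∀ u : Sch d, Gam lam ψ u = ∫ x, (inner ℝ (u x) (J (Hop ψ) x) + lam * inner ℝ (I * fN u x) (ψ x)) := by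
    intro u
    unfold Gam ip
    rw [integral_add, integral_const_mul]
    · exact ((rd u).inner (rd _).pg).integrable
    · exact ((PG.const lam).rmul (RD.inner ((PG.const I).rmul (fN_rd (rd u))) (rd ψ).pg)).integrable
  refine deriv_limit (f := fun n t => ∫ x, ct ((n : ℝ) + 1) x ^ 2 * inner ℝ (v t x) (ψ x)) (ε := fun n => (C1 + C2) / ((n : ℝ) + 1))
    (fun n t _ => cut_deriv hv ψ (by positivity) t) (fun t _ => ?_) (fun n t ht => ?_) ?_
  · have hr : RD (fun x => (inner ℝ (v t x) (ψ x) : ℝ)) := (rd _).inner (rd _).pg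
    rw [tendsto_iff_norm_sub_tendsto_zero]
    have h1 : Tendsto (fun n : ℕ => 2 / ((n : ℝ) + 1) * ∫ x, ‖x‖ * |(inner ℝ (v t x) (ψ x) : ℝ)|) atTop (nhds (0 * ∫ x, ‖x‖ * |(inner ℝ (v t x) (ψ x) : ℝ)|)) := by
      apply Tendsto.mul_const
      have := (tendsto_one_div_add_atTop_nhds_zero_nat (𝕜 := ℝ)).const_mul 2
      simpa [div_eq_mul_inv] using this
    rw [zero_mul] at h1
    exact squeeze_zero (fun n => norm_nonneg _) (fun n => ct_int (by positivity) hr) h1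
  · have hR : 0 < (n : ℝ) + 1 := by positivity
    have h1 := ct_int hR (hrg (v t))
    rw [← hGam] at h1
    have h2 : ∀ i, |∫ x, 2 * ct ((n : ℝ) + 1) x * lineDeriv ℝ (ct ((n : ℝ) + 1)) x (stdBasis i) * gi (v t) ψ i x|
        ≤ 2 / ((n : ℝ) + 1) * (√S0 * n2 ψ + √M0 * n2 (D i ψ)) := by
      intro i
      refine (green_bd hR (v t) ψ i).trans ?_
      have := hS t ht
      have := hM t ht
      have := n2_nonneg (u := (ψ : Ed d → ℂ))
      have := n2_nonneg (u := (D i ψ : Ed d → ℂ))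
      gcongr
    have h3 : ∫ x, ‖x‖ * |(inner ℝ (v t x) (J (Hop ψ) x) + lam * inner ℝ (I * fN (v t) x) (ψ x) : ℝ)| ≤
        √M0 * √(∫ x, (‖x‖ * ‖J (Hop ψ) x‖) ^ 2) + |lam| * ((∫ x, ‖x‖ * ‖ψ x‖) + B * P0) := by
      have i1 : RD (fun x => ‖v t x‖ * (‖x‖ * ‖J (Hop ψ) x‖)) := (rd _).norm.mul (hrx _).pg
      have i2 : RD (fun x => ‖fN (v t) x‖ * (‖x‖ * ‖ψ x‖)) := (fN_rd (rd _)).norm.mul (hrx _).pg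
      calc _ ≤ ∫ x, (‖v t x‖ * (‖x‖ * ‖J (Hop ψ) x‖) + |lam| * (‖fN (v t) x‖ * (‖x‖ * ‖ψ x‖))) := by
            refine integral_mono (PG.nrm.rmul (hrg (v t)).norm).integrable
              (i1.integrable.add (i2.integrable.const_mul _)) fun x => ?_
            simp only []
            have e1 := abs_real_inner_le_norm (v t x) (J (Hop ψ) x)
            have e2 := abs_real_inner_le_norm (I * fN (v t) x) (ψ x)
            rw [norm_mul, norm_I, one_mul] at e2
            calc _ ≤ ‖x‖ * (‖v t x‖ * ‖J (Hop ψ) x‖ + |lam| * (‖fN (v t) x‖ * ‖ψ x‖)) := by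
                  gcongr
                  refine (abs_add_le _ _).trans (add_le_add e1 ?_)
                  rw [abs_mul]; gcongr
              _ = _ := by ring
        _ = (∫ x, ‖v t x‖ * (‖x‖ * ‖J (Hop ψ) x‖)) + |lam| * ∫ x, ‖fN (v t) x‖ * (‖x‖ * ‖ψ x‖) := by
            rw [integral_add i1.integrable (i2.integrable.const_mul _), integral_const_mul]
        _ ≤ _ := by
            gcongr
            · have := int_norm_mul_le (u := v t) (w := fun x => ((‖x‖ : ℝ) : ℂ) * J (Hop ψ) x) (rd _) (PG.nrm.ofReal.rmul (rd _))
              simp only [norm_mul, Complex.norm_real, norm_norm] at this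
              refine this.trans ?_
              unfold n2
              simp only [norm_mul, Complex.norm_real, norm_norm]
              gcongr
              exact hM t ht
            · have h4 := fN_int_le (v t) (hrx ψ) (B := B) (fun x => by simpa using hB x)
              have h5 : ∀ x, |‖x‖ * ‖ψ x‖| = ‖x‖ * ‖ψ x‖ := fun x => abs_of_nonneg (by positivity)
              simp only [h5] at h4
              refine h4.trans ?_
              have := hP t ht
              gcongr
    calc _ ≤ (∑ i, |∫ x, 2 * ct ((n : ℝ) + 1) x * lineDeriv ℝ (ct ((n : ℝ) + 1)) x (stdBasis i) * gi (v t) ψ i x|)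
          + |(∫ x, ct ((n : ℝ) + 1) x ^ 2 * (inner ℝ (v t x) (J (Hop ψ) x) + lam * inner ℝ (I * fN (v t) x) (ψ x))) - Gam lam ψ (v t)| := by
          rw [add_sub_assoc]
          refine (abs_add_le _ _).trans ?_
          gcongr
          refine (Finset.abs_sum_le_sum_abs _ _).trans ?_
          simp
      _ ≤ (∑ i, 2 / ((n : ℝ) + 1) * (√S0 * n2 ψ + √M0 * n2 (D i ψ))) + 2 / ((n : ℝ) + 1) * (√M0 * √(∫ x, (‖x‖ * ‖J (Hop ψ) x‖) ^ 2) + |lam| * ((∫ x, ‖x‖ * ‖ψ x‖) + B * P0)) := by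
          gcongr with i
          · exact h2 i
          · exact h1.trans (by gcongr)
      _ = _ := by
          rw [hC1, hC2, add_div, Finset.sum_div]
          congr 1
          · exact Finset.sum_congr rfl fun i _ => by ring
          · ring
  · have := (tendsto_one_div_add_atTop_nhds_zero_nat (𝕜 := ℝ)).const_mul (C1 + C2)
    simpa [div_eq_mul_inv] using this

end HS

namespace HS
open Complex ComplexConjugate Module
variable {d : ℕ}
open scoped ENNReal NNReal

theorem GN_cpt_ge2 (hd : 2 ≤ d) : ∃ C : ℝ≥0, ∀ u : Ed d → ℂ, ContDiff ℝ 1 u → HasCompactSupport u →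
    ∫⁻ x, ‖u x‖ₑ ^ (2 + sg d) ≤ C * (∫⁻ x, ‖u x‖ₑ ^ (2:ℝ)) ^ (2 / (d:ℝ)) * ∫⁻ x, ‖fderiv ℝ u x‖ₑ ^ (2:ℝ) := by
  have hd' : (2:ℝ) ≤ d := by exact_mod_cast hd
  have hd0 : (0:ℝ) < d := by linarith
  set q : ℝ≥0 := ⟨(2*d+4)*(d-1)/d^2, by apply div_nonneg _ (by positivity); nlinarith⟩ with hq
  have hqv : (q:ℝ) = (2*d+4)*(d-1)/d^2 := rfl
  have hq1 : (1:ℝ) < q := by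
    rw [hqv, lt_div_iff₀ (by positivity)]; nlinarith
  have hq1' : 1 < q := by exact_mod_cast hq1
  set r : ℝ≥0 := ⟨d/(d-1), by apply div_nonneg <;> linarith⟩ with hr
  have hrv : (r:ℝ) = d/(d-1) := rfl
  have hconj : NNReal.HolderConjugate (finrank ℝ (Ed d)) r := by
    rw [← NNReal.holderConjugate_coe_iff, Real.holderConjugate_iff, hrv]
    simp only [finrank_euclideanSpace, Fintype.card_fin, NNReal.coe_natCast]
    refine ⟨by linarith, ?_⟩
    field_simp; ring
  set K := eLpNormLESNormFDerivOneConst (volume : Measure (Ed d)) r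
  refine ⟨(K * q)^2, fun u hu hc => ?_⟩
  have hF : ContDiff ℝ 1 (fun x => ‖u x‖ ^ (q:ℝ)) := hu.norm_rpow hq1
  have hFc : HasCompactSupport (fun x => ‖u x‖ ^ (q:ℝ)) := by
    refine hc.comp_left (g := fun z : ℂ => ‖z‖ ^ (q:ℝ)) ?_
    simp only [norm_zero]; exact Real.zero_rpow (by linarith)
  have h1 := eLpNorm_le_eLpNorm_fderiv_one volume hF hFc hconj
  have hr0 : 0 < (r:ℝ) := by rw [hrv]; apply div_pos <;> linarith
  have hrne : r ≠ 0 := by rintro h; rw [h] at hr0; simp at hr0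
  have hP : eLpNorm (fun x => ‖u x‖ ^ (q:ℝ)) r volume = (∫⁻ x, ‖u x‖ₑ ^ (2 + sg d)) ^ (1 / (r:ℝ)) := by
    rw [eLpNorm_eq_lintegral_rpow_enorm_toReal (by simpa using hrne) (by simp)]
    simp only [ENNReal.coe_toReal]
    congr 1
    refine lintegral_congr fun x => ?_
    rw [Real.enorm_rpow_of_nonneg (norm_nonneg _) (by linarith), enorm_norm, ← ENNReal.rpow_mul]
    congr 1
    rw [hqv, hrv, sg]
    have : (d:ℝ) - 1 ≠ 0 := by linarith
    field_simp
  rw [hP, eLpNorm_one_eq_lintegral_enorm] at h1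
  set P := ∫⁻ x, ‖u x‖ₑ ^ (2 + sg d) with hPdef
  set N := ∫⁻ x, ‖u x‖ₑ ^ (2:ℝ)
  set G := ∫⁻ x, ‖fderiv ℝ u x‖ₑ ^ (2:ℝ)
  have hum : Measurable (fun x => ‖u x‖ₑ) := hu.continuous.measurable.enorm
  have hfm : Measurable (fun x => ‖fderiv ℝ u x‖ₑ) := (measurable_fderiv ℝ u).enorm
  have hdiff : Differentiable ℝ u := hu.differentiable (by simp)
  have h2 : ∫⁻ x, ‖fderiv ℝ (fun x => ‖u x‖ ^ (q:ℝ)) x‖ₑ ≤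
      q * ((∫⁻ x, ‖u x‖ₑ ^ (2 * ((q:ℝ) - 1))) ^ (1/2:ℝ) * G ^ (1/2:ℝ)) := by
    calc _ ≤ ∫⁻ x, q * ((‖u x‖ₑ ^ (2 * ((q:ℝ) - 1))) ^ (1/2:ℝ) * (‖fderiv ℝ u x‖ₑ ^ (2:ℝ)) ^ (1/2:ℝ)) := by
          refine lintegral_mono fun x => (enorm_fderiv_norm_rpow_le hdiff hq1').trans (le_of_eq ?_)
          rw [← ENNReal.rpow_mul, ← ENNReal.rpow_mul, mul_assoc]
          congr 2
          · congr 1; ring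
          · norm_num
      _ = q * ∫⁻ x, ((‖u x‖ₑ ^ (2 * ((q:ℝ) - 1))) ^ (1/2:ℝ) * (‖fderiv ℝ u x‖ₑ ^ (2:ℝ)) ^ (1/2:ℝ)) := by
          rw [lintegral_const_mul' _ _ (by simp)]
      _ ≤ _ := by
          gcongr
          exact ENNReal.lintegral_mul_norm_pow_le (hum.pow_const _).aemeasurable (hfm.pow_const _).aemeasurable
            (by norm_num) (by norm_num) (by norm_num)
  have h3 : ∫⁻ x, ‖u x‖ₑ ^ (2 * ((q:ℝ) - 1)) ≤ N ^ (2/(d:ℝ)) * P ^ (1 - 2/(d:ℝ)) := by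
    have h2d : 2/(d:ℝ) ≤ 1 := by rw [div_le_one hd0]; exact hd'
    have h2d0 : 0 ≤ 2/(d:ℝ) := by positivity
    refine le_trans (le_of_eq ?_) (ENNReal.lintegral_mul_norm_pow_le (hum.pow_const _).aemeasurable (hum.pow_const _).aemeasurable h2d0
      (by linarith) (by ring))
    refine lintegral_congr fun x => ?_
    rw [← ENNReal.rpow_mul, ← ENNReal.rpow_mul, ← ENNReal.rpow_add_of_nonneg]
    · congr 1; rw [hqv, sg]; field_simp; ring
    · positivity
    · have := sg_nonneg (d := d); apply mul_nonneg; positivity; linarith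
  have hPfin : P ≠ ∞ := by
    have hcont : Continuous (fun x => ‖u x‖ ^ (2 + sg d)) :=
      hu.continuous.norm.rpow_const (fun x => Or.inr (by have := sg_nonneg (d := d); linarith))
    have hcs : HasCompactSupport (fun x => ‖u x‖ ^ (2 + sg d)) := by
      refine hc.comp_left (g := fun z : ℂ => ‖z‖ ^ (2 + sg d)) ?_
      simp only [norm_zero]; exact Real.zero_rpow (by have := sg_nonneg (d := d); linarith)
    have := (hcont.integrable_of_hasCompactSupport (μ := volume) hcs).2.ne
    convert this using 1
    refine lintegral_congr fun x => ?_
    rw [Real.enorm_rpow_of_nonneg (norm_nonneg _) (by have := sg_nonneg (d := d); linarith), enorm_norm]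
  have h4 : P ^ (1/(r:ℝ)) ≤ K * (q * ((N ^ (2/(d:ℝ)) * P ^ (1 - 2/(d:ℝ))) ^ (1/2:ℝ) * G ^ (1/2:ℝ))) := by
    refine h1.trans ?_
    gcongr
    refine h2.trans ?_
    gcongr
  by_cases hP0 : P = 0
  · rw [hP0]; exact zero_le
  have h5 : (P ^ (1/(r:ℝ))) ^ (2:ℝ) ≤ (K * q)^2 * N ^ (2/(d:ℝ)) * G * P ^ (1 - 2/(d:ℝ)) := by
    refine (ENNReal.rpow_le_rpow h4 (by norm_num : (0:ℝ) ≤ 2)).trans (le_of_eq ?_)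
    rw [ENNReal.mul_rpow_of_nonneg _ _ (by norm_num), ENNReal.mul_rpow_of_nonneg _ _ (by norm_num),
      ENNReal.mul_rpow_of_nonneg _ _ (by norm_num), ← ENNReal.rpow_mul, ← ENNReal.rpow_mul]
    norm_num
    ring
  have h6 : (P ^ (1/(r:ℝ))) ^ (2:ℝ) = P * P ^ (1 - 2/(d:ℝ)) := by
    nth_rewrite 2 [← ENNReal.rpow_one P]
    rw [← ENNReal.rpow_mul, ← ENNReal.rpow_add _ _ hP0 hPfin]
    congr 1
    rw [hrv]
    have : (d:ℝ) - 1 ≠ 0 := by linarith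
    field_simp; ring
  rw [h6] at h5
  have hpos : P ^ (1 - 2/(d:ℝ)) ≠ 0 := by simp [ENNReal.rpow_eq_zero_iff, hP0, hPfin]
  have hfin : P ^ (1 - 2/(d:ℝ)) ≠ ∞ := by simp [ENNReal.rpow_eq_top_iff, hP0, hPfin]
  have := (ENNReal.mul_le_mul_iff_left hpos hfin).1 h5
  simpa using this


theorem GN_cpt_1 (u : Ed 1 → ℂ) (hu : ContDiff ℝ 1 u) (hc : HasCompactSupport u) :
    ∫⁻ x, ‖u x‖ₑ ^ (6:ℝ) ≤ 4 * (∫⁻ x, ‖u x‖ₑ ^ (2:ℝ)) ^ (2:ℝ) * ∫⁻ x, ‖fderiv ℝ u x‖ₑ ^ (2:ℝ) := by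
  set N := ∫⁻ x, ‖u x‖ₑ ^ (2:ℝ)
  set G := ∫⁻ x, ‖fderiv ℝ u x‖ₑ ^ (2:ℝ)
  have hum : Measurable (fun x => ‖u x‖ₑ) := hu.continuous.measurable.enorm
  have hfm : Measurable (fun x => ‖fderiv ℝ u x‖ₑ) := (measurable_fderiv ℝ u).enorm
  have hdiff : Differentiable ℝ u := hu.differentiable (by simp)
  -- the line
  let ι : ℝ → Ed 1 := fun s => s • stdBasis 0
  have hι : MeasurePreserving ι volume volume := by
    have h1 := (volume_preserving_funUnique (Fin 1) ℝ).symm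
    have h2 := PiLp.volume_preserving_toLp (Fin 1)
    have h3 := h2.comp h1
    have heq : ι = WithLp.toLp 2 ∘ (MeasurableEquiv.funUnique (Fin 1) ℝ).symm := by
      funext s
      ext i
      fin_cases i
      simp [ι, stdBasis]
    rw [heq]; exact h3
  have hιi : ∀ x : Ed 1, x = ι (x 0) := by
    intro x; ext i; fin_cases i; simp [ι, stdBasis]
  have hιc : ContDiff ℝ 1 ι := contDiff_id.smul contDiff_const
  have hF : ContDiff ℝ 1 (fun x => ‖u x‖ ^ (2:ℝ)) := hu.norm_rpow (by norm_num)
  have hψc : ContDiff ℝ 1 (fun s => ‖u (ι s)‖ ^ (2:ℝ)) := hF.comp hιc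
  have hψs : HasCompactSupport (fun s => ‖u (ι s)‖ ^ (2:ℝ)) := by
    have h1 : HasCompactSupport (fun x => ‖u x‖ ^ (2:ℝ)) := by
      refine hc.comp_left (g := fun z : ℂ => ‖z‖ ^ (2:ℝ)) ?_
      simp
    have hemb : Topology.IsClosedEmbedding ι := by
      have hne : stdBasis (0 : Fin 1) ≠ (0 : Ed 1) := by
        intro h; have := congrArg (fun x : Ed 1 => x 0) h; simp [stdBasis] at this
      exact isClosedEmbedding_smul_left hne
    exact h1.comp_isClosedEmbedding hemb
  have hder : ∀ s, ‖deriv (fun s => ‖u (ι s)‖ ^ (2:ℝ)) s‖ₑ ≤ 2 * (‖u (ι s)‖ₑ * ‖fderiv ℝ u (ι s)‖ₑ) := by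
    intro s
    have h1 : HasDerivAt ι (stdBasis 0) s := by
      simpa using (hasDerivAt_id s).smul_const (stdBasis (0 : Fin 1))
    have h2 := ((hF.differentiable (by simp)) (ι s)).hasFDerivAt.comp_hasDerivAt s h1
    have h3 : deriv (fun s => ‖u (ι s)‖ ^ (2:ℝ)) s = fderiv ℝ (fun x => ‖u x‖ ^ (2:ℝ)) (ι s) (stdBasis 0) := h2.deriv
    rw [h3]
    have h4 := (fderiv ℝ (fun x => ‖u x‖ ^ (2:ℝ)) (ι s)).le_opENorm (stdBasis 0)
    have h5 := enorm_fderiv_norm_rpow_le hdiff (x := ι s) (p := 2) (by norm_num)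
    have h6 : ‖(stdBasis 0 : Ed 1)‖ₑ = 1 := by
      rw [← ofReal_norm]; simp [stdBasis]
    rw [h6, mul_one] at h4
    refine h4.trans (le_trans h5 (le_of_eq ?_))
    norm_num [mul_assoc]
  have hsup : ∀ x, ‖u x‖ₑ ^ (2:ℝ) ≤ 2 * (N ^ (1/2:ℝ) * G ^ (1/2:ℝ)) := by
    intro x
    have h1 := hψs.enorm_le_lintegral_Ici_deriv hψc (x 0)
    rw [← hιi x, Real.enorm_rpow_of_nonneg (norm_nonneg _) (by norm_num), enorm_norm] at h1
    refine h1.trans ((setLIntegral_le_lintegral _ _).trans ((lintegral_mono hder).trans ?_))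
    rw [lintegral_const_mul' _ _ (by simp)]
    gcongr
    rw [hι.lintegral_comp (f := fun x => ‖u x‖ₑ * ‖fderiv ℝ u x‖ₑ) (hum.mul hfm)]
    refine le_trans (le_of_eq ?_) (ENNReal.lintegral_mul_norm_pow_le (hum.pow_const 2).aemeasurable (hfm.pow_const 2).aemeasurable
            (by norm_num) (by norm_num) (by norm_num))
    refine lintegral_congr fun x => ?_
    rw [← ENNReal.rpow_mul, ← ENNReal.rpow_mul]; norm_num
  calc ∫⁻ x, ‖u x‖ₑ ^ (6:ℝ) = ∫⁻ x, (‖u x‖ₑ ^ (2:ℝ)) ^ (2:ℝ) * ‖u x‖ₑ ^ (2:ℝ) := by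
        refine lintegral_congr fun x => ?_
        rw [← ENNReal.rpow_mul, ← ENNReal.rpow_add_of_nonneg _ _ (by norm_num) (by norm_num)]; norm_num
    _ ≤ ∫⁻ x, (2 * (N ^ (1/2:ℝ) * G ^ (1/2:ℝ))) ^ (2:ℝ) * ‖u x‖ₑ ^ (2:ℝ) := by
        refine lintegral_mono fun x => ?_
        gcongr
        exact hsup x
    _ = (2 * (N ^ (1/2:ℝ) * G ^ (1/2:ℝ))) ^ (2:ℝ) * N := lintegral_const_mul _ (hum.pow_const 2)
    _ = _ := by
        rw [ENNReal.mul_rpow_of_nonneg _ _ (by norm_num), ENNReal.mul_rpow_of_nonneg _ _ (by norm_num),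
          ← ENNReal.rpow_mul, ← ENNReal.rpow_mul]
        norm_num
        ring

theorem GN_cpt (hd : 1 ≤ d) : ∃ C : ℝ≥0, ∀ u : Ed d → ℂ, ContDiff ℝ 1 u → HasCompactSupport u →
    ∫⁻ x, ‖u x‖ₑ ^ (2 + sg d) ≤ C * (∫⁻ x, ‖u x‖ₑ ^ (2:ℝ)) ^ (2 / (d:ℝ)) * ∫⁻ x, ‖fderiv ℝ u x‖ₑ ^ (2:ℝ) := by
  rcases hd.eq_or_lt with h | h
  · subst h
    refine ⟨4, fun u hu hc => ?_⟩
    have := GN_cpt_1 u hu hc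
    norm_num [sg] at this ⊢
    exact this
  · exact GN_cpt_ge2 h

/-- a fixed smooth bump -/
def bp : ContDiffBump (0 : Ed d) := ⟨1, 2, by norm_num, by norm_num⟩

/-- smooth cutoffs -/
def chi (R : ℝ) (x : Ed d) : ℝ := bp (R⁻¹ • x)

theorem chi_smooth (R : ℝ) : ContDiff ℝ (⊤ : ℕ∞) (chi R : Ed d → ℝ) :=
  (bp (d := d)).contDiff.comp (contDiff_const_smul R⁻¹)

theorem chi_nonneg (R : ℝ) (x : Ed d) : 0 ≤ chi R x := bp.nonneg
theorem chi_le_one (R : ℝ) (x : Ed d) : chi R x ≤ 1 := bp.le_one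

theorem chi_one {R : ℝ} (hR : 0 < R) {x : Ed d} (hx : ‖x‖ ≤ R) : chi R x = 1 := by
  refine bp.one_of_mem_closedBall ?_
  simp only [mem_closedBall_zero_iff, norm_smul, norm_inv, Real.norm_eq_abs, abs_of_pos hR]
  show R⁻¹ * ‖x‖ ≤ 1
  rw [inv_mul_le_iff₀ hR]; simpa using hx

theorem chi_zero {R : ℝ} (hR : 0 < R) {x : Ed d} (hx : 2 * R ≤ ‖x‖) : chi R x = 0 := by
  refine bp.zero_of_le_dist ?_
  simp only [dist_zero_right, norm_smul, norm_inv, Real.norm_eq_abs, abs_of_pos hR]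
  show 2 ≤ R⁻¹ * ‖x‖
  rw [← div_eq_inv_mul, le_div_iff₀ hR]; exact hx

theorem chi_supp {R : ℝ} (hR : 0 < R) : HasCompactSupport (chi R : Ed d → ℝ) := by
  refine HasCompactSupport.intro (isCompact_closedBall (0 : Ed d) (2 * R)) fun x hx => chi_zero hR ?_
  simp only [mem_closedBall_zero_iff, not_le] at hx
  exact hx.le

theorem chi_grad (d : ℕ) : ∃ C : ℝ, 0 < C ∧ ∀ R > 0, ∀ x : Ed d, ‖fderiv ℝ (chi R) x‖ ≤ C / R := by
  have hc : Continuous (fderiv ℝ (bp (d := d))) := (bp (d := d)).contDiff.continuous_fderiv (n := 1) (by simp)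
  have hs : HasCompactSupport (fderiv ℝ (bp (d := d))) := (bp (d := d)).hasCompactSupport.fderiv ℝ
  obtain ⟨C, hC⟩ := hc.bounded_above_of_compact_support hs
  refine ⟨max C 1, by positivity, fun R hR x => ?_⟩
  have h1 : HasFDerivAt (fun x : Ed d => R⁻¹ • x) (R⁻¹ • ContinuousLinearMap.id ℝ (Ed d)) x :=
    (hasFDerivAt_id x).const_smul R⁻¹
  have h2 : HasFDerivAt (chi R) _ x :=
    (((bp (d := d)).contDiff (n := 1)).differentiable (by simp) (R⁻¹ • x)).hasFDerivAt.comp x h1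
  rw [h2.fderiv, ContinuousLinearMap.comp_smul, ContinuousLinearMap.comp_id, norm_smul, norm_inv, Real.norm_eq_abs,
    abs_of_pos hR, div_eq_inv_mul]
  gcongr
  exact (hC _).trans (le_max_left _ _)

theorem GN_gen (hd : 1 ≤ d) : ∃ C : ℝ≥0, ∀ u : Ed d → ℂ, ContDiff ℝ 1 u → ∫⁻ x, ‖u x‖ₑ ^ (2:ℝ) ≠ ∞ →
    ∫⁻ x, ‖u x‖ₑ ^ (2 + sg d) ≤ C * (∫⁻ x, ‖u x‖ₑ ^ (2:ℝ)) ^ (2 / (d:ℝ)) * ∫⁻ x, ‖fderiv ℝ u x‖ₑ ^ (2:ℝ) := by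
  obtain ⟨C, hC⟩ := GN_cpt hd
  obtain ⟨B, hB0, hB⟩ := chi_grad d
  refine ⟨C * 2, fun u hu hN => ?_⟩
  set N := ∫⁻ x, ‖u x‖ₑ ^ (2:ℝ)
  set G := ∫⁻ x, ‖fderiv ℝ u x‖ₑ ^ (2:ℝ)
  have hs := sg_nonneg (d := d)
  have hum : Measurable (fun x => ‖u x‖ₑ) := hu.continuous.measurable.enorm
  have hfm : Measurable (fun x => ‖fderiv ℝ u x‖ₑ) := (measurable_fderiv ℝ u).enorm
  have hdiff : Differentiable ℝ u := hu.differentiable (by simp)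
  let w : ℕ → Ed d → ℂ := fun n x => chi (n+1 : ℝ) x • u x
  have hw : ∀ n, ContDiff ℝ 1 (w n) := fun n => ((chi_smooth _).of_le (by exact_mod_cast le_top)).smul hu
  have hwc : ∀ n, HasCompactSupport (w n) := fun n => (chi_supp (by positivity)).smul_right
  have hwle : ∀ n x, ‖w n x‖ₑ ≤ ‖u x‖ₑ := by
    intro n x
    rw [enorm_le_iff_norm_le, norm_smul, Real.norm_eq_abs, abs_of_nonneg (chi_nonneg _ _)]
    exact mul_le_of_le_one_left (norm_nonneg _) (chi_le_one _ _)
  have hwd : ∀ n x, ‖fderiv ℝ (w n) x‖ₑ ≤ ‖fderiv ℝ u x‖ₑ + ENNReal.ofReal (B/(n+1)) * ‖u x‖ₑ := by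
    intro n x
    have h1 : HasFDerivAt (w n) _ x := (((chi_smooth (n+1 : ℝ)).differentiable (by simp)) x).hasFDerivAt.smul (hdiff x).hasFDerivAt
    rw [h1.fderiv]
    have h2 : ‖chi (n+1:ℝ) x • fderiv ℝ u x + (fderiv ℝ (chi (n+1:ℝ)) x).smulRight (u x)‖ ≤ ‖fderiv ℝ u x‖ + B/(n+1) * ‖u x‖ := by
      refine (norm_add_le _ _).trans ?_
      rw [norm_smul, Real.norm_eq_abs, abs_of_nonneg (chi_nonneg _ _), ContinuousLinearMap.norm_smulRight_apply]
      gcongr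
      · exact mul_le_of_le_one_left (norm_nonneg _) (chi_le_one _ _)
      · exact hB _ (by positivity) x
    have h3 := ENNReal.ofReal_le_ofReal h2
    rw [ENNReal.ofReal_add (by positivity) (by positivity), ENNReal.ofReal_mul (by positivity)] at h3
    simpa only [ofReal_norm] using h3
  have hwG : ∀ n, ∫⁻ x, ‖fderiv ℝ (w n) x‖ₑ ^ (2:ℝ) ≤ 2 * (G + ENNReal.ofReal (B/(n+1)) ^ (2:ℝ) * N) := by
    intro n
    calc _ ≤ ∫⁻ x, 2 * (‖fderiv ℝ u x‖ₑ ^ (2:ℝ) + ENNReal.ofReal (B/(n+1)) ^ (2:ℝ) * ‖u x‖ₑ ^ (2:ℝ)) := by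
          refine lintegral_mono fun x => ?_
          refine (ENNReal.rpow_le_rpow (hwd n x) (by norm_num)).trans ?_
          rw [← ENNReal.mul_rpow_of_nonneg _ _ (by norm_num)]
          refine (ENNReal.rpow_add_le_mul_rpow_add_rpow _ _ (by norm_num : (1:ℝ) ≤ 2)).trans ?_
          norm_num
      _ = _ := by
          rw [lintegral_const_mul' _ _ (by simp), lintegral_add_left (hfm.pow_const _), lintegral_const_mul _ (hum.pow_const _)]
  have hPn : ∀ n, ∫⁻ x, ‖w n x‖ₑ ^ (2 + sg d) ≤ C * N ^ (2/(d:ℝ)) * (2 * (G + ENNReal.ofReal (B/(n+1)) ^ (2:ℝ) * N)) := by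
    intro n
    refine (hC (w n) (hw n) (hwc n)).trans ?_
    gcongr
    · exact lintegral_mono fun x => ENNReal.rpow_le_rpow (hwle n x) (by norm_num)
    · exact hwG n
  have hlim : Tendsto (fun n : ℕ => (C:ℝ≥0∞) * N ^ (2/(d:ℝ)) * (2 * (G + ENNReal.ofReal (B/(n+1)) ^ (2:ℝ) * N))) atTop
      (nhds (C * N ^ (2/(d:ℝ)) * (2 * (G + 0 * N)))) := by
    refine ENNReal.Tendsto.const_mul (ENNReal.Tendsto.const_mul (tendsto_const_nhds.add
      (ENNReal.Tendsto.mul_const ?_ (Or.inr hN))) (Or.inr (by simp))) (Or.inr ?_)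
    · have h1 : Tendsto (fun n : ℕ => B/((n:ℝ)+1)) atTop (nhds 0) :=
        Tendsto.div_atTop tendsto_const_nhds (tendsto_atTop_add_const_right _ _ tendsto_natCast_atTop_atTop)
      have h2 := (ENNReal.tendsto_ofReal h1).ennrpow_const 2
      simpa using h2
    · exact ENNReal.mul_ne_top (by simp) (ENNReal.rpow_ne_top_of_nonneg (by positivity) hN)
  calc ∫⁻ x, ‖u x‖ₑ ^ (2 + sg d) = ∫⁻ x, liminf (fun n => ‖w n x‖ₑ ^ (2 + sg d)) atTop := by
        refine lintegral_congr fun x => ?_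
        refine (Tendsto.liminf_eq (tendsto_const_nhds.congr' ?_)).symm
        obtain ⟨m, hm⟩ := exists_nat_ge ‖x‖
        filter_upwards [eventually_ge_atTop m] with n hn
        have : chi (n+1:ℝ) x = 1 := chi_one (by positivity) (by
          have : (m:ℝ) ≤ n := by exact_mod_cast hn
          linarith)
        simp only [w, this, one_smul]
    _ ≤ liminf (fun n => ∫⁻ x, ‖w n x‖ₑ ^ (2 + sg d)) atTop :=
        lintegral_liminf_le fun n => ((hw n).continuous.measurable.enorm).pow_const _
    _ ≤ liminf (fun n : ℕ => (C:ℝ≥0∞) * N ^ (2/(d:ℝ)) * (2 * (G + ENNReal.ofReal (B/(n+1)) ^ (2:ℝ) * N))) atTop :=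
        liminf_le_liminf (Eventually.of_forall hPn)
    _ = _ := by
        rw [hlim.liminf_eq]; push_cast; ring

theorem enorm_int_eq {f : Ed d → ℂ} {p : ℝ} (hp : 0 ≤ p) (hf : Integrable (fun x => ‖f x‖ ^ p)) :
    ∫⁻ x, ‖f x‖ₑ ^ p = ENNReal.ofReal (∫ x, ‖f x‖ ^ p) := by
  rw [ofReal_integral_eq_lintegral_ofReal hf (Eventually.of_forall fun x => by positivity)]
  refine lintegral_congr fun x => ?_
  rw [← ofReal_norm, ENNReal.ofReal_rpow_of_nonneg (norm_nonneg _) hp]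

theorem fderiv_norm_le_grad (f : Ed d → ℂ) (x : Ed d) : ‖fderiv ℝ f x‖ ^ 2 ≤ gradNormSq f x := by
  set l := fderiv ℝ f x with hl
  have h0 : ‖l‖ ≤ √(gradNormSq f x) := by
    refine ContinuousLinearMap.opNorm_le_bound _ (Real.sqrt_nonneg _) fun a => ?_
    have ha : a = ∑ i, a i • stdBasis i := by
      have := (EuclideanSpace.basisFun (Fin d) ℝ).sum_repr a
      simpa [stdBasis] using this.symm
    have h1 : ‖l a‖ ≤ ∑ i, |a i| * ‖pd f i x‖ := by
      conv_lhs => rw [ha]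
      rw [map_sum]
      refine (norm_sum_le _ _).trans (Finset.sum_le_sum fun i _ => ?_)
      rw [map_smul, norm_smul, Real.norm_eq_abs]; rfl
    refine h1.trans ?_
    have h2 := Finset.sum_mul_sq_le_sq_mul_sq Finset.univ (fun i => |a i|) (fun i => ‖pd f i x‖)
    rw [EuclideanSpace.norm_eq, ← Real.sqrt_mul (gradNormSq_nonneg f x)]
    refine Real.le_sqrt_of_sq_le (h2.trans (le_of_eq ?_))
    rw [mul_comm]; simp [gradNormSq]
  calc ‖l‖ ^ 2 ≤ √(gradNormSq f x) ^ 2 := by gcongr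
    _ = _ := Real.sq_sqrt (gradNormSq_nonneg f x)

/-- Gagliardo-Nirenberg -/
theorem GN (hd : 1 ≤ d) : ∃ C : ℝ, 0 ≤ C ∧ ∀ u : Sch d, PP u ≤ C * n2 u ^ sg d * S2 u := by
  obtain ⟨C, hC⟩ := GN_gen hd
  have hd0 : (0:ℝ) < d := by exact_mod_cast hd
  have hs := sg_nonneg (d := d)
  refine ⟨C, NNReal.coe_nonneg C, fun u => ?_⟩
  have hi2 : Integrable (fun x => ‖u x‖ ^ (2:ℝ)) := by simpa using int_sq u
  have hN := enorm_int_eq (f := u) (by norm_num) hi2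
  have h1 := hC u ((sch_smooth u).of_le (by exact_mod_cast le_top)) (by rw [hN]; simp)
  have hG : ∫⁻ x, ‖fderiv ℝ u x‖ₑ ^ (2:ℝ) ≤ ENNReal.ofReal (S2 u) := by
    unfold S2
    rw [ofReal_integral_eq_lintegral_ofReal (int_grad u) (Eventually.of_forall fun x => gradNormSq_nonneg _ _)]
    refine lintegral_mono fun x => ?_
    rw [← ofReal_norm, ENNReal.ofReal_rpow_of_nonneg (norm_nonneg _) (by norm_num)]
    refine ENNReal.ofReal_le_ofReal ?_
    simpa using fderiv_norm_le_grad u x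
  rw [enorm_int_eq (f := u) (by linarith) (PP_rd (rd u)).integrable, hN] at h1
  have h2 := h1.trans (mul_le_mul_right hG _)
  have hM0 : 0 ≤ ∫ x, ‖u x‖ ^ (2:ℝ) := integral_nonneg fun x => by positivity
  have hS0 : 0 ≤ S2 u := integral_nonneg fun x => gradNormSq_nonneg _ _
  rw [ENNReal.ofReal_rpow_of_nonneg hM0 (by positivity), ← ENNReal.ofReal_coe_nnreal, ← ENNReal.ofReal_mul (NNReal.coe_nonneg C),
    ← ENNReal.ofReal_mul (by positivity), ENNReal.ofReal_le_ofReal_iff (by positivity)] at h2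
  have h3 : n2 u ^ sg d = (∫ x, ‖u x‖ ^ (2:ℝ)) ^ (2/(d:ℝ)) := by
    unfold n2
    rw [Real.sqrt_eq_rpow, ← Real.rpow_mul (by simpa using hM0)]
    simp only [Real.rpow_two]
    congr 1; unfold sg; field_simp; norm_num
  rw [h3]; exact h2

end HS

namespace HS
open Complex ComplexConjugate
variable {d : ℕ}
open scoped ENNReal NNReal

/-- Lipschitz weight -/
def th (R : ℝ) (x : Ed d) : ℝ := min ‖x‖ (max 0 (2 * R - ‖x‖))

theorem th_nonneg (R : ℝ) (x : Ed d) : 0 ≤ th R x := le_min (norm_nonneg _) (le_max_left _ _)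
theorem th_le (R : ℝ) (x : Ed d) : th R x ≤ ‖x‖ := min_le_left _ _
theorem th_eq {R : ℝ} {x : Ed d} (h : ‖x‖ ≤ R) : th R x = ‖x‖ :=
  min_eq_left (le_max_of_le_right (by linarith))
theorem th_lip (R : ℝ) : LipschitzWith 1 (th R : Ed d → ℝ) := by
  have h1 : LipschitzWith 1 (fun x : Ed d => 2 * R - ‖x‖) := by
    simpa using (LipschitzWith.const (2 * R)).sub (lipschitzWith_one_norm (E := Ed d))
  have h := (lipschitzWith_one_norm (E := Ed d)).min (h1.const_max 0)
  rw [max_self] at h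
  exact h
theorem th_cont (R : ℝ) : Continuous (th R : Ed d → ℝ) := (th_lip R).continuous
theorem th_zero {R : ℝ} {x : Ed d} (h : 2 * R ≤ ‖x‖) : th R x = 0 := by
  unfold th; rw [max_eq_left (by linarith)]; exact min_eq_right (norm_nonneg _)
theorem th_le_R {R : ℝ} (hR : 0 ≤ R) (x : Ed d) : th R x ≤ R := by
  unfold th
  rcases le_total ‖x‖ R with h | h
  · exact (min_le_left _ _).trans h
  · exact (min_le_right _ _).trans (max_le hR (by linarith))
theorem th_supp (R : ℝ) : HasCompactSupport (th R : Ed d → ℝ) := by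
  refine HasCompactSupport.intro (isCompact_closedBall (0 : Ed d) (2 * R)) fun x hx => th_zero ?_
  simp only [mem_closedBall_zero_iff, not_le] at hx
  exact hx.le

theorem th_tendsto {u : Ed d → ℂ} (hu : RD u) :
    Tendsto (fun n : ℕ => ∫ x, th n x ^ 2 * ‖u x‖ ^ 2) atTop (nhds (∫ x, ‖x‖ ^ 2 * ‖u x‖ ^ 2)) := by
  refine tendsto_integral_of_dominated_convergence (fun x => ‖x‖ ^ 2 * ‖u x‖ ^ 2) (fun n => ?_) ?_ (fun n => ?_) ?_
  · exact (((th_cont _).pow 2).mul (hu.cont.norm.pow 2)).aestronglyMeasurable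
  · exact ((PG.nrm.pow 2).rmul (hu.norm.pow two_ne_zero)).integrable
  · refine Eventually.of_forall fun x => ?_
    have h1 := th_nonneg (n:ℝ) x
    have h2 := th_le (n:ℝ) x
    rw [Real.norm_of_nonneg (by positivity)]
    gcongr
  · refine Eventually.of_forall fun x => ?_
    obtain ⟨m, hm⟩ := exists_nat_ge ‖x‖
    refine tendsto_const_nhds.congr' ?_
    filter_upwards [eventually_ge_atTop m] with n hn
    have : (m:ℝ) ≤ n := by exact_mod_cast hn
    rw [th_eq (hm.trans this)]

theorem ct_tendsto {u : Ed d → ℂ} (hu : RD u) :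
    Tendsto (fun n : ℕ => ∫ x, ct (n+1:ℝ) x ^ 2 * ‖u x‖ ^ 2) atTop (nhds (∫ x, ‖u x‖ ^ 2)) := by
  rw [tendsto_iff_norm_sub_tendsto_zero]
  have h0 : Tendsto (fun n : ℕ => 2 / ((n:ℝ)+1) * ∫ x, ‖x‖ * |‖u x‖ ^ 2|) atTop (nhds (0 * ∫ x, ‖x‖ * |‖u x‖ ^ 2|)) :=
    (Tendsto.div_atTop tendsto_const_nhds (tendsto_atTop_add_const_right _ _ tendsto_natCast_atTop_atTop)).mul_const _
  rw [zero_mul] at h0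
  exact squeeze_zero (fun n => norm_nonneg _) (fun n => ct_int (by positivity) (hu.norm.pow two_ne_zero)) h0

theorem S2_nonneg (u : Sch d) : 0 ≤ S2 u := integral_nonneg fun x => gradNormSq_nonneg _ _
theorem M_nonneg (u : Sch d) : 0 ≤ M u := integral_nonneg fun x => by positivity
theorem V_nonneg (u : Sch d) : 0 ≤ V u := integral_nonneg fun x => by positivity

theorem M_const {lam : ℝ} {v : ℝ → Sch d} (hv : IsSol lam v) {s t S0 : ℝ} (hst : s ≤ t)
    (hS : ∀ τ ∈ Set.Icc s t, S2 (v τ) ≤ S0) : M (v t) = M (v s) := by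
  have h1 := fun n : ℕ => TL hv (ct_lip (R := n+1) (by positivity)) (ct_supp (by positivity)) hst
    (fun τ hτ => Real.sqrt_le_sqrt (hS τ hτ))
  have h2 : Tendsto (fun n : ℕ => |√(∫ x, ct (n+1:ℝ) x ^ 2 * ‖v t x‖ ^ 2) - √(∫ x, ct (n+1:ℝ) x ^ 2 * ‖v s x‖ ^ 2)|) atTop
      (nhds |√(M (v t)) - √(M (v s))|) :=
    ((ct_tendsto (rd (v t))).sqrt.sub (ct_tendsto (rd (v s))).sqrt).abs
  have h3 : Tendsto (fun n : ℕ => 2 * (Real.toNNReal (1 / ((n:ℝ)+1)) : ℝ) * √S0 * (t - s)) atTop (nhds (2 * 0 * √S0 * (t-s))) := by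
    refine ((Tendsto.const_mul 2 ?_).mul_const _).mul_const _
    have : ∀ n : ℕ, (Real.toNNReal (1 / ((n:ℝ)+1)) : ℝ) = 1 / ((n:ℝ)+1) := fun n => Real.coe_toNNReal _ (by positivity)
    simp only [this]
    exact tendsto_one_div_add_atTop_nhds_zero_nat
  have h4 := le_of_tendsto_of_tendsto' h2 h3 h1
  have h5 : √(M (v t)) = √(M (v s)) := by
    have : |√(M (v t)) - √(M (v s))| ≤ 0 := by simpa using h4
    exact sub_eq_zero.1 (abs_nonpos_iff.1 this)
  exact (Real.sqrt_inj (M_nonneg _) (M_nonneg _)).1 h5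

theorem V_lip {lam : ℝ} {v : ℝ → Sch d} (hv : IsSol lam v) {s t S0 : ℝ} (hst : s ≤ t)
    (hS : ∀ τ ∈ Set.Icc s t, S2 (v τ) ≤ S0) : |√(V (v t)) - √(V (v s))| ≤ 2 * √S0 * (t - s) := by
  have h1 := fun n : ℕ => TL hv (th_lip (n:ℝ)) (th_supp _) hst (fun τ hτ => Real.sqrt_le_sqrt (hS τ hτ))
  have h2 : Tendsto (fun n : ℕ => |√(∫ x, th (n:ℝ) x ^ 2 * ‖v t x‖ ^ 2) - √(∫ x, th (n:ℝ) x ^ 2 * ‖v s x‖ ^ 2)|) atTop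
      (nhds |√(V (v t)) - √(V (v s))|) :=
    ((th_tendsto (rd (v t))).sqrt.sub (th_tendsto (rd (v s))).sqrt).abs
  have h4 := le_of_tendsto' h2 h1
  simpa using h4

/-- GN for less regular functions -/
theorem GN' (hd : 1 ≤ d) : ∃ C : ℝ, 0 ≤ C ∧ ∀ (u : Ed d → ℂ) (k : Ed d → ℝ), ContDiff ℝ 1 u → RD u → Integrable k →
    (∀ x, ‖fderiv ℝ u x‖ ^ 2 ≤ k x) → PP u ≤ C * n2 u ^ sg d * ∫ x, k x := by
  obtain ⟨C, hC⟩ := GN_gen hd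
  have hd0 : (0:ℝ) < d := by exact_mod_cast hd
  have hs := sg_nonneg (d := d)
  refine ⟨C, NNReal.coe_nonneg C, fun u k hu hr hk hle => ?_⟩
  have hi2 : Integrable (fun x => ‖u x‖ ^ (2:ℝ)) := by
    simpa using (hr.norm.pow two_ne_zero).integrable
  have hN := enorm_int_eq (f := u) (by norm_num) hi2
  have h1 := hC u hu (by rw [hN]; simp)
  have hk0 : ∀ x, 0 ≤ k x := fun x => (by positivity : 0 ≤ ‖fderiv ℝ u x‖ ^ 2).trans (hle x)
  have hG : ∫⁻ x, ‖fderiv ℝ u x‖ₑ ^ (2:ℝ) ≤ ENNReal.ofReal (∫ x, k x) := by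
    rw [ofReal_integral_eq_lintegral_ofReal hk (Eventually.of_forall hk0)]
    refine lintegral_mono fun x => ?_
    rw [← ofReal_norm, ENNReal.ofReal_rpow_of_nonneg (norm_nonneg _) (by norm_num)]
    refine ENNReal.ofReal_le_ofReal ?_
    simpa using hle x
  rw [enorm_int_eq (f := u) (by linarith) (PP_rd hr).integrable, hN] at h1
  have h2 := h1.trans (mul_le_mul_right hG _)
  have hM0 : 0 ≤ ∫ x, ‖u x‖ ^ (2:ℝ) := integral_nonneg fun x => by positivity
  have hS0 : 0 ≤ ∫ x, k x := integral_nonneg hk0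
  rw [ENNReal.ofReal_rpow_of_nonneg hM0 (by positivity), ← ENNReal.ofReal_coe_nnreal, ← ENNReal.ofReal_mul (NNReal.coe_nonneg C),
    ← ENNReal.ofReal_mul (by positivity), ENNReal.ofReal_le_ofReal_iff (by positivity)] at h2
  have h3 : n2 u ^ sg d = (∫ x, ‖u x‖ ^ (2:ℝ)) ^ (2/(d:ℝ)) := by
    unfold n2
    rw [Real.sqrt_eq_rpow, ← Real.rpow_mul (by simpa using hM0)]
    simp only [Real.rpow_two]
    congr 1; unfold sg; field_simp; norm_num
  rw [h3]; exact h2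

/-- the part away from the origin -/
theorem GN_tail (hd : 1 ≤ d) : ∃ C : ℝ, 0 ≤ C ∧ ∀ (u : Sch d) (R : ℝ), 1 ≤ R →
    PP (fun x => (1 - chi R x) • u x) ≤ C * (√(V u) / R) ^ sg d * (S2 u + M u) := by
  obtain ⟨C, hC0, hC⟩ := GN' hd
  obtain ⟨B, hB0, hB⟩ := chi_grad d
  have hs := sg_nonneg (d := d)
  refine ⟨C * (2 + 2 * B ^ 2), by positivity, fun u R hR => ?_⟩
  have hR0 : 0 < R := by linarith
  have hu1 : ContDiff ℝ 1 (fun x => u x) := (sch_smooth u).of_le (by exact_mod_cast le_top)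
  have hc1 : ContDiff ℝ 1 (fun x : Ed d => 1 - chi R x) :=
    contDiff_const.sub ((chi_smooth R).of_le (by exact_mod_cast le_top))
  have hle1 : ∀ x : Ed d, |1 - chi R x| ≤ 1 := fun x => by
    rw [abs_of_nonneg (by linarith [chi_le_one R x])]; linarith [chi_nonneg R x]
  have hw : ContDiff ℝ 1 (fun x => (1 - chi R x) • u x) := hc1.smul hu1
  have hrd : RD (fun x => (1 - chi R x) • u x) := (rd u).of_le hw.continuous fun x => by
    rw [norm_smul, Real.norm_eq_abs]; exact mul_le_of_le_one_left (norm_nonneg _) (hle1 x)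
  have hki : Integrable (fun x => 2 * gradNormSq u x + 2 * B ^ 2 * ‖u x‖ ^ 2) :=
    ((int_grad u).const_mul 2).add ((int_sq u).const_mul _)
  have h := hC _ _ hw hrd hki (fun x => ?_)
  · refine h.trans ?_
    have hn : n2 (fun x => (1 - chi R x) • u x) ≤ √(V u) / R := by
      unfold n2
      rw [le_div_iff₀ hR0]
      refine Real.le_sqrt_of_sq_le ?_
      rw [mul_pow, Real.sq_sqrt (integral_nonneg fun x => by positivity), mul_comm, ← integral_const_mul]
      refine integral_mono ((hrd.norm.pow two_ne_zero).integrable.const_mul _) ((PG.nrm.pow 2).rmul ((rd u).norm.pow two_ne_zero)).integrable fun x => ?_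
      simp only [norm_smul, Real.norm_eq_abs]
      rcases le_total ‖x‖ R with hx | hx
      · rw [chi_one hR0 hx]; simp; positivity
      · gcongr
        exact mul_le_of_le_one_left (norm_nonneg _) (hle1 x)
    have hint : ∫ x, (2 * gradNormSq u x + 2 * B ^ 2 * ‖u x‖ ^ 2) = 2 * S2 u + 2 * B ^ 2 * M u := by
      rw [integral_add ((int_grad u).const_mul 2) ((int_sq u).const_mul _), integral_const_mul, integral_const_mul]; rfl
    rw [hint]
    have hS := S2_nonneg u
    have hM := M_nonneg u
    calc _ ≤ C * (√(V u) / R) ^ sg d * ((2 + 2 * B ^ 2) * (S2 u + M u)) := by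
          have hn0 : 0 ≤ n2 (fun x => (1 - chi R x) • u x) := Real.sqrt_nonneg _
          gcongr
          nlinarith [sq_nonneg B, mul_nonneg (sq_nonneg B) hS]
      _ = _ := by ring
  · have h1 : HasFDerivAt (fun x => (1 - chi R x) • u x) ((1 - chi R x) • fderiv ℝ u x + (-fderiv ℝ (chi R) x).smulRight (u x)) x := by
      have ha : HasFDerivAt (fun x : Ed d => 1 - chi R x) (- fderiv ℝ (chi R) x) x := by
        have := (((chi_smooth R).differentiable (by simp)) x).hasFDerivAt
        exact this.const_sub (1:ℝ)
      exact ha.smul (u.hasFDerivAt x)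
    rw [h1.fderiv]
    have h2 : ‖(1 - chi R x) • fderiv ℝ u x + (-fderiv ℝ (chi R) x).smulRight (u x)‖ ≤ ‖fderiv ℝ u x‖ + B * ‖u x‖ := by
      refine (norm_add_le _ _).trans ?_
      rw [norm_smul, Real.norm_eq_abs, ContinuousLinearMap.norm_smulRight_apply, norm_neg]
      gcongr
      · exact mul_le_of_le_one_left (norm_nonneg _) (hle1 x)
      · exact (hB R hR0 x).trans (div_le_self hB0.le hR)
    have h3 := fderiv_norm_le_grad u x
    calc _ ≤ (‖fderiv ℝ u x‖ + B * ‖u x‖) ^ 2 := by gcongr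
      _ ≤ _ := by nlinarith [sq_nonneg (‖fderiv ℝ u x‖ - B * ‖u x‖)]

theorem loc_bdd {v : ℝ → Sch d} (hv : Continuous (fun p : ℝ × Ed d => v p.1 p.2)) (a b R : ℝ) :
    ∃ K, 0 ≤ K ∧ ∀ t ∈ Set.Icc a b, ∀ x : Ed d, ‖x‖ ≤ R → ‖v t x‖ ≤ K := by
  obtain ⟨K, hK⟩ := (isCompact_Icc.prod (isCompact_closedBall (0 : Ed d) R)).exists_bound_of_continuousOn
    (f := fun p : ℝ × Ed d => v p.1 p.2) (s := Set.Icc a b ×ˢ Metric.closedBall 0 R) hv.continuousOn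
  refine ⟨max K 0, le_max_right _ _, fun t ht x hx => (hK (t, x) ⟨ht, by simpa using hx⟩).trans (le_max_left _ _)⟩

theorem M_le_V {v : ℝ → Sch d} (hv : Continuous (fun p : ℝ × Ed d => v p.1 p.2)) (a b : ℝ) :
    ∃ C, 0 ≤ C ∧ ∀ t ∈ Set.Icc a b, M (v t) ≤ V (v t) + C := by
  obtain ⟨K, hK0, hK⟩ := loc_bdd hv a b 1
  have hi : Integrable (Set.indicator (Metric.closedBall (0 : Ed d) 1) (fun _ => K ^ 2)) :=
    (integrable_indicator_iff Metric.isClosed_closedBall.measurableSet).2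
      (integrableOn_const (isCompact_closedBall _ _).measure_lt_top.ne)
  refine ⟨∫ x, Set.indicator (Metric.closedBall (0 : Ed d) 1) (fun _ => K ^ 2) x,
    integral_nonneg fun x => Set.indicator_nonneg (fun _ _ => by positivity) x, fun t ht => ?_⟩
  unfold M V
  have hi2 : Integrable (fun x => ‖x‖ ^ 2 * ‖v t x‖ ^ 2) := ((PG.nrm.pow 2).rmul ((rd (v t)).norm.pow two_ne_zero)).integrable
  rw [← integral_add hi2 hi]
  refine integral_mono (int_sq _) (hi2.add hi) fun x => ?_
  simp only [Pi.add_apply]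
  by_cases hx : ‖x‖ ≤ 1
  · rw [Set.indicator_of_mem (by simpa using hx)]
    have := hK t ht x hx
    have : ‖v t x‖ ^ 2 ≤ K ^ 2 := by gcongr
    nlinarith [sq_nonneg (‖x‖ * ‖v t x‖)]
  · rw [Set.indicator_of_notMem (by simpa using hx)]
    push Not at hx
    nlinarith [sq_nonneg ‖v t x‖, mul_nonneg (by nlinarith : 0 ≤ ‖x‖ ^ 2 - 1) (sq_nonneg ‖v t x‖)]

/-- tightness controls the potential energy -/
theorem TIGHT (hd : 1 ≤ d) {v : ℝ → Sch d} (hv : Continuous (fun p : ℝ × Ed d => v p.1 p.2)) (a b Vm : ℝ) {ε : ℝ} (hε : 0 < ε) :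
    ∃ C, 0 ≤ C ∧ ∀ t ∈ Set.Icc a b, V (v t) ≤ Vm → PP (v t) ≤ ε * S2 (v t) + C := by
  obtain ⟨C, hC0, hC⟩ := GN_tail hd
  obtain ⟨C1, hC10, hC1⟩ := M_le_V hv a b
  have hd0 : (0:ℝ) < d := by exact_mod_cast hd
  have hs : 0 < sg d := by unfold sg; positivity
  have hlim : Tendsto (fun R : ℝ => C * (√Vm / R) ^ sg d) atTop (nhds (C * 0 ^ sg d)) := by
    refine Tendsto.const_mul _ (Tendsto.rpow_const ?_ (Or.inr hs.le))
    exact Tendsto.div_atTop tendsto_const_nhds tendsto_id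
  rw [Real.zero_rpow hs.ne', mul_zero] at hlim
  obtain ⟨R, hR, hR1⟩ := ((hlim.eventually (gt_mem_nhds hε)).and (eventually_ge_atTop 1)).exists
  obtain ⟨K, hK0, hK⟩ := loc_bdd hv a b (2 * R)
  have hi : Integrable (Set.indicator (Metric.closedBall (0 : Ed d) (2 * R)) (fun _ => K ^ (2 + sg d))) :=
    (integrable_indicator_iff Metric.isClosed_closedBall.measurableSet).2
      (integrableOn_const (isCompact_closedBall _ _).measure_lt_top.ne)
  set I0 := ∫ x, Set.indicator (Metric.closedBall (0 : Ed d) (2 * R)) (fun _ => K ^ (2 + sg d)) x with hI0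
  have hI00 : 0 ≤ I0 := integral_nonneg fun x => Set.indicator_nonneg (fun _ _ => by positivity) x
  refine ⟨ε * (max Vm 0 + C1) + I0, by positivity, fun t ht hV => ?_⟩
  have hR0 : 0 < R := by linarith
  have hw : RD (fun x => (1 - chi R x) • v t x) := (rd (v t)).of_le
      ((continuous_const.sub (chi_smooth R).continuous).smul (rd (v t)).cont) fun x => by
    rw [norm_smul, Real.norm_eq_abs]
    refine mul_le_of_le_one_left (norm_nonneg _) ?_
    rw [abs_of_nonneg (by linarith [chi_le_one R x])]; linarith [chi_nonneg R x]
  have h1 : PP (v t) ≤ PP (fun x => (1 - chi R x) • v t x) + I0 := by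
    unfold PP
    rw [hI0, ← integral_add (PP_rd hw).integrable hi]
    refine integral_mono (PP_rd (rd (v t))).integrable ((PP_rd hw).integrable.add hi) fun x => ?_
    simp only [Pi.add_apply]
    by_cases hx : ‖x‖ ≤ 2 * R
    · rw [Set.indicator_of_mem (by simpa using hx)]
      have h2 : ‖v t x‖ ^ (2 + sg d) ≤ K ^ (2 + sg d) := Real.rpow_le_rpow (norm_nonneg _) (hK t ht x hx) (by positivity)
      have h3 : 0 ≤ ‖(1 - chi R x) • v t x‖ ^ (2 + sg d) := by positivity
      linarith
    · rw [Set.indicator_of_notMem (by simpa using hx)]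
      push Not at hx
      rw [chi_zero hR0 hx.le]; simp
  have h2 := hC (v t) R hR1
  have hS := S2_nonneg (v t)
  have hM := M_nonneg (v t)
  have h3 : C * (√(V (v t)) / R) ^ sg d ≤ ε := by
    refine le_trans ?_ hR.le
    gcongr
  have h4 := hC1 t ht
  have h5 : V (v t) ≤ max Vm 0 := hV.trans (le_max_left _ _)
  calc PP (v t) ≤ ε * (S2 (v t) + M (v t)) + I0 := by
        refine h1.trans (add_le_add_left (h2.trans ?_) _)
        gcongr
    _ ≤ ε * (S2 (v t) + (max Vm 0 + C1)) + I0 := by gcongr; linarith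
    _ = _ := by ring

end HS

namespace HS
open Complex ComplexConjugate

theorem add_rpow_le' {x y r : ℝ} (hx : 0 ≤ x) (hy : 0 ≤ y) (hr : 0 ≤ r) : (x + y) ^ r ≤ 2 ^ r * (x ^ r + y ^ r) := by
  have key : ∀ {a b : ℝ}, 0 ≤ a → a ≤ b → (a + b) ^ r ≤ 2 ^ r * (a ^ r + b ^ r) := by
    intro a b ha hab
    calc (a + b) ^ r ≤ (2 * b) ^ r := Real.rpow_le_rpow (by linarith) (by linarith) hr
      _ = 2 ^ r * b ^ r := Real.mul_rpow (by norm_num) (by linarith)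
      _ ≤ _ := by have := Real.rpow_nonneg ha r; gcongr; linarith
  rcases le_total x y with h | h
  · exact key hx h
  · rw [add_comm x, add_comm (x ^ r)]; exact key hy h

theorem nlA {A B σ : ℝ} (hB : 0 ≤ B) (hAB : B ≤ A) (hσ : 0 ≤ σ) :
    A ^ (1 + σ) - B ^ (1 + σ) ≤ (1 + σ) * A ^ σ * (A - B) := by
  rcases (hB.trans hAB).eq_or_lt with h | h
  · have hB0 : B = 0 := le_antisymm (h ▸ hAB) hB
    rw [← h, hB0]; simp
  · have h1 := one_add_mul_self_le_rpow_one_add (s := B / A - 1) (p := 1 + σ) (by have : 0 ≤ B / A := by positivity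
                                                                                  linarith) (by linarith)
    have h2 : (1 + (B / A - 1)) ^ (1 + σ) = B ^ (1 + σ) / A ^ (1 + σ) := by
      rw [show 1 + (B / A - 1) = B / A by ring, Real.div_rpow hB h.le]
    rw [h2, le_div_iff₀ (by positivity)] at h1
    have h3 : A ^ (1 + σ) = A * A ^ σ := by rw [Real.rpow_add h, Real.rpow_one]
    have h4 : (1 + (1 + σ) * (B / A - 1)) * A ^ (1 + σ) = A ^ (1 + σ) - (1 + σ) * A ^ σ * (A - B) := by
      rw [h3]; field_simp; ring
    linarith

/-- the larger or the smaller factor in front -/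
theorem nlB {A B σ : ℝ} (hB : 0 ≤ B) (hAB : B ≤ A) (hσ : 0 ≤ σ) :
    A * (A ^ σ - B ^ σ) ≤ (1 + σ) * A ^ σ * (A - B) := by
  have h := nlA hB hAB hσ
  have h1 : ∀ {x : ℝ}, 0 ≤ x → x ^ (1 + σ) = x * x ^ σ := fun hx => by
    rw [Real.rpow_add' hx (by positivity), Real.rpow_one]
  rw [h1 hB, h1 (hB.trans hAB)] at h
  have := Real.rpow_nonneg hB σ
  nlinarith

theorem nlC {a b σ : ℝ} (ha : 0 ≤ a) (hb : 0 ≤ b) (hσ : 0 ≤ σ) :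
    a * |b ^ σ - a ^ σ| ≤ (1 + σ) * (max a b) ^ σ * |b - a| := by
  rcases le_total a b with h | h
  · rw [max_eq_right h, abs_of_nonneg (sub_nonneg.2 (Real.rpow_le_rpow ha h hσ)), abs_of_nonneg (sub_nonneg.2 h)]
    refine le_trans ?_ (nlB ha h hσ)
    exact mul_le_mul_of_nonneg_right h (sub_nonneg.2 (Real.rpow_le_rpow ha h hσ))
  · rw [max_eq_left h, abs_sub_comm, abs_of_nonneg (sub_nonneg.2 (Real.rpow_le_rpow hb h hσ)), abs_sub_comm,
      abs_of_nonneg (sub_nonneg.2 h)]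
    exact nlB hb h hσ

theorem NLpt {σ : ℝ} (hσ : 0 ≤ σ) : ∃ C, 0 ≤ C ∧ ∀ a b s : ℝ, 0 ≤ a → 0 ≤ b → |b - a| ≤ s →
    a * |b ^ σ - a ^ σ| ≤ C * (a ^ σ * s + (if 1 < σ then a * s ^ σ else 0)) := by
  refine ⟨(1 + σ) + σ * 2 ^ (σ - 1), by positivity, fun a b s ha hb hs => ?_⟩
  have hs0 : 0 ≤ s := (abs_nonneg _).trans hs
  have hI : 0 ≤ (if 1 < σ then a * s ^ σ else 0) := by split_ifs <;> positivity
  rcases le_total b a with h | h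
  · have h1 := nlC ha hb hσ
    rw [max_eq_left h] at h1
    refine h1.trans ?_
    have h2 : a ^ σ * |b - a| ≤ a ^ σ * s + (if 1 < σ then a * s ^ σ else 0) := by
      have : a ^ σ * |b - a| ≤ a ^ σ * s := by gcongr
      linarith
    have h3 : 0 ≤ a ^ σ * |b - a| := by positivity
    have h4 : 0 ≤ σ * 2 ^ (σ - 1) := by positivity
    nlinarith
  · rw [abs_of_nonneg (sub_nonneg.2 h)] at hs
    rw [abs_of_nonneg (sub_nonneg.2 (Real.rpow_le_rpow ha h hσ))]
    split_ifs with h1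
    · have h2 := nlA ha h (σ := σ - 1) (by linarith)
      rw [show 1 + (σ - 1) = σ by ring] at h2
      have h3 : b ^ (σ - 1) ≤ 2 ^ (σ - 1) * (a ^ (σ - 1) + s ^ (σ - 1)) :=
        (Real.rpow_le_rpow hb (by linarith) (by linarith)).trans (add_rpow_le' ha hs0 (by linarith))
      have e1 : a ^ σ = a * a ^ (σ - 1) := by
        rw [← Real.rpow_one_add' ha (by linarith)]; congr 1; ring
      have e2 : s ^ σ = s ^ (σ - 1) * s := by
        rw [mul_comm, ← Real.rpow_one_add' hs0 (by linarith)]; congr 1; ring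
      calc a * (b ^ σ - a ^ σ) ≤ a * (σ * (2 ^ (σ - 1) * (a ^ (σ - 1) + s ^ (σ - 1))) * s) := by
            gcongr
            refine h2.trans ?_
            have : 0 ≤ b - a := by linarith
            gcongr
        _ = σ * 2 ^ (σ - 1) * (a ^ σ * s + a * s ^ σ) := by rw [e1, e2]; ring
        _ ≤ _ := by
          have : 0 ≤ a ^ σ * s + a * s ^ σ := by positivity
          gcongr; linarith
    · rcases ha.eq_or_lt with h0 | h0
      · rw [← h0]; simp; positivity
      have h2 := rpow_one_add_le_one_add_mul_self (s := b / a - 1) (p := σ) (by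
        have : 0 ≤ b / a := by positivity
        linarith) hσ (by linarith)
      rw [show 1 + (b / a - 1) = b / a by ring, Real.div_rpow hb ha, div_le_iff₀ (by positivity)] at h2
      have h3 : a * (b ^ σ - a ^ σ) ≤ σ * a ^ σ * (b - a) := by
        calc a * (b ^ σ - a ^ σ) ≤ a * ((1 + σ * (b / a - 1)) * a ^ σ - a ^ σ) := by gcongr
          _ = _ := by field_simp; ring
      have h4 : a ^ σ * (b - a) ≤ a ^ σ * s := by gcongr
      have h5 : 0 ≤ a ^ σ * s := by positivity
      have h6 : 0 ≤ σ * 2 ^ (σ - 1) := by positivity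
      nlinarith

theorem NLK {σ : ℝ} (hσ : 0 ≤ σ) (hσ4 : σ ≤ 4) : ∃ C, 0 ≤ C ∧ ∀ a b s K : ℝ, 0 ≤ a → 0 ≤ b → |b - a| ≤ s → 1 ≤ K →
    a * |b ^ σ - a ^ σ| * s ≤ C * ((a ^ σ + a) * (K ^ 3 * s ^ 2 + (if 1 < σ then K⁻¹ * s ^ (2 + σ) else 0))) := by
  obtain ⟨C, hC0, hC⟩ := NLpt hσ
  refine ⟨2 * C, by positivity, fun a b s K ha hb hs hK => ?_⟩
  have hs0 : 0 ≤ s := (abs_nonneg _).trans hs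
  have h := hC a b s ha hb hs
  have hK3 : 1 ≤ K ^ 3 := one_le_pow₀ hK
  refine (mul_le_mul_of_nonneg_right h hs0).trans ?_
  rw [mul_assoc C, mul_comm 2 C, mul_assoc C]
  refine mul_le_mul_of_nonneg_left ?_ hC0
  have ha' := Real.rpow_nonneg ha σ
  have hq : a ^ σ * s * s ≤ (a ^ σ + a) * (K ^ 3 * s ^ 2) := by
    calc a ^ σ * s * s = a ^ σ * (1 * s ^ 2) := by ring
      _ ≤ (a ^ σ + a) * (K ^ 3 * s ^ 2) := by gcongr; linarith
  split_ifs with h1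
  · have h2 : s ^ σ * s ≤ K ^ 3 * s ^ 2 + K⁻¹ * s ^ (2 + σ) := by
      have hr : 0 ≤ s ^ (2 + σ) := by positivity
      rcases le_total s K with h3 | h3
      · have : s ^ σ * s = s ^ (σ - 1) * s ^ 2 := by
          rw [← Real.rpow_add_one' hs0 (by linarith), ← Real.rpow_natCast s 2, ← Real.rpow_add' hs0 (by push_cast; linarith)]
          congr 1; push_cast; ring
        have h4 : s ^ (σ - 1) ≤ K ^ 3 := by
          calc s ^ (σ - 1) ≤ K ^ (σ - 1) := Real.rpow_le_rpow hs0 h3 (by linarith)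
            _ ≤ K ^ (3:ℝ) := Real.rpow_le_rpow_of_exponent_le hK (by linarith)
            _ = K ^ 3 := by norm_cast
        rw [this]
        have : 0 ≤ K⁻¹ * s ^ (2 + σ) := by positivity
        have : s ^ (σ - 1) * s ^ 2 ≤ K ^ 3 * s ^ 2 := by gcongr
        linarith
      · have hsp : 0 < s := by linarith
        have : s ^ σ * s = s⁻¹ * s ^ (2 + σ) := by
          rw [← Real.rpow_add_one' hs0 (by linarith), show 2 + σ = (σ + 1) + 1 by ring, Real.rpow_add_one hsp.ne' (σ+1)]
          field_simp
        rw [this]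
        have h5 : s⁻¹ * s ^ (2 + σ) ≤ K⁻¹ * s ^ (2 + σ) := by gcongr
        have : 0 ≤ K ^ 3 * s ^ 2 := by positivity
        linarith
    have h6 : a * (s ^ σ * s) ≤ (a ^ σ + a) * (K ^ 3 * s ^ 2 + K⁻¹ * s ^ (2 + σ)) := by gcongr; linarith
    have h7 : 0 ≤ (a ^ σ + a) * (K⁻¹ * s ^ (2 + σ)) := by positivity
    nlinarith
  · have h7 : 0 ≤ (a ^ σ + a) * (K ^ 3 * s ^ 2) := by positivity
    simp only [add_zero]
    nlinarith

/-- the nonlinearity -/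
def fz (σ : ℝ) (z : ℂ) : ℂ := ((‖z‖ ^ σ : ℝ) : ℂ) * z

theorem fz_norm (σ : ℝ) (z : ℂ) : ‖fz σ z‖ = ‖z‖ ^ σ * ‖z‖ := by
  unfold fz; rw [norm_mul, Complex.norm_real, Real.norm_of_nonneg (by positivity)]

theorem fLip {σ : ℝ} (hσ : 0 ≤ σ) (z w : ℂ) :
    ‖fz σ (z + w) - fz σ z‖ ≤ (2 + σ) * 2 ^ σ * ((‖z‖ ^ σ + ‖w‖ ^ σ) * ‖w‖) := by
  have e : fz σ (z + w) - fz σ z = ((‖z + w‖ ^ σ : ℝ) : ℂ) * w + ((‖z + w‖ ^ σ - ‖z‖ ^ σ : ℝ) : ℂ) * z := by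
    unfold fz; push_cast; ring
  have hm : max ‖z‖ ‖z + w‖ ≤ ‖z‖ + ‖w‖ := max_le (by linarith [norm_nonneg w]) (norm_add_le _ _)
  have h1 : (max ‖z‖ ‖z + w‖) ^ σ ≤ 2 ^ σ * (‖z‖ ^ σ + ‖w‖ ^ σ) :=
    (Real.rpow_le_rpow (le_max_of_le_left (norm_nonneg _)) hm hσ).trans (add_rpow_le' (norm_nonneg _) (norm_nonneg _) hσ)
  have h2 : |‖z + w‖ - ‖z‖| ≤ ‖w‖ := by simpa using abs_norm_sub_norm_le (z + w) z
  have h3 := nlC (norm_nonneg z) (norm_nonneg (z + w)) hσ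
  have h4 : ‖z + w‖ ^ σ ≤ 2 ^ σ * (‖z‖ ^ σ + ‖w‖ ^ σ) :=
    (Real.rpow_le_rpow (norm_nonneg _) (le_max_right _ _) hσ).trans h1
  rw [e]
  refine (norm_add_le _ _).trans ?_
  rw [norm_mul, norm_mul, Complex.norm_real, Complex.norm_real, Real.norm_of_nonneg (by positivity), Real.norm_eq_abs]
  calc _ ≤ 2 ^ σ * (‖z‖ ^ σ + ‖w‖ ^ σ) * ‖w‖ + (1 + σ) * (2 ^ σ * (‖z‖ ^ σ + ‖w‖ ^ σ)) * ‖w‖ := by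
        refine add_le_add (by gcongr) ?_
        rw [mul_comm]
        refine h3.trans ?_
        gcongr
    _ = _ := by ring

theorem inner_ofReal_mul (r : ℝ) (a b : ℂ) : inner ℝ ((r:ℂ) * a) b = r * inner ℝ a b := by
  rw [← Complex.real_smul, real_inner_smul_left]

theorem pTaylor {σ : ℝ} (hσ : 0 ≤ σ) (z w : ℂ) :
    |‖z + w‖ ^ (2 + σ) - ‖z‖ ^ (2 + σ) - (2 + σ) * inner ℝ (fz σ z) w| ≤
      (2 + σ) ^ 2 * 2 ^ σ * ((‖z‖ ^ σ + ‖w‖ ^ σ) * ‖w‖ ^ 2) := by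
  have hd : ∀ s : ℝ, HasDerivAt (fun s : ℝ => ‖z + (s:ℂ) * w‖ ^ (2 + σ) - (2 + σ) * inner ℝ (fz σ z) ((s:ℂ) * w))
      ((2 + σ) * inner ℝ (fz σ (z + (s:ℂ) * w) - fz σ z) w) s := by
    intro s
    have h1 : HasDerivAt (fun s : ℝ => z + (s:ℂ) * w) w s := by
      have := ((Complex.ofRealCLM.hasDerivAt (x := s)).mul_const w).const_add z
      simpa using this
    have h2 := (hasFDerivAt_norm_rpow (z + (s:ℂ) * w) (p := 2 + σ) (by linarith)).comp_hasDerivAt s h1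
    have h3 : HasDerivAt (fun s : ℝ => (2 + σ) * inner ℝ (fz σ z) ((s:ℂ) * w)) ((2 + σ) * inner ℝ (fz σ z) w) s := by
      have := (((Complex.ofRealCLM.hasDerivAt (x := s)).mul_const w).const_mul (1:ℂ))
      have h5 : HasDerivAt (fun s : ℝ => (s:ℂ) * w) w s := by simpa using this
      exact ((hasDerivAt_const s (fz σ z)).inner ℝ h5 |>.congr_deriv (by simp)).const_mul _
    refine (h2.sub h3).congr_deriv ?_
    rw [inner_sub_left, mul_sub]
    congr 1
    simp only [add_sub_cancel_left, smul_apply, innerSL_apply_apply, smul_eq_mul]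
    rw [mul_assoc]
    congr 1
    unfold fz
    rw [inner_ofReal_mul]
  have hb : ∀ s ∈ Set.Icc (0:ℝ) 1, ‖(2 + σ) * inner ℝ (fz σ (z + (s:ℂ) * w) - fz σ z) w‖ ≤
      (2 + σ) ^ 2 * 2 ^ σ * ((‖z‖ ^ σ + ‖w‖ ^ σ) * ‖w‖ ^ 2) := by
    intro s hs
    have hn : ‖(s:ℂ) * w‖ ≤ ‖w‖ := by
      rw [norm_mul, Complex.norm_real, Real.norm_of_nonneg hs.1]
      exact mul_le_of_le_one_left (norm_nonneg _) hs.2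
    rw [norm_mul, Real.norm_of_nonneg (by linarith)]
    have h1 := (norm_inner_le_norm (𝕜 := ℝ) (fz σ (z + (s:ℂ) * w) - fz σ z) w)
    have h2 := fLip hσ z ((s:ℂ) * w)
    calc (2 + σ) * ‖inner ℝ (fz σ (z + (s:ℂ) * w) - fz σ z) w‖
        ≤ (2 + σ) * (((2 + σ) * 2 ^ σ * ((‖z‖ ^ σ + ‖w‖ ^ σ) * ‖w‖)) * ‖w‖) := by
          gcongr
          refine h1.trans ?_
          gcongr
          refine h2.trans ?_
          gcongr
      _ = _ := by ring
  have := (convex_Icc (0:ℝ) 1).norm_image_sub_le_of_norm_hasDerivWithin_le (fun s _ => (hd s).hasDerivWithinAt) hb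
    (Set.left_mem_Icc.2 zero_le_one) (Set.right_mem_Icc.2 zero_le_one)
  simp only [Complex.ofReal_one, one_mul, Complex.ofReal_zero, zero_mul, add_zero, inner_zero_right, mul_zero, sub_zero,
    norm_one, mul_one, Real.norm_eq_abs] at this
  rw [show ‖z + w‖ ^ (2 + σ) - ‖z‖ ^ (2 + σ) - (2 + σ) * inner ℝ (fz σ z) w =
    ‖z + w‖ ^ (2 + σ) - (2 + σ) * inner ℝ (fz σ z) w - ‖z‖ ^ (2 + σ) by ring]
  exact this
end HS

namespace HS
open Complex ComplexConjugate
variable {d : ℕ}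

theorem sg_le_four (hd : 1 ≤ d) : sg d ≤ 4 := by
  unfold sg
  have : (1:ℝ) ≤ d := by exact_mod_cast hd
  rw [div_le_iff₀ (by linarith)]; linarith

theorem fN_fz (u : Ed d → ℂ) (x : Ed d) : fN u x = fz (sg d) (u x) := rfl

theorem NLI (hd : 1 ≤ d) : ∃ C, 0 ≤ C ∧ ∀ (u v : Sch d) (ω : Ed d → ℝ) (B K : ℝ), (∀ x, 0 ≤ ω x) →
    (∀ x, ω x * (‖u x‖ ^ sg d + ‖u x‖) ≤ B) → 1 ≤ K →
    ∫ x, ω x * (‖u x‖ * |‖v x‖ ^ sg d - ‖u x‖ ^ sg d| * ‖(v - u : Sch d) x‖) ≤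
      C * B * (K ^ 3 * n2 (v - u : Sch d) ^ 2 + (if 1 < sg d then K⁻¹ * PP (v - u : Sch d) else 0)) := by
  obtain ⟨C, hC0, hC⟩ := NLK (sg_nonneg (d := d)) (sg_le_four hd)
  refine ⟨C, hC0, fun u v ω B K hω hB hK => ?_⟩
  set w : Sch d := v - u with hw
  have hi1 : Integrable (fun x => ‖w x‖ ^ 2) := int_sq w
  have hi2 : Integrable (fun x => ‖w x‖ ^ (2 + sg d)) := (PP_rd (rd w)).integrable
  have hB0 : 0 ≤ B := (mul_nonneg (hω 0) (by positivity)).trans (hB 0)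
  have hpt : ∀ x, ω x * (‖u x‖ * |‖v x‖ ^ sg d - ‖u x‖ ^ sg d| * ‖w x‖) ≤
      C * B * (K ^ 3 * ‖w x‖ ^ 2 + (if 1 < sg d then K⁻¹ * ‖w x‖ ^ (2 + sg d) else 0)) := by
    intro x
    have h1 := hC ‖u x‖ ‖v x‖ ‖w x‖ K (norm_nonneg _) (norm_nonneg _) (by
      rw [hw, sub_apply]; exact abs_norm_sub_norm_le _ _) hK
    have h2 : 0 ≤ K ^ 3 * ‖w x‖ ^ 2 + (if 1 < sg d then K⁻¹ * ‖w x‖ ^ (2 + sg d) else 0) := by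
      split_ifs <;> positivity
    calc _ ≤ ω x * (C * ((‖u x‖ ^ sg d + ‖u x‖) * (K ^ 3 * ‖w x‖ ^ 2 + (if 1 < sg d then K⁻¹ * ‖w x‖ ^ (2 + sg d) else 0)))) :=
          mul_le_mul_of_nonneg_left h1 (hω x)
      _ = C * (ω x * (‖u x‖ ^ sg d + ‖u x‖)) * (K ^ 3 * ‖w x‖ ^ 2 + (if 1 < sg d then K⁻¹ * ‖w x‖ ^ (2 + sg d) else 0)) := by ring
      _ ≤ _ := by
        refine mul_le_mul_of_nonneg_right (mul_le_mul_of_nonneg_left (hB x) hC0) h2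
  have hint : Integrable (fun x => (if 1 < sg d then K⁻¹ * ‖w x‖ ^ (2 + sg d) else 0)) := by
    split_ifs
    · exact hi2.const_mul _
    · simp
  have h0 := integral_mono_of_nonneg (μ := volume) (ae_of_all _ fun x => by have := hω x; positivity)
    (((hi1.const_mul (K ^ 3)).add hint).const_mul (C * B)) (ae_of_all _ hpt)
  refine h0.trans (le_of_eq ?_)
  simp only [Pi.add_apply]
  rw [integral_const_mul, integral_add (hi1.const_mul _) hint, integral_const_mul, n2_sq]
  congr 2
  split_ifs
  · rw [integral_const_mul]; rfl
  · simp

theorem NL_1 (hd : 1 ≤ d) (N S : ℝ) : ∃ C, 0 ≤ C ∧ ∀ (u v : Sch d) (ω : Ed d → ℝ) (B : ℝ), (∀ x, 0 ≤ ω x) →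
    (∀ x, ω x * (‖u x‖ ^ sg d + ‖u x‖) ≤ B) → n2 (v - u : Sch d) ≤ N → S2 (v - u) ≤ S →
    ∫ x, ω x * (‖u x‖ * |‖v x‖ ^ sg d - ‖u x‖ ^ sg d| * ‖(v - u : Sch d) x‖) ≤ C * B * n2 (v - u : Sch d) := by
  obtain ⟨C, hC0, hC⟩ := NLI hd
  obtain ⟨G, hG0, hG⟩ := GN hd
  refine ⟨C * (|N| + G * |N| ^ (sg d - 1) * |S|), by positivity, fun u v ω B hω hB hN hS => ?_⟩
  have h := hC u v ω B 1 hω hB le_rfl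
  refine h.trans ?_
  have hB0 : 0 ≤ B := (mul_nonneg (hω 0) (by positivity)).trans (hB 0)
  set w : Sch d := v - u
  have hy : 0 ≤ n2 w := n2_nonneg
  have hN' : n2 w ≤ |N| := hN.trans (le_abs_self _)
  have h1 : n2 w ^ 2 ≤ |N| * n2 w := by rw [sq]; gcongr
  have h2 : (if 1 < sg d then (1:ℝ)⁻¹ * PP w else 0) ≤ G * |N| ^ (sg d - 1) * |S| * n2 w := by
    split_ifs with h1
    · have h3 : n2 w ^ sg d ≤ |N| ^ (sg d - 1) * n2 w := by
        calc n2 w ^ sg d = n2 w ^ (sg d - 1) * n2 w := by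
              rw [← Real.rpow_add_one' hy (by linarith)]; congr 1; ring
          _ ≤ _ := by
            gcongr
      rw [inv_one, one_mul]
      calc PP w ≤ G * n2 w ^ sg d * S2 w := hG w
        _ ≤ G * (|N| ^ (sg d - 1) * n2 w) * |S| := by
          have := S2_nonneg w
          have := hS.trans (le_abs_self _)
          gcongr
        _ = _ := by ring
    · positivity
  calc _ ≤ C * B * (|N| * n2 w + G * |N| ^ (sg d - 1) * |S| * n2 w) := by
        have h1' : (1:ℝ) ^ 3 * n2 w ^ 2 ≤ |N| * n2 w := by simpa using h1
        exact mul_le_mul_of_nonneg_left (add_le_add h1' h2) (by positivity)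
    _ = _ := by ring

theorem NL_t (hd : 1 ≤ d) (N S : ℝ) : ∃ C, 0 ≤ C ∧ ∀ (u v : Sch d) (ω : Ed d → ℝ) (B t : ℝ), (∀ x, 0 ≤ ω x) →
    (∀ x, ω x * (‖u x‖ ^ sg d + ‖u x‖) ≤ B) → 0 < t → t ≤ 1 → n2 (v - u : Sch d) ≤ N * t → S2 (v - u) ≤ S →
    ∫ x, ω x * (‖u x‖ * |‖v x‖ ^ sg d - ‖u x‖ ^ sg d| * ‖(v - u : Sch d) x‖) ≤ C * B * t ^ (5/4 : ℝ) := by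
  obtain ⟨C, hC0, hC⟩ := NLI hd
  obtain ⟨G, hG0, hG⟩ := GN hd
  refine ⟨C * (|N| ^ 2 + G * |N| ^ (sg d) * |S|), by positivity, fun u v ω B t hω hB ht0 ht1 hN hS => ?_⟩
  have hK : 1 ≤ t ^ (-(1/4) : ℝ) := Real.one_le_rpow_of_pos_of_le_one_of_nonpos ht0 ht1 (by norm_num)
  have h := hC u v ω B _ hω hB hK
  refine h.trans ?_
  have hB0 : 0 ≤ B := (mul_nonneg (hω 0) (by positivity)).trans (hB 0)
  set w : Sch d := v - u
  have hy : 0 ≤ n2 w := n2_nonneg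
  have hN' : n2 w ≤ |N| * t := hN.trans (by gcongr; exact le_abs_self _)
  have h1 : (t ^ (-(1/4) : ℝ)) ^ 3 * n2 w ^ 2 ≤ |N| ^ 2 * t ^ (5/4 : ℝ) := by
    calc (t ^ (-(1/4) : ℝ)) ^ 3 * n2 w ^ 2 ≤ (t ^ (-(1/4) : ℝ)) ^ 3 * (|N| * t) ^ 2 := by gcongr
      _ = |N| ^ 2 * ((t ^ (-(1/4) : ℝ)) ^ 3 * t ^ 2) := by ring
      _ = |N| ^ 2 * t ^ (5/4 : ℝ) := by
        congr 1
        rw [← Real.rpow_natCast, ← Real.rpow_mul ht0.le, ← Real.rpow_natCast t 2, ← Real.rpow_add ht0]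
        norm_num
  have h2 : (if 1 < sg d then (t ^ (-(1/4) : ℝ))⁻¹ * PP w else 0) ≤ G * |N| ^ (sg d) * |S| * t ^ (5/4 : ℝ) := by
    split_ifs with h1
    · have h3 : n2 w ^ sg d ≤ |N| ^ (sg d) * t := by
        calc n2 w ^ sg d ≤ (|N| * t) ^ sg d := by gcongr
          _ = |N| ^ sg d * t ^ sg d := Real.mul_rpow (abs_nonneg _) ht0.le
          _ ≤ _ := by
            gcongr
            simpa using Real.rpow_le_rpow_of_exponent_ge ht0 ht1 h1.le
      rw [← Real.rpow_neg ht0.le, neg_neg]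
      calc t ^ (1/4:ℝ) * PP w ≤ t ^ (1/4:ℝ) * (G * n2 w ^ sg d * S2 w) := by gcongr; exact hG w
        _ ≤ t ^ (1/4:ℝ) * (G * (|N| ^ (sg d) * t) * |S|) := by
          have := S2_nonneg w
          have := hS.trans (le_abs_self _)
          gcongr
        _ = G * |N| ^ (sg d) * |S| * (t ^ (1/4:ℝ) * t) := by ring
        _ = _ := by rw [← Real.rpow_add_one ht0.ne']; norm_num
    · positivity
  calc _ ≤ C * B * (|N| ^ 2 * t ^ (5/4 : ℝ) + G * |N| ^ (sg d) * |S| * t ^ (5/4 : ℝ)) := by gcongr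
    _ = _ := by ring

theorem pow_split {s σ : ℝ} (hs : 0 ≤ s) (hσ : 0 ≤ σ) :
    s ^ σ * s ≤ s + s ^ 2 + (if 1 < σ then s ^ (2 + σ) else 0) := by
  rcases le_total s 1 with h | h
  · have : s ^ σ ≤ 1 := Real.rpow_le_one hs h hσ
    have h1 : 0 ≤ (if 1 < σ then s ^ (2 + σ) else 0) := by split_ifs <;> positivity
    nlinarith [sq_nonneg s]
  · split_ifs with h1
    · have : s ^ (2 + σ) = s ^ σ * s ^ 2 := by
        rw [add_comm, Real.rpow_add' hs (by linarith)]; norm_cast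
      have h2 := Real.rpow_nonneg hs σ
      rw [this]
      nlinarith [mul_nonneg h2 hs, sq_nonneg s]
    · have : s ^ σ ≤ s := by simpa using Real.rpow_le_rpow_of_exponent_le h (not_lt.1 h1)
      nlinarith

/-- continuity of the nonlinearity in L2 -/
theorem FE (hd : 1 ≤ d) (N S : ℝ) : ∃ C, 0 ≤ C ∧ ∀ (u v : Sch d) (k : Ed d → ℂ) (B U : ℝ), RD k → (∀ x, ‖k x‖ ≤ B) →
    (∀ x, ‖u x‖ ^ sg d ≤ U) → n2 (v - u : Sch d) ≤ N → S2 (v - u) ≤ S →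
    ∫ x, ‖fN v x - fN u x‖ * ‖k x‖ ≤ C * (1 + U) * (B + n2 k) * n2 (v - u : Sch d) := by
  obtain ⟨G, hG0, hG⟩ := GN hd
  have hσ := sg_nonneg (d := d)
  set c : ℝ := (2 + sg d) * 2 ^ sg d with hc
  have hc0 : 0 ≤ c := by positivity
  refine ⟨c * (1 + |N| + G * |N| ^ (sg d - 1) * |S|), by positivity, fun u v k B U hk hB hU hN hS => ?_⟩
  have hU0 : 0 ≤ U := le_trans (by positivity) (hU 0)
  have hB0 : 0 ≤ B := le_trans (norm_nonneg _) (hB 0)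
  set w : Sch d := v - u with hw
  have hv : ∀ x, v x = u x + w x := fun x => by rw [hw, sub_apply]; ring
  have hi1 : Integrable (fun x => ‖w x‖ ^ 2) := int_sq w
  have hi2 : Integrable (fun x => ‖w x‖ ^ (2 + sg d)) := (PP_rd (rd w)).integrable
  have hi3 : Integrable (fun x => ‖w x‖ * ‖k x‖) := ((rd w).norm.mul hk.norm.pg).integrable
  have hint : Integrable (fun x => (if 1 < sg d then ‖w x‖ ^ (2 + sg d) else 0)) := by
    split_ifs
    · exact hi2
    · simp
  have hpt : ∀ x, ‖fN v x - fN u x‖ * ‖k x‖ ≤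
      c * ((1 + U) * (‖w x‖ * ‖k x‖) + B * ‖w x‖ ^ 2 + B * (if 1 < sg d then ‖w x‖ ^ (2 + sg d) else 0)) := by
    intro x
    have h1 := fLip hσ (u x) (w x)
    have h2 := pow_split (norm_nonneg (w x)) hσ
    have h3 : 0 ≤ (if 1 < sg d then ‖w x‖ ^ (2 + sg d) else 0) := by split_ifs <;> positivity
    rw [fN_fz, fN_fz, hv x]
    calc _ ≤ c * ((‖u x‖ ^ sg d + ‖w x‖ ^ sg d) * ‖w x‖) * ‖k x‖ := by gcongr
      _ = c * ((‖u x‖ ^ sg d * ‖w x‖ + ‖w x‖ ^ sg d * ‖w x‖) * ‖k x‖) := by ring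
      _ ≤ c * ((U * ‖w x‖ + (‖w x‖ + ‖w x‖ ^ 2 + (if 1 < sg d then ‖w x‖ ^ (2 + sg d) else 0))) * ‖k x‖) := by
        gcongr
        exact hU x
      _ = c * ((1 + U) * (‖w x‖ * ‖k x‖) + ‖k x‖ * ‖w x‖ ^ 2 + ‖k x‖ * (if 1 < sg d then ‖w x‖ ^ (2 + sg d) else 0)) := by ring
      _ ≤ _ := by
        gcongr
        · exact hB x
        · exact hB x
  have h0 := integral_mono_of_nonneg (μ := volume) (ae_of_all _ fun x => by positivity)
    ((((hi3.const_mul (1 + U)).add (hi1.const_mul B)).add (hint.const_mul B)).const_mul c) (ae_of_all _ hpt)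
  refine h0.trans ?_
  simp only [Pi.add_apply]
  have hI12 : Integrable (fun x => (1 + U) * (‖w x‖ * ‖k x‖) + B * ‖w x‖ ^ 2) := (hi3.const_mul _).add (hi1.const_mul _)
  rw [integral_const_mul, integral_add hI12 (hint.const_mul _),
    integral_add (hi3.const_mul _) (hi1.const_mul _), integral_const_mul, integral_const_mul, integral_const_mul, ← n2_sq]
  have hy : 0 ≤ n2 w := n2_nonneg
  have hnk : 0 ≤ n2 k := n2_nonneg
  have hN' : n2 w ≤ |N| := hN.trans (le_abs_self _)
  have e1 := int_norm_mul_le (rd w) hk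
  have e2 : n2 w ^ 2 ≤ |N| * n2 w := by rw [sq]; gcongr
  have e3 : ∫ x, (if 1 < sg d then ‖w x‖ ^ (2 + sg d) else 0) ≤ G * |N| ^ (sg d - 1) * |S| * n2 w := by
    split_ifs with h1
    · have h3 : n2 w ^ sg d ≤ |N| ^ (sg d - 1) * n2 w := by
        calc n2 w ^ sg d = n2 w ^ (sg d - 1) * n2 w := by
              rw [← Real.rpow_add_one' hy (by linarith)]; congr 1; ring
          _ ≤ _ := by
            gcongr
      calc PP w ≤ G * n2 w ^ sg d * S2 w := hG w
        _ ≤ G * (|N| ^ (sg d - 1) * n2 w) * |S| := by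
          have := S2_nonneg w
          have := hS.trans (le_abs_self _)
          gcongr
        _ = _ := by ring
    · simp; positivity
  set Z := G * |N| ^ (sg d - 1) * |S| with hZ
  have hZ0 : 0 ≤ Z := by positivity
  calc _ ≤ c * ((1 + U) * (n2 w * n2 k) + B * (|N| * n2 w) + B * (Z * n2 w)) := by gcongr
    _ = c * ((1 + U) * n2 k + (|N| + Z) * B) * n2 w := by ring
    _ ≤ c * ((1 + |N| + Z) * ((1 + U) * (B + n2 k))) * n2 w := by
      gcongr
      have := abs_nonneg N
      have a1 : 0 ≤ (|N| + Z) * (U * B) := by positivity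
      have a2 : 0 ≤ (|N| + Z) * ((1 + U) * n2 k) := by positivity
      have a3 : 0 ≤ (1 + U) * B := by positivity
      nlinarith
    _ = _ := by ring

/-- second order expansion of the potential energy -/
theorem PTI (d : ℕ) : ∃ C, 0 ≤ C ∧ ∀ (u v : Sch d) (U : ℝ), (∀ x, ‖u x‖ ^ sg d ≤ U) →
    |PP v - PP u - (2 + sg d) * ip (fN u) (v - u : Sch d)| ≤ C * (U * n2 (v - u : Sch d) ^ 2 + PP (v - u : Sch d)) := by
  have hσ := sg_nonneg (d := d)
  refine ⟨(2 + sg d) ^ 2 * 2 ^ sg d, by positivity, fun u v U hU => ?_⟩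
  set w : Sch d := v - u with hw
  have hv : ∀ x, v x = u x + w x := fun x => by rw [hw, sub_apply]; ring
  have hi1 : Integrable (fun x => ‖w x‖ ^ 2) := int_sq w
  have hi2 : Integrable (fun x => ‖w x‖ ^ (2 + sg d)) := (PP_rd (rd w)).integrable
  have j1 := (PP_rd (rd v)).integrable
  have j2 := (PP_rd (rd u)).integrable
  have j3 : Integrable (fun x => inner ℝ (fN u x) (w x)) := ((fN_rd (rd u)).inner (rd w).pg).integrable
  have j12 : Integrable (fun x => ‖v x‖ ^ (2 + sg d) - ‖u x‖ ^ (2 + sg d)) := j1.sub j2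
  unfold PP ip
  rw [← integral_sub j1 j2, ← integral_const_mul, ← integral_sub j12 (j3.const_mul _), n2_sq, ← integral_const_mul,
    ← integral_add (hi1.const_mul _) hi2, ← integral_const_mul]
  refine (abs_integral_le_integral_abs).trans (integral_mono_of_nonneg (ae_of_all _ fun x => abs_nonneg _)
    (((hi1.const_mul _).add hi2).const_mul _) (ae_of_all _ fun x => ?_))
  simp only [fN_fz]
  rw [hv x]
  refine (pTaylor hσ (u x) (w x)).trans ?_
  have : ‖w x‖ ^ (2 + sg d) = ‖w x‖ ^ sg d * ‖w x‖ ^ 2 := by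
    rw [add_comm, Real.rpow_add' (norm_nonneg _) (by linarith)]; norm_cast
  rw [this, add_mul]
  have := hU x
  gcongr
end HS

namespace HS
open Complex ComplexConjugate
variable {d : ℕ}

/-- affine comparison path -/
def uf (u0 h : Sch d) (t0 t : ℝ) : Sch d := u0 + (t - t0) • h
/-- residual of the comparison path -/
def rho (lam : ℝ) (u h : Sch d) (x : Ed d) : ℂ := -(I * Hop u x) + I * ((lam : ℂ) * fN u x) - h x
/-- weighted nonlinear interaction -/
def NLf (θ : Ed d → ℝ) (u v : Sch d) : ℝ :=
  ∫ x, θ x ^ 2 * (‖u x‖ * |‖v x‖ ^ sg d - ‖u x‖ ^ sg d| * ‖(v - u : Sch d) x‖)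
/-- forcing -/
def Ff (lam : ℝ) (u v h : Sch d) (x : Ed d) : ℂ :=
  I * ((lam * (‖v x‖ ^ sg d - ‖u x‖ ^ sg d) : ℝ) : ℂ) * u x + rho lam u h x

theorem smul_apply' (c : ℝ) (u : Sch d) (x : Ed d) : (c • u : Sch d) x = (c : ℂ) * u x := by
  rw [smul_apply]; simp

theorem rho_rd (lam : ℝ) (u h : Sch d) : RD (rho lam u h) := by
  unfold rho
  refine (RD.add (RD.neg ?_) ?_).sub (rd h)
  · exact (PG.const I).rmul (rd (Hop u))
  · exact (PG.const I).rmul ((PG.const (lam : ℂ)).rmul (fN_rd (rd u)))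

theorem powsg_cont {u : Ed d → ℂ} (hu : Continuous u) : Continuous (fun x => ‖u x‖ ^ sg d) :=
  hu.norm.rpow_const fun _ => Or.inr sg_nonneg

theorem Ff_cont (lam : ℝ) (u v h : Sch d) : Continuous (Ff lam u v h) := by
  unfold Ff
  have h1 := powsg_cont u.continuous
  have h2 := powsg_cont v.continuous
  have h3 := (rho_rd lam u h).cont
  have h4 := u.continuous
  fun_prop

theorem w_smooth {lam : ℝ} {v : ℝ → Sch d} (hv : IsSol lam v) (u0 h : Sch d) (t0 : ℝ) :
    ContDiff ℝ (⊤ : ℕ∞) (fun p : ℝ × Ed d => (v p.1 - uf u0 h t0 p.1 : Sch d) p.2) := by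
  have h1 : ContDiff ℝ (⊤ : ℕ∞) (fun p : ℝ × Ed d => u0 p.2) := (u0.smooth ⊤).comp contDiff_snd
  have h2 : ContDiff ℝ (⊤ : ℕ∞) (fun p : ℝ × Ed d => h p.2) := (h.smooth ⊤).comp contDiff_snd
  have h3 : ContDiff ℝ (⊤ : ℕ∞) (fun p : ℝ × Ed d => v p.1 p.2 - (u0 p.2 + (p.1 - t0) • h p.2)) :=
    hv.smooth.sub (h1.add ((contDiff_fst.sub contDiff_const).smul h2))
  exact h3

theorem w_eq {lam : ℝ} {v : ℝ → Sch d} (hv : IsSol lam v) (u0 h : Sch d) (t0 t : ℝ) (x : Ed d) :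
    deriv (fun s => (v s - uf u0 h t0 s : Sch d) x) t =
      I * lap (v t - uf u0 h t0 t : Sch d) x +
      I * ((-‖x‖ ^ 2 + lam * ‖v t x‖ ^ sg d : ℝ) : ℂ) * (v t - uf u0 h t0 t : Sch d) x +
      Ff lam (uf u0 h t0 t) (v t) h x := by
  have e1 : (fun s => (v s - uf u0 h t0 s : Sch d) x) = fun s => v s x - (u0 x + (s - t0) • h x) := rfl
  have h1 := time_hasDerivAt (w := fun s x => v s x) hv.smooth t x
  have h2 : HasDerivAt (fun s : ℝ => u0 x + (s - t0) • h x) ((1:ℝ) • h x) t :=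
    (((hasDerivAt_id t).sub_const t0).smul_const (h x)).const_add _
  have h3 : HasDerivAt (fun s => v s x - (u0 x + (s - t0) • h x)) _ t := h1.sub h2
  rw [e1, h3.deriv]
  rw [sol_form hv, one_smul, ← Lap_apply, ← Lap_apply, map_sub, sub_apply, sub_apply]
  unfold Ff rho fN
  rw [Hop_eq, sub_apply, Q_apply]
  push_cast
  ring

theorem LW {lam : ℝ} {v : ℝ → Sch d} (hv : IsSol lam v) (u0 h : Sch d) (t0 : ℝ)
    {θ : Ed d → ℝ} {L : NNReal} (hθ : LipschitzWith L θ) (hs : HasCompactSupport θ) (t : ℝ) :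
    HasDerivAt (fun t => ∫ x, θ x ^ 2 * ‖(v t - uf u0 h t0 t : Sch d) x‖ ^ 2)
      (4 * (∫ x, θ x * ∑ i, lineDeriv ℝ θ x (stdBasis i) *
        (conj ((v t - uf u0 h t0 t : Sch d) x) * pd (v t - uf u0 h t0 t : Sch d) i x).im)
        + 2 * ∫ x, θ x ^ 2 * (conj ((v t - uf u0 h t0 t : Sch d) x) * Ff lam (uf u0 h t0 t) (v t) h x).re) t :=
  LM (w := fun t x => (v t - uf u0 h t0 t : Sch d) x) (w_smooth hv u0 h t0) hθ hs t
    (fun x => -‖x‖ ^ 2 + lam * ‖v t x‖ ^ sg d) _ (Ff_cont _ _ _ _) (fun x => w_eq hv u0 h t0 t x)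

theorem FLX {θ : Ed d → ℝ} {L : NNReal} (hθ : LipschitzWith L θ) (hs : HasCompactSupport θ) (u : Sch d) :
    |∫ x, θ x * ∑ i, lineDeriv ℝ θ x (stdBasis i) * (conj (u x) * pd u i x).im|
      ≤ L * (√(∫ x, θ x ^ 2 * ‖u x‖ ^ 2) * √(S2 u)) := by
  have hu : Continuous u := u.continuous
  have hf : Integrable (fun x => (|θ x| * ‖u x‖) ^ 2) := by
    simp only [mul_pow, sq_abs]
    exact int_cut hθ.continuous hs hu
  have hgc : Continuous (fun x => √(gradNormSq u x)) := by
    unfold gradNormSq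
    refine Real.continuous_sqrt.comp (continuous_finsetSum _ fun i _ => ?_)
    rw [← D_coe]; exact ((D i u).continuous.norm.pow 2)
  have hg : Integrable (fun x => (√(gradNormSq u x)) ^ 2) := by
    simp only [Real.sq_sqrt (gradNormSq_nonneg _ _)]; exact int_grad u
  obtain ⟨hi, hcs⟩ := cs_int (f := fun x => |θ x| * ‖u x‖) (g := fun x => √(gradNormSq u x)) (hθ.continuous.abs.mul hu.norm).aestronglyMeasurable
    hgc.aestronglyMeasurable hf hg
  have h1 : |∫ x, θ x * ∑ i, lineDeriv ℝ θ x (stdBasis i) * (conj (u x) * pd u i x).im|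
      ≤ L * ∫ x, (|θ x| * ‖u x‖) * √(gradNormSq u x) := by
    rw [← integral_const_mul, ← Real.norm_eq_abs]
    refine norm_integral_le_of_norm_le (hi.const_mul _) ?_
    filter_upwards [lip_grad_sq hθ] with x hx
    rw [norm_mul, Real.norm_eq_abs, Real.norm_eq_abs]
    have := flux_pt L.2 hx (u x) (fun i => pd u i x)
    calc |θ x| * _ ≤ |θ x| * (L * ‖u x‖ * √(∑ i, ‖pd u i x‖ ^ 2)) :=
            mul_le_mul_of_nonneg_left this (abs_nonneg _)
      _ = _ := by unfold gradNormSq; ring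
  have h2 := (le_abs_self _).trans hcs
  simp only [mul_pow, sq_abs, Real.sq_sqrt (gradNormSq_nonneg _ _)] at h2
  exact h1.trans (mul_le_mul_of_nonneg_left h2 L.2)

theorem int_cpt {θ f : Ed d → ℝ} (hθ : Continuous θ) (hs : HasCompactSupport θ) (hf : Continuous f) :
    Integrable (fun x => θ x ^ 2 * f x) := by
  have hc : Continuous (fun x => θ x * (θ x * f x)) := by fun_prop
  have h := hc.integrable_of_hasCompactSupport (μ := volume) hs.mul_right
  refine h.congr (Eventually.of_forall fun x => ?_)
  simp only []; ring

theorem LWb {lam : ℝ} (u v h : Sch d) {θ : Ed d → ℝ} (hθ : Continuous θ) (hs : HasCompactSupport θ) :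
    |∫ x, θ x ^ 2 * (conj ((v - u : Sch d) x) * Ff lam u v h x).re| ≤
      |lam| * NLf θ u v + √(∫ x, θ x ^ 2 * ‖(v - u : Sch d) x‖ ^ 2) * √(∫ x, θ x ^ 2 * ‖rho lam u h x‖ ^ 2) := by
  set w : Sch d := v - u with hw
  have hc1 := powsg_cont u.continuous
  have hc2 := powsg_cont v.continuous
  have hcr := (rho_rd lam u h).cont
  have hcu := u.continuous
  have hcw := w.continuous
  have i1 : Integrable (fun x => θ x ^ 2 * (‖u x‖ * |‖v x‖ ^ sg d - ‖u x‖ ^ sg d| * ‖w x‖)) :=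
    int_cpt hθ hs (by fun_prop)
  have hf : Integrable (fun x => (|θ x| * ‖w x‖) ^ 2) := by
    simp only [mul_pow, sq_abs]; exact int_cut hθ hs hcw
  have hg : Integrable (fun x => (|θ x| * ‖rho lam u h x‖) ^ 2) := by
    simp only [mul_pow, sq_abs]; exact int_cut hθ hs hcr
  obtain ⟨i2, hcs⟩ := cs_int (f := fun x => |θ x| * ‖w x‖) (g := fun x => |θ x| * ‖rho lam u h x‖)
    (hθ.abs.mul hcw.norm).aestronglyMeasurable (hθ.abs.mul hcr.norm).aestronglyMeasurable hf hg
  have h1 : |∫ x, θ x ^ 2 * (conj (w x) * Ff lam u v h x).re| ≤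
      ∫ x, (|lam| * (θ x ^ 2 * (‖u x‖ * |‖v x‖ ^ sg d - ‖u x‖ ^ sg d| * ‖w x‖)) + |θ x| * ‖w x‖ * (|θ x| * ‖rho lam u h x‖)) := by
    rw [← Real.norm_eq_abs]
    refine norm_integral_le_of_norm_le ((i1.const_mul _).add i2) (ae_of_all _ fun x => ?_)
    rw [norm_mul, Real.norm_eq_abs, Real.norm_eq_abs, abs_of_nonneg (sq_nonneg (θ x))]
    have h2 : |(conj (w x) * Ff lam u v h x).re| ≤
        |lam| * (‖u x‖ * |‖v x‖ ^ sg d - ‖u x‖ ^ sg d| * ‖w x‖) + ‖w x‖ * ‖rho lam u h x‖ := by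
      refine (abs_re_le_norm _).trans ?_
      rw [norm_mul, norm_conj]
      have : ‖Ff lam u v h x‖ ≤ |lam| * |‖v x‖ ^ sg d - ‖u x‖ ^ sg d| * ‖u x‖ + ‖rho lam u h x‖ := by
        unfold Ff
        refine (norm_add_le _ _).trans (le_of_eq ?_)
        rw [norm_mul, norm_mul, norm_I, Complex.norm_real, Real.norm_eq_abs, abs_mul]; ring
      calc ‖w x‖ * _ ≤ ‖w x‖ * (|lam| * |‖v x‖ ^ sg d - ‖u x‖ ^ sg d| * ‖u x‖ + ‖rho lam u h x‖) := by gcongr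
        _ = _ := by ring
    calc θ x ^ 2 * _ ≤ θ x ^ 2 * _ := mul_le_mul_of_nonneg_left h2 (sq_nonneg _)
      _ = _ := by rw [← sq_abs (θ x)]; ring
  rw [integral_add (i1.const_mul _) i2, integral_const_mul] at h1
  simp only [mul_pow, sq_abs] at hcs
  refine h1.trans (add_le_add le_rfl ((le_abs_self _).trans hcs))

theorem uf_self (u0 h : Sch d) (t0 : ℝ) : uf u0 h t0 t0 = u0 := by simp [uf]
theorem uf_zero (u0 : Sch d) (t0 t : ℝ) : uf u0 0 t0 t = u0 := by simp [uf]

/-- weighted bound -/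
theorem WB {lam : ℝ} {v : ℝ → Sch d} (hv : IsSol lam v) (u0 h : Sch d) (t0 : ℝ)
    {θ : Ed d → ℝ} {L : NNReal} (hθ : LipschitzWith L θ) (hs : HasCompactSupport θ) {t c : ℝ}
    (hc : ∀ τ ∈ Set.uIcc t0 t, 4 * (L * (√(∫ x, θ x ^ 2 * ‖(v τ - uf u0 h t0 τ : Sch d) x‖ ^ 2) * √(S2 (v τ - uf u0 h t0 τ)))) +
      2 * (|lam| * NLf θ (uf u0 h t0 τ) (v τ) + √(∫ x, θ x ^ 2 * ‖(v τ - uf u0 h t0 τ : Sch d) x‖ ^ 2) *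
        √(∫ x, θ x ^ 2 * ‖rho lam (uf u0 h t0 τ) h x‖ ^ 2)) ≤ c) :
    |(∫ x, θ x ^ 2 * ‖(v t - uf u0 h t0 t : Sch d) x‖ ^ 2) - ∫ x, θ x ^ 2 * ‖(v t0 - u0 : Sch d) x‖ ^ 2| ≤ c * |t - t0| := by
  have h1 := (convex_uIcc t0 t).norm_image_sub_le_of_norm_hasDerivWithin_le
    (f := fun t => ∫ x, θ x ^ 2 * ‖(v t - uf u0 h t0 t : Sch d) x‖ ^ 2) (C := c)
    (fun τ hτ => (LW hv u0 h t0 hθ hs τ).hasDerivWithinAt) (fun τ hτ => ?_) Set.left_mem_uIcc Set.right_mem_uIcc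
  · simpa only [Real.norm_eq_abs, uf_self] using h1
  · rw [Real.norm_eq_abs]
    refine le_trans ?_ (hc τ hτ)
    refine (abs_add_le _ _).trans (add_le_add ?_ ?_)
    · rw [abs_mul, abs_of_pos (by norm_num : (0:ℝ) < 4)]
      exact mul_le_mul_of_nonneg_left (FLX hθ hs _) (by norm_num)
    · rw [abs_mul, abs_of_pos (by norm_num : (0:ℝ) < 2)]
      exact mul_le_mul_of_nonneg_left (LWb _ _ _ hθ.continuous hs) (by norm_num)

theorem sup_trick {J : Set ℝ} {f : ℝ → ℝ} {N c K : ℝ} (hf : ∀ τ ∈ J, 0 ≤ f τ) (hN : ∀ τ ∈ J, f τ ≤ N) (hc : 0 ≤ c) (hK : 0 ≤ K)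
    (h : ∀ B, 0 ≤ B → (∀ τ ∈ J, f τ ≤ B) → ∀ τ ∈ J, f τ ^ 2 ≤ c + K * B) : ∀ τ ∈ J, f τ ≤ √c + K := by
  intro τ0 h0
  set m := sSup (f '' J) with hm
  have hbd : BddAbove (f '' J) := ⟨N, by rintro _ ⟨τ, hτ, rfl⟩; exact hN τ hτ⟩
  have h1 : ∀ τ ∈ J, f τ ≤ m := fun τ hτ => le_csSup hbd ⟨τ, hτ, rfl⟩
  have hm0 : 0 ≤ m := (hf τ0 h0).trans (h1 τ0 h0)
  have h2 := h m hm0 h1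
  have h3 : m ≤ √(c + K * m) := csSup_le ⟨_, τ0, h0, rfl⟩ (by
    rintro _ ⟨τ, hτ, rfl⟩; exact Real.le_sqrt_of_sq_le (h2 τ hτ))
  have h4 : m ^ 2 ≤ c + K * m := by
    have := pow_le_pow_left₀ hm0 h3 2
    rwa [Real.sq_sqrt (by positivity)] at this
  have h5 : m ≤ √c + K := by
    by_contra hlt
    push Not at hlt
    have := Real.sqrt_nonneg c
    have := Real.sq_sqrt hc
    nlinarith
  exact (h1 τ0 h0).trans h5

theorem NLf_nonneg (θ : Ed d → ℝ) (u v : Sch d) : 0 ≤ NLf θ u v := integral_nonneg fun x => by positivity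

/-- L2 bound -/
theorem MB {lam : ℝ} {v : ℝ → Sch d} (hv : IsSol lam v) (u0 h : Sch d) {t0 t c N S : ℝ} (h0 : v t0 = u0)
    (hN : ∀ τ ∈ Set.uIcc t0 t, n2 (v τ - uf u0 h t0 τ : Sch d) ≤ N) (hS : ∀ τ ∈ Set.uIcc t0 t, S2 (v τ - uf u0 h t0 τ) ≤ S)
    (hc : ∀ τ ∈ Set.uIcc t0 t, 2 * (|lam| * (∫ x, ‖uf u0 h t0 τ x‖ * |‖v τ x‖ ^ sg d - ‖uf u0 h t0 τ x‖ ^ sg d| * ‖(v τ - uf u0 h t0 τ : Sch d) x‖)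
      + n2 (v τ - uf u0 h t0 τ : Sch d) * n2 (rho lam (uf u0 h t0 τ) h)) ≤ c) :
    n2 (v t - uf u0 h t0 t : Sch d) ^ 2 ≤ c * |t - t0| := by
  have key : ∀ n : ℕ, ∫ x, ct (n+1:ℝ) x ^ 2 * ‖(v t - uf u0 h t0 t : Sch d) x‖ ^ 2 ≤ (4 * (1 / ((n:ℝ)+1) * (N * √S)) + c) * |t - t0| := by
    intro n
    have hR : (0:ℝ) < n + 1 := by positivity
    have h1 := WB hv u0 h t0 (ct_lip hR) (ct_supp hR) (t := t) (c := 4 * (1 / ((n:ℝ)+1) * (N * √S)) + c) (fun τ hτ => ?_)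
    · rw [h0] at h1
      simp only [sub_self, zero_apply, norm_zero, ne_eq, OfNat.ofNat_ne_zero, not_false_eq_true, zero_pow, mul_zero,
        integral_zero, sub_zero] at h1
      exact (le_abs_self _).trans h1
    · have hle : ∀ f : Ed d → ℂ, RD f → √(∫ x, ct (n+1:ℝ) x ^ 2 * ‖f x‖ ^ 2) ≤ n2 f := by
        intro f hf
        refine Real.sqrt_le_sqrt (integral_mono (int_cut ct_cont (ct_supp hR) hf.cont) hf.sq_int fun x => ?_)
        have := pow_le_one₀ (n := 2) (ct_nonneg (n+1:ℝ) x) (ct_le_one hR x)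
        exact mul_le_of_le_one_left (by positivity) this
      set w : Sch d := v τ - uf u0 h t0 τ with hw
      have e1 := hle w (rd w)
      have e2 := hle _ (rho_rd lam (uf u0 h t0 τ) h)
      have e3 : NLf (ct (n+1:ℝ)) (uf u0 h t0 τ) (v τ) ≤ (∫ x, ‖uf u0 h t0 τ x‖ * |‖v τ x‖ ^ sg d - ‖uf u0 h t0 τ x‖ ^ sg d| * ‖w x‖) := by
        unfold NLf
        have hr : RD (fun x => ‖uf u0 h t0 τ x‖ * |‖v τ x‖ ^ sg d - ‖uf u0 h t0 τ x‖ ^ sg d| * ‖w x‖) := by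
          refine RD.mul (RD.mul (rd _).norm ?_) (rd w).norm.pg
          have hp : ∀ u : Sch d, PG (fun x => ‖u x‖ ^ sg d) := fun u => by
            obtain ⟨B, hB0, hB⟩ := (rd u).bdd
            refine ⟨powsg_cont u.continuous, 0, B ^ sg d, fun x => ?_⟩
            have h1 := Real.rpow_le_rpow (norm_nonneg _) (hB x) sg_nonneg (z := sg d)
            rw [Real.norm_of_nonneg (by positivity)]
            simpa using h1
          exact ((hp _).sub (hp _)).norm
        refine integral_mono (int_cpt ct_cont (ct_supp hR) hr.cont) hr.integrable fun x => ?_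
        have := pow_le_one₀ (n := 2) (ct_nonneg (n+1:ℝ) x) (ct_le_one hR x)
        exact mul_le_of_le_one_left (by positivity) this
      rw [Real.coe_toNNReal _ (by positivity)]
      have hw0 : 0 ≤ n2 w := n2_nonneg
      have hr0 : 0 ≤ n2 (rho lam (uf u0 h t0 τ) h) := n2_nonneg
      have e4 := hN τ hτ
      have e5 := hS τ hτ
      have e6 := hc τ hτ
      refine (add_le_add ?_ ?_).trans (add_le_add (le_refl (4 * (1 / ((n:ℝ)+1) * (N * √S)))) e6)
      · have := e1.trans e4
        have hN0 : 0 ≤ N := hw0.trans e4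
        gcongr
      · gcongr
  have hlim : Tendsto (fun n : ℕ => (4 * (1 / ((n:ℝ)+1) * (N * √S)) + c) * |t - t0|) atTop (nhds ((4 * (0 * (N * √S)) + c) * |t - t0|)) :=
    (((tendsto_one_div_add_atTop_nhds_zero_nat.mul_const _).const_mul _).add_const _).mul_const _
  have := le_of_tendsto_of_tendsto' (ct_tendsto (rd (v t - uf u0 h t0 t : Sch d))) hlim key
  rw [n2_sq]; simpa using this

theorem S2_sub_le (u w : Sch d) : S2 (u - w) ≤ 2 * S2 u + 2 * S2 w := by
  rw [S2_eq, S2_eq, S2_eq, Finset.mul_sum, Finset.mul_sum, ← Finset.sum_add_distrib]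
  refine Finset.sum_le_sum fun i _ => ?_
  rw [← integral_const_mul, ← integral_const_mul, ← integral_add ((int_sq _).const_mul _) ((int_sq _).const_mul _)]
  refine integral_mono (int_sq _) (((int_sq (D i u)).const_mul _).add ((int_sq (D i w)).const_mul _)) fun x => ?_
  simp only [D_sub, sub_apply]
  have := norm_sub_le (D i u x) (D i w x)
  have h0 := norm_nonneg (D i u x - D i w x)
  nlinarith [sq_nonneg (‖D i u x‖ - ‖D i w x‖)]

theorem powsg_bdd (u : Sch d) : ∃ U, 0 ≤ U ∧ ∀ x, ‖u x‖ ^ sg d ≤ U := by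
  obtain ⟨B, hB0, hB⟩ := (rd u).bdd
  exact ⟨B ^ sg d, by positivity, fun x => Real.rpow_le_rpow (norm_nonneg _) (hB x) sg_nonneg⟩

theorem sg_pos (hd : 1 ≤ d) : 0 < sg d := by
  have : (0:ℝ) < d := by exact_mod_cast hd
  unfold sg; positivity

theorem powsg_rd (hd : 1 ≤ d) {u : Ed d → ℂ} (hu : RD u) : RD (fun x => ‖u x‖ ^ sg d) :=
  hu.norm.rpow (fun _ => norm_nonneg _) (sg_pos hd)

theorem n2_const {lam : ℝ} {v : ℝ → Sch d} (hv : IsSol lam v) {a b S0 s t : ℝ} (hs : s ∈ Set.Icc a b) (ht : t ∈ Set.Icc a b)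
    (hS : ∀ τ ∈ Set.Icc a b, S2 (v τ) ≤ S0) : n2 (v t) = n2 (v s) := by
  rw [n2_M, n2_M]
  rcases le_total s t with h | h
  · rw [M_const hv h fun τ hτ => hS τ ⟨hs.1.trans hτ.1, hτ.2.trans ht.2⟩]
  · rw [M_const hv h fun τ hτ => hS τ ⟨ht.1.trans hτ.1, hτ.2.trans hs.2⟩]

theorem BASE1 (hd : 1 ≤ d) {lam : ℝ} {v : ℝ → Sch d} (hv : IsSol lam v) {a b S0 s : ℝ} (hs : s ∈ Set.Icc a b)
    (hS : ∀ τ ∈ Set.Icc a b, S2 (v τ) ≤ S0) : ∃ C, 0 ≤ C ∧ ∀ t ∈ Set.Icc a b, n2 (v t - v s : Sch d) ≤ C * |t - s| := by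
  set N := 2 * n2 (v s) with hN
  set S1 := 4 * S0 with hS1
  obtain ⟨C, hC0, hC⟩ := NL_1 hd N S1
  obtain ⟨B1, hB10, hB1⟩ := (rd (v s)).bdd
  obtain ⟨B2, hB20, hB2⟩ := powsg_bdd (v s)
  have hr0 : 0 ≤ n2 (rho lam (v s) 0) := n2_nonneg
  have hNb : ∀ τ ∈ Set.Icc a b, n2 (v τ - v s : Sch d) ≤ N := fun τ hτ => by
    have h1 : n2 (v τ - v s : Sch d) ≤ n2 (v τ) + n2 (v s) := n2_sub_le (rd (v τ)) (rd (v s))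
    rw [n2_const hv hs hτ hS] at h1; linarith
  have hSb : ∀ τ ∈ Set.Icc a b, S2 (v τ - v s : Sch d) ≤ S1 := fun τ hτ => by
    have h1 := S2_sub_le (v τ) (v s)
    have := hS τ hτ
    have := hS s hs
    linarith
  refine ⟨2 * (|lam| * (C * (B2 + B1)) + n2 (rho lam (v s) 0)), by positivity, fun t ht => ?_⟩
  have hsub : Set.uIcc s t ⊆ Set.Icc a b := Set.uIcc_subset_Icc hs ht
  have h := sup_trick (J := Set.uIcc s t) (f := fun τ => n2 (v τ - v s : Sch d)) (N := N) (c := 0)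
    (K := 2 * (|lam| * (C * (B2 + B1)) + n2 (rho lam (v s) 0)) * |t - s|) (fun _ _ => n2_nonneg)
    (fun τ hτ => hNb τ (hsub hτ)) le_rfl (by positivity) (fun B hB hfB τ hτ => ?_) t Set.right_mem_uIcc
  · simpa using h
  · have hsub' : Set.uIcc s τ ⊆ Set.uIcc s t := Set.uIcc_subset_uIcc_left hτ
    have h1 := MB hv (v s) 0 (t0 := s) (t := τ) (N := N) (S := S1)
      (c := 2 * (|lam| * (C * (B2 + B1)) + n2 (rho lam (v s) 0)) * B) rfl (fun r hr => ?_) (fun r hr => ?_) (fun r hr => ?_)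
    · rw [uf_zero] at h1
      refine h1.trans ?_
      have : |τ - s| ≤ |t - s| := by
        exact Set.abs_sub_left_of_mem_uIcc hτ
      calc _ ≤ 2 * (|lam| * (C * (B2 + B1)) + n2 (rho lam (v s) 0)) * B * |t - s| := by gcongr
        _ = _ := by ring
    · rw [uf_zero]; exact hNb r (hsub (hsub' hr))
    · rw [uf_zero]; exact hSb r (hsub (hsub' hr))
    · simp only [uf_zero]
      have e1 := hC (v s) (v r) (fun _ => 1) (B2 + B1) (fun _ => zero_le_one)
        (fun x => by rw [one_mul]; exact add_le_add (hB2 x) (hB1 x)) (hNb r (hsub (hsub' hr))) (hSb r (hsub (hsub' hr)))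
      simp only [one_mul] at e1
      have e2 := hfB r (hsub' hr)
      calc _ ≤ 2 * (|lam| * (C * (B2 + B1) * n2 (v r - v s : Sch d)) + n2 (v r - v s : Sch d) * n2 (rho lam (v s) 0)) := by gcongr
        _ = 2 * (|lam| * (C * (B2 + B1)) + n2 (rho lam (v s) 0)) * n2 (v r - v s : Sch d) := by ring
        _ ≤ _ := by gcongr

theorem th_n2_le (n : ℕ) {f : Ed d → ℂ} (hf : RD f) : √(∫ x, th (n:ℝ) x ^ 2 * ‖f x‖ ^ 2) ≤ √(∫ x, ‖x‖ ^ 2 * ‖f x‖ ^ 2) := by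
  refine Real.sqrt_le_sqrt (integral_mono (int_cut (th_cont _) (th_supp _) hf.cont)
    ((PG.nrm.pow 2).rmul (hf.norm.pow two_ne_zero)).integrable fun x => ?_)
  have := th_nonneg (n:ℝ) x
  have := th_le (n:ℝ) x
  simp only
  gcongr

theorem th_n2_le' (n : ℕ) {f : Ed d → ℂ} (hf : RD f) : √(∫ x, th (n:ℝ) x ^ 2 * ‖f x‖ ^ 2) ≤ n * n2 f := by
  refine Real.sqrt_le_iff.2 ⟨by have : 0 ≤ n2 f := n2_nonneg
                                positivity, ?_⟩
  rw [mul_pow, n2_sq, ← integral_const_mul]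
  refine integral_mono (int_cut (th_cont _) (th_supp _) hf.cont) (hf.sq_int.const_mul _) fun x => ?_
  have := th_nonneg (n:ℝ) x
  have := th_le_R (Nat.cast_nonneg n) x
  simp only
  gcongr

theorem BASE2 (hd : 1 ≤ d) {lam : ℝ} {v : ℝ → Sch d} (hv : IsSol lam v) {a b S0 s : ℝ} (hs : s ∈ Set.Icc a b)
    (hS : ∀ τ ∈ Set.Icc a b, S2 (v τ) ≤ S0) : ∃ C, 0 ≤ C ∧ ∀ t ∈ Set.Icc a b, √(V (v t - v s)) ≤ C * |t - s| := by
  obtain ⟨C1, hC10, hC1⟩ := BASE1 hd hv hs hS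
  set N := 2 * n2 (v s) with hN
  set S1 := 4 * S0 with hS1
  obtain ⟨C, hC0, hC⟩ := NL_1 hd N S1
  obtain ⟨B, hB0, hB⟩ := RD.bdd ((PG.nrm.pow 2).rmul ((powsg_rd hd (rd (v s))).add (rd (v s)).norm))
  have hB' : ∀ n : ℕ, ∀ x, th (n:ℝ) x ^ 2 * (‖v s x‖ ^ sg d + ‖v s x‖) ≤ B := fun n x => by
    refine le_trans ?_ ((le_abs_self _).trans (hB x))
    have := th_nonneg (n:ℝ) x
    have := th_le (n:ℝ) x
    gcongr
  set r := √(∫ x, ‖x‖ ^ 2 * ‖rho lam (v s) 0 x‖ ^ 2) with hr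
  have hr0 : 0 ≤ r := Real.sqrt_nonneg _
  have hNb : ∀ τ ∈ Set.Icc a b, n2 (v τ - v s : Sch d) ≤ N := fun τ hτ => by
    have h1 : n2 (v τ - v s : Sch d) ≤ n2 (v τ) + n2 (v s) := n2_sub_le (rd (v τ)) (rd (v s))
    rw [n2_const hv hs hτ hS] at h1; linarith
  have hSb : ∀ τ ∈ Set.Icc a b, S2 (v τ - v s : Sch d) ≤ S1 := fun τ hτ => by
    have h1 := S2_sub_le (v τ) (v s)
    have := hS τ hτ
    have := hS s hs
    linarith
  refine ⟨√(2 * (|lam| * (C * B * C1))) + (4 * √S1 + 2 * r), by positivity, fun t ht => ?_⟩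
  have hsub : Set.uIcc s t ⊆ Set.Icc a b := Set.uIcc_subset_Icc hs ht
  have key : ∀ n : ℕ, √(∫ x, th (n:ℝ) x ^ 2 * ‖(v t - v s : Sch d) x‖ ^ 2) ≤
      (√(2 * (|lam| * (C * B * C1))) + (4 * √S1 + 2 * r)) * |t - s| := by
    intro n
    have h := sup_trick (J := Set.uIcc s t) (f := fun τ => √(∫ x, th (n:ℝ) x ^ 2 * ‖(v τ - v s : Sch d) x‖ ^ 2)) (N := n * N)
      (c := 2 * (|lam| * (C * B * C1)) * |t - s| ^ 2)
      (K := (4 * √S1 + 2 * r) * |t - s|) (fun _ _ => Real.sqrt_nonneg _)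
      (fun τ hτ => (th_n2_le' n (rd (v τ - v s : Sch d))).trans (by have := hNb τ (hsub hτ); gcongr)) (by positivity) (by positivity)
      (fun B' hB'0 hfB τ hτ => ?_) t Set.right_mem_uIcc
    · rw [Real.sqrt_mul (by positivity), Real.sqrt_sq (abs_nonneg _)] at h
      refine h.trans (le_of_eq (by ring))
    · have hsub' : Set.uIcc s τ ⊆ Set.uIcc s t := Set.uIcc_subset_uIcc_left hτ
      have hle : |τ - s| ≤ |t - s| := Set.abs_sub_left_of_mem_uIcc hτ
      have h1 := WB hv (v s) 0 s (th_lip (n:ℝ)) (th_supp _) (t := τ) (c := 2 * (|lam| * (C * B * C1)) * |t - s| + (4 * √S1 + 2 * r) * B') (fun q hq => ?_)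
      · simp only [sub_self, zero_apply, norm_zero, ne_eq, OfNat.ofNat_ne_zero, not_false_eq_true, zero_pow, mul_zero,
          integral_zero, sub_zero, uf_zero] at h1
        have h2 := (le_abs_self _).trans h1
        rw [Real.sq_sqrt (integral_nonneg fun x => by positivity)]
        refine h2.trans ?_
        calc _ ≤ (2 * (|lam| * (C * B * C1)) * |t - s| + (4 * √S1 + 2 * r) * B') * |t - s| := by gcongr
          _ = _ := by ring
      · simp only [uf_zero]
        have hq' := hsub (hsub' hq)
        have e1 : NLf (th (n:ℝ)) (v s) (v q) ≤ C * B * n2 (v q - v s : Sch d) :=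
          hC (v s) (v q) (fun x => th (n:ℝ) x ^ 2) B (fun _ => sq_nonneg _) (hB' n) (hNb q hq') (hSb q hq')
        have e2 := hfB q (hsub' hq)
        have e3 := hC1 q hq'
        have e4 : |q - s| ≤ |t - s| := Set.abs_sub_left_of_mem_uIcc (hsub' hq)
        have e5 := hSb q hq'
        have e6 := th_n2_le n (rho_rd lam (v s) 0)
        calc _ ≤ 4 * (1 * (B' * √S1)) + 2 * (|lam| * (C * B * (C1 * |t - s|)) + B' * r) := by
              have e7 : n2 (v q - v s : Sch d) ≤ C1 * |t - s| := e3.trans (by gcongr)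
              have e8 : NLf (th (n:ℝ)) (v s) (v q) ≤ C * B * (C1 * |t - s|) := e1.trans (by gcongr)
              have e9 := NLf_nonneg (th (n:ℝ)) (v s) (v q)
              simp only [NNReal.coe_one]
              gcongr
          _ = _ := by ring
  have hlim := (th_tendsto (rd (v t - v s : Sch d))).sqrt
  exact le_of_tendsto' hlim key
end HS

namespace HS
open Complex ComplexConjugate
variable {d : ℕ}

/-- energy -/
def En (lam : ℝ) (u : Sch d) : ℝ := S2 u + V u - 2 * lam / (2 + sg d) * PP u
/-- virial current -/
def W (u : Sch d) : ℝ := -2 * ip u (J (A u))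

theorem ip_f_Q (u : Sch d) : ip (fun x => I * fN u x) (Q u) = 0 := by
  unfold ip
  refine integral_eq_zero_of_ae (ae_of_all _ fun x => ?_)
  show inner ℝ (I * fN u x) (Q u x) = 0
  rw [Q_apply]
  unfold fN
  have : inner ℝ (I * (((‖u x‖ ^ sg d : ℝ) : ℂ) * u x)) (((‖x‖ ^ 2 : ℝ) : ℂ) * u x) = 0 := by
    generalize ‖u x‖ ^ sg d = r
    generalize ‖x‖ ^ 2 = q
    rw [Complex.inner]
    simp [Complex.mul_re, Complex.mul_im]
    ring
  simpa using this

theorem Gam_Q (lam : ℝ) (u : Sch d) : 2 * Gam lam (Q u) u = W u := by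
  unfold Gam W
  rw [ip_f_Q]
  have h1 : ip u (J (Hop (Q u))) = ip u (J (Q (Hop u))) - 2 * ip u (J (A u)) := by
    rw [H_Q, map_sub, map_smul, ips', ipm']
  have h2 : ip u (J (Q (Hop u))) = - ip u (J (Hop (Q u))) := by
    have : ip u (J (Q (Hop u))) = - ip (Hop (Q (J u))) u := by
      rw [ip_H, ip_Q, ip_J, neg_neg]
    rw [this, Q_J, H_J, ip_comm]
  linarith

theorem PP_ibp (i : Fin d) (u : Sch d) : (2 + sg d) * ip (fN u) (X i (D i u)) = - PP u := by
  have hσ := sg_nonneg (d := d)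
  have hd1 : ∀ x : Ed d, HasFDerivAt (fun x => ‖u x‖ ^ (2 + sg d))
      ((((2 + sg d) * ‖u x‖ ^ (2 + sg d - 2)) • innerSL ℝ (u x)).comp (fderiv ℝ u x)) x := fun x =>
    (hasFDerivAt_norm_rpow (u x) (by linarith)).comp x (u.differentiableAt.hasFDerivAt)
  have hd2 : ∀ x : Ed d, HasFDerivAt (fun x : Ed d => x i) (EuclideanSpace.proj i : Ed d →L[ℝ] ℝ) x := fun x =>
    (EuclideanSpace.proj i : Ed d →L[ℝ] ℝ).hasFDerivAt
  have e1 : ∀ x, (fderiv ℝ (fun x => ‖u x‖ ^ (2 + sg d)) x) (stdBasis i) = (2 + sg d) * (‖u x‖ ^ sg d * inner ℝ (u x) (D i u x)) := by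
    intro x
    rw [(hd1 x).fderiv, D_apply]
    have : 2 + sg d - 2 = sg d := by ring
    simp only [this, ContinuousLinearMap.comp_apply, smul_apply, innerSL_apply_apply, smul_eq_mul, pd]
    ring
  have e2 : ∀ x : Ed d, (fderiv ℝ (fun x : Ed d => x i) x) (stdBasis i) = 1 := by
    intro x
    rw [(hd2 x).fderiv]
    simp [stdBasis]
  have r1 : RD (fun x => x i * ((2 + sg d) * (‖u x‖ ^ sg d * inner ℝ (u x) (D i u x)))) := by
    have : RD (fun x => x i * ((2 + sg d) * inner ℝ (fN u x) (D i u x))) :=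
      (PG.coord i).rmul ((PG.const _).rmul ((fN_rd (rd u)).inner (rd (D i u)).pg))
    convert this using 4
    unfold fN
    rw [inner_ofReal_mul]
  have h := integral_mul_fderiv_eq_neg_fderiv_mul_of_integrable (𝕜 := ℝ) (μ := (volume : Measure (Ed d))) (f := fun x : Ed d => x i)
    (g := fun x => ‖u x‖ ^ (2 + sg d)) (v := stdBasis i) (by simp only [e2, one_mul]; exact (PP_rd (rd u)).integrable)
    (by simp only [e1]; exact r1.integrable) ((PG.coord i).rmul (PP_rd (rd u))).integrable (fun x _ => (hd2 x).differentiableAt)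
    (fun x _ => (hd1 x).differentiableAt)
  simp only [e1, e2, one_mul] at h
  unfold PP
  rw [← h]
  unfold ip
  rw [← integral_const_mul]
  congr 1; funext x
  rw [X_apply]
  unfold fN
  have : inner ℝ (((‖u x‖ ^ sg d : ℝ) : ℂ) * u x) ((x i : ℂ) * D i u x) = x i * (‖u x‖ ^ sg d * inner ℝ (u x) (D i u x)) := by
    rw [inner_ofReal_mul, real_inner_comm, inner_ofReal_mul, real_inner_comm]; ring
  rw [this]; ring

theorem ip_sumR' {ι : Type} (s : Finset ι) (f : ι → Sch d) {g : Ed d → ℂ} (hg : RD g) :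
    ip g (∑ i ∈ s, f i : Sch d) = ∑ i ∈ s, ip g (f i) := by
  classical
  induction s using Finset.induction_on with
  | empty => simp [ip]
  | insert a s ha ih =>
    rw [Finset.sum_insert ha, Finset.sum_insert ha, ← ih]
    exact ip_add_right hg (rd _) (rd _)

theorem ip_f_A (hd : 1 ≤ d) (u : Sch d) : (2 + sg d) * ip (fN u) (A u) = 4 * PP u := by
  have hd0 : (0:ℝ) < d := by exact_mod_cast hd
  have hσ := sg_nonneg (d := d)
  have h1 : ip (fN u) u = PP u := by
    unfold ip PP
    congr 1; funext x
    unfold fN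
    rw [inner_ofReal_mul, real_inner_self_eq_norm_sq, add_comm, Real.rpow_add' (norm_nonneg _) (by linarith)]; norm_cast
  have h2 : ip (fN u) (A u) = 2 * ∑ i, ip (fN u) (X i (D i u)) + d * ip (fN u) u := by
    rw [A_eq, ← ip_sumR' _ _ (fN_rd (rd u)), ← ip_smul_right, ← ip_smul_right]
    have := ip_add_right (u := fN u) (v := ((2:ℝ) • ∑ i, X i (D i u) : Sch d)) (w := ((d:ℝ) • u : Sch d)) (fN_rd (rd u)) (rd _) (rd _)
    convert this using 2
    all_goals (congr 1)
    all_goals (funext x; rw [smul_apply'])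
  rw [h2, h1, mul_add, ← mul_assoc, mul_comm (2 + sg d) 2, mul_assoc, Finset.mul_sum]
  simp only [PP_ibp, Finset.sum_const, Finset.card_univ, Fintype.card_fin, nsmul_eq_mul]
  have : (d:ℝ) * sg d = 4 := by unfold sg; field_simp
  linear_combination PP u * this

theorem Gam_A (hd : 1 ≤ d) (lam : ℝ) (u : Sch d) : Gam lam (-(J (A u))) u = 2 * En lam u - 4 * V u := by
  have hσ := sg_nonneg (d := d)
  unfold Gam
  have h1 : ip u (J (Hop (-(J (A u))))) = ip u (Hop (A u)) := by
    rw [map_neg, map_neg, H_J, J_J, neg_neg]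
  have h2 : ip u (Hop (A u)) = - ip u (Hop (A u)) + 4 * S2 u - 4 * V u := by
    have a1 : ip u (Hop (A u)) = ip u (A (Hop u)) - 4 * ip u (Lap u) - 4 * ip u (Q u) := by
      conv_lhs => rw [H_A, ips', ips', ipm', ipm']
    have a2 : ip u (A (Hop u)) = - ip u (Hop (A u)) := by
      rw [← ip_H, ip_comm (u := Hop u), ip_A, neg_neg]
    rw [ip_Lap_self, ip_Q_self] at a1
    linarith
  have h3 : ip (fun x => I * fN u x) (-(J (A u)) : Sch d) = - ip (fN u) (A u) := by
    have : ((-(J (A u)) : Sch d) : Ed d → ℂ) = fun x => -(I * A u x) := by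
      funext x; rw [neg_apply, J_apply]
    rw [this, ip_neg_right, ip_I_left, neg_neg]
    unfold ip
    rw [← integral_neg]
    congr 1; funext x
    show inner ℝ (fN u x) (I * (I * A u x)) = _
    rw [← mul_assoc, I_mul_I, neg_one_mul, inner_neg_right]
  have h4 := ip_f_A hd u
  rw [h1, h3]
  unfold En
  have h5 : ip (fN u) (A u) = 4 * PP u / (2 + sg d) := by
    rw [eq_div_iff (by linarith)]; linarith
  have h6 : ip u (Hop (A u)) = 2 * S2 u - 2 * V u := by linarith
  rw [h5, h6]
  ring

theorem ip_JA (u w : Sch d) : ip (J (A u)) w = ip u (J (A w)) := by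
  rw [ip_J, ip_A, neg_neg, A_J]

theorem V_eq (u : Sch d) : V u = ∑ i, n2 (X i u) ^ 2 := by
  rw [← ip_Q_self, Q_eq, ip_sumR]
  refine Finset.sum_congr rfl fun i _ => ?_
  rw [← ip_X, ip_self, n2_sq]

theorem S2_eq' (u : Sch d) : S2 u = ∑ i, n2 (D i u) ^ 2 := by
  rw [S2_eq]; simp only [n2_sq]

theorem n2_J (u : Sch d) : n2 (J u) = n2 u := by
  unfold n2; simp [J_apply]

theorem ip_JA_le (u : Sch d) : |ip u (J (A u))| ≤ 2 * (√(V u) * √(S2 u)) := by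
  have h1 : ip u (J (A u)) = 2 * ∑ i, ip (X i u) (J (D i u)) := by
    rw [A_eq, map_add, map_smul, map_smul, ipa', ipm', ipm', ip_J_self, map_sum, ip_sumR]
    simp only [← X_J, ip_X]; ring
  rw [h1, abs_mul, abs_two]
  refine mul_le_mul_of_nonneg_left ?_ (by norm_num)
  calc |∑ i, ip (X i u) (J (D i u))| ≤ ∑ i, n2 (X i u) * n2 (D i u) := by
        refine (Finset.abs_sum_le_sum_abs _ _).trans (Finset.sum_le_sum fun i _ => ?_)
        have := ip_le_n2 (rd (X i u)) (rd (J (D i u)))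
        rwa [n2_J] at this
    _ ≤ √(∑ i, n2 (X i u) ^ 2) * √(∑ i, n2 (D i u) ^ 2) := Real.sum_mul_le_sqrt_mul_sqrt _ _ _
    _ = _ := by rw [V_eq, S2_eq']

theorem W_le (u : Sch d) : |W u| ≤ 4 * (√(V u) * √(S2 u)) := by
  unfold W
  rw [abs_mul]
  have := ip_JA_le u
  norm_num
  linarith

theorem V_sub (u w : Sch d) : V u - V w = 2 * ip (u - w : Sch d) (Q w) + V (u - w) := by
  rw [← ip_Q_self, ← ip_Q_self, ← ip_Q_self, map_sub, ips, ips, ips', ips', ip_comm (u := w) (w := Q u), ip_Q, ip_Q_self]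
  ring

theorem W_sub (u w : Sch d) : W u - W w = 4 * ip (u - w : Sch d) (-(J (A w)) : Sch d) - 2 * ip (u - w : Sch d) (J (A (u - w))) := by
  unfold W
  rw [map_sub, map_sub, ipn', ips, ips, ips', ips', ip_comm (u := w) (w := J (A u)), ip_JA]
  ring

theorem S2_sub (u w : Sch d) : S2 u - S2 w = - 2 * ip (u - w : Sch d) (Lap w) + S2 (u - w) := by
  have h := fun u : Sch d => (by rw [ip_Lap_self, neg_neg] : S2 u = - ip u (Lap u))
  rw [h, h, h (u - w), map_sub, ips, ips, ips', ips', ip_comm (u := w) (w := Lap u), ip_Lap]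
  ring

theorem deriv_pert {K : Set ℝ} {f g r : ℝ → ℝ} {g' s : ℝ} (hg : HasDerivWithinAt g g' K s)
    (hr : Tendsto r (nhdsWithin s K) (nhds 0)) (h : ∀ t ∈ K, |f t - f s - (g t - g s)| ≤ |t - s| * r t) :
    HasDerivWithinAt f g' K s := by
  have h1 : HasDerivWithinAt (fun t => f t - g t) 0 K s := by
    rw [hasDerivWithinAt_iff_isLittleO]
    rw [Asymptotics.isLittleO_iff]
    intro c hc
    have h2 := hr.eventually (gt_mem_nhds hc)
    filter_upwards [h2, self_mem_nhdsWithin] with t h3 ht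
    have h4 := h t ht
    simp only [smul_zero, sub_zero, Real.norm_eq_abs]
    calc |f t - g t - (f s - g s)| = |f t - f s - (g t - g s)| := by congr 1; ring
      _ ≤ |t - s| * r t := h4
      _ ≤ |t - s| * c := by gcongr
      _ = _ := mul_comm _ _
  have h5 : HasDerivWithinAt (fun t => f t - g t + g t) (0 + g') K s := h1.add hg
  simpa using h5

section bdd
variable {lam : ℝ} {v : ℝ → Sch d} {a b S0 : ℝ}

theorem PP_bdd (hd : 1 ≤ d) (hv : IsSol lam v) (hS : ∀ τ ∈ Set.Icc a b, S2 (v τ) ≤ S0) :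
    ∃ P0, 0 ≤ P0 ∧ ∀ t ∈ Set.Icc a b, PP (v t) ≤ P0 := by
  rcases lt_or_ge b a with h | h
  · exact ⟨0, le_rfl, fun t ht => absurd (ht.1.trans ht.2) (not_le.2 h)⟩
  obtain ⟨G, hG0, hG⟩ := GN hd
  have ha : a ∈ Set.Icc a b := ⟨le_rfl, h⟩
  have hn : 0 ≤ n2 (v a) := n2_nonneg
  have hS0 : 0 ≤ S0 := (S2_nonneg _).trans (hS a ha)
  refine ⟨G * n2 (v a) ^ sg d * S0, by positivity, fun t ht => (hG (v t)).trans ?_⟩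
  rw [n2_const hv ha ht hS]
  have := hS t ht
  gcongr

theorem PLc (hd : 1 ≤ d) (hv : IsSol lam v) (hS : ∀ τ ∈ Set.Icc a b, S2 (v τ) ≤ S0) (ψ : Sch d) :
    ∀ t ∈ Set.Icc a b, HasDerivWithinAt (fun t => ip (v t) ψ) (Gam lam ψ (v t)) (Set.Icc a b) t := by
  obtain ⟨P0, hP0, hP⟩ := PP_bdd hd hv hS
  intro t ht
  have ha : a ∈ Set.Icc a b := ⟨le_rfl, ht.1.trans ht.2⟩
  refine PL hv ψ (M0 := M (v a)) (fun t ht => ?_) hS hP t ht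
  exact (M_const hv ht.1 fun τ hτ => hS τ ⟨hτ.1, hτ.2.trans ht.2⟩).le

theorem abs_sub_tendsto (K : Set ℝ) (s : ℝ) : Tendsto (fun t => |t - s|) (nhdsWithin s K) (nhds 0) := by
  have : Continuous (fun t : ℝ => |t - s|) := by fun_prop
  have h := (this.tendsto s).mono_left (nhdsWithin_le_nhds (s := K))
  simpa using h

theorem V_deriv (hd : 1 ≤ d) (hv : IsSol lam v) (hS : ∀ τ ∈ Set.Icc a b, S2 (v τ) ≤ S0) {s : ℝ} (hs : s ∈ Set.Icc a b) :
    HasDerivWithinAt (fun t => V (v t)) (W (v s)) (Set.Icc a b) s := by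
  obtain ⟨C, hC0, hC⟩ := BASE2 hd hv hs hS
  have h1 := (PLc hd hv hS (Q (v s)) s hs).const_mul 2
  rw [Gam_Q] at h1
  refine deriv_pert h1 (r := fun t => C ^ 2 * |t - s|) (by simpa using (abs_sub_tendsto _ s).const_mul (C ^ 2)) fun t ht => ?_
  have h2 := V_sub (v t) (v s)
  rw [ips] at h2
  have h3 : V (v t) - V (v s) - (2 * ip (v t) (Q (v s)) - 2 * ip (v s) (Q (v s))) = V (v t - v s) := by linarith
  rw [h3, abs_of_nonneg (V_nonneg _)]
  have h4 := pow_le_pow_left₀ (Real.sqrt_nonneg _) (hC t ht) 2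
  rw [Real.sq_sqrt (V_nonneg _)] at h4
  linarith [h4]

theorem n2_sub_tendsto (hd : 1 ≤ d) (hv : IsSol lam v) (hS : ∀ τ ∈ Set.Icc a b, S2 (v τ) ≤ S0) {s : ℝ} (hs : s ∈ Set.Icc a b) :
    Tendsto (fun t => n2 (v t - v s : Sch d)) (nhdsWithin s (Set.Icc a b)) (nhds 0) := by
  obtain ⟨C, hC0, hC⟩ := BASE1 hd hv hs hS
  refine squeeze_zero' (Eventually.of_forall fun _ => n2_nonneg) (g := fun t => C * |t - s|) ?_ (by simpa using (abs_sub_tendsto _ s).const_mul C)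
  filter_upwards [self_mem_nhdsWithin] with t ht using hC t ht

theorem ip_sub_tendsto (hd : 1 ≤ d) (hv : IsSol lam v) (hS : ∀ τ ∈ Set.Icc a b, S2 (v τ) ≤ S0) {s : ℝ} (hs : s ∈ Set.Icc a b) {ψ : Ed d → ℂ} (hψ : RD ψ) :
    Tendsto (fun t => ip (v t - v s : Sch d) ψ) (nhdsWithin s (Set.Icc a b)) (nhds 0) := by
  refine squeeze_zero_norm (a := fun t => n2 (v t - v s : Sch d) * n2 ψ) (fun t => ?_) (by simpa using (n2_sub_tendsto hd hv hS hs).mul_const (n2 ψ))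
  exact ip_le_n2 (rd _) hψ

theorem S2w_le (hS : ∀ τ ∈ Set.Icc a b, S2 (v τ) ≤ S0) {s t : ℝ} (hs : s ∈ Set.Icc a b) (ht : t ∈ Set.Icc a b) :
    S2 (v t - v s) ≤ 4 * S0 := by
  have h1 := S2_sub_le (v t) (v s)
  have := hS t ht
  have := hS s hs
  linarith

theorem Vw_tendsto (hd : 1 ≤ d) (hv : IsSol lam v) (hS : ∀ τ ∈ Set.Icc a b, S2 (v τ) ≤ S0) {s : ℝ} (hs : s ∈ Set.Icc a b) :
    Tendsto (fun t => √(V (v t - v s))) (nhdsWithin s (Set.Icc a b)) (nhds 0) := by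
  obtain ⟨C, hC0, hC⟩ := BASE2 hd hv hs hS
  refine squeeze_zero' (Eventually.of_forall fun _ => Real.sqrt_nonneg _) (g := fun t => C * |t - s|) ?_ (by simpa using (abs_sub_tendsto _ s).const_mul C)
  filter_upwards [self_mem_nhdsWithin] with t ht using hC t ht

theorem W_cont (hd : 1 ≤ d) (hv : IsSol lam v) (hS : ∀ τ ∈ Set.Icc a b, S2 (v τ) ≤ S0) :
    ContinuousOn (fun t => W (v t)) (Set.Icc a b) := by
  intro s hs
  have h1 : Tendsto (fun t => W (v t) - W (v s)) (nhdsWithin s (Set.Icc a b)) (nhds 0) := by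
    have e : ∀ t, W (v t) - W (v s) = _ := fun t => W_sub (v t) (v s)
    simp only [e]
    have h2 := (ip_sub_tendsto hd hv hS hs (rd (-(J (A (v s))) : Sch d))).const_mul 4
    have h3 : Tendsto (fun t => ip (v t - v s : Sch d) (J (A (v t - v s)))) (nhdsWithin s (Set.Icc a b)) (nhds 0) := by
      refine squeeze_zero_norm' (a := fun t => 2 * (√(V (v t - v s)) * √(4 * S0))) ?_
        (by simpa using ((Vw_tendsto hd hv hS hs).mul_const (√(4 * S0))).const_mul 2)
      filter_upwards [self_mem_nhdsWithin] with t ht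
      refine (ip_JA_le _).trans ?_
      have := S2w_le hS hs ht
      gcongr
    simpa using h2.sub (h3.const_mul 2)
  have h4 := h1.add_const (W (v s))
  simpa [ContinuousWithinAt] using h4

theorem PPw_tendsto (hd : 1 ≤ d) (hv : IsSol lam v) (hS : ∀ τ ∈ Set.Icc a b, S2 (v τ) ≤ S0) {s : ℝ} (hs : s ∈ Set.Icc a b) :
    Tendsto (fun t => PP (v t - v s : Sch d)) (nhdsWithin s (Set.Icc a b)) (nhds 0) := by
  obtain ⟨G, hG0, hG⟩ := GN hd
  have h1 := (n2_sub_tendsto hd hv hS hs).rpow_const (p := sg d) (Or.inr (sg_nonneg))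
  rw [Real.zero_rpow (sg_pos hd).ne'] at h1
  have h2 := (h1.const_mul G).mul_const (4 * S0)
  rw [mul_zero, zero_mul] at h2
  refine squeeze_zero' (Eventually.of_forall fun _ => PP_nonneg _) ?_ h2
  filter_upwards [self_mem_nhdsWithin] with t ht
  refine (hG _).trans ?_
  have := S2w_le hS hs ht
  have hn : 0 ≤ n2 (v t - v s : Sch d) := n2_nonneg
  gcongr

theorem PP_cont (hd : 1 ≤ d) (hv : IsSol lam v) (hS : ∀ τ ∈ Set.Icc a b, S2 (v τ) ≤ S0) :
    ContinuousOn (fun t => PP (v t)) (Set.Icc a b) := by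
  intro s hs
  obtain ⟨C, hC0, hC⟩ := PTI d
  obtain ⟨U, hU0, hU⟩ := powsg_bdd (v s)
  have h1 : Tendsto (fun t => PP (v t) - PP (v s) - (2 + sg d) * ip (fN (v s)) (v t - v s : Sch d)) (nhdsWithin s (Set.Icc a b)) (nhds 0) := by
    refine squeeze_zero_norm (fun t => hC (v s) (v t) U hU) ?_
    simpa using ((((n2_sub_tendsto hd hv hS hs).pow 2).const_mul U).add (PPw_tendsto hd hv hS hs)).const_mul C
  have h2 := (ip_sub_tendsto hd hv hS hs (fN_rd (rd (v s)))).const_mul (2 + sg d)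
  have h3 := (h1.add h2).add_const (PP (v s))
  simp only [mul_zero, add_zero, zero_add] at h3
  refine h3.congr fun t => ?_
  rw [ip_comm (u := (v t - v s : Sch d))]; ring

theorem V_cont (hd : 1 ≤ d) (hv : IsSol lam v) (hS : ∀ τ ∈ Set.Icc a b, S2 (v τ) ≤ S0) :
    ContinuousOn (fun t => V (v t)) (Set.Icc a b) := fun _ hs => (V_deriv hd hv hS hs).continuousWithinAt

theorem S2w_tendsto (hd : 1 ≤ d) (hv : IsSol lam v) (hS : ∀ τ ∈ Set.Icc a b, S2 (v τ) ≤ S0) {e : ℝ}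
    (hE : ∀ τ ∈ Set.Icc a b, En lam (v τ) = e) {s : ℝ} (hs : s ∈ Set.Icc a b) :
    Tendsto (fun t => S2 (v t - v s)) (nhdsWithin s (Set.Icc a b)) (nhds 0) := by
  have h1 : Tendsto (fun t => (e - V (v t) + 2 * lam / (2 + sg d) * PP (v t)) - (e - V (v s) + 2 * lam / (2 + sg d) * PP (v s))
      + 2 * ip (v t - v s : Sch d) (Lap (v s))) (nhdsWithin s (Set.Icc a b)) (nhds 0) := by
    have a1 := (V_cont hd hv hS s hs)
    have a2 := (PP_cont hd hv hS s hs)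
    have a3 := (ip_sub_tendsto hd hv hS hs (rd (Lap (v s)))).const_mul 2
    have := ((((tendsto_const_nhds (x := e)).sub a1).add (a2.const_mul (2 * lam / (2 + sg d)))).sub_const (e - V (v s) + 2 * lam / (2 + sg d) * PP (v s))).add a3
    simpa using this
  refine h1.congr' ?_
  filter_upwards [self_mem_nhdsWithin] with t ht
  have e1 := hE t ht
  have e2 := hE s hs
  have e3 := S2_sub (v t) (v s)
  unfold En at e1 e2
  linarith

theorem W_deriv (hd : 1 ≤ d) (hv : IsSol lam v) (hS : ∀ τ ∈ Set.Icc a b, S2 (v τ) ≤ S0) {e : ℝ}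
    (hE : ∀ τ ∈ Set.Icc a b, En lam (v τ) = e) {s : ℝ} (hs : s ∈ Set.Icc a b) :
    HasDerivWithinAt (fun t => W (v t)) (8 * e - 16 * V (v s)) (Set.Icc a b) s := by
  obtain ⟨C, hC0, hC⟩ := BASE2 hd hv hs hS
  have h1 := (PLc hd hv hS (-(J (A (v s)))) s hs).const_mul 4
  rw [Gam_A hd, hE s hs, (by ring : 4 * (2 * e - 4 * V (v s)) = 8 * e - 16 * V (v s))] at h1
  have h0 := (S2w_tendsto hd hv hS hE hs).sqrt
  rw [Real.sqrt_zero] at h0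
  refine deriv_pert h1 (r := fun t => 4 * C * √(S2 (v t - v s))) (by simpa using h0.const_mul (4 * C)) fun t ht => ?_
  have h2 := W_sub (v t) (v s)
  rw [ips] at h2
  have h3 : W (v t) - W (v s) - (4 * ip (v t) (-(J (A (v s))) : Sch d) - 4 * ip (v s) (-(J (A (v s))) : Sch d)) = -2 * ip (v t - v s : Sch d) (J (A (v t - v s))) := by linarith
  rw [h3, abs_mul, abs_neg, abs_two]
  have h4 := ip_JA_le (v t - v s)
  have h5 : √(V (v t - v s)) * √(S2 (v t - v s)) ≤ C * |t - s| * √(S2 (v t - v s)) := by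
    have := hC t ht; gcongr
  linarith
end bdd
end HS

namespace HS
open Complex ComplexConjugate
variable {d : ℕ} {lam : ℝ} {v : ℝ → Sch d} {a b : ℝ}

theorem IsSol.cont (hv : IsSol lam v) : Continuous (fun p : ℝ × Ed d => v p.1 p.2) := hv.smooth.continuous

theorem coef_le (d : ℕ) (lam : ℝ) : |2 * lam / (2 + sg d)| ≤ |lam| := by
  have hσ := sg_nonneg (d := d)
  rw [abs_div, abs_mul, abs_two, abs_of_nonneg (by linarith : 0 ≤ 2 + sg d), div_le_iff₀ (by linarith)]
  nlinarith [abs_nonneg lam]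

theorem S2_of_PP (lam : ℝ) (u : Sch d) {C ε : ℝ} (hε : |lam| * ε ≤ 1/2) (h : PP u ≤ ε * S2 u + C) :
    S2 u ≤ 2 * (En lam u - V u) + 2 * |lam| * C := by
  have h1 : 2 * lam / (2 + sg d) * PP u ≤ |lam| * PP u :=
    (le_abs_self _).trans (by rw [abs_mul, abs_of_nonneg (PP_nonneg u)]; exact mul_le_mul_of_nonneg_right (coef_le d lam) (PP_nonneg u))
  have h2 : |lam| * PP u ≤ |lam| * (ε * S2 u + C) := mul_le_mul_of_nonneg_left h (abs_nonneg _)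
  have h3 : |lam| * ε * S2 u ≤ 1/2 * S2 u := mul_le_mul_of_nonneg_right hε (S2_nonneg u)
  have : En lam u = S2 u + V u - 2 * lam / (2 + sg d) * PP u := rfl
  nlinarith

theorem TIGHTE (hd : 1 ≤ d) (lam : ℝ) (hv : Continuous (fun p : ℝ × Ed d => v p.1 p.2)) (a b Vm : ℝ) :
    ∃ C, 0 ≤ C ∧ ∀ t ∈ Set.Icc a b, V (v t) ≤ Vm → S2 (v t) ≤ 2 * (En lam (v t) - V (v t)) + C := by
  have hl := abs_nonneg lam
  obtain ⟨C, hC0, hC⟩ := TIGHT hd hv a b Vm (ε := 1 / (2 * (|lam| + 1))) (by positivity)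
  refine ⟨2 * |lam| * C, by positivity, fun t ht hV => S2_of_PP lam _ ?_ (hC t ht hV)⟩
  rw [mul_one_div, div_le_iff₀ (by positivity)]
  linarith

/-- second order Taylor upper bound -/
theorem taylor_up {f f' f'' : ℝ → ℝ} {k : ℝ} (h1 : ∀ t ∈ Set.Ioo a b, HasDerivAt f (f' t) t)
    (h2 : ∀ t ∈ Set.Ioo a b, HasDerivAt f' (f'' t) t) (h3 : ∀ t ∈ Set.Ioo a b, f'' t ≤ 2 * k) {c t : ℝ} (hc : c ∈ Set.Ioo a b)
    (ht : t ∈ Set.Ioo a b) : f t ≤ f c + f' c * (t - c) + k * (t - c) ^ 2 := by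
  have hanti : AntitoneOn (fun t => f' t - 2 * k * (t - c)) (Set.Ioo a b) := by
    have hh : ∀ t ∈ Set.Ioo a b, HasDerivAt (fun t => f' t - 2 * k * (t - c)) (f'' t - 2 * k) t := fun t ht => by
      have : HasDerivAt (fun t => f' t - 2 * k * (t - c)) (f'' t - 2 * k * 1) t :=
        (h2 t ht).sub (((hasDerivAt_id t).sub_const c).const_mul (2 * k))
      rwa [mul_one] at this
    refine antitoneOn_of_deriv_nonpos (convex_Ioo a b) (fun t ht => (hh t ht).continuousAt.continuousWithinAt) ?_ ?_
    · rw [interior_Ioo]; exact fun t ht => (hh t ht).differentiableAt.differentiableWithinAt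
    · rw [interior_Ioo]; intro t ht; rw [(hh t ht).deriv]; linarith [h3 t ht]
  have hg : ∀ t ∈ Set.Ioo a b, HasDerivAt (fun t => f t - k * (t - c) ^ 2) (f' t - 2 * k * (t - c)) t := fun t ht => by
    have h5 : HasDerivAt (fun t => (t - c) ^ 2) (2 * (t - c)) t := by
      have h6 : HasDerivAt (fun t => (t - c) ^ 2) (((2:ℕ):ℝ) * (t - c) ^ (2 - 1) * 1) t := ((hasDerivAt_id t).sub_const c).pow 2
      norm_num at h6
      exact h6
    have : HasDerivAt (fun t => f t - k * (t - c) ^ 2) (f' t - k * (2 * (t - c))) t :=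
      (h1 t ht).sub (h5.const_mul k)
    have e1 : k * (2 * (t - c)) = 2 * k * (t - c) := by ring
    rwa [e1] at this
  rcases lt_trichotomy c t with h | h | h
  · obtain ⟨ξ, hξ, h4⟩ := exists_hasDerivAt_eq_slope (fun t => f t - k * (t - c) ^ 2) (fun t => f' t - 2 * k * (t - c)) h
      (fun s hs => (hg s ⟨hc.1.trans_le hs.1, hs.2.trans_lt ht.2⟩).continuousAt.continuousWithinAt)
      (fun s hs => hg s ⟨hc.1.trans hs.1, hs.2.trans ht.2⟩)
    have h5 := hanti hc ⟨hc.1.trans hξ.1, hξ.2.trans ht.2⟩ hξ.1.le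
    beta_reduce at h4 h5
    rw [h4, div_le_iff₀ (by linarith)] at h5
    nlinarith
  · subst h; simp
  · obtain ⟨ξ, hξ, h4⟩ := exists_hasDerivAt_eq_slope (fun t => f t - k * (t - c) ^ 2) (fun t => f' t - 2 * k * (t - c)) h
      (fun s hs => (hg s ⟨ht.1.trans_le hs.1, hs.2.trans_lt hc.2⟩).continuousAt.continuousWithinAt)
      (fun s hs => hg s ⟨ht.1.trans hs.1, hs.2.trans hc.2⟩)
    have h5 := hanti ⟨ht.1.trans hξ.1, hξ.2.trans hc.2⟩ hc hξ.2.le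
    beta_reduce at h4 h5
    rw [h4, le_div_iff₀ (by linarith)] at h5
    nlinarith

theorem Icc_nhds_of_Ioo {t : ℝ} (ht : t ∈ Set.Ioo a b) : ∃ a' b', a < a' ∧ b' < b ∧ t ∈ Set.Ioo a' b' :=
  ⟨(a + t) / 2, (t + b) / 2, by linarith [ht.1], by linarith [ht.2], by constructor <;> linarith [ht.1, ht.2]⟩

theorem V_derivI (hd : 1 ≤ d) (hv : IsSol lam v)
    (hS : ∀ a' b', a < a' → b' < b → ∃ S0, ∀ τ ∈ Set.Icc a' b', S2 (v τ) ≤ S0) {t : ℝ} (ht : t ∈ Set.Ioo a b) :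
    HasDerivAt (fun t => V (v t)) (W (v t)) t := by
  obtain ⟨a', b', h1, h2, h3⟩ := Icc_nhds_of_Ioo ht
  obtain ⟨S0, hS0⟩ := hS a' b' h1 h2
  exact (V_deriv hd hv hS0 (Set.Ioo_subset_Icc_self h3)).hasDerivAt (Icc_mem_nhds h3.1 h3.2)

theorem W_derivI (hd : 1 ≤ d) (hv : IsSol lam v)
    (hS : ∀ a' b', a < a' → b' < b → ∃ S0, ∀ τ ∈ Set.Icc a' b', S2 (v τ) ≤ S0) {e : ℝ} (hE : ∀ τ ∈ Set.Ioo a b, En lam (v τ) = e)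
    {t : ℝ} (ht : t ∈ Set.Ioo a b) :
    HasDerivAt (fun t => W (v t)) (8 * e - 16 * V (v t)) t := by
  obtain ⟨a', b', h1, h2, h3⟩ := Icc_nhds_of_Ioo ht
  obtain ⟨S0, hS0⟩ := hS a' b' h1 h2
  exact (W_deriv hd hv hS0 (fun τ hτ => hE τ ⟨h1.trans_le hτ.1, hτ.2.trans_lt h2⟩) (Set.Ioo_subset_Icc_self h3)).hasDerivAt (Icc_mem_nhds h3.1 h3.2)

theorem GLB (hd : 1 ≤ d) (hv : IsSol lam v) (hab : a < b)
    (hS : ∀ a' b', a < a' → b' < b → ∃ S0, ∀ τ ∈ Set.Icc a' b', S2 (v τ) ≤ S0) {e : ℝ} (hE : ∀ τ ∈ Set.Ioo a b, En lam (v τ) = e) :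
    ∃ S0, ∀ τ ∈ Set.Icc a b, S2 (v τ) ≤ S0 := by
  set c := (a + b) / 2 with hc
  have hcm : c ∈ Set.Ioo a b := by constructor <;> linarith
  have hV : ∀ t ∈ Set.Ioo a b, V (v t) ≤ V (v c) + |W (v c)| * (b - a) + 4 * |e| * (b - a) ^ 2 := by
    intro t ht
    have h := taylor_up (k := 4 * e) (fun t ht => V_derivI hd hv hS ht) (fun t ht => W_derivI hd hv hS hE ht)
      (fun t ht => by linarith [V_nonneg (v t)]) hcm ht
    have h1 : |t - c| ≤ b - a := abs_le.2 ⟨by linarith [ht.1, hcm.2], by linarith [ht.2, hcm.1]⟩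
    have h2 : W (v c) * (t - c) ≤ |W (v c)| * (b - a) :=
      (le_abs_self _).trans (by rw [abs_mul]; gcongr)
    have h3 : 4 * e * (t - c) ^ 2 ≤ 4 * |e| * (b - a) ^ 2 := by
      have := le_abs_self e
      have h4 : (t - c) ^ 2 ≤ (b - a) ^ 2 := sq_le_sq' (by linarith [abs_le.1 h1]) (abs_le.1 h1).2
      have h5 : 4 * e * (t - c) ^ 2 ≤ 4 * |e| * (t - c) ^ 2 := by gcongr
      refine h5.trans (by gcongr)
    linarith
  obtain ⟨C, hC0, hC⟩ := TIGHTE hd lam hv.cont a b (V (v c) + |W (v c)| * (b - a) + 4 * |e| * (b - a) ^ 2)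
  refine ⟨max (2 * e + C) (max (S2 (v a)) (S2 (v b))), fun t ht => ?_⟩
  rcases eq_or_lt_of_le ht.1 with h | h
  · rw [← h]; simp
  rcases eq_or_lt_of_le ht.2 with h' | h'
  · rw [h']; simp
  refine le_max_of_le_left ?_
  have := hC t ht (hV t ⟨h, h'⟩)
  rw [hE t ⟨h, h'⟩] at this
  linarith [V_nonneg (v t)]

end HS

namespace HS
open Complex ComplexConjugate
variable {d : ℕ}

/-- mollified power -/
def qf (u : Sch d) (ζ : ℝ) (x : Ed d) : ℝ := (1 + ‖ζ • u x‖ ^ 2) ^ (sg d / 2)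

theorem qf_contDiff (u : Sch d) (ζ : ℝ) : ContDiff ℝ (⊤ : ℕ∞) (qf u ζ) := by
  have h := (Function.hasTemperateGrowth_one_add_norm_sq_rpow ℂ (sg d / 2)).1
  exact h.comp ((u.smooth _).const_smul ζ)

theorem it_bdd (u : Sch d) (n : ℕ) : ∃ K, 1 ≤ K ∧ ∀ i ≤ n, ∀ x, ‖iteratedFDeriv ℝ i u x‖ ≤ K := by
  induction n with
  | zero =>
    obtain ⟨C, hC0, hC⟩ := u.decay 0 0
    refine ⟨max C 1, le_max_right _ _, fun i hi x => ?_⟩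
    have := hC x
    rw [pow_zero, one_mul] at this
    rw [Nat.le_zero.1 hi]; exact this.trans (le_max_left _ _)
  | succ n ih =>
    obtain ⟨K, hK1, hK⟩ := ih
    obtain ⟨C, hC0, hC⟩ := u.decay 0 (n+1)
    refine ⟨max C K, hK1.trans (le_max_right _ _), fun i hi x => ?_⟩
    rcases Nat.lt_or_ge n i with h | h
    · have h' : i = n + 1 := by omega
      have := hC x
      rw [pow_zero, one_mul] at this
      rw [h']; exact this.trans (le_max_left _ _)
    · exact (hK i h x).trans (le_max_right _ _)

theorem qf_bd (u : Sch d) (n : ℕ) : ∃ C : ℝ, ∃ m : ℕ, 0 ≤ C ∧ ∀ ζ : ℝ, 1 ≤ ζ → ∀ i ≤ n, ∀ x,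
    ‖iteratedFDeriv ℝ i (qf u ζ) x‖ ≤ C * ζ ^ m := by
  have hT := Function.hasTemperateGrowth_one_add_norm_sq_rpow ℂ (sg d / 2)
  obtain ⟨k, C, hC0, hC⟩ := hT.norm_iteratedFDeriv_le_uniform n
  obtain ⟨K, hK1, hK⟩ := it_bdd u n
  refine ⟨n.factorial * (C * (2 * K) ^ k) * K ^ n, k + n, by positivity, fun ζ hζ i hi x => ?_⟩
  have hζ0 : 0 < ζ := by linarith
  have hKζ : 1 ≤ K * ζ := one_le_mul_of_one_le_of_one_le hK1 hζ
  have hs : ContDiff ℝ (⊤ : ℕ∞) (fun x => ζ • u x) := (u.smooth _).const_smul ζ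
  have hu0 : ‖u x‖ ≤ K := by
    have := hK 0 (Nat.zero_le _) x
    rwa [norm_iteratedFDeriv_zero] at this
  have h := norm_iteratedFDeriv_comp_le (n := i) (N := (⊤ : ℕ∞)) hT.1 hs (by exact_mod_cast le_top) x (C := C * (2 * K * ζ) ^ k) (D := K * ζ) (fun j hj => ?_) (fun j hj1 hj => ?_)
  · refine h.trans ?_
    have h1 : (i.factorial : ℝ) ≤ n.factorial := by exact_mod_cast Nat.factorial_le hi
    have h2 : (K * ζ) ^ i ≤ (K * ζ) ^ n := pow_le_pow_right₀ hKζ hi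
    calc (i.factorial : ℝ) * (C * (2 * K * ζ) ^ k) * (K * ζ) ^ i ≤ n.factorial * (C * (2 * K * ζ) ^ k) * (K * ζ) ^ n := by gcongr
      _ = _ := by rw [mul_pow (2 * K) ζ, mul_pow K ζ, pow_add]; ring
  · refine (hC j (hj.trans hi) _).trans ?_
    gcongr
    rw [norm_smul, Real.norm_of_nonneg hζ0.le]
    nlinarith
  · have e : iteratedFDeriv ℝ j (fun x => ζ • u x) x = ζ • iteratedFDeriv ℝ j u x := by
      exact iteratedFDeriv_const_smul_apply' (𝕜 := ℝ) ((u.smooth j).contDiffAt)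
    rw [e, norm_smul, Real.norm_of_nonneg hζ0.le]
    calc ζ * ‖iteratedFDeriv ℝ j u x‖ ≤ ζ * K := by gcongr; exact hK j (hj.trans hi) x
      _ = (K * ζ) ^ 1 := by ring
      _ ≤ _ := pow_le_pow_right₀ hKζ hj1

/-- mollified nonlinearity -/
def gf (u : Sch d) (ζ : ℝ) (x : Ed d) : ℂ := (ζ ^ (-sg d) * qf u ζ x) • u x

theorem gf_contDiff (u : Sch d) (ζ : ℝ) : ContDiff ℝ (⊤ : ℕ∞) (gf u ζ) :=
  (contDiff_const.mul (qf_contDiff u ζ)).smul (u.smooth _)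

theorem gf_bd (u : Sch d) (k n : ℕ) : ∃ C : ℝ, ∃ m : ℕ, 0 ≤ C ∧ ∀ ζ : ℝ, 1 ≤ ζ → ∀ x,
    ‖x‖ ^ k * ‖iteratedFDeriv ℝ n (gf u ζ) x‖ ≤ C * ζ ^ m := by
  obtain ⟨C, m, hC0, hC⟩ := qf_bd u n
  choose K hK0 hK using fun j => u.decay k j
  refine ⟨∑ i ∈ Finset.range (n + 1), (n.choose i : ℝ) * C * K (n - i), m,
    Finset.sum_nonneg fun i _ => by have := (hK0 (n - i)).le; positivity, fun ζ hζ x => ?_⟩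
  have hζ0 : 0 < ζ := by linarith
  have e : gf u ζ = ζ ^ (-sg d) • fun x => qf u ζ x • u x := by
    funext x; simp [gf, mul_smul]
  have hsm : ContDiff ℝ (⊤ : ℕ∞) fun x => qf u ζ x • u x := (qf_contDiff u ζ).smul (u.smooth _)
  have hz : ζ ^ (-sg d) ≤ 1 := Real.rpow_le_one_of_one_le_of_nonpos hζ (by linarith [sg_nonneg (d := d)])
  have hz0 : 0 ≤ ζ ^ (-sg d) := by positivity
  have h1 : ‖iteratedFDeriv ℝ n (gf u ζ) x‖ ≤ ‖iteratedFDeriv ℝ n (fun x => qf u ζ x • u x) x‖ := by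
    rw [e, iteratedFDeriv_const_smul_apply ((hsm.of_le (by exact_mod_cast le_top)).contDiffAt), norm_smul, Real.norm_of_nonneg hz0]
    exact mul_le_of_le_one_left (norm_nonneg _) hz
  have h2 := norm_iteratedFDeriv_smul_le (qf_contDiff u ζ) (u.smooth _) x (n := n) (by exact_mod_cast le_top)
  calc ‖x‖ ^ k * ‖iteratedFDeriv ℝ n (gf u ζ) x‖ ≤ ‖x‖ ^ k * ∑ i ∈ Finset.range (n + 1),
      (n.choose i : ℝ) * ‖iteratedFDeriv ℝ i (qf u ζ) x‖ * ‖iteratedFDeriv ℝ (n - i) u x‖ := by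
        gcongr; exact h1.trans h2
    _ ≤ _ := by
      rw [Finset.mul_sum, Finset.sum_mul]
      refine Finset.sum_le_sum fun i hi => ?_
      have a1 := hC ζ hζ i (by have := Finset.mem_range.1 hi; omega) x
      have a2 := hK (n - i) x
      calc ‖x‖ ^ k * ((n.choose i : ℝ) * ‖iteratedFDeriv ℝ i (qf u ζ) x‖ * ‖iteratedFDeriv ℝ (n - i) u x‖)
          = (n.choose i : ℝ) * ‖iteratedFDeriv ℝ i (qf u ζ) x‖ * (‖x‖ ^ k * ‖iteratedFDeriv ℝ (n - i) u x‖) := by ring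
        _ ≤ (n.choose i : ℝ) * (C * ζ ^ m) * K (n - i) := by gcongr
        _ = _ := by ring

open Classical in
/-- mollified nonlinearity as a Schwartz function -/
def gS (u : Sch d) (ζ : ℝ) : Sch d :=
  if h : 1 ≤ ζ then
    { toFun := gf u ζ
      smooth' := gf_contDiff u ζ
      decay' := fun k n => by
        obtain ⟨C, m, _, hC⟩ := gf_bd u k n
        exact ⟨C * ζ ^ m, fun x => hC ζ h x⟩ }
  else 0

theorem gS_coe (u : Sch d) {ζ : ℝ} (h : 1 ≤ ζ) : (gS u ζ : Ed d → ℂ) = gf u ζ := by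
  unfold gS; rw [dif_pos h]; rfl

theorem gS_semi (u : Sch d) (s : Finset (ℕ × ℕ)) : ∃ C : ℝ, ∃ m : ℕ, 0 ≤ C ∧ ∀ ζ : ℝ, 1 ≤ ζ →
    (s.sup (schwartzSeminormFamily ℝ (Ed d) ℂ)) (gS u ζ) ≤ C * ζ ^ m := by
  classical
  induction s using Finset.induction_on with
  | empty => exact ⟨0, 0, le_rfl, fun ζ hζ => by simp⟩
  | insert p s hp ih =>
    obtain ⟨C, m, hC0, hC⟩ := ih
    obtain ⟨C', m', hC0', hC'⟩ := gf_bd u p.1 p.2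
    refine ⟨C + C', m + m', by positivity, fun ζ hζ => ?_⟩
    have hm : ζ ^ m ≤ ζ ^ (m + m') := pow_le_pow_right₀ hζ (by omega)
    have hm' : ζ ^ m' ≤ ζ ^ (m + m') := pow_le_pow_right₀ hζ (by omega)
    have hp0 : 0 ≤ ζ ^ (m + m') := by positivity
    rw [Finset.sup_insert, Seminorm.sup_apply]
    refine max_le ?_ ?_
    · refine (SchwartzMap.seminorm_le_bound ℝ p.1 p.2 _ (M := C' * ζ ^ m') (by positivity) fun x => ?_).trans ?_
      · rw [gS_coe u hζ]; exact hC' ζ hζ x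
      · nlinarith
    · exact (hC ζ hζ).trans (by nlinarith)

theorem Sch_bd (d : ℕ) : ∃ C : ℝ, 0 ≤ C ∧ ∃ m : ℕ × ℕ, ∀ u : Sch d, (∀ x, ‖u x‖ ≤ C * ((Finset.Iic m).sup (schwartzSeminormFamily ℝ (Ed d) ℂ)) u) ∧
    n2 u ≤ C * ((Finset.Iic m).sup (schwartzSeminormFamily ℝ (Ed d) ℂ)) u := by
  have hi : Integrable (fun x : Ed d => (1 + ‖x‖) ^ (-((d:ℝ) + 1))) :=
    integrable_one_add_norm (by simp)
  set Z := ∫ x : Ed d, (1 + ‖x‖) ^ (-((d:ℝ) + 1)) with hZ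
  have hZ0 : 0 ≤ Z := integral_nonneg fun x => by positivity
  refine ⟨2 ^ (d + 1) * (1 + √Z), by positivity, (d + 1, 0), fun u => ?_⟩
  set q := ((Finset.Iic (d + 1, 0)).sup (schwartzSeminormFamily ℝ (Ed d) ℂ)) u with hq
  have hq0 : 0 ≤ q := apply_nonneg _ _
  have h1 : ∀ x, (1 + ‖x‖) ^ (d + 1) * ‖u x‖ ≤ 2 ^ (d + 1) * q := fun x => by
    have := SchwartzMap.one_add_le_sup_seminorm_apply (𝕜 := ℝ) (m := (d + 1, 0)) (k := d + 1) (n := 0) le_rfl le_rfl u x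
    rw [norm_iteratedFDeriv_zero] at this
    exact this
  have h2 : ∀ x, ‖u x‖ ≤ 2 ^ (d + 1) * q := fun x => by
    refine le_trans ?_ (h1 x)
    exact le_mul_of_one_le_left (norm_nonneg _) (one_le_pow₀ (by linarith [norm_nonneg x]))
  have hs : 0 ≤ √Z := Real.sqrt_nonneg Z
  have hp : (0:ℝ) ≤ 2 ^ (d + 1) * q := by positivity
  constructor
  · intro x
    refine (h2 x).trans ?_
    nlinarith
  · have h3 : ∀ x, ‖u x‖ ^ 2 ≤ (2 ^ (d + 1) * q) ^ 2 * (1 + ‖x‖) ^ (-((d:ℝ) + 1)) := fun x => by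
      have hx : 0 < 1 + ‖x‖ := by positivity
      have hx1 : 1 ≤ 1 + ‖x‖ := by linarith [norm_nonneg x]
      rw [Real.rpow_neg hx.le, ← div_eq_mul_inv, le_div_iff₀ (by positivity)]
      have e : (1 + ‖x‖) ^ ((d:ℝ) + 1) = (1 + ‖x‖) ^ (d + 1) := by
        rw [← Real.rpow_natCast]; push_cast; rfl
      rw [e]
      calc ‖u x‖ ^ 2 * (1 + ‖x‖) ^ (d + 1) = ‖u x‖ * ((1 + ‖x‖) ^ (d + 1) * ‖u x‖) := by ring
        _ ≤ (2 ^ (d + 1) * q) * (2 ^ (d + 1) * q) := by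
          exact mul_le_mul (h2 x) (h1 x) (by positivity) hp
        _ = _ := by ring
    have h4 : ∫ x, ‖u x‖ ^ 2 ≤ (2 ^ (d + 1) * q) ^ 2 * Z := by
      rw [hZ, ← integral_const_mul]
      exact integral_mono (rd u).sq_int (hi.const_mul _) h3
    have h5 : n2 u ≤ 2 ^ (d + 1) * q * √Z := by
      unfold n2
      refine (Real.sqrt_le_sqrt h4).trans ?_
      rw [Real.sqrt_mul (by positivity), Real.sqrt_sq hp]
    nlinarith

theorem gS_bd (u : Sch d) (T : Sch d →L[ℝ] Sch d) : ∃ C : ℝ, ∃ m : ℕ, 0 ≤ C ∧ ∀ ζ : ℝ, 1 ≤ ζ →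
    (∀ x, ‖T (gS u ζ) x‖ ≤ C * ζ ^ m) ∧ n2 (T (gS u ζ)) ≤ C * ζ ^ m := by
  obtain ⟨C1, hC10, m1, h1⟩ := Sch_bd d
  set q : Seminorm ℝ (Sch d) := ((Finset.Iic m1).sup (schwartzSeminormFamily ℝ (Ed d) ℂ)) with hq
  have hqc : Continuous q := by
    have h0 := (schwartz_withSeminorms ℝ (Ed d) ℂ)
    have : ∀ s : Finset (ℕ × ℕ), Continuous (s.sup (schwartzSeminormFamily ℝ (Ed d) ℂ) : Seminorm ℝ (Sch d)) := by
      classical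
      intro s
      induction s using Finset.induction_on with
      | empty => exact (continuous_const : Continuous fun _ : Sch d => (0:ℝ))
      | insert p s hp ih =>
        rw [Finset.sup_insert]
        exact (h0.continuous_seminorm p).max ih
    exact this _
  obtain ⟨s, C2, -, h2⟩ := Seminorm.bound_of_continuous (schwartz_withSeminorms ℝ (Ed d) ℂ) (q.comp T.toLinearMap)
    (hqc.comp T.continuous)
  obtain ⟨C3, m, hC30, h3⟩ := gS_semi u s
  have key : ∀ ζ : ℝ, 1 ≤ ζ → C1 * q (T (gS u ζ)) ≤ C1 * (C2 * C3) * ζ ^ m := fun ζ hζ => by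
    have a1 := h2 (gS u ζ)
    have a2 := h3 ζ hζ
    have a3 : q (T (gS u ζ)) ≤ C2 * (s.sup (schwartzSeminormFamily ℝ (Ed d) ℂ)) (gS u ζ) := a1
    have a4 : (C2:ℝ) * (s.sup (schwartzSeminormFamily ℝ (Ed d) ℂ)) (gS u ζ) ≤ C2 * (C3 * ζ ^ m) :=
      mul_le_mul_of_nonneg_left a2 C2.2
    calc C1 * q (T (gS u ζ)) ≤ C1 * (C2 * (C3 * ζ ^ m)) := mul_le_mul_of_nonneg_left (a3.trans a4) hC10
      _ = _ := by ring
  refine ⟨C1 * (C2 * C3), m, by have := C2.2; positivity, fun ζ hζ => ⟨fun x => ?_, ?_⟩⟩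
  · exact ((h1 _).1 x).trans (key ζ hζ)
  · exact ((h1 _).2).trans (key ζ hζ)

/-- rate -/
def dl (d : ℕ) : ℝ := min (sg d) 1

theorem dl_pos (hd : 1 ≤ d) : 0 < dl d := lt_min (sg_pos hd) one_pos
theorem dl_le_one : dl d ≤ 1 := min_le_right _ _

theorem rpow_add_sub_le {σ a η A : ℝ} (hσ : 0 ≤ σ) (ha : 0 ≤ a) (haA : a ≤ A) (hη : 0 < η) (hη1 : η ≤ 1) :
    (a + η) ^ σ - a ^ σ ≤ (1 + σ * (A + 1) ^ σ) * η ^ min σ 1 := by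
  rcases le_total σ 1 with h | h
  · rw [min_eq_left h]
    have h1 := Real.rpow_add_le_add_rpow ha hη.le hσ h
    have h2 : 0 ≤ σ * (A + 1) ^ σ * η ^ σ := by
      have : 0 ≤ A + 1 := by linarith
      positivity
    linarith
  · rw [min_eq_right h, Real.rpow_one]
    have h1 := nlA (A := a + η) (B := a) (σ := σ - 1) ha (by linarith) (by linarith)
    have e : 1 + (σ - 1) = σ := by ring
    rw [e, add_sub_cancel_left] at h1
    have h2 : (a + η) ^ (σ - 1) ≤ (A + 1) ^ σ := by
      calc (a + η) ^ (σ - 1) ≤ (A + 1) ^ (σ - 1) := Real.rpow_le_rpow (by linarith) (by linarith) (by linarith)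
        _ ≤ _ := Real.rpow_le_rpow_of_exponent_le (by linarith) (by linarith)
    have h3 : σ * (a + η) ^ (σ - 1) * η ≤ σ * (A + 1) ^ σ * η := by gcongr
    linarith

theorem gS_sub (u : Sch d) : ∃ C : ℝ, 0 ≤ C ∧ ∀ ζ : ℝ, 1 ≤ ζ → ∀ x, ‖gS u ζ x - fN u x‖ ≤ C * ζ ^ (-dl d) * ‖u x‖ := by
  obtain ⟨A, hA0, hA⟩ := (rd u).bdd
  have hσ := sg_nonneg (d := d)
  refine ⟨1 + sg d * (A + 1) ^ sg d, by positivity, fun ζ hζ x => ?_⟩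
  have hζ0 : 0 < ζ := by linarith
  rw [gS_coe u hζ]
  have e0 : ζ ^ (-sg d) * qf u ζ x = ((ζ⁻¹) ^ 2 + ‖u x‖ ^ 2) ^ (sg d / 2) := by
    unfold qf
    have : (ζ⁻¹) ^ 2 + ‖u x‖ ^ 2 = ζ⁻¹ ^ 2 * (1 + ‖ζ • u x‖ ^ 2) := by
      rw [norm_smul, Real.norm_of_nonneg hζ0.le]; field_simp
    rw [this, Real.mul_rpow (by positivity) (by positivity)]
    congr 1
    rw [← Real.rpow_natCast, ← Real.rpow_mul (by positivity), Real.inv_rpow hζ0.le, ← Real.rpow_neg hζ0.le]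
    congr 1; push_cast; ring
  have e1 : gf u ζ x - fN u x = ((ζ⁻¹ ^ 2 + ‖u x‖ ^ 2) ^ (sg d / 2) - ‖u x‖ ^ sg d) • u x := by
    unfold gf fN
    rw [e0, sub_smul, Complex.real_smul, Complex.real_smul]
  rw [e1, norm_smul]
  refine mul_le_mul_of_nonneg_right ?_ (norm_nonneg _)
  have hi : 0 < ζ⁻¹ := by positivity
  have e2 : ∀ y : ℝ, 0 ≤ y → (y ^ 2) ^ (sg d / 2) = y ^ sg d := fun y hy => by
    rw [← Real.rpow_natCast, ← Real.rpow_mul hy]; congr 1; push_cast; ring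
  have h1 : ‖u x‖ ^ sg d ≤ (ζ⁻¹ ^ 2 + ‖u x‖ ^ 2) ^ (sg d / 2) := by
    rw [← e2 _ (norm_nonneg _)]
    exact Real.rpow_le_rpow (by positivity) (by nlinarith) (by linarith)
  have h2 : (ζ⁻¹ ^ 2 + ‖u x‖ ^ 2) ^ (sg d / 2) ≤ (‖u x‖ + ζ⁻¹) ^ sg d := by
    rw [← e2 (‖u x‖ + ζ⁻¹) (by positivity)]
    exact Real.rpow_le_rpow (by positivity) (by nlinarith [norm_nonneg (u x), mul_nonneg (norm_nonneg (u x)) hi.le]) (by linarith)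
  have h3 := rpow_add_sub_le (A := A) hσ (norm_nonneg (u x)) (hA x) hi (inv_le_one_of_one_le₀ hζ)
  rw [Real.norm_of_nonneg (by linarith)]
  have e3 : ζ⁻¹ ^ min (sg d) 1 = ζ ^ (-dl d) := by
    unfold dl; rw [Real.inv_rpow hζ0.le, Real.rpow_neg hζ0.le]
  rw [e3] at h3
  linarith

end HS

namespace HS
open Complex ComplexConjugate
variable {d : ℕ} {lam : ℝ} {v : ℝ → Sch d} {a b S0 : ℝ}

theorem RD.cmul {u : Ed d → ℂ} (hu : RD u) (c : ℂ) : RD (fun x => c * u x) := (PG.const c).rmul hu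

theorem gf_rd (u : Sch d) (ζ : ℝ) : RD (fun x => gS u ζ x - fN u x) := (rd _).sub (fN_rd (rd u))

theorem gS_n2 (u : Sch d) : ∃ C : ℝ, 0 ≤ C ∧ ∀ ζ : ℝ, 1 ≤ ζ → n2 (fun x => gS u ζ x - fN u x) ≤ C * ζ ^ (-dl d) := by
  obtain ⟨C, hC0, hC⟩ := gS_sub u
  refine ⟨C * n2 u, mul_nonneg hC0 n2_nonneg, fun ζ hζ => ?_⟩
  have h := n2_mono (u := fun x => gS u ζ x - fN u x) (w := fun x => ((C * ζ ^ (-dl d) : ℝ) : ℂ) * u x)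
    ((rd u).cmul _) (fun x => by
      rw [norm_mul, Complex.norm_real, Real.norm_of_nonneg (by positivity)]; exact hC ζ hζ x)
  rw [n2_smul, Complex.norm_real, Real.norm_of_nonneg (by positivity)] at h
  linarith

theorem ip_If_self {f : Ed d → ℂ} : ip (fun x => I * f x) f = 0 := by
  have h := ip_I_left (u := f) (w := f)
  rw [ip_comm (u := f)] at h; linarith

theorem Gam_g (lam : ℝ) (u : Sch d) (ζ : ℝ) : Gam lam (Hop u - lam • gS u ζ) u =
    lam * ip (fun x => gS u ζ x - fN u x) (J (Hop u)) - lam ^ 2 * ip (fun x => I * fN u x) (fun x => gS u ζ x - fN u x) := by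
  unfold Gam
  have hf : RD (fN u) := fN_rd (rd u)
  have hIf : RD (fun x => I * fN u x) := by
    exact hf.cmul I
  have e1 : ip u (J (Hop (Hop u - lam • gS u ζ))) = lam * ip (gS u ζ) (J (Hop u)) := by
    rw [← H_J, ← ip_H, map_sub, ips', ip_J_self, map_smul, ipm', ip_comm (w := J (gS u ζ)), ip_J]; ring
  have e2 : ip (fun x => I * fN u x) (Hop u - lam • gS u ζ : Sch d) = - ip (fN u) (J (Hop u)) - lam * ip (fun x => I * fN u x) (gS u ζ) := by
    have h1 : ((Hop u - lam • gS u ζ : Sch d) : Ed d → ℂ) = fun x => Hop u x - (lam : ℂ) * gS u ζ x := by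
      funext x; rw [sub_apply, smul_apply']
    have h2 : (J (Hop u) : Ed d → ℂ) = fun x => I * Hop u x := by funext x; exact J_apply _ x
    rw [h1, ip_sub_right hIf (rd _) ((rd _).cmul _), ip_smul_right, ip_I_left, h2]
  rw [e1, e2, ip_sub_left (rd _) hf (rd _), ip_sub_right hIf (rd _) hf, ip_If_self]
  ring

theorem Gam_g_bd (lam : ℝ) (u : Sch d) : ∃ C : ℝ, 0 ≤ C ∧ ∀ ζ : ℝ, 1 ≤ ζ →
    |Gam lam (Hop u - lam • gS u ζ) u| ≤ C * ζ ^ (-dl d) := by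
  obtain ⟨C, hC0, hC⟩ := gS_n2 u
  have hf : RD (fN u) := fN_rd (rd u)
  have hIf : RD (fun x => I * fN u x) := by
    exact hf.cmul I
  have n1 : 0 ≤ n2 (J (Hop u)) := n2_nonneg
  have n3 : 0 ≤ n2 (fun x => I * fN u x) := n2_nonneg
  refine ⟨|lam| * C * n2 (J (Hop u)) + lam ^ 2 * n2 (fun x => I * fN u x) * C, by positivity, fun ζ hζ => ?_⟩
  rw [Gam_g]
  have h1 := ip_le_n2 (gf_rd u ζ) (rd (J (Hop u)))
  have h2 := ip_le_n2 hIf (gf_rd u ζ)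
  have h3 := hC ζ hζ
  refine (abs_sub _ _).trans ?_
  rw [abs_mul, abs_mul, abs_of_nonneg (sq_nonneg lam)]
  have h4 := mul_le_mul_of_nonneg_left (h1.trans (mul_le_mul_of_nonneg_right h3 n1)) (abs_nonneg lam)
  have h5 := mul_le_mul_of_nonneg_left (h2.trans (mul_le_mul_of_nonneg_left h3 n3)) (sq_nonneg lam)
  linarith

theorem exists_zeta (hd : 1 ≤ d) (C : ℝ) {ε : ℝ} (hε : 0 < ε) : ∃ ζ : ℝ, 1 ≤ ζ ∧ C * ζ ^ (-dl d) ≤ ε := by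
  have h := (tendsto_rpow_neg_atTop (dl_pos hd)).const_mul C
  rw [mul_zero] at h
  obtain ⟨ζ, h1, h2⟩ := ((h.eventually (gt_mem_nhds hε)).and (eventually_ge_atTop 1)).exists
  exact ⟨ζ, h2, h1.le⟩

set_option maxHeartbeats 800000 in
/-- lower differentiability of the energy -/
theorem C7 (hd : 1 ≤ d) (hv : IsSol lam v) (hS : ∀ τ ∈ Set.Icc a b, S2 (v τ) ≤ S0) {s : ℝ} (hs : s ∈ Set.Icc a b) {ε : ℝ} (hε : 0 < ε) :
    ∀ᶠ t in nhdsWithin s (Set.Icc a b), En lam (v s) - ε * |t - s| ≤ En lam (v t) := by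
  obtain ⟨C, hC0, hC⟩ := PTI d
  obtain ⟨U, hU0, hU⟩ := powsg_bdd (v s)
  obtain ⟨G, hG0, hG⟩ := GN hd
  obtain ⟨Y, hY0, hY⟩ := BASE1 hd hv hs hS
  obtain ⟨C1, hC10, hC1⟩ := gS_n2 (v s)
  obtain ⟨C2, hC20, hC2⟩ := Gam_g_bd lam (v s)
  obtain ⟨ζ, hζ, hz⟩ := exists_zeta hd (2 * |lam| * Y * C1 + 2 * C2) (show 0 < ε / 4 by positivity)
  set ψ : Sch d := Hop (v s) - lam • gS (v s) ζ with hψ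
  have hP := PLc hd hv hS ψ s hs
  rw [hasDerivWithinAt_iff_isLittleO] at hP
  have hP1 := hP.bound (show 0 < ε / 8 by positivity)
  have hsm1 : ∀ᶠ t in nhdsWithin s (Set.Icc a b), |lam| * C * G * n2 (v t - v s : Sch d) ^ sg d < 1 := by
    have h1 := ((n2_sub_tendsto hd hv hS hs).rpow_const (p := sg d) (Or.inr (sg_nonneg))).const_mul (|lam| * C * G)
    rw [Real.zero_rpow (sg_pos hd).ne', mul_zero] at h1
    exact h1.eventually (gt_mem_nhds one_pos)
  have hsm2 : ∀ᶠ t in nhdsWithin s (Set.Icc a b), |lam| * C * U * Y ^ 2 * |t - s| < ε / 4 := by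
    have h1 := (abs_sub_tendsto (Set.Icc a b) s).const_mul (|lam| * C * U * Y ^ 2)
    rw [mul_zero] at h1
    exact h1.eventually (gt_mem_nhds (by positivity))
  filter_upwards [hP1, hsm1, hsm2, self_mem_nhdsWithin] with t h1 h2 h3 ht
  set w : Sch d := v t - v s with hw
  set y := n2 w with hy
  have hy0 : 0 ≤ y := n2_nonneg
  have hyt : y ≤ Y * |t - s| := hY t ht
  have hT0 : 0 ≤ |t - s| := abs_nonneg _
  have p1 := hC (v s) (v t) U hU
  rw [← hw, ← hy] at p1
  have p2 := hG w
  rw [← hy] at p2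
  have q1 := S2_sub (v t) (v s)
  have q2 := V_sub (v t) (v s)
  rw [← hw] at q1 q2
  have hk := coef_le d lam
  have hf : RD (fN (v s)) := fN_rd (rd (v s))
  have q3 : ip w (Hop (v s)) = ip w (Q (v s)) - ip w (Lap (v s)) := by rw [Hop_eq, ips']
  have q4 : ip w ψ = ip w (Hop (v s)) - lam * ip w (gS (v s) ζ) := by rw [hψ, ips', ipm']
  have q5 : ip w (fun x => gS (v s) ζ x - fN (v s) x) = ip w (gS (v s) ζ) - ip w (fN (v s)) :=
    ip_sub_right (rd w) (rd _) hf
  have q6 := ip_le_n2 (rd w) (gf_rd (v s) ζ)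
  have q7 : |ip w (fun x => gS (v s) ζ x - fN (v s) x)| ≤ Y * |t - s| * (C1 * ζ ^ (-dl d)) :=
    q6.trans (mul_le_mul hyt (hC1 ζ hζ) n2_nonneg (by positivity))
  have q8 : ip w ψ = ip (v t) ψ - ip (v s) ψ := ips _ _ _
  have h1' : |ip w ψ - (t - s) * Gam lam ψ (v s)| ≤ ε / 8 * |t - s| := by
    rw [q8]; simpa [Real.norm_eq_abs, smul_eq_mul] using h1
  have q9 : |(t - s) * Gam lam ψ (v s)| ≤ |t - s| * (C2 * ζ ^ (-dl d)) := by
    rw [abs_mul]; exact mul_le_mul_of_nonneg_left (hC2 ζ hζ) hT0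
  -- remainder of the potential
  set r := PP (v t) - PP (v s) - (2 + sg d) * ip (fN (v s)) w with hr
  have hS0 : 0 ≤ S2 w := S2_nonneg w
  have hV0 : 0 ≤ V w := V_nonneg w
  have r1 : |2 * lam / (2 + sg d) * r| ≤ |lam| * (C * (U * y ^ 2 + PP w)) := by
    rw [abs_mul]; exact mul_le_mul hk p1 (abs_nonneg _) (abs_nonneg _)
  have r2 : |lam| * C * PP w ≤ S2 w := by
    have h6 := mul_le_mul_of_nonneg_left p2 (mul_nonneg (abs_nonneg lam) hC0)
    have h7 := mul_le_mul_of_nonneg_right h2.le hS0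
    linarith
  have r3 : |lam| * C * U * y ^ 2 ≤ ε / 4 * |t - s| := by
    have h6 : y ^ 2 ≤ (Y * |t - s|) ^ 2 := pow_le_pow_left₀ hy0 hyt 2
    have h7 := mul_le_mul_of_nonneg_left h6 (show 0 ≤ |lam| * C * U by positivity)
    have h8 := mul_le_mul_of_nonneg_right h3.le hT0
    linarith [mul_pow Y |t - s| 2, (by ring : |lam| * C * U * (Y * |t - s|) ^ 2 = |lam| * C * U * Y ^ 2 * |t - s| * |t - s|)]
  have r4 : 2 * lam / (2 + sg d) * ((2 + sg d) * ip (fN (v s)) w) = 2 * lam * ip (fN (v s)) w := by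
    have : (2 + sg d) ≠ 0 := by have := sg_nonneg (d := d); linarith
    rw [← mul_assoc, div_mul_cancel₀ _ this]
  have r5 : 2 * lam / (2 + sg d) * r = 2 * lam / (2 + sg d) * PP (v t) - 2 * lam / (2 + sg d) * PP (v s) - 2 * lam * ip (fN (v s)) w := by
    rw [hr, ← r4]; ring
  have r6 : |lam * ip w (fun x => gS (v s) ζ x - fN (v s) x)| ≤ |lam| * (Y * |t - s| * (C1 * ζ ^ (-dl d))) := by
    rw [abs_mul]; exact mul_le_mul_of_nonneg_left q7 (abs_nonneg _)
  have r7 := mul_le_mul_of_nonneg_right hz hT0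
  rw [q5] at r6
  rw [ip_comm (u := fN (v s))] at r5
  unfold En
  have a1 := (abs_le.1 r1).2
  have a2 := (abs_le.1 h1').1
  have a3 := (abs_le.1 q9).1
  have a4 := (abs_le.1 r6).1
  have a5 := mul_nonneg hε.le hT0
  clear_value r
  generalize 2 * lam / (2 + sg d) = k at *
  linarith
end HS

namespace HS
open Complex ComplexConjugate
variable {d : ℕ} {lam : ℝ} {v : ℝ → Sch d} {a b S0 : ℝ}

theorem fN_ip_le (u ψ : Sch d) {B : ℝ} (hB : ∀ x, ‖ψ x‖ ≤ B) :
    |ip (fun x => I * fN u x) ψ| ≤ n2 u * n2 ψ + B * PP u := by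
  have hf : RD (fN u) := fN_rd (rd u)
  have hσ := sg_nonneg (d := d)
  have hi : Integrable (fun x => ‖u x‖ * ‖ψ x‖) := ((rd u).norm.mul (rd ψ).norm.pg).integrable
  have hj : Integrable (fun x => B * ‖u x‖ ^ (2 + sg d)) := (PP_rd (rd u)).integrable.const_mul B
  have h1 : |ip (fun x => I * fN u x) ψ| ≤ ∫ x, (‖u x‖ * ‖ψ x‖ + B * ‖u x‖ ^ (2 + sg d)) := by
    unfold ip
    refine norm_integral_le_of_norm_le (G := ℝ) (hi.add hj) (Eventually.of_forall fun x => ?_)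
    refine (norm_inner_le_norm (𝕜 := ℝ) (I * fN u x) (ψ x)).trans ?_
    rw [norm_mul, norm_I, one_mul, fN_norm']
    have h2 : ‖u x‖ ^ (1 + sg d) ≤ ‖u x‖ + ‖u x‖ ^ (2 + sg d) := by
      rcases le_total ‖u x‖ 1 with h | h
      · have := Real.rpow_le_rpow_of_exponent_ge' (norm_nonneg (u x)) h zero_le_one (show (1:ℝ) ≤ 1 + sg d by linarith)
        rw [Real.rpow_one] at this
        have h3 : 0 ≤ ‖u x‖ ^ (2 + sg d) := by positivity
        linarith
      · have := Real.rpow_le_rpow_of_exponent_le h (show 1 + sg d ≤ 2 + sg d by linarith)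
        linarith [norm_nonneg (u x)]
    have h3 := mul_le_mul_of_nonneg_right h2 (norm_nonneg (ψ x))
    have h4 := mul_le_mul_of_nonneg_left (hB x) (show 0 ≤ ‖u x‖ ^ (2 + sg d) by positivity)
    linarith
  refine h1.trans ?_
  rw [integral_add hi hj, integral_const_mul]
  have := int_norm_mul_le (rd u) (rd ψ)
  unfold PP
  linarith

theorem Gam_le (lam : ℝ) (u ψ : Sch d) {B : ℝ} (hB : ∀ x, ‖ψ x‖ ≤ B) :
    |Gam lam ψ u| ≤ n2 u * n2 (Hop ψ) + |lam| * (n2 u * n2 ψ + B * PP u) := by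
  unfold Gam
  refine (abs_add_le _ _).trans ?_
  rw [abs_mul]
  have h1 := ip_le_n2 (rd u) (rd (J (Hop ψ)))
  rw [n2_J] at h1
  exact add_le_add h1 (mul_le_mul_of_nonneg_left (fN_ip_le u ψ hB) (abs_nonneg _))

/-- the quantitative bounds used in the category argument -/
def BD (n : ℝ) (u : Sch d) : Prop :=
  n2 u ≤ n ∧ V u ≤ n ∧ S2 u ≤ n ∧ PP u ≤ n ∧ n2 (A u) ≤ n ∧ n2 (Hop (A u)) ≤ n ∧ ∀ x, ‖A u x‖ ≤ n

theorem n2_add_le' (u w : Sch d) : n2 (u + w : Sch d) ≤ n2 u + n2 w := n2_add_le (rd u) (rd w)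

theorem Gam_BD {n : ℝ} {u1 u2 : Sch d} (h1 : BD n u1) (h2 : BD n u2) (lam : ℝ) (u : Sch d) (hu : n2 u ≤ n) :
    |Gam lam (-(J (A (u1 + u2)))) u| ≤ 2 * n * (n + |lam| * (n + PP u)) := by
  have hn : 0 ≤ n := n2_nonneg.trans h1.1
  have e0 : (-(J (A (u1 + u2))) : Sch d) = J (-(A (u1 + u2))) := (map_neg J _).symm
  have k1 : n2 (-(A (u1 + u2)) : Sch d) ≤ 2 * n := by
    have : n2 (-(A (u1 + u2)) : Sch d) = n2 (A (u1 + u2)) := n2_neg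
    rw [this, map_add]
    linarith [n2_add_le' (A u1) (A u2), h1.2.2.2.2.1, h2.2.2.2.2.1]
  have k2 : n2 (Hop (-(A (u1 + u2))) : Sch d) ≤ 2 * n := by
    have : n2 (Hop (-(A (u1 + u2))) : Sch d) = n2 (Hop (A (u1 + u2))) := by rw [map_neg]; exact n2_neg
    rw [this, map_add, map_add]
    linarith [n2_add_le' (Hop (A u1)) (Hop (A u2)), h1.2.2.2.2.2.1, h2.2.2.2.2.2.1]
  have k3 : ∀ x, ‖J (-(A (u1 + u2))) x‖ ≤ 2 * n := fun x => by
    rw [J_apply, norm_mul, norm_I, one_mul, neg_apply, norm_neg, map_add, add_apply]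
    refine (norm_add_le _ _).trans ?_
    linarith [h1.2.2.2.2.2.2 x, h2.2.2.2.2.2.2 x]
  rw [e0]
  refine (Gam_le lam u _ k3).trans ?_
  rw [H_J, n2_J, n2_J]
  have m1 := mul_le_mul hu k2 n2_nonneg hn
  have m2 := mul_le_mul hu k1 n2_nonneg hn
  have m3 := mul_le_mul_of_nonneg_left m2 (abs_nonneg lam)
  linarith

/-- energy is lower semicontinuous -/
theorem En_lsc (hd : 1 ≤ d) (hv : IsSol lam v) (hS : ∀ τ ∈ Set.Icc a b, S2 (v τ) ≤ S0) {s : ℝ} (hs : s ∈ Set.Icc a b) {ε : ℝ} (hε : 0 < ε) :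
    ∀ᶠ t in nhdsWithin s (Set.Icc a b), En lam (v s) - ε ≤ En lam (v t) := by
  have h1 := (abs_sub_tendsto (Set.Icc a b) s).eventually (gt_mem_nhds one_pos)
  filter_upwards [C7 hd hv hS hs hε, h1] with t h2 h3
  nlinarith

theorem En_le_of_const (hd : 1 ≤ d) (hv : IsSol lam v) (hab : a < b) (hS : ∀ τ ∈ Set.Icc a b, S2 (v τ) ≤ S0) {e : ℝ}
    (hE : ∀ τ ∈ Set.Ioo a b, En lam (v τ) = e) {s : ℝ} (hs : s ∈ Set.Icc a b) : En lam (v s) ≤ e := by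
  refine le_of_forall_pos_le_add fun ε hε => ?_
  have h := En_lsc hd hv hS hs hε
  have h2 : (nhdsWithin s (Set.Ioo a b)).NeBot := by
    rw [← mem_closure_iff_nhdsWithin_neBot, closure_Ioo hab.ne]; exact hs
  obtain ⟨t, h3, h4⟩ := ((h.filter_mono (nhdsWithin_mono s Set.Ioo_subset_Icc_self)).and self_mem_nhdsWithin).exists
  rw [hE t h4] at h3
  linarith

theorem W_diff (u w : Sch d) : W w - W u = 2 * (ip w (-(J (A (u + w))) : Sch d) - ip u (-(J (A (u + w))) : Sch d)) := by
  unfold W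
  simp only [map_add, ipn', ipa']
  have := ip_JA u w
  rw [ip_comm] at this
  linarith

/-- uniform bounds on short gaps -/
theorem PROP1 (hd : 1 ≤ d) (hv : IsSol lam v) (T1 T2 n : ℝ) : ∃ Sm, ∀ a b e, T1 ≤ a → a < b → b ≤ T2 → b - a ≤ 1/4 →
    BD n (v a) → BD n (v b) → (∀ a' b', a < a' → b' < b → ∃ S0, ∀ τ ∈ Set.Icc a' b', S2 (v τ) ≤ S0) →
    (∀ τ ∈ Set.Ioo a b, En lam (v τ) = e) → ∀ τ ∈ Set.Icc a b, S2 (v τ) ≤ Sm := by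
  rcases lt_or_ge n 0 with hn | hn
  · exact ⟨0, fun a b e _ _ _ _ h _ _ _ => absurd (n2_nonneg.trans h.1) (by linarith)⟩
  set k := |lam| * n with hk
  have hk0 : 0 ≤ k := by positivity
  set m := 2 * (n + 1) + k with hm
  obtain ⟨C1, hC10, hC1⟩ := TIGHTE hd lam hv.cont T1 T2 m
  set β := 2 * n * |lam| with hβ
  have hβ0 : 0 ≤ β := by positivity
  obtain ⟨C2, hC20, hC2⟩ := TIGHT hd hv.cont T1 T2 m (show (0:ℝ) < 1 / (β + 1) by positivity)
  set α := 2 * n * (n + |lam| * n) with hα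
  have hα0 : 0 ≤ α := by positivity
  set Em := α + C1 + β * C2 + 4 * m + k with hEm
  refine ⟨2 * Em + C1, fun a b e ha hab hb hl hBa hBb hS hE τ hτ => ?_⟩
  obtain ⟨S0, hS0⟩ := GLB hd hv hab hS hE
  have haI : a ∈ Set.Icc a b := ⟨le_rfl, hab.le⟩
  have hbI : b ∈ Set.Icc a b := ⟨hab.le, le_rfl⟩
  have hEle := fun s hs => En_le_of_const hd hv hab hS0 hE (s := s) hs
  have he : -k ≤ e := by
    refine le_trans ?_ (hEle a haI)
    have h1 := coef_le d lam
    have h2 : |2 * lam / (2 + sg d) * PP (v a)| ≤ |lam| * n := by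
      rw [abs_mul, abs_of_nonneg (PP_nonneg (v a))]
      exact mul_le_mul h1 hBa.2.2.2.1 (PP_nonneg _) (abs_nonneg _)
    have h3 := (abs_le.1 h2).2
    unfold En
    linarith [S2_nonneg (v a), V_nonneg (v a)]
  have hVc := V_cont hd hv hS0
  -- bound for V
  have hVm : ∀ t ∈ Set.Icc a b, V (v t) ≤ m := by
    obtain ⟨c, hc, hcm⟩ := isCompact_Icc.exists_isMaxOn ⟨a, haI⟩ hVc
    intro t ht
    refine (hcm ht).trans ?_
    show V (v c) ≤ m
    rcases eq_or_lt_of_le hc.1 with h | hac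
    · rw [← h]; linarith [hBa.2.1]
    rcases eq_or_lt_of_le hc.2 with h | hcb
    · rw [h]; linarith [hBb.2.1]
    have hcI : c ∈ Set.Ioo a b := ⟨hac, hcb⟩
    have hW0 : W (v c) = 0 := by
      have hmax : IsLocalMax (fun t => V (v t)) c := hcm.isLocalMax (Icc_mem_nhds hac hcb)
      exact hmax.hasDerivAt_eq_zero (V_derivI hd hv hS hcI)
    have hnear : ∃ t ∈ Set.Ioo a b, V (v t) ≤ n + 1 := by
      have h1 : ∀ᶠ t in nhdsWithin a (Set.Icc a b), V (v t) < n + 1 :=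
        (hVc a haI).eventually (gt_mem_nhds (by linarith [hBa.2.1]))
      have h2 : (nhdsWithin a (Set.Ioo a b)).NeBot := by
        rw [← mem_closure_iff_nhdsWithin_neBot, closure_Ioo hab.ne]; exact haI
      obtain ⟨t, h3, h4⟩ := ((h1.filter_mono (nhdsWithin_mono a Set.Ioo_subset_Icc_self)).and self_mem_nhdsWithin).exists
      exact ⟨t, h4, h3.le⟩
    obtain ⟨t, ht, hVt⟩ := hnear
    have h := taylor_up (f := fun t => -V (v t)) (f' := fun t => -W (v t)) (f'' := fun t => -(8 * e - 16 * V (v t)))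
      (k := 4 * k + 8 * V (v c)) (fun t ht => (V_derivI hd hv hS ht).neg) (fun t ht => (W_derivI hd hv hS hE ht).neg)
      (fun t ht => by
        have : V (v t) ≤ V (v c) := hcm (Set.Ioo_subset_Icc_self ht)
        linarith) hcI ht
    beta_reduce at h
    rw [hW0] at h
    have h5 : (t - c) ^ 2 ≤ 1 / 16 := by
      have h6 : |t - c| ≤ 1 / 4 := abs_le.2 ⟨by linarith [ht.1], by linarith [ht.2]⟩
      rw [← sq_abs]; nlinarith [abs_nonneg (t - c)]
    have h7 := mul_le_mul_of_nonneg_left h5 (show 0 ≤ 4 * k + 8 * V (v c) by linarith [V_nonneg (v c)])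
    linarith
  have hS2 : ∀ t ∈ Set.Icc a b, S2 (v t) ≤ 2 * e + C1 := fun t ht => by
    have h1 := hC1 t ⟨ha.trans ht.1, ht.2.trans hb⟩ (hVm t ht)
    linarith [hEle t ht, V_nonneg (v t)]
  -- W identity
  obtain ⟨c1, hc1, hc1e⟩ := exists_hasDerivAt_eq_slope (fun t => W (v t)) (fun t => 8 * e - 16 * V (v t)) hab
    (W_cont hd hv hS0) (fun t ht => W_derivI hd hv hS hE ht)
  set ψ : Sch d := -(J (A (v a + v b))) with hψ
  have hpl := PLc hd hv hS0 ψ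
  obtain ⟨c2, hc2, hc2e⟩ := exists_hasDerivAt_eq_slope (fun t => ip (v t) ψ) (fun t => Gam lam ψ (v t)) hab
    (fun t ht => (hpl t ht).continuousWithinAt)
    (fun t ht => (hpl t (Set.Ioo_subset_Icc_self ht)).hasDerivAt (Icc_mem_nhds ht.1 ht.2))
  have hd1 := W_diff (v a) (v b)
  rw [← hψ] at hd1
  rw [hd1, mul_div_assoc, ← hc2e] at hc1e
  have hG := Gam_BD hBa hBb lam (v c2) (by
    rw [n2_const hv haI (Set.Ioo_subset_Icc_self hc2) hS0]; exact hBa.1)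
  rw [← hψ] at hG
  have hP := hC2 c2 ⟨ha.trans hc2.1.le, hc2.2.le.trans hb⟩ (hVm c2 (Set.Ioo_subset_Icc_self hc2))
  have hS3 := hS2 c2 (Set.Ioo_subset_Icc_self hc2)
  have hV3 := hVm c1 (Set.Ioo_subset_Icc_self hc1)
  have hG2 := (abs_le.1 hG).2
  have hmul : β * PP (v c2) ≤ (2 * e + C1) + β * C2 := by
    have h1 : β * (1 / (β + 1) * S2 (v c2)) ≤ S2 (v c2) := by
      have : β * (1 / (β + 1)) ≤ 1 := by rw [mul_one_div, div_le_one (by linarith)]; linarith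
      rw [← mul_assoc]
      exact mul_le_of_le_one_left (S2_nonneg _) this
    have h2 := mul_le_mul_of_nonneg_left hP hβ0
    linarith
  have heE : e ≤ Em := by
    have : Gam lam ψ (v c2) ≤ α + β * PP (v c2) := by rw [hα, hβ]; linarith
    have hβC : 0 ≤ β * C2 := by positivity
    linarith
  linarith [hS2 τ hτ]
end HS

namespace HS
open Complex ComplexConjugate
variable {d : ℕ} {lam : ℝ} {v w : ℝ → Sch d}

theorem closed_int {g : ℝ → Ed d → ℝ} (hg : Continuous (fun p : ℝ × Ed d => g p.1 p.2)) (h0 : ∀ t x, 0 ≤ g t x)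
    (hi : ∀ t, Integrable (g t)) (n : ℝ) : IsClosed {t | ∫ x, g t x ≤ n} := by
  rcases lt_or_ge n 0 with hn | hn
  · convert isClosed_empty
    ext t
    simp only [Set.mem_ofPred_eq, Set.mem_empty_iff_false, iff_false, not_le]
    exact hn.trans_le (integral_nonneg (h0 t))
  have key : ∀ t, ∫ x, g t x ≤ n ↔ ∫⁻ x, ENNReal.ofReal (g t x) ≤ ENNReal.ofReal n := fun t => by
    rw [← ofReal_integral_eq_lintegral_ofReal (hi t) (Eventually.of_forall (h0 t)), ENNReal.ofReal_le_ofReal_iff hn]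
  refine IsSeqClosed.isClosed fun s t hs hst => ?_
  simp only [Set.mem_ofPred_eq] at hs ⊢
  rw [key]
  have hc : ∀ t, Continuous (g t) := fun t => hg.comp (continuous_const.prodMk continuous_id)
  have h1 : ∀ x, ENNReal.ofReal (g t x) = liminf (fun k => ENNReal.ofReal (g (s k) x)) atTop := fun x => by
    refine (Tendsto.liminf_eq ?_).symm
    refine ENNReal.tendsto_ofReal ?_
    have : Continuous (fun t => g t x) := hg.comp (continuous_id.prodMk continuous_const)
    exact (this.tendsto t).comp hst
  simp only [h1]
  refine (lintegral_liminf_le fun k => (ENNReal.measurable_ofReal.comp (hc (s k)).measurable)).trans ?_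
  refine (liminf_le_of_frequently_le' (Frequently.of_forall (f := atTop) fun k => ?_))
  exact (key (s k)).1 (hs k)

/-- joint smoothness -/
def JS (w : ℝ → Sch d) : Prop := ContDiff ℝ (⊤ : ℕ∞) (fun p : ℝ × Ed d => w p.1 p.2)

theorem JS.add (hv : JS v) (hw : JS w) : JS (fun t => v t + w t) := ContDiff.add hv hw
theorem JS.sub (hv : JS v) (hw : JS w) : JS (fun t => v t - w t) := ContDiff.sub hv hw
theorem JS.smul (c : ℝ) (hv : JS v) : JS (fun t => c • v t) := ContDiff.const_smul c hv
theorem JS.sum {ι : Type} (s : Finset ι) {f : ι → ℝ → Sch d} (h : ∀ i, JS (f i)) : JS (fun t => ∑ i ∈ s, f i t) := by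
  unfold JS
  simp only [sum_apply']
  exact ContDiff.sum fun i _ => h i
theorem JS.X (i : Fin d) (hv : JS v) : JS (fun t => X i (v t)) := by
  unfold JS
  simp only [X_apply]
  refine ContDiff.mul ?_ hv
  have : ContDiff ℝ (⊤ : ℕ∞) (fun p : ℝ × Ed d => p.2 i) := by fun_prop
  exact Complex.ofRealCLM.contDiff.comp this
theorem JS.Q (hv : JS v) : JS (fun t => Q (v t)) := by
  unfold JS
  simp only [Q_apply]
  refine ContDiff.mul ?_ hv
  have : ContDiff ℝ (⊤ : ℕ∞) (fun p : ℝ × Ed d => ‖p.2‖ ^ 2) := contDiff_snd.norm_sq ℝ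
  exact Complex.ofRealCLM.contDiff.comp this
theorem JS.D (i : Fin d) (hv : JS v) : JS (fun t => D i (v t)) := by
  have h1 : ContDiff ℝ (⊤ : ℕ∞) (fun p : ℝ × Ed d => fderiv ℝ (fun p : ℝ × Ed d => v p.1 p.2) p (0, stdBasis i)) :=
    (ContDiff.fderiv_right (m := (⊤ : ℕ∞)) hv (by simp)).clm_apply contDiff_const
  unfold JS
  convert h1 using 1
  funext p
  rw [D_apply]
  unfold pd
  have h2 : HasFDerivAt (fun p : ℝ × Ed d => v p.1 p.2) (fderiv ℝ (fun p : ℝ × Ed d => v p.1 p.2) p) p :=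
    (ContDiff.differentiable hv (by simp) p).hasFDerivAt
  have h3 := HasFDerivAt.comp (g := fun p : ℝ × Ed d => v p.1 p.2) (f := fun x => (p.1, x)) p.2 h2 (hasFDerivAt_prodMk_right (𝕜 := ℝ) p.1 p.2)
  have h4 : HasFDerivAt (fun x => v p.1 x) ((fderiv ℝ (fun p : ℝ × Ed d => v p.1 p.2) p).comp (ContinuousLinearMap.inr ℝ ℝ (Ed d))) p.2 := h3
  rw [h4.fderiv]; simp
theorem JS.Lap (hv : JS v) : JS (fun t => Lap (v t)) := by
  simp only [Lap_eq]
  exact JS.sum _ fun i => (hv.D i).D i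
theorem JS.Hop (hv : JS v) : JS (fun t => Hop (v t)) := by
  simp only [Hop_eq]; exact hv.Q.sub hv.Lap
theorem JS.A (hv : JS v) : JS (fun t => A (v t)) := by
  simp only [A_eq]
  exact ((JS.sum _ fun i => (hv.D i).X i).smul 2).add (hv.smul d)
theorem JS.cont (hv : JS v) : Continuous (fun p : ℝ × Ed d => v p.1 p.2) := ContDiff.continuous hv

theorem JS.contx (hv : JS v) (x : Ed d) : Continuous (fun t => v t x) := by
  have h := Continuous.comp (g := fun p : ℝ × Ed d => v p.1 p.2) (f := fun t => (t, x)) hv.cont (by fun_prop)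
  exact h

theorem closed_n2 (hv : JS v) {n : ℝ} (hn : 0 ≤ n) : IsClosed {t | n2 (v t) ≤ n} := by
  unfold n2
  simp only [Real.sqrt_le_left hn]
  have := hv.cont
  exact closed_int (g := fun t x => ‖v t x‖ ^ 2) (by fun_prop) (fun _ _ => by positivity) (fun t => int_sq _) _

theorem BD_closed (hv : JS v) (n : ℝ) : IsClosed {t | BD n (v t)} := by
  rcases lt_or_ge n 0 with hn | hn
  · convert isClosed_empty
    ext t
    simp only [Set.mem_ofPred_eq, Set.mem_empty_iff_false, iff_false]
    exact fun h => absurd (n2_nonneg.trans h.1) (by linarith)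
  have c0 := hv.cont
  have hσ := sg_nonneg (d := d)
  have k1 : IsClosed {t | V (v t) ≤ n} := by
    refine closed_int (g := fun t x => ‖x‖ ^ 2 * ‖v t x‖ ^ 2) (by fun_prop) (fun _ _ => by positivity) (fun t => ?_) _
    exact (((PG.nrm).pow 2).rmul ((rd (v t)).norm.pow two_ne_zero)).integrable
  have k2 : IsClosed {t | S2 (v t) ≤ n} := by
    refine closed_int (g := fun t x => gradNormSq (v t) x) ?_ (fun _ _ => gradNormSq_nonneg _ _) (fun t => int_grad _) _
    unfold gradNormSq
    refine continuous_finsetSum _ fun i _ => ?_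
    have h := (hv.D i).cont
    simp only [D_apply] at h
    fun_prop
  have k3 : IsClosed {t | PP (v t) ≤ n} := by
    refine closed_int (g := fun t x => ‖v t x‖ ^ (2 + sg d)) ?_ (fun _ _ => by positivity) (fun t => (PP_rd (rd (v t))).integrable) _
    exact c0.norm.rpow_const fun _ => Or.inr (by linarith)
  have k4 : IsClosed {t | ∀ x, ‖A (v t) x‖ ≤ n} := by
    have h : {t | ∀ x, ‖A (v t) x‖ ≤ n} = ⋂ x, {t | ‖A (v t) x‖ ≤ n} := by ext t; simp
    rw [h]
    refine isClosed_iInter fun x => ?_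
    exact isClosed_le (hv.A.contx x).norm continuous_const
  have h7 := closed_n2 hv.A hn
  have h8 := closed_n2 hv.A.Hop hn
  have := (closed_n2 hv hn).inter (k1.inter (k2.inter (k3.inter (h7.inter (h8.inter k4)))))
  exact this

theorem BD_exists (u : Sch d) : ∃ n : ℕ, BD n u := by
  obtain ⟨B, hB0, hB⟩ := (rd (A u)).bdd
  obtain ⟨n, hn⟩ := exists_nat_ge (n2 u + V u + S2 u + PP u + n2 (A u) + n2 (Hop (A u)) + B)
  have h1 : 0 ≤ n2 u := n2_nonneg
  have h2 := V_nonneg u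
  have h3 := S2_nonneg u
  have h4 := PP_nonneg u
  have h5 : 0 ≤ n2 (A u) := n2_nonneg
  have h6 : 0 ≤ n2 (Hop (A u)) := n2_nonneg
  exact ⟨n, by linarith, by linarith, by linarith, by linarith, by linarith, by linarith, fun x => (hB x).trans (by linarith)⟩
end HS

namespace HS
open Complex ComplexConjugate
variable {d : ℕ} {lam : ℝ}

/-- approximate velocity at horizon `t1` with error parameter `η` -/
structure APX (lam : ℝ) (u : Sch d) (Φ : Ed d → ℝ) (C t1 η : ℝ) (h : Sch d) : Prop where
  le : ∀ x, ‖h x‖ ≤ Φ x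
  sub : ∀ x, ‖h x - rho lam u 0 x‖ ≤ η ^ 2 * Φ x
  lap : t1 * n2 (Lap h) ≤ C * η ^ 2
  dil : t1 * n2 (A h) ≤ C * η ^ 2
  ham : t1 * n2 (Hop h) ≤ C * η ^ 2
  hamx : t1 * √(V (Hop h)) ≤ C * η ^ 2

theorem sqrtV_le (u : Sch d) : √(V u) ≤ n2 u + n2 (Q u) := by
  have h1 := ip_le_n2 (rd u) (rd (Q u))
  rw [ip_Q_self, abs_of_nonneg (V_nonneg u)] at h1
  have a1 : 0 ≤ n2 u := n2_nonneg
  have a2 : 0 ≤ n2 (Q u) := n2_nonneg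
  rw [Real.sqrt_le_left (by positivity)]
  nlinarith

theorem gT_bd (lam : ℝ) (u : Sch d) (T : Sch d →L[ℝ] Sch d) : ∃ C : ℝ, ∃ m : ℕ, 0 ≤ C ∧ ∀ ζ : ℝ, 1 ≤ ζ →
    ∀ k : ℕ, m ≤ k → n2 (T (-(J (Hop u)) + lam • J (gS u ζ))) ≤ C * ζ ^ k := by
  obtain ⟨C, m, hC0, hC⟩ := gS_bd u (T.comp J)
  refine ⟨n2 (T (-(J (Hop u)))) + |lam| * C, m, add_nonneg n2_nonneg (by positivity), fun ζ hζ k hk => ?_⟩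
  have h1 : n2 (T (J (gS u ζ))) ≤ C * ζ ^ k := ((hC ζ hζ).2).trans (mul_le_mul_of_nonneg_left (pow_le_pow_right₀ hζ hk) hC0)
  rw [map_add, map_smul]
  refine (n2_add_le' _ _).trans ?_
  have h2 : n2 (lam • T (J (gS u ζ)) : Sch d) = |lam| * n2 (T (J (gS u ζ))) := by
    have : ((lam • T (J (gS u ζ)) : Sch d) : Ed d → ℂ) = fun x => (lam : ℂ) * T (J (gS u ζ)) x := by
      funext x; exact smul_apply' _ _ _
    rw [this, n2_smul, Complex.norm_real, Real.norm_eq_abs]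
  rw [h2]
  have h3 : 1 ≤ ζ ^ k := one_le_pow₀ hζ
  have h4 := mul_le_mul_of_nonneg_left h1 (abs_nonneg lam)
  have h5 : 0 ≤ n2 (T (-(J (Hop u)))) := n2_nonneg
  nlinarith

theorem PKG (hd : 1 ≤ d) (lam : ℝ) (u : Sch d) : ∃ (Φ : Ed d → ℝ) (C δ : ℝ), RD Φ ∧ (∀ x, ‖u x‖ ≤ Φ x) ∧ (∀ x, ‖rho lam u 0 x‖ ≤ Φ x) ∧
    0 ≤ C ∧ 0 < δ ∧ δ ≤ 1/8 ∧ δ ≤ sg d ∧ ∀ t1, 0 < t1 → t1 ≤ 1 → ∃ h, APX lam u Φ C t1 (t1 ^ δ) h := by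
  obtain ⟨Cg, hCg0, hCg⟩ := gS_sub u
  obtain ⟨C1, m1, h10, h1⟩ := gT_bd lam u Lap
  obtain ⟨C2, m2, h20, h2⟩ := gT_bd lam u A
  obtain ⟨C3, m3, h30, h3⟩ := gT_bd lam u Hop
  obtain ⟨C4, m4, h40, h4⟩ := gT_bd lam u (Q.comp Hop)
  have hdl := dl_pos hd
  have hr0 : RD (rho lam u 0) := rho_rd lam u 0
  set m : ℕ := m1 + m2 + m3 + m4 + 1 with hm
  have hm1 : (1:ℝ) ≤ m := by exact_mod_cast (by omega : 1 ≤ m)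
  set δ : ℝ := dl d / (8 * m) with hδ
  have hδ0 : 0 < δ := by positivity
  have hδ1 : δ ≤ dl d / 8 := by
    rw [hδ]; exact div_le_div_of_nonneg_left hdl.le (by norm_num) (by linarith)
  have hdl1 : dl d ≤ 1 := dl_le_one
  have hdl2 : dl d ≤ sg d := min_le_left _ _
  refine ⟨fun x => ‖rho lam u 0 x‖ + (1 + |lam| * Cg) * ‖u x‖, C1 + C2 + C3 + C4, δ,
    hr0.norm.add ((PG.const _).rmul (rd u).norm), fun x => ?_, fun x => ?_, by positivity, hδ0, by linarith, by linarith, ?_⟩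
  · have : 0 ≤ |lam| * Cg * ‖u x‖ := by positivity
    linarith [norm_nonneg (rho lam u 0 x)]
  · have : 0 ≤ (1 + |lam| * Cg) * ‖u x‖ := by positivity
    linarith
  intro t1 ht0 ht1
  set ζ : ℝ := t1 ^ (-(1 / (2 * m)) : ℝ) with hζ
  have hζ1 : 1 ≤ ζ := Real.one_le_rpow_of_pos_of_le_one_of_nonpos ht0 ht1 (by
    have : (0:ℝ) ≤ 1 / (2 * m) := by positivity
    linarith)
  have hη1 : t1 * ζ ^ m ≤ (t1 ^ δ) ^ 2 := by
    have e1 : t1 * ζ ^ m = t1 ^ (1/2 : ℝ) := by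
      have : (m:ℝ) ≠ 0 := by linarith
      rw [hζ, ← Real.rpow_natCast, ← Real.rpow_mul ht0.le]
      nth_rewrite 1 [← Real.rpow_one t1]
      rw [← Real.rpow_add ht0]
      congr 1; field_simp; norm_num
    rw [e1, ← Real.rpow_natCast, ← Real.rpow_mul ht0.le]
    exact Real.rpow_le_rpow_of_exponent_ge ht0 ht1 (by push_cast; linarith)
  have hη2 : ζ ^ (-dl d) ≤ (t1 ^ δ) ^ 2 := by
    rw [hζ, ← Real.rpow_mul ht0.le, ← Real.rpow_natCast, ← Real.rpow_mul ht0.le]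
    refine Real.rpow_le_rpow_of_exponent_ge ht0 ht1 ?_
    have : -(1 / (2 * (m:ℝ))) * -dl d = 4 * δ := by
      have : (m:ℝ) ≠ 0 := by linarith
      rw [hδ]; field_simp; norm_num
    rw [this]; push_cast; linarith
  have hη0 : (t1 ^ δ) ^ 2 ≤ 1 := pow_le_one₀ (by positivity) (Real.rpow_le_one ht0.le ht1 hδ0.le)
  set h : Sch d := -(J (Hop u)) + lam • J (gS u ζ) with hh
  have hsub : ∀ x, ‖h x - rho lam u 0 x‖ ≤ (t1 ^ δ) ^ 2 * (|lam| * Cg * ‖u x‖) := fun x => by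
    have e1 : h x - rho lam u 0 x = I * ((lam : ℂ) * (gS u ζ x - fN u x)) := by
      rw [hh, add_apply, neg_apply, smul_apply', J_apply, J_apply, rho, zero_apply]; ring
    rw [e1, norm_mul, norm_I, one_mul, norm_mul, Complex.norm_real, Real.norm_eq_abs]
    have := mul_le_mul_of_nonneg_left ((hCg ζ hζ1 x).trans (mul_le_mul_of_nonneg_right (mul_le_mul_of_nonneg_left hη2 hCg0) (norm_nonneg _))) (abs_nonneg lam)
    linarith
  have hT : ∀ {N c : ℝ}, 0 ≤ c → c ≤ C1 + C2 + C3 + C4 → N ≤ c * ζ ^ m → t1 * N ≤ (C1 + C2 + C3 + C4) * (t1 ^ δ) ^ 2 := by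
    intro N c hc hcC hN
    calc t1 * N ≤ t1 * (c * ζ ^ m) := by gcongr
      _ = c * (t1 * ζ ^ m) := by ring
      _ ≤ _ := by gcongr
  have k1 := h1 ζ hζ1 m (by omega)
  have k2 := h2 ζ hζ1 m (by omega)
  have k3 := h3 ζ hζ1 m (by omega)
  have k4 := h4 ζ hζ1 m (by omega)
  refine ⟨h, ⟨fun x => ?_, fun x => ?_, hT h10 (by linarith) k1, hT h20 (by linarith) k2, hT h30 (by linarith) k3, ?_⟩⟩
  · have a1 := hsub x
    have a2 : (t1 ^ δ) ^ 2 * (|lam| * Cg * ‖u x‖) ≤ |lam| * Cg * ‖u x‖ := mul_le_of_le_one_left (by positivity) hη0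
    have a3 := norm_le_norm_add_norm_sub (rho lam u 0 x) (h x)
    rw [norm_sub_rev] at a3
    linarith [norm_nonneg (u x)]
  · refine (hsub x).trans (mul_le_mul_of_nonneg_left ?_ (by positivity))
    linarith [norm_nonneg (u x), norm_nonneg (rho lam u 0 x)]
  · refine hT (c := C3 + C4) (by positivity) (by linarith) ((sqrtV_le _).trans ?_)
    have : n2 (Q (Hop h)) ≤ C4 * ζ ^ m := k4
    linarith
end HS

namespace HS
open Complex ComplexConjugate
variable {d : ℕ} {lam : ℝ} {v : ℝ → Sch d} {a b S0 : ℝ}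

theorem th_dil (R : ℝ) {s : ℝ} (hs : 0 ≤ s) (x : Ed d) : th R (x + s • x) ≤ (1 + s) * th R x := by
  have e : x + s • x = (1 + s) • x := by rw [add_smul, one_smul]
  have hn : ‖(1 + s) • x‖ = (1 + s) * ‖x‖ := by rw [norm_smul, Real.norm_of_nonneg (by linarith)]
  unfold th
  rw [e, hn, mul_min_of_nonneg _ _ (by linarith : (0:ℝ) ≤ 1 + s), mul_max_of_nonneg _ _ (by linarith : (0:ℝ) ≤ 1 + s), mul_zero]
  refine min_le_min le_rfl ?_
  by_cases h : 0 ≤ 2 * R - ‖x‖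
  · refine max_le_max le_rfl ?_
    have : 0 ≤ s * (2 * R) := mul_nonneg hs (by linarith [norm_nonneg x])
    linarith
  · push Not at h
    have : 0 ≤ s * ‖x‖ := mul_nonneg hs (norm_nonneg x)
    exact max_le (le_max_left _ _) (le_max_of_le_left (by linarith))

theorem th_radial (R : ℝ) : ∀ᵐ x : Ed d, ∑ i, lineDeriv ℝ (th R) x (stdBasis i) * x i ≤ th R x := by
  filter_upwards [(th_lip (d := d) R).ae_differentiableAt] with x hx
  have h1 : ∀ i, lineDeriv ℝ (th R) x (stdBasis i) = fderiv ℝ (th R) x (stdBasis i) := fun i =>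
    (hx.hasFDerivAt.hasLineDerivAt _).lineDeriv
  simp only [h1]
  have h2 : ∑ i, fderiv ℝ (th R) x (stdBasis i) * x i = fderiv ℝ (th R) x x := by
    have : x = ∑ i, x i • (stdBasis i : Ed d) := by
      ext j
      simp [stdBasis, Pi.single_apply]
    conv_rhs => rw [this, map_sum]
    refine Finset.sum_congr rfl fun i _ => ?_
    rw [map_smul, smul_eq_mul, mul_comm, ← this]
  rw [h2]
  have h3 : HasDerivAt (fun s : ℝ => th R (x + s • x)) (fderiv ℝ (th R) x x) 0 := hx.hasFDerivAt.hasLineDerivAt x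
  refine le_of_tendsto h3.tendsto_slope_zero_right ?_
  filter_upwards [self_mem_nhdsWithin] with s hs
  have hs' : (0:ℝ) < s := hs
  have := th_dil R hs'.le x
  simp only [zero_add, zero_smul, add_zero, smul_eq_mul]
  rw [inv_mul_le_iff₀ hs']
  linarith

/-- Galilean-type quantity -/
def Zq (t : ℝ) (w : Sch d) : ℝ := V w - t * W w + 4 * t ^ 2 * S2 w

theorem Zq_eq (t : ℝ) (w : Sch d) : Zq t w = ∑ i, ∫ x, ‖(X i w + (2 * t) • J (D i w) : Sch d) x‖ ^ 2 := by
  have hW : ip w (J (A w)) = 2 * ∑ i, ip (X i w) (J (D i w)) := by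
    rw [A_eq, map_add, map_smul, map_smul, ipa', ipm', ipm', ip_J_self, map_sum, ip_sumR]
    simp only [← X_J, ip_X]; ring
  unfold Zq W
  rw [hW, V_eq, S2_eq', Finset.mul_sum, Finset.mul_sum, Finset.mul_sum, Finset.mul_sum, ← Finset.sum_sub_distrib, ← Finset.sum_add_distrib]
  refine Finset.sum_congr rfl fun i _ => ?_
  rw [← ip_self, ipa, ipa', ipa', ipm, ipm, ipm', ipm', ip_comm (u := J (D i w)) (w := X i w), n2_sq, n2_sq, ← ip_self, ← ip_self,
    ip_J, J_J, ipn']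
  ring

theorem Zq_nonneg (t : ℝ) (w : Sch d) : 0 ≤ Zq t w := by
  rw [Zq_eq]; exact Finset.sum_nonneg fun i _ => integral_nonneg fun x => by positivity

theorem FLZ (R : ℝ) (t : ℝ) (w : Sch d) :
    2 * t * (∫ x, th R x * ∑ i, lineDeriv ℝ (th R) x (stdBasis i) * (conj (w x) * pd w i x).im)
      ≤ (∫ x, th R x ^ 2 * ‖w x‖ ^ 2) + √(∫ x, th R x ^ 2 * ‖w x‖ ^ 2) * √(Zq t w) := by
  set m : Fin d → Sch d := fun i => X i w + (2 * t) • J (D i w) with hm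
  have hf : Integrable (fun x => (th R x * ‖w x‖) ^ 2) := by
    simp only [mul_pow]
    exact int_cut (th_cont R) (th_supp R) w.continuous
  have hgc : Continuous (fun x => √(∑ i, ‖m i x‖ ^ 2)) :=
    Real.continuous_sqrt.comp (continuous_finsetSum _ fun i _ => ((m i).continuous.norm.pow 2))
  have hs0 : ∀ x, 0 ≤ ∑ i, ‖m i x‖ ^ 2 := fun x => Finset.sum_nonneg fun i _ => by positivity
  have hg : Integrable (fun x => (√(∑ i, ‖m i x‖ ^ 2)) ^ 2) := by
    simp only [Real.sq_sqrt (hs0 _)]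
    exact integrable_finsetSum _ fun i _ => (rd (m i)).sq_int
  obtain ⟨hi, hcs⟩ := cs_int (f := fun x => th R x * ‖w x‖) (g := fun x => √(∑ i, ‖m i x‖ ^ 2)) ((th_cont R).mul w.continuous.norm).aestronglyMeasurable
    hgc.aestronglyMeasurable hf hg
  have h2 := (le_abs_self _).trans hcs
  simp only [mul_pow, Real.sq_sqrt (hs0 _)] at h2
  rw [integral_finsetSum _ (fun i _ => (rd (m i)).sq_int), ← Zq_eq] at h2
  refine le_trans ?_ (add_le_add le_rfl h2)
  have hint : Integrable (fun x => th R x ^ 2 * ‖w x‖ ^ 2) := int_cut (th_cont R) (th_supp R) w.continuous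
  rw [← integral_add hint hi, ← integral_const_mul]
  have hr0 : ∀ x, 0 ≤ th R x ^ 2 * ‖w x‖ ^ 2 + th R x * ‖w x‖ * √(∑ i, ‖m i x‖ ^ 2) := fun x => by
    have := th_nonneg R x
    positivity
  by_cases hI : Integrable (fun x => 2 * t * (th R x * ∑ i, lineDeriv ℝ (th R) x (stdBasis i) * (conj (w x) * pd w i x).im))
  swap
  · rw [integral_undef hI]; exact integral_nonneg hr0
  refine integral_mono_ae hI (hint.add hi) ?_
  filter_upwards [lip_grad_sq (th_lip (d := d) R), th_radial (d := d) R] with x hx hr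
  have h3 := (abs_le.1 (flux_pt (L := 1) zero_le_one (by simpa using hx) (w x) (fun i => I * m i x))).1
  have hth := th_nonneg R x
  have e : ∀ i, 2 * t * (conj (w x) * pd w i x).im = x i * ‖w x‖ ^ 2 - (conj (w x) * (I * m i x)).im := fun i => by
    have hmx : m i x = (x i : ℂ) * w x + ((2 * t : ℝ) : ℂ) * (I * pd w i x) := by
      simp only [hm]
      rw [add_apply, smul_apply', X_apply, J_apply, D_apply]
    have hns : ((‖w x‖ ^ 2 : ℝ) : ℂ) = conj (w x) * w x := by
      rw [← Complex.normSq_eq_norm_sq, Complex.normSq_eq_conj_mul_self]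
    rw [hmx]
    have : conj (w x) * (I * ((x i : ℂ) * w x + ((2 * t : ℝ) : ℂ) * (I * pd w i x))) = ((x i * ‖w x‖ ^ 2 : ℝ) : ℂ) * I
        - ((2 * t : ℝ) : ℂ) * (conj (w x) * pd w i x) := by
      rw [Complex.ofReal_mul (x i), hns]; linear_combination (2 * t : ℝ) * conj (w x) * pd w i x * I_sq
    rw [this, sub_im, im_ofReal_mul, im_ofReal_mul, I_im]; ring
  have e2 : 2 * t * (th R x * ∑ i, lineDeriv ℝ (th R) x (stdBasis i) * (conj (w x) * pd w i x).im)
      = th R x * ((∑ i, lineDeriv ℝ (th R) x (stdBasis i) * x i) * ‖w x‖ ^ 2 - ∑ i, lineDeriv ℝ (th R) x (stdBasis i) * (conj (w x) * (I * m i x)).im) := by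
    rw [Finset.sum_mul, ← Finset.sum_sub_distrib, mul_left_comm, Finset.mul_sum]
    congr 1
    refine Finset.sum_congr rfl fun i _ => ?_
    linear_combination lineDeriv ℝ (th R) x (stdBasis i) * e i
  rw [e2]
  have h4 : ∑ i, ‖I * m i x‖ ^ 2 = ∑ i, ‖m i x‖ ^ 2 := by simp
  rw [h4] at h3
  have h5 := mul_le_mul_of_nonneg_right hr (sq_nonneg ‖w x‖)
  beta_reduce
  calc _ ≤ th R x * (th R x * ‖w x‖ ^ 2 + 1 * ‖w x‖ * √(∑ i, ‖m i x‖ ^ 2)) := mul_le_mul_of_nonneg_left (by linarith) hth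
    _ = _ := by ring
end HS

namespace HS
open Complex ComplexConjugate
variable {d : ℕ} {lam : ℝ} {v : ℝ → Sch d} {a b S0 : ℝ} {u0 : Sch d} {Φ : Ed d → ℝ} {Ca : ℝ}

/-- base data of the approximation package -/
structure BH (lam : ℝ) (u0 : Sch d) (Φ : Ed d → ℝ) (Ca : ℝ) : Prop where
  rd : RD Φ
  u : ∀ x, ‖u0 x‖ ≤ Φ x
  h0 : ∀ x, ‖rho lam u0 0 x‖ ≤ Φ x
  C0 : 0 ≤ Ca

/-- admissible parameters -/
structure ADM (lam : ℝ) (u0 : Sch d) (Φ : Ed d → ℝ) (Ca t1 η : ℝ) (h : Sch d) : Prop where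
  t0 : 0 < t1
  t1le : t1 ≤ 1
  e0 : 0 < η
  e1 : η ≤ 1
  te : t1 ≤ η ^ 2
  tq : t1 ^ (1/4 : ℝ) ≤ η ^ 2
  ts : t1 ^ sg d ≤ η
  ap : APX lam u0 Φ Ca t1 η h

theorem uf0 (u0 h : Sch d) (t : ℝ) : uf u0 h 0 t = u0 + t • h := by simp [uf]

theorem V_smul (c : ℝ) (u : Sch d) : V (c • u) = c ^ 2 * V u := by
  rw [← ip_Q_self, ← ip_Q_self, map_smul, ipm, ipm']; ring
theorem W_smul (c : ℝ) (u : Sch d) : W (c • u) = c ^ 2 * W u := by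
  unfold W; rw [map_smul, map_smul, ipm, ipm']; ring
theorem S2_smul (c : ℝ) (u : Sch d) : S2 (c • u) = c ^ 2 * S2 u := by
  have h := fun u : Sch d => (by rw [ip_Lap_self, neg_neg] : S2 u = - ip u (Lap u))
  rw [h, h u, map_smul, ipm, ipm']; ring
theorem n2_smul' (c : ℝ) (u : Sch d) : n2 (c • u : Sch d) = |c| * n2 u := by
  have : ((c • u : Sch d) : Ed d → ℂ) = fun x => (c : ℂ) * u x := by
    funext x; exact smul_apply' _ _ _
  rw [this, n2_smul, Complex.norm_real, Real.norm_eq_abs]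
theorem n2_sub_le' (u w : Sch d) : n2 (u - w : Sch d) ≤ n2 u + n2 w := n2_sub_le (rd u) (rd w)

theorem S2_le_Lap (u : Sch d) : S2 u ≤ n2 u * n2 (Lap u) := by
  have h := ip_le_n2 (rd u) (rd (Lap u))
  rw [ip_Lap_self, abs_neg] at h
  exact (le_abs_self _).trans h

theorem n2_Phi (hΦ : RD Φ) {f : Ed d → ℂ} {c : ℝ} (h : ∀ x, ‖f x‖ ≤ c * Φ x) :
    n2 f ≤ |c| * n2 (fun x => (Φ x : ℂ)) := by
  have h1 := n2_mono (u := f) (w := fun x => (c : ℂ) * (Φ x : ℂ)) (hΦ.ofReal.cmul c) (fun x => by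
    refine (h x).trans ?_
    rw [← Complex.ofReal_mul, Complex.norm_real]; exact Real.le_norm_self _)
  rwa [n2_smul, Complex.norm_real, Real.norm_eq_abs] at h1

theorem nx_eq (f : Ed d → ℂ) : √(∫ x, ‖x‖ ^ 2 * ‖f x‖ ^ 2) = n2 (fun x => (‖x‖ : ℂ) * f x) := by
  unfold n2
  congr 1
  refine integral_congr_ae (Eventually.of_forall fun x => ?_)
  simp only []
  rw [norm_mul, Complex.norm_real, norm_norm, mul_pow]

theorem BH.pos (hB : BH lam u0 Φ Ca) (x : Ed d) : 0 ≤ Φ x := (norm_nonneg _).trans (hB.u x)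

theorem uf_le (hB : BH lam u0 Φ Ca) {t1 η : ℝ} {h : Sch d} (hA : ADM lam u0 Φ Ca t1 η h) {t : ℝ} (ht0 : 0 ≤ t) (ht : t ≤ t1) (x : Ed d) :
    ‖uf u0 h 0 t x‖ ≤ 2 * Φ x := by
  rw [uf0, add_apply, smul_apply']
  refine (norm_add_le _ _).trans ?_
  rw [norm_mul, Complex.norm_real, Real.norm_of_nonneg ht0]
  have h1 := hB.u x
  have h2 := hA.ap.le x
  have h3 : t * ‖h x‖ ≤ 1 * Φ x := mul_le_mul (ht.trans hA.t1le) h2 (norm_nonneg _) zero_le_one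
  linarith

theorem fN_uf (hB : BH lam u0 Φ Ca) : ∃ C, 0 ≤ C ∧ ∀ (t1 η : ℝ) (h : Sch d) (t : ℝ), ADM lam u0 Φ Ca t1 η h → 0 ≤ t → t ≤ t1 →
    ∀ x, ‖fN (uf u0 h 0 t) x - fN u0 x‖ ≤ C * t * Φ x := by
  obtain ⟨K, hK0, hK⟩ := hB.rd.bdd
  have hσ := sg_nonneg (d := d)
  refine ⟨(2 + sg d) * 2 ^ sg d * (2 * K ^ sg d), by positivity, fun t1 η h t hA ht0 ht x => ?_⟩
  have hKx : Φ x ≤ K := (Real.le_norm_self _).trans (hK x)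
  have hP := hB.pos x
  have e := fLip hσ (u0 x) ((t : ℂ) * h x)
  have e1 : fN (uf u0 h 0 t) x = fz (sg d) (u0 x + (t : ℂ) * h x) := by
    rw [fN_fz, uf0, add_apply, smul_apply']
  rw [e1, fN_fz]
  refine e.trans ?_
  have hn : ‖(t : ℂ) * h x‖ = t * ‖h x‖ := by rw [norm_mul, Complex.norm_real, Real.norm_of_nonneg ht0]
  rw [hn]
  have h2 := hA.ap.le x
  have ht1 := ht.trans hA.t1le
  have h3 : t * ‖h x‖ ≤ t * Φ x := mul_le_mul_of_nonneg_left h2 ht0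
  have h4 : t * ‖h x‖ ≤ K := by
    refine h3.trans ((mul_le_of_le_one_left hP ht1).trans hKx)
  have h5 : ‖u0 x‖ ^ sg d ≤ K ^ sg d := Real.rpow_le_rpow (norm_nonneg _) ((hB.u x).trans hKx) hσ
  have h6 : (t * ‖h x‖) ^ sg d ≤ K ^ sg d := Real.rpow_le_rpow (by positivity) h4 hσ
  have h7 : (‖u0 x‖ ^ sg d + (t * ‖h x‖) ^ sg d) * (t * ‖h x‖) ≤ (2 * K ^ sg d) * (t * Φ x) :=
    mul_le_mul (by linarith) h3 (by positivity) (by positivity)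
  calc _ ≤ (2 + sg d) * 2 ^ sg d * ((2 * K ^ sg d) * (t * Φ x)) := mul_le_mul_of_nonneg_left h7 (by positivity)
    _ = _ := by ring

theorem rho_uf (lam : ℝ) (u0 h : Sch d) (t : ℝ) (x : Ed d) : rho lam (uf u0 h 0 t) h x =
    (I * ((lam : ℂ) * (fN (uf u0 h 0 t) x - fN u0 x)) - (h x - rho lam u0 0 x)) - (t : ℂ) * (I * Hop h x) := by
  unfold rho
  have : Hop (uf u0 h 0 t) x = Hop u0 x + (t : ℂ) * Hop h x := by
    rw [uf0, map_add, map_smul, add_apply, smul_apply']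
  rw [this, zero_apply]; ring

/-- residual bounds -/
theorem L1 (hB : BH lam u0 Φ Ca) : ∃ C, 0 ≤ C ∧ ∀ (t1 η : ℝ) (h : Sch d) (t : ℝ), ADM lam u0 Φ Ca t1 η h → 0 ≤ t → t ≤ t1 →
    n2 h ≤ C ∧ n2 (rho lam (uf u0 h 0 t) h) ≤ C * η ^ 2 ∧ √(∫ x, ‖x‖ ^ 2 * ‖rho lam (uf u0 h 0 t) h x‖ ^ 2) ≤ C * η ^ 2 := by
  obtain ⟨C1, hC1, h1⟩ := fN_uf hB
  set N1 := n2 (fun x => (Φ x : ℂ)) with hN1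
  have hΨ : RD (fun x => ‖x‖ * Φ x) := PG.nrm.rmul hB.rd
  set N2 := n2 (fun x => ((‖x‖ * Φ x : ℝ) : ℂ)) with hN2
  have hN10 : 0 ≤ N1 := n2_nonneg
  have hN20 : 0 ≤ N2 := n2_nonneg
  have hCa := hB.C0
  set c := |lam| * C1 + 1 with hc
  have hc0 : 1 ≤ c := by have : 0 ≤ |lam| * C1 := by positivity
                         linarith
  refine ⟨c * N1 + c * N2 + Ca, by positivity, fun t1 η h t hA ht0 ht => ?_⟩
  have he := hA.e0
  have hη2 : 0 ≤ η ^ 2 := by positivity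
  set f : Ed d → ℂ := fun x => I * ((lam : ℂ) * (fN (uf u0 h 0 t) x - fN u0 x)) - (h x - rho lam u0 0 x) with hf
  have hfr : RD f := (((((fN_rd (rd _)).sub (fN_rd (rd _))).cmul _).cmul _)).sub ((rd h).sub (rho_rd _ _ _))
  have hfx : ∀ x, ‖f x‖ ≤ (c * η ^ 2) * Φ x := fun x => by
    have hP := hB.pos x
    refine (norm_sub_le _ _).trans ?_
    rw [norm_mul, norm_mul, norm_I, one_mul, Complex.norm_real, Real.norm_eq_abs]
    have e1 := h1 t1 η h t hA ht0 ht x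
    have e2 := hA.ap.sub x
    have e3 : C1 * t * Φ x ≤ C1 * η ^ 2 * Φ x := by
      have := ht.trans hA.te
      gcongr
    have e4 := mul_le_mul_of_nonneg_left (e1.trans e3) (abs_nonneg lam)
    calc _ ≤ |lam| * (C1 * η ^ 2 * Φ x) + η ^ 2 * Φ x := add_le_add e4 e2
      _ = _ := by rw [hc]; ring
  have e : rho lam (uf u0 h 0 t) h = fun x => f x - (t : ℂ) * (I * Hop h x) := funext fun x => rho_uf lam u0 h t x
  have hHr : RD (fun x => (t : ℂ) * (I * Hop h x)) := ((rd (Hop h)).cmul I).cmul _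
  have ha : |c * η ^ 2| = c * η ^ 2 := abs_of_nonneg (by positivity)
  refine ⟨?_, ?_, ?_⟩
  · have := n2_Phi (c := 1) hB.rd (fun x => by simpa using hA.ap.le x)
    rw [abs_one, one_mul] at this
    nlinarith
  · rw [e]
    refine (n2_sub_le hfr hHr).trans ?_
    rw [n2_smul, n2_smul, norm_I, one_mul, Complex.norm_real, Real.norm_of_nonneg ht0]
    have e1 := n2_Phi hB.rd hfx
    rw [ha] at e1
    have e2 : t * n2 (Hop h) ≤ Ca * η ^ 2 := (mul_le_mul_of_nonneg_right ht n2_nonneg).trans hA.ap.ham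
    have e3 : 0 ≤ c * N2 * η ^ 2 := by positivity
    linarith
  · rw [nx_eq, e]
    have e0 : (fun x : Ed d => (‖x‖ : ℂ) * (f x - (t : ℂ) * (I * Hop h x))) = fun x => (‖x‖ : ℂ) * f x - (t : ℂ) * (I * ((‖x‖ : ℂ) * Hop h x)) := by
      funext x; ring
    have hx : ∀ g : Ed d → ℂ, RD g → RD (fun x => (‖x‖ : ℂ) * g x) := fun g hg => PG.nrm.ofReal.rmul hg
    rw [e0]
    refine (n2_sub_le (hx f hfr) (((hx _ (rd (Hop h))).cmul I).cmul _)).trans ?_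
    rw [n2_smul, n2_smul, norm_I, one_mul, Complex.norm_real, Real.norm_of_nonneg ht0, ← nx_eq (Hop h)]
    have e1 := n2_Phi (f := fun x => (‖x‖ : ℂ) * f x) (c := c * η ^ 2) hΨ (fun x => by
      rw [norm_mul, Complex.norm_real, norm_norm]
      have := mul_le_mul_of_nonneg_left (hfx x) (norm_nonneg x)
      linarith)
    rw [ha, ← hN2] at e1
    have e2 : t * √(∫ x, ‖x‖ ^ 2 * ‖Hop h x‖ ^ 2) ≤ Ca * η ^ 2 := (mul_le_mul_of_nonneg_right ht (Real.sqrt_nonneg _)).trans hA.ap.hamx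
    have e3 : 0 ≤ c * N1 * η ^ 2 := by positivity
    linarith
end HS

namespace HS
open Complex ComplexConjugate
variable {d : ℕ} {lam : ℝ} {v : ℝ → Sch d} {a b S0 : ℝ} {u0 : Sch d} {Φ : Ed d → ℝ} {Ca : ℝ}

theorem S2_h (hB : BH lam u0 Φ Ca) : ∃ C, 0 ≤ C ∧ ∀ (t1 η : ℝ) (h : Sch d) (t : ℝ), ADM lam u0 Φ Ca t1 η h → 0 ≤ t → t ≤ t1 →
    t * S2 h ≤ C * η ^ 2 ∧ t * |W h| ≤ C * η ^ 2 := by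
  obtain ⟨C, hC0, hC⟩ := L1 hB
  have hCa := hB.C0
  refine ⟨2 * C * Ca, by positivity, fun t1 η h t hA ht0 ht => ?_⟩
  obtain ⟨h1, -, -⟩ := hC t1 η h t hA ht0 ht
  have h0 : 0 ≤ n2 h := n2_nonneg
  have hη : 0 ≤ η ^ 2 := by positivity
  constructor
  · have e1 := mul_le_mul_of_nonneg_left (S2_le_Lap h) ht0
    have e2 : t * n2 (Lap h) ≤ Ca * η ^ 2 := (mul_le_mul_of_nonneg_right ht n2_nonneg).trans hA.ap.lap
    have e3 := mul_le_mul h1 e2 (mul_nonneg ht0 n2_nonneg) hC0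
    have e4 : 0 ≤ C * Ca * η ^ 2 := by positivity
    linarith
  · have e1 := ip_le_n2 (rd h) (rd (J (A h)))
    rw [n2_J] at e1
    have e2 : t * n2 (A h) ≤ Ca * η ^ 2 := (mul_le_mul_of_nonneg_right ht n2_nonneg).trans hA.ap.dil
    have e3 := mul_le_mul h1 e2 (mul_nonneg ht0 n2_nonneg) hC0
    have e4 : |W h| = 2 * |ip h (J (A h))| := by unfold W; rw [abs_mul]; norm_num
    rw [e4]
    have e5 := mul_le_mul_of_nonneg_left e1 ht0
    linarith

theorem L2a (hd : 1 ≤ d) (hv : IsSol lam v) (hb : 0 < b) (hS : ∀ τ ∈ Set.Icc 0 b, S2 (v τ) ≤ S0) (hB : BH lam (v 0) Φ Ca) :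
    ∃ C, 0 ≤ C ∧ ∀ (t1 η : ℝ) (h : Sch d) (t : ℝ), ADM lam (v 0) Φ Ca t1 η h → t1 ≤ b → 0 ≤ t → t ≤ t1 →
      n2 (v t - uf (v 0) h 0 t : Sch d) ≤ C * t ∧ S2 (v t - uf (v 0) h 0 t) ≤ C := by
  obtain ⟨C1, hC10, hC1⟩ := BASE1 hd hv (Set.left_mem_Icc.2 hb.le) hS
  obtain ⟨C2, hC20, hC2⟩ := L1 hB
  obtain ⟨C3, hC30, hC3⟩ := S2_h hB
  have hS00 : 0 ≤ S0 := (S2_nonneg _).trans (hS 0 (Set.left_mem_Icc.2 hb.le))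
  refine ⟨C1 + C2 + (8 * S0 + 2 * C3), by positivity, fun t1 η h t hA htb ht0 ht => ?_⟩
  have htI : t ∈ Set.Icc 0 b := ⟨ht0, ht.trans htb⟩
  have e1 := hC1 t htI
  rw [sub_zero, abs_of_nonneg ht0] at e1
  have e2 := (hC2 t1 η h t hA ht0 ht).1
  have e3 := (hC3 t1 η h t hA ht0 ht).1
  have ew : v t - uf (v 0) h 0 t = (v t - v 0) - t • h := by rw [uf0]; abel
  have ht1 := ht.trans hA.t1le
  have hη1 : η ^ 2 ≤ 1 := pow_le_one₀ hA.e0.le hA.e1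
  rw [ew]
  constructor
  · refine (n2_sub_le' _ _).trans ?_
    rw [n2_smul', abs_of_nonneg ht0]
    have := mul_le_mul_of_nonneg_left e2 ht0
    have h8 : 0 ≤ (8 * S0 + 2 * C3) * t := by positivity
    linarith
  · refine (S2_sub_le _ _).trans ?_
    rw [S2_smul]
    have h1 := S2_sub_le (v t) (v 0)
    have h2 := hS t htI
    have h3 := hS 0 (Set.left_mem_Icc.2 hb.le)
    have h4 : t ^ 2 * S2 h ≤ C3 := by
      have : t * (t * S2 h) ≤ 1 * C3 := mul_le_mul ht1 (e3.trans (mul_le_of_le_one_right hC30 hη1)) (mul_nonneg ht0 (S2_nonneg _)) zero_le_one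
      linarith
    linarith

theorem L2b (hd : 1 ≤ d) (hv : IsSol lam v) (hb : 0 < b) (hS : ∀ τ ∈ Set.Icc 0 b, S2 (v τ) ≤ S0) (hB : BH lam (v 0) Φ Ca) :
    ∃ C, 0 ≤ C ∧ ∀ (t1 η : ℝ) (h : Sch d) (t : ℝ), ADM lam (v 0) Φ Ca t1 η h → t1 ≤ b → 0 ≤ t → t ≤ t1 →
      (∫ x, ‖x‖ ^ 2 * (‖uf (v 0) h 0 t x‖ * |‖v t x‖ ^ sg d - ‖uf (v 0) h 0 t x‖ ^ sg d| * ‖(v t - uf (v 0) h 0 t : Sch d) x‖)) ≤ C * (t1 * η ^ 2)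
      ∧ (∫ x, ‖uf (v 0) h 0 t x‖ * |‖v t x‖ ^ sg d - ‖uf (v 0) h 0 t x‖ ^ sg d| * ‖(v t - uf (v 0) h 0 t : Sch d) x‖) ≤ C * (t1 * η ^ 2) := by
  obtain ⟨N, hN0, hN⟩ := L2a hd hv hb hS hB
  obtain ⟨C, hC0, hC⟩ := NL_t hd N N
  have hσ := sg_nonneg (d := d)
  have hP2 : RD (fun x => 2 * Φ x) := (PG.const (2:ℝ)).rmul hB.rd
  have hR : RD (fun x => (2 * Φ x) ^ sg d + 2 * Φ x) := (hP2.rpow (fun x => by have := hB.pos x; positivity) (sg_pos hd)).add hP2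
  obtain ⟨B1, hB10, hB1⟩ := hR.bdd
  obtain ⟨B2, hB20, hB2⟩ := ((PG.nrm.pow 2).rmul hR).bdd
  refine ⟨C * B1 + C * B2, by positivity, fun t1 η h t hA htb ht0 ht => ?_⟩
  obtain ⟨hn, hs⟩ := hN t1 η h t hA htb ht0 ht
  have hn' := hn.trans (mul_le_mul_of_nonneg_left ht hN0)
  have hpt : ∀ x, ‖uf (v 0) h 0 t x‖ ^ sg d + ‖uf (v 0) h 0 t x‖ ≤ (2 * Φ x) ^ sg d + 2 * Φ x := fun x => by
    have := uf_le hB hA ht0 ht x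
    exact add_le_add (Real.rpow_le_rpow (norm_nonneg _) this hσ) this
  have e54 : t1 ^ (5/4 : ℝ) ≤ t1 * η ^ 2 := by
    have : t1 ^ (5/4 : ℝ) = t1 * t1 ^ (1/4 : ℝ) := by
      rw [show (5/4 : ℝ) = 1 + 1/4 by norm_num, Real.rpow_add hA.t0, Real.rpow_one]
    rw [this]
    exact mul_le_mul_of_nonneg_left hA.tq hA.t0.le
  have hp : 0 ≤ t1 * η ^ 2 := mul_nonneg hA.t0.le (sq_nonneg _)
  constructor
  · have h1 := hC (uf (v 0) h 0 t) (v t) (fun x => ‖x‖ ^ 2) B2 t1 (fun x => by positivity) (fun x =>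
      (mul_le_mul_of_nonneg_left (hpt x) (by positivity)).trans ((Real.le_norm_self _).trans (hB2 x))) hA.t0 hA.t1le hn' hs
    refine h1.trans ?_
    have := mul_le_mul_of_nonneg_left e54 (by positivity : 0 ≤ C * B2)
    have h2 : 0 ≤ C * B1 * (t1 * η ^ 2) := by positivity
    linarith
  · have h1 := hC (uf (v 0) h 0 t) (v t) (fun x => 1) B1 t1 (fun x => by positivity) (fun x => by
      rw [one_mul]; exact (hpt x).trans ((Real.le_norm_self _).trans (hB1 x))) hA.t0 hA.t1le hn' hs
    simp only [one_mul] at h1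
    refine h1.trans ?_
    have := mul_le_mul_of_nonneg_left e54 (by positivity : 0 ≤ C * B1)
    have h2 : 0 ≤ C * B2 * (t1 * η ^ 2) := by positivity
    linarith

theorem L2c (hd : 1 ≤ d) (hv : IsSol lam v) (hb : 0 < b) (hS : ∀ τ ∈ Set.Icc 0 b, S2 (v τ) ≤ S0) (hB : BH lam (v 0) Φ Ca) :
    ∃ C, 0 ≤ C ∧ ∀ (t1 η : ℝ) (h : Sch d) (t : ℝ), ADM lam (v 0) Φ Ca t1 η h → t1 ≤ b → 0 ≤ t → t ≤ t1 →
      n2 (v t - uf (v 0) h 0 t : Sch d) ≤ C * (t1 * η) := by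
  obtain ⟨N, hN0, hN⟩ := L2a hd hv hb hS hB
  obtain ⟨C1, hC10, hC1⟩ := L2b hd hv hb hS hB
  obtain ⟨C2, hC20, hC2⟩ := L1 hB
  set K := 2 * (|lam| * C1 + N * C2) with hK
  have hK0 : 0 ≤ K := by positivity
  refine ⟨√K, Real.sqrt_nonneg _, fun t1 η h t hA htb ht0 ht => ?_⟩
  have hsub : ∀ τ ∈ Set.uIcc 0 t, 0 ≤ τ ∧ τ ≤ t1 := fun τ hτ => by
    rw [Set.uIcc_of_le ht0] at hτ; exact ⟨hτ.1, hτ.2.trans ht⟩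
  have hm := MB hv (v 0) h (t0 := 0) (t := t) (c := K * (t1 * η ^ 2)) (N := N * t1) (S := N) rfl
    (fun τ hτ => by
      obtain ⟨h1, h2⟩ := hsub τ hτ
      exact (hN t1 η h τ hA htb h1 h2).1.trans (mul_le_mul_of_nonneg_left h2 hN0))
    (fun τ hτ => by
      obtain ⟨h1, h2⟩ := hsub τ hτ
      exact (hN t1 η h τ hA htb h1 h2).2)
    (fun τ hτ => by
      obtain ⟨h1, h2⟩ := hsub τ hτ
      have e1 := mul_le_mul_of_nonneg_left (hC1 t1 η h τ hA htb h1 h2).2 (abs_nonneg lam)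
      have e2 := (hC2 t1 η h τ hA h1 h2).2.1
      have e3 := (hN t1 η h τ hA htb h1 h2).1.trans (mul_le_mul_of_nonneg_left h2 hN0)
      have e4 := mul_le_mul e3 e2 n2_nonneg (mul_nonneg hN0 hA.t0.le)
      rw [hK]
      linarith)
  rw [sub_zero, abs_of_nonneg ht0] at hm
  have hp : 0 ≤ t1 * η ^ 2 := mul_nonneg hA.t0.le (sq_nonneg _)
  have h1 : n2 (v t - uf (v 0) h 0 t : Sch d) ^ 2 ≤ K * (t1 * η) ^ 2 := by
    refine hm.trans ((mul_le_mul_of_nonneg_left ht (by positivity)).trans (le_of_eq (by ring)))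
  have h2 := Real.le_sqrt_of_sq_le h1
  rwa [Real.sqrt_mul hK0, Real.sqrt_sq (mul_nonneg hA.t0.le hA.e0.le)] at h2
end HS

namespace HS
open Complex ComplexConjugate
variable {d : ℕ} {lam : ℝ} {v : ℝ → Sch d} {a b S0 e : ℝ} {u0 : Sch d} {Φ : Ed d → ℝ} {Ca : ℝ}

theorem mvt0 {f f' : ℝ → ℝ} {t K : ℝ} (ht : 0 ≤ t) (hc : ContinuousOn f (Set.Icc 0 t)) (hd : ∀ s ∈ Set.Ioo 0 t, HasDerivAt f (f' s) s)
    (hK : ∀ s ∈ Set.Ioo 0 t, |f' s| ≤ K) : |f t - f 0| ≤ K * t := by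
  rcases ht.eq_or_lt with h | h
  · subst h; simp
  obtain ⟨c, hc1, hc2⟩ := exists_hasDerivAt_eq_slope f f' h hc hd
  have h1 := hK c hc1
  rw [hc2, sub_zero, abs_div, abs_of_pos h, div_le_iff₀ h] at h1
  exact h1

theorem V_d0 (hd : 1 ≤ d) (hv : IsSol lam v) (hb : 0 < b) (hS : ∀ τ ∈ Set.Icc 0 b, S2 (v τ) ≤ S0) :
    ∃ C, 0 ≤ C ∧ ∀ t ∈ Set.Icc 0 b, |V (v t) - V (v 0)| ≤ C * t := by
  obtain ⟨C1, hC10, hC1⟩ := BASE1 hd hv (Set.left_mem_Icc.2 hb.le) hS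
  obtain ⟨C2, hC20, hC2⟩ := BASE2 hd hv (Set.left_mem_Icc.2 hb.le) hS
  have hq : 0 ≤ n2 (Q (v 0)) := n2_nonneg
  refine ⟨2 * (C1 * n2 (Q (v 0))) + C2 ^ 2 * b, by positivity, fun t ht => ?_⟩
  have e1 := hC1 t ht
  have e2 := hC2 t ht
  rw [sub_zero, abs_of_nonneg ht.1] at e1 e2
  have e3 := Real.sqrt_le_iff.1 e2
  rw [V_sub]
  have e4 := ip_le_n2 (rd (v t - v 0)) (rd (Q (v 0)))
  have e5 := mul_le_mul_of_nonneg_right e1 hq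
  refine (abs_add_le _ _).trans ?_
  rw [abs_mul, abs_two, abs_of_nonneg (V_nonneg _)]
  have e6 : (C2 * t) ^ 2 ≤ C2 ^ 2 * b * t := by
    have h1 : t * t ≤ b * t := mul_le_mul_of_nonneg_right ht.2 ht.1
    have h2 := mul_le_mul_of_nonneg_left h1 (sq_nonneg C2)
    linarith
  linarith [e3.2]

theorem W_exp (hd : 1 ≤ d) (hv : IsSol lam v) (hb : 0 < b) (hS : ∀ τ ∈ Set.Icc 0 b, S2 (v τ) ≤ S0)
    (hE : ∀ τ ∈ Set.Ioo 0 b, En lam (v τ) = e) :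
    ∃ C, 0 ≤ C ∧ ∀ t ∈ Set.Icc 0 b, |W (v t) - W (v 0) - t * (8 * e - 16 * V (v 0))| ≤ C * t ^ 2 := by
  obtain ⟨C, hC0, hC⟩ := V_d0 hd hv hb hS
  refine ⟨16 * C, by positivity, fun t ht => ?_⟩
  have hcon : ContinuousOn (fun s => W (v s) - s * (8 * e - 16 * V (v 0))) (Set.Icc 0 t) :=
    ((W_cont hd hv hS).mono (Set.Icc_subset_Icc le_rfl ht.2)).sub (continuous_id.mul continuous_const).continuousOn
  have h := mvt0 (f' := fun s => (8 * e - 16 * V (v s)) - (8 * e - 16 * V (v 0))) (K := 16 * C * t) ht.1 hcon (fun s hs => ?_) (fun s hs => ?_)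
  · simp only [zero_mul, sub_zero] at h
    rw [show W (v t) - W (v 0) - t * (8 * e - 16 * V (v 0)) = W (v t) - t * (8 * e - 16 * V (v 0)) - W (v 0) by ring]
    refine h.trans (le_of_eq (by ring))
  · have hs' : s ∈ Set.Ioo 0 b := ⟨hs.1, hs.2.trans_le ht.2⟩
    have h1 := W_derivI hd hv (a := 0) (b := b) (fun a' b' ha hb' => ⟨S0, fun τ hτ => hS τ ⟨ha.le.trans hτ.1, hτ.2.trans hb'.le⟩⟩) hE hs'
    have h2 : HasDerivAt (fun s : ℝ => s * (8 * e - 16 * V (v 0))) (1 * (8 * e - 16 * V (v 0))) s := (hasDerivAt_id s).mul_const _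
    rw [one_mul] at h2
    exact h1.sub h2
  · have h1 := hC s ⟨hs.1.le, hs.2.le.trans ht.2⟩
    rw [show (8 * e - 16 * V (v s)) - (8 * e - 16 * V (v 0)) = -16 * (V (v s) - V (v 0)) by ring, abs_mul]
    have h2 := mul_le_mul_of_nonneg_left hs.2.le hC0
    norm_num
    linarith

theorem V_exp (hd : 1 ≤ d) (hv : IsSol lam v) (hb : 0 < b) (hS : ∀ τ ∈ Set.Icc 0 b, S2 (v τ) ≤ S0)
    (hE : ∀ τ ∈ Set.Ioo 0 b, En lam (v τ) = e) :
    ∃ C, 0 ≤ C ∧ ∀ t ∈ Set.Icc 0 b, |V (v t) - V (v 0) - t * W (v 0) - t ^ 2 * (4 * e - 8 * V (v 0))| ≤ C * t ^ 3 := by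
  obtain ⟨C, hC0, hC⟩ := W_exp hd hv hb hS hE
  refine ⟨C, hC0, fun t ht => ?_⟩
  have hcon : ContinuousOn (fun s => V (v s) - (s * W (v 0) + s ^ 2 * (4 * e - 8 * V (v 0)))) (Set.Icc 0 t) :=
    ((V_cont hd hv hS).mono (Set.Icc_subset_Icc le_rfl ht.2)).sub (Continuous.continuousOn (by fun_prop))
  have h := mvt0 (f' := fun s => W (v s) - (W (v 0) + s * (8 * e - 16 * V (v 0)))) (K := C * t ^ 2) ht.1 hcon (fun s hs => ?_) (fun s hs => ?_)
  · simp only [zero_mul, sub_zero, add_zero, ne_eq, OfNat.ofNat_ne_zero, not_false_eq_true, zero_pow] at h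
    rw [show V (v t) - V (v 0) - t * W (v 0) - t ^ 2 * (4 * e - 8 * V (v 0)) = V (v t) - (t * W (v 0) + t ^ 2 * (4 * e - 8 * V (v 0))) - V (v 0) by ring]
    refine h.trans (le_of_eq (by ring))
  · have hs' : s ∈ Set.Ioo 0 b := ⟨hs.1, hs.2.trans_le ht.2⟩
    have h1 := (V_deriv hd hv hS (Set.Ioo_subset_Icc_self hs')).hasDerivAt (Icc_mem_nhds hs'.1 hs'.2)
    have h2 : HasDerivAt (fun s : ℝ => s * W (v 0) + s ^ 2 * (4 * e - 8 * V (v 0))) (1 * W (v 0) + (2:ℕ) * s ^ (2-1) * (4 * e - 8 * V (v 0))) s :=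
      ((hasDerivAt_id s).mul_const _).add ((hasDerivAt_pow 2 s).mul_const _)
    rw [show (1 * W (v 0) + (2:ℕ) * s ^ (2-1) * (4 * e - 8 * V (v 0))) = W (v 0) + s * (8 * e - 16 * V (v 0)) by norm_num; ring] at h2
    exact h1.sub h2
  · have h1 := hC s ⟨hs.1.le, hs.2.le.trans ht.2⟩
    rw [show W (v s) - (W (v 0) + s * (8 * e - 16 * V (v 0))) = W (v s) - W (v 0) - s * (8 * e - 16 * V (v 0)) by ring]
    refine h1.trans (mul_le_mul_of_nonneg_left (pow_le_pow_left₀ hs.1.le hs.2.le 2) hC0)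

theorem PP_d0 (hd : 1 ≤ d) (hv : IsSol lam v) (hb : 0 < b) (hS : ∀ τ ∈ Set.Icc 0 b, S2 (v τ) ≤ S0) :
    ∃ C, 0 ≤ C ∧ ∀ t ∈ Set.Icc 0 b, |PP (v t) - PP (v 0)| ≤ C * (t + t ^ sg d) := by
  obtain ⟨C1, hC10, hC1⟩ := BASE1 hd hv (Set.left_mem_Icc.2 hb.le) hS
  obtain ⟨C2, hC20, hC2⟩ := PTI d
  obtain ⟨G, hG0, hG⟩ := GN hd
  obtain ⟨U, hU0, hU⟩ := powsg_bdd (v 0)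
  have hσ := sg_nonneg (d := d)
  have hf : 0 ≤ n2 (fN (v 0)) := n2_nonneg
  have hS00 : 0 ≤ S0 := (S2_nonneg _).trans (hS 0 (Set.left_mem_Icc.2 hb.le))
  refine ⟨(2 + sg d) * (n2 (fN (v 0)) * C1) + C2 * (U * (C1 ^ 2 * b)) + C2 * (G * C1 ^ sg d * (4 * S0)), by positivity, fun t ht => ?_⟩
  have ht0 := ht.1
  have e1 := hC1 t ht
  rw [sub_zero, abs_of_nonneg ht0] at e1
  have hn0 : 0 ≤ n2 (v t - v 0 : Sch d) := n2_nonneg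
  have e2 := hC2 (v 0) (v t) U hU
  have e3 : PP (v t - v 0 : Sch d) ≤ G * C1 ^ sg d * (4 * S0) * t ^ sg d := by
    refine (hG _).trans ?_
    have h1 := S2w_le hS (Set.left_mem_Icc.2 hb.le) ht
    have h2 : n2 (v t - v 0 : Sch d) ^ sg d ≤ C1 ^ sg d * t ^ sg d := by
      rw [← Real.mul_rpow hC10 ht0]; exact Real.rpow_le_rpow hn0 e1 hσ
    calc _ ≤ G * (C1 ^ sg d * t ^ sg d) * (4 * S0) := by
          have := S2_nonneg (v t - v 0)
          gcongr
      _ = _ := by ring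
  have e4 : n2 (v t - v 0 : Sch d) ^ 2 ≤ C1 ^ 2 * b * t := by
    have h1 := pow_le_pow_left₀ hn0 e1 2
    have h2 : t * t ≤ b * t := mul_le_mul_of_nonneg_right ht.2 ht.1
    have h3 := mul_le_mul_of_nonneg_left h2 (sq_nonneg C1)
    linarith
  have e5 := ip_le_n2 (fN_rd (rd (v 0))) (rd (v t - v 0))
  have e6 := e5.trans (mul_le_mul_of_nonneg_left e1 hf)
  have e7 : |PP (v t) - PP (v 0)| ≤ (2 + sg d) * |ip (fN (v 0)) (v t - v 0 : Sch d)| + C2 * (U * n2 (v t - v 0 : Sch d) ^ 2 + PP (v t - v 0 : Sch d)) := by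
    have := abs_add_le ((2 + sg d) * ip (fN (v 0)) (v t - v 0 : Sch d)) (PP (v t) - PP (v 0) - (2 + sg d) * ip (fN (v 0)) (v t - v 0 : Sch d))
    rw [abs_mul, abs_of_nonneg (by positivity : 0 ≤ 2 + sg d)] at this
    rw [show PP (v t) - PP (v 0) = (2 + sg d) * ip (fN (v 0)) (v t - v 0 : Sch d) + (PP (v t) - PP (v 0) - (2 + sg d) * ip (fN (v 0)) (v t - v 0 : Sch d)) by ring]
    exact this.trans (add_le_add le_rfl e2)
  refine e7.trans ?_
  have f1 := mul_le_mul_of_nonneg_left e6 (by positivity : 0 ≤ 2 + sg d)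
  have f2 := mul_le_mul_of_nonneg_left (add_le_add (mul_le_mul_of_nonneg_left e4 hU0) e3) hC20
  have hts : 0 ≤ t ^ sg d := by positivity
  have g1 : 0 ≤ ((2 + sg d) * (n2 (fN (v 0)) * C1) + C2 * (U * (C1 ^ 2 * b))) * t ^ sg d := by positivity
  have g2 : 0 ≤ C2 * (G * C1 ^ sg d * (4 * S0)) * t := by positivity
  linarith

theorem n2_T_uf (T : Sch d →L[ℝ] Sch d) (u0 h : Sch d) {t : ℝ} (ht : 0 ≤ t) : n2 (T (uf u0 h 0 t)) ≤ n2 (T u0) + t * n2 (T h) := by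
  rw [uf0, map_add, map_smul]
  refine (n2_add_le' _ _).trans ?_
  rw [n2_smul', abs_of_nonneg ht]

/-- gradient of the error -/
theorem L3 (hd : 1 ≤ d) (hv : IsSol lam v) (hb : 0 < b) (hS : ∀ τ ∈ Set.Icc 0 b, S2 (v τ) ≤ S0) (hB : BH lam (v 0) Φ Ca)
    (hE : ∀ τ ∈ Set.Ioc 0 b, En lam (v τ) = e) :
    ∃ C, 0 ≤ C ∧ ∀ (t1 η : ℝ) (h : Sch d) (t : ℝ), ADM lam (v 0) Φ Ca t1 η h → t1 ≤ b → 0 < t → t ≤ t1 →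
      S2 (v t - uf (v 0) h 0 t) ≤ (e - En lam (v 0)) + C * η := by
  obtain ⟨C1, hC10, hC1⟩ := V_d0 hd hv hb hS
  obtain ⟨C2, hC20, hC2⟩ := PP_d0 hd hv hb hS
  obtain ⟨C3, hC30, hC3⟩ := L2c hd hv hb hS hB
  obtain ⟨C4, hC40, hC4⟩ := L1 hB
  have hL : 0 ≤ n2 (Lap (v 0)) := n2_nonneg
  have hCa := hB.C0
  refine ⟨C1 + |lam| * (C2 * 2) + 2 * (C4 * n2 (Lap (v 0))) + 2 * (C3 * (n2 (Lap (v 0)) + Ca)), by positivity, fun t1 η h t hA htb ht0 ht => ?_⟩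
  have htI : t ∈ Set.Icc 0 b := ⟨ht0.le, ht.trans htb⟩
  have hη0 := hA.e0
  have hη1 := hA.e1
  have hη2 : η ^ 2 ≤ η := by nlinarith
  have htη : t ≤ η := ht.trans (hA.te.trans hη2)
  have ht1 : t1 ≤ 1 := hA.t1le
  have e1 := (abs_le.1 (hC1 t htI)).1
  have e2 := hC2 t htI
  have e2' : t + t ^ sg d ≤ 2 * η := by
    have := (Real.rpow_le_rpow ht0.le ht sg_nonneg).trans hA.ts
    linarith
  have e2'' := e2.trans (mul_le_mul_of_nonneg_left e2' hC20)
  have e3 := hC3 t1 η h t hA htb ht0.le ht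
  have e4 := (hC4 t1 η h t hA ht0.le ht).1
  set u := uf (v 0) h 0 t with hu
  have f1 := S2_sub (v t) u
  have f2 := S2_sub u (v 0)
  have f3 : u - v 0 = t • h := by rw [hu, uf0]; abel
  rw [f3, S2_smul, ipm] at f2
  have f4 := ip_le_n2 (rd h) (rd (Lap (v 0)))
  have f4' := f4.trans (mul_le_mul_of_nonneg_right e4 hL)
  have f5 := ip_le_n2 (rd (v t - u)) (rd (Lap u))
  have f6 : n2 (Lap u) ≤ n2 (Lap (v 0)) + Ca := by
    refine (n2_T_uf Lap (v 0) h ht0.le).trans (add_le_add le_rfl ?_)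
    refine (mul_le_mul_of_nonneg_right ht n2_nonneg).trans (hA.ap.lap.trans ?_)
    exact mul_le_of_le_one_right hCa (hη2.trans hη1)
  have f7 := f5.trans (mul_le_mul e3 f6 n2_nonneg (by have := hA.t0; positivity))
  have f8 : C3 * (t1 * η) * (n2 (Lap (v 0)) + Ca) ≤ C3 * (n2 (Lap (v 0)) + Ca) * η := by
    have : t1 * η ≤ 1 * η := mul_le_mul_of_nonneg_right ht1 hη0.le
    have := mul_le_mul_of_nonneg_left this (by positivity : 0 ≤ C3 * (n2 (Lap (v 0)) + Ca))
    linarith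
  have f9 : t * |ip h (Lap (v 0))| ≤ C4 * n2 (Lap (v 0)) * η := by
    have := mul_le_mul htη f4' (abs_nonneg _) hη0.le
    linarith
  have f10 : t * ip h (Lap (v 0)) ≤ t * |ip h (Lap (v 0))| := mul_le_mul_of_nonneg_left (le_abs_self _) ht0.le
  have f11 : 0 ≤ t ^ 2 * S2 h := mul_nonneg (sq_nonneg _) (S2_nonneg _)
  have hEt := hE t ⟨ht0, ht.trans htb⟩
  unfold En at hEt ⊢
  have hk := coef_le d lam
  generalize 2 * lam / (2 + sg d) = k at *
  have g1 : k * (PP (v t) - PP (v 0)) ≤ |lam| * (C2 * (2 * η)) := by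
    refine (le_abs_self _).trans ?_
    rw [abs_mul]
    exact mul_le_mul hk e2'' (abs_nonneg _) (abs_nonneg _)
  have g2 := le_abs_self (ip (v t - u : Sch d) (Lap u))
  have g3 : C1 * t ≤ C1 * η := mul_le_mul_of_nonneg_left htη hC10
  clear_value u
  linarith

theorem ip_rho0 (lam : ℝ) (u ψ : Sch d) : ip (rho lam u 0) ψ = Gam lam ψ u := by
  have e : rho lam u 0 = fun x => (-(J (Hop u)) : Sch d) x + (lam : ℂ) * (I * fN u x) := by
    funext x; unfold rho; rw [neg_apply, J_apply, zero_apply]; ring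
  have hf : RD (fun x => I * fN u x) := (fN_rd (rd u)).cmul I
  rw [e, ip_add_left (rd _) (hf.cmul _) (rd ψ), ip_smul_left, ipn, ip_J, ip_H, H_J, neg_neg]
  rfl

theorem ip_h0 (hB : BH lam u0 Φ Ca) (ψ : Sch d) : ∃ C, 0 ≤ C ∧ ∀ (t1 η : ℝ) (h : Sch d), ADM lam u0 Φ Ca t1 η h →
    |ip h ψ - Gam lam ψ u0| ≤ C * η ^ 2 := by
  have hn : 0 ≤ n2 (fun x => (Φ x : ℂ)) * n2 ψ := mul_nonneg n2_nonneg n2_nonneg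
  refine ⟨_, hn, fun t1 η h hA => ?_⟩
  rw [← ip_rho0, ← ip_sub_left (rd h) (rho_rd _ _ _) (rd ψ)]
  refine (ip_le_n2 ((rd h).sub (rho_rd _ _ _)) (rd ψ)).trans ?_
  have := n2_Phi hB.rd hA.ap.sub
  rw [abs_of_nonneg (sq_nonneg η)] at this
  have := mul_le_mul_of_nonneg_right this (n2_nonneg (u := ψ))
  linarith

/-- dilation current of the error -/
theorem L4 (hd : 1 ≤ d) (hv : IsSol lam v) (hb : 0 < b) (hS : ∀ τ ∈ Set.Icc 0 b, S2 (v τ) ≤ S0) (hB : BH lam (v 0) Φ Ca)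
    (hE : ∀ τ ∈ Set.Ioc 0 b, En lam (v τ) = e) :
    ∃ C, 0 ≤ C ∧ ∀ (t1 η : ℝ) (h : Sch d) (t : ℝ), ADM lam (v 0) Φ Ca t1 η h → t1 ≤ b → 0 ≤ t → t ≤ t1 →
      8 * (e - En lam (v 0)) * t - C * (t1 * η) ≤ W (v t - uf (v 0) h 0 t) := by
  obtain ⟨C1, hC10, hC1⟩ := W_exp hd hv hb hS (fun τ hτ => hE τ ⟨hτ.1, hτ.2.le⟩)
  obtain ⟨C2, hC20, hC2⟩ := ip_h0 hB (-(J (A (v 0))))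
  obtain ⟨C3, hC30, hC3⟩ := L2c hd hv hb hS hB
  obtain ⟨C4, hC40, hC4⟩ := S2_h hB
  have hL : 0 ≤ n2 (A (v 0)) := n2_nonneg
  have hCa := hB.C0
  refine ⟨C1 + 4 * C2 + C4 + 4 * (C3 * (n2 (A (v 0)) + Ca)), by positivity, fun t1 η h t hA htb ht0 ht => ?_⟩
  have htI : t ∈ Set.Icc 0 b := ⟨ht0, ht.trans htb⟩
  have hη0 := hA.e0
  have hη1 := hA.e1
  have hη2 : η ^ 2 ≤ η := by nlinarith
  have ht10 := hA.t0
  have htη : t ≤ η := ht.trans (hA.te.trans hη2)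
  have e1 := (abs_le.1 (hC1 t htI)).1
  have e2 := hC2 t1 η h hA
  have e3 := hC3 t1 η h t hA htb ht0 ht
  have e4 := (hC4 t1 η h t hA ht0 ht).2
  set u := uf (v 0) h 0 t with hu
  have f1 : W (v t) - W u = 4 * ip (v t - u : Sch d) (-(J (A u)) : Sch d) + W (v t - u) := by rw [W_sub]; unfold W; ring
  have f2 : W u - W (v 0) = 4 * (t * ip h (-(J (A (v 0))) : Sch d)) + t ^ 2 * W h := by
    have f3 : u - v 0 = t • h := by rw [hu, uf0]; abel
    rw [← W_smul, ← ipm, ← f3, W_sub]; unfold W; ring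
  rw [Gam_A hd] at e2
  have f5 := ip_le_n2 (rd (v t - u)) (rd (-(J (A u))))
  have f6 : n2 (-(J (A u)) : Sch d) ≤ n2 (A (v 0)) + Ca := by
    have : n2 (-(J (A u)) : Sch d) = n2 (A u) := by rw [← n2_J (A u)]; exact n2_neg
    rw [this]
    refine (n2_T_uf A (v 0) h ht0).trans (add_le_add le_rfl ?_)
    refine (mul_le_mul_of_nonneg_right ht n2_nonneg).trans (hA.ap.dil.trans ?_)
    exact mul_le_of_le_one_right hCa (hη2.trans hη1)
  have f7 := f5.trans (mul_le_mul e3 f6 n2_nonneg (by positivity))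
  have f8 := le_abs_self (ip (v t - u : Sch d) (-(J (A u)) : Sch d))
  have g1 : t * (t * |W h|) ≤ t1 * (C4 * η) := mul_le_mul ht (e4.trans (mul_le_mul_of_nonneg_left hη2 hC40)) (by positivity) ht10.le
  have g2 : t ^ 2 * W h ≤ t * (t * |W h|) := by
    have := mul_le_mul_of_nonneg_left (le_abs_self (W h)) (sq_nonneg t); linarith
  have g3 : t * (ip h (-(J (A (v 0))) : Sch d) - (2 * En lam (v 0) - 4 * V (v 0))) ≤ t1 * (C2 * η) := by
    refine (le_abs_self _).trans ?_
    rw [abs_mul, abs_of_nonneg ht0]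
    exact mul_le_mul ht (e2.trans (mul_le_mul_of_nonneg_left hη2 hC20)) (abs_nonneg _) ht10.le
  have g4 : C1 * t ^ 2 ≤ C1 * (t1 * η) := by
    have : t * t ≤ t1 * η := mul_le_mul ht htη ht0 ht10.le
    have := mul_le_mul_of_nonneg_left this hC10
    linarith
  clear_value u
  linarith
end HS

namespace HS
open Complex ComplexConjugate
variable {d : ℕ} {lam : ℝ} {v : ℝ → Sch d} {a b S0 e : ℝ} {u0 : Sch d} {Φ : Ed d → ℝ} {Ca : ℝ}

theorem ip_If_diff (u w : Sch d) {k : Ed d → ℂ} (hk : RD k) :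
    |ip (fun x => I * fN w x) k - ip (fun x => I * fN u x) k| ≤ ∫ x, ‖fN w x - fN u x‖ * ‖k x‖ := by
  have h1 : RD (fun x => I * fN w x) := (fN_rd (rd w)).cmul I
  have h2 : RD (fun x => I * fN u x) := (fN_rd (rd u)).cmul I
  rw [← ip_sub_left h1 h2 hk]
  unfold ip
  rw [← Real.norm_eq_abs]
  refine norm_integral_le_of_norm_le (G := ℝ) ?_ (ae_of_all _ fun x => ?_)
  · exact (((fN_rd (rd w)).sub (fN_rd (rd u))).norm.mul hk.norm.pg).integrable
  · refine (norm_inner_le_norm (𝕜 := ℝ) _ _).trans (le_of_eq ?_)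
    beta_reduce
    rw [← mul_sub, norm_mul, norm_I, one_mul]

theorem n2_Qh (hB : BH lam u0 Φ Ca) : ∃ C, 0 ≤ C ∧ ∀ (t1 η : ℝ) (h : Sch d), ADM lam u0 Φ Ca t1 η h → n2 (Q h) ≤ C := by
  have hΨ : RD (fun x => ‖x‖ ^ 2 * Φ x) := (PG.nrm.pow 2).rmul hB.rd
  refine ⟨n2 (fun x => ((‖x‖ ^ 2 * Φ x : ℝ) : ℂ)), n2_nonneg, fun t1 η h hA => ?_⟩
  have := n2_Phi (f := Q h) (c := 1) hΨ (fun x => by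
    rw [Q_apply, norm_mul, one_mul]
    have h1 := mul_le_mul_of_nonneg_left (hA.ap.le x) (sq_nonneg ‖x‖)
    simpa using h1)
  rwa [abs_one, one_mul] at this

theorem beta_eq (lam : ℝ) (u h : Sch d) : ip h (J (Hop (Q u))) - lam * ip (fun x => I * fN u x) (Q h) + V h
    = 2 * ip h (-(J (A u)) : Sch d) + ip (fun x => h x - rho lam u 0 x) (Q h) := by
  rw [ip_sub_left (rd h) (rho_rd _ _ _) (rd _), ip_rho0, ip_Q_self]
  unfold Gam
  have e1 : ip u (J (Hop (Q h))) = - ip (J (Hop u)) (Q h) := by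
    have := ip_J u (Hop (Q h))
    have h2 := ip_H (J u) (Q h)
    rw [H_J] at h2
    linarith
  have e2 : ip h (J (Hop (Q u))) = ip (J (Hop u)) (Q h) + 2 * ip h (-(J (A u)) : Sch d) := by
    rw [H_Q, map_sub, map_smul, ips', ipm', ← Q_J, ← ip_Q, ip_comm, ipn']; ring
  rw [e1, e2]; ring

set_option maxHeartbeats 800000 in
theorem G5 (hd : 1 ≤ d) (hv : IsSol lam v) (hb : 0 < b) (hS : ∀ τ ∈ Set.Icc 0 b, S2 (v τ) ≤ S0) (hB : BH lam (v 0) Φ Ca) :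
    ∃ C, 0 ≤ C ∧ ∀ (t1 η : ℝ) (h : Sch d) (t : ℝ), ADM lam (v 0) Φ Ca t1 η h → t1 ≤ b → 0 ≤ t → t ≤ t1 →
      |Gam lam (Q (v 0)) (v t) - W (v 0) / 2 - t * (ip h (J (Hop (Q (v 0)))) - lam * ip (fun x => I * fN (v 0) x) (Q h))| ≤ C * (t1 * η) := by
  obtain ⟨C2, hC20, hC2⟩ := L2a hd hv hb hS hB
  obtain ⟨C3, hC30, hC3⟩ := L2c hd hv hb hS hB
  obtain ⟨C4, hC40, hC4⟩ := fN_uf hB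
  obtain ⟨C5, hC50, hC5⟩ := n2_Qh hB
  obtain ⟨C6, hC60, hC6⟩ := FE hd (C2 * b) C2
  obtain ⟨K, hK0, hK⟩ := hB.rd.bdd
  obtain ⟨B, hB0, hBq⟩ := (rd (Q (v 0))).bdd
  have hσ := sg_nonneg (d := d)
  set ψ : Sch d := J (Hop (Q (v 0))) with hψ
  have hn1 : 0 ≤ n2 ψ := n2_nonneg
  have hn2 : 0 ≤ n2 (Q (v 0)) := n2_nonneg
  have hn3 : 0 ≤ n2 (fun x => (Φ x : ℂ)) := n2_nonneg
  set K6 := C6 * (1 + (2 * K) ^ sg d) * (B + n2 (Q (v 0))) with hK6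
  have hK60 : 0 ≤ K6 := by positivity
  refine ⟨C3 * n2 ψ + |lam| * (K6 * C3) + |lam| * (C4 * n2 (fun x => (Φ x : ℂ)) * C5), by positivity, fun t1 η h t hA htb ht0 ht => ?_⟩
  have hη0 := hA.e0
  have hη1 := hA.e1
  have hη2 : η ^ 2 ≤ η := by nlinarith
  have ht10 := hA.t0
  have htη : t ≤ η := ht.trans (hA.te.trans hη2)
  have e2 := hC2 t1 η h t hA htb ht0 ht
  have e3 := hC3 t1 η h t hA htb ht0 ht
  have e4 := hC4 t1 η h t hA ht0 ht
  have e5 := hC5 t1 η h hA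
  have hul := uf_le hB hA ht0 ht
  set u := uf (v 0) h 0 t with hu
  have hu' : u = v 0 + t • h := uf0 _ _ _
  have f1 : ip (v t) ψ = ip (v 0) ψ + t * ip h ψ + ip (v t - u : Sch d) ψ := by
    rw [ips, hu', ipa, ipm]; ring
  have f2 : W (v 0) / 2 = ip (v 0) ψ := by
    rw [← Gam_Q lam (v 0)]; unfold Gam; rw [ip_f_Q, ← hψ]; ring
  have hIf : RD (fun x => I * fN u x) := (fN_rd (rd u)).cmul I
  have hI0 : RD (fun x => I * fN (v 0) x) := (fN_rd (rd (v 0))).cmul I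
  have f3 : ip (fun x => I * fN u x) (Q (v 0)) = - (t * ip (fun x => I * fN u x) (Q h)) := by
    have h1 := ip_f_Q u
    have h2 : ((Q u : Sch d) : Ed d → ℂ) = fun x => Q (v 0) x + (t : ℂ) * Q h x := by
      funext x; rw [hu', map_add, map_smul, add_apply, smul_apply']
    rw [h2, ip_add_right hIf (rd _) ((rd (Q h)).cmul _), ip_smul_right] at h1
    linarith
  have f4 : |ip (fun x => I * fN (v t) x) (Q (v 0)) - ip (fun x => I * fN u x) (Q (v 0))| ≤ K6 * (C3 * (t1 * η)) := by
    refine (ip_If_diff u (v t) (rd _)).trans ?_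
    refine (hC6 u (v t) (Q (v 0)) B ((2 * K) ^ sg d) (rd _) hBq (fun x => ?_) ?_ e2.2).trans ?_
    · refine Real.rpow_le_rpow (norm_nonneg _) ((hul x).trans ?_) hσ
      have := (Real.le_norm_self _).trans (hK x)
      linarith
    · exact e2.1.trans (mul_le_mul_of_nonneg_left (ht.trans htb) hC20)
    · exact mul_le_mul_of_nonneg_left e3 hK60
  have f5 : |ip (fun x => I * fN u x) (Q h) - ip (fun x => I * fN (v 0) x) (Q h)| ≤ (C4 * η * n2 (fun x => (Φ x : ℂ))) * C5 := by
    rw [← ip_sub_left hIf hI0 (rd _)]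
    refine (ip_le_n2 (hIf.sub hI0) (rd _)).trans (mul_le_mul ?_ e5 n2_nonneg (by positivity))
    have := n2_Phi (f := fun x => I * fN u x - I * fN (v 0) x) (c := C4 * t) hB.rd (fun x => by
      rw [← mul_sub, norm_mul, norm_I, one_mul]; exact e4 x)
    rw [abs_of_nonneg (by positivity)] at this
    exact this.trans (mul_le_mul_of_nonneg_right (mul_le_mul_of_nonneg_left htη hC40) hn3)
  have f6 : |ip (v t - u : Sch d) ψ| ≤ C3 * (t1 * η) * n2 ψ :=
    (ip_le_n2 (rd _) (rd _)).trans (mul_le_mul_of_nonneg_right e3 hn1)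
  have key : Gam lam (Q (v 0)) (v t) - W (v 0) / 2 - t * (ip h ψ - lam * ip (fun x => I * fN (v 0) x) (Q h))
      = ip (v t - u : Sch d) ψ + lam * (ip (fun x => I * fN (v t) x) (Q (v 0)) - ip (fun x => I * fN u x) (Q (v 0)))
        - lam * (t * (ip (fun x => I * fN u x) (Q h) - ip (fun x => I * fN (v 0) x) (Q h))) := by
    unfold Gam
    rw [← hψ, f1, f2, f3]; ring
  rw [key]
  refine (abs_sub _ _).trans ((add_le_add (abs_add_le _ _) le_rfl).trans ?_)
  rw [abs_mul, abs_mul, abs_mul, abs_of_nonneg ht0]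
  have g1 := mul_le_mul_of_nonneg_left f4 (abs_nonneg lam)
  have g2 := mul_le_mul_of_nonneg_left (mul_le_mul ht f5 (abs_nonneg _) ht10.le) (abs_nonneg lam)
  clear_value u ψ K6
  linarith

set_option maxHeartbeats 800000 in
theorem L5 (hd : 1 ≤ d) (hv : IsSol lam v) (hb : 0 < b) (hS : ∀ τ ∈ Set.Icc 0 b, S2 (v τ) ≤ S0) (hB : BH lam (v 0) Φ Ca)
    (hE : ∀ τ ∈ Set.Ioc 0 b, En lam (v τ) = e) :
    ∃ C, 0 ≤ C ∧ ∀ (t1 η : ℝ) (h : Sch d) (t : ℝ), ADM lam (v 0) Φ Ca t1 η h → t1 ≤ b → 0 ≤ t → t ≤ t1 →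
      |V (v t - uf (v 0) h 0 t) - 4 * (e - En lam (v 0)) * t ^ 2| ≤ C * (t1 ^ 2 * η) := by
  obtain ⟨C1, hC10, hC1⟩ := V_exp hd hv hb hS (fun τ hτ => hE τ ⟨hτ.1, hτ.2.le⟩)
  obtain ⟨C2, hC20, hC2⟩ := ip_h0 hB (-(J (A (v 0))))
  obtain ⟨C3, hC30, hC3⟩ := L2c hd hv hb hS hB
  obtain ⟨C4, hC40, hC4⟩ := G5 hd hv hb hS hB
  obtain ⟨C5, hC50, hC5⟩ := n2_Qh hB
  have hn3 : 0 ≤ n2 (fun x => (Φ x : ℂ)) := n2_nonneg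
  refine ⟨C1 + 2 * C4 + 2 * (C3 * C5) + 2 * C2 + n2 (fun x => (Φ x : ℂ)) * C5, by positivity, fun t1 η h t hA htb ht0 ht => ?_⟩
  have htI : t ∈ Set.Icc 0 b := ⟨ht0, ht.trans htb⟩
  have hη0 := hA.e0
  have hη1 := hA.e1
  have hη2 : η ^ 2 ≤ η := by nlinarith
  have ht10 := hA.t0
  have htη : t ≤ η := ht.trans (hA.te.trans hη2)
  have e1 := hC1 t htI
  have e2 := hC2 t1 η h hA
  have e3 := hC3 t1 η h t hA htb ht0 ht
  have e5 := hC5 t1 η h hA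
  set β := ip h (J (Hop (Q (v 0)))) - lam * ip (fun x => I * fN (v 0) x) (Q h) with hβ
  have m : |ip (v t) (Q (v 0)) - ip (v 0) (Q (v 0)) - (t * (W (v 0) / 2) + t ^ 2 * (β / 2))| ≤ C4 * (t1 * η) * t := by
    have hP := PLc hd hv hS (Q (v 0))
    have hcon : ContinuousOn (fun s => ip (v s) (Q (v 0)) - (s * (W (v 0) / 2) + s ^ 2 * (β / 2))) (Set.Icc 0 t) := by
      have h1 : ContinuousOn (fun s => ip (v s) (Q (v 0))) (Set.Icc 0 b) := fun s hs => (hP s hs).continuousWithinAt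
      exact (h1.mono (Set.Icc_subset_Icc le_rfl htI.2)).sub (Continuous.continuousOn (by fun_prop))
    have h := mvt0 (f' := fun s => Gam lam (Q (v 0)) (v s) - (W (v 0) / 2 + s * β)) (K := C4 * (t1 * η)) ht0 hcon (fun s hs => ?_) (fun s hs => ?_)
    · simp only [zero_mul, sub_zero, add_zero, ne_eq, OfNat.ofNat_ne_zero, not_false_eq_true, zero_pow] at h
      rw [sub_right_comm] at h
      exact h
    · have h1 := (hP s ⟨hs.1.le, hs.2.le.trans htI.2⟩).hasDerivAt (Icc_mem_nhds hs.1 (hs.2.trans_le htI.2))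
      have h2 : HasDerivAt (fun s : ℝ => s * (W (v 0) / 2) + s ^ 2 * (β / 2)) (1 * (W (v 0) / 2) + (2:ℕ) * s ^ (2-1) * (β / 2)) s :=
        ((hasDerivAt_id s).mul_const _).add ((hasDerivAt_pow 2 s).mul_const _)
      rw [show (1 * (W (v 0) / 2) + (2:ℕ) * s ^ (2-1) * (β / 2)) = W (v 0) / 2 + s * β by norm_num; ring] at h2
      exact h1.sub h2
    · have := hC4 t1 η h s hA htb hs.1.le (hs.2.le.trans ht)
      rw [← sub_sub]; exact this
  set u := uf (v 0) h 0 t with hu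
  have hu' : u = v 0 + t • h := uf0 _ _ _
  have f1 := V_sub (v t) (v 0)
  have f2 : V (v t - v 0) - V (v t - u) = 2 * (t * ip (v t - u : Sch d) (Q h)) + t ^ 2 * V h := by
    have hz : (v t - v 0) - (v t - u) = t • h := by rw [hu']; abel
    rw [V_sub, hz, V_smul, ipm, ← ip_Q, ip_comm]
  rw [ips] at f1
  have f3 := beta_eq lam (v 0) h
  rw [← hβ] at f3
  rw [Gam_A hd] at e2
  have f4 : |ip (fun x => h x - rho lam (v 0) 0 x) (Q h)| ≤ (η * n2 (fun x => (Φ x : ℂ))) * C5 := by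
    refine (ip_le_n2 ((rd h).sub (rho_rd _ _ _)) (rd _)).trans (mul_le_mul ?_ e5 n2_nonneg (by positivity))
    have := n2_Phi hB.rd hA.ap.sub
    rw [abs_of_nonneg (sq_nonneg η)] at this
    exact this.trans (mul_le_mul_of_nonneg_right hη2 hn3)
  have f5 : |ip (v t - u : Sch d) (Q h)| ≤ C3 * (t1 * η) * C5 :=
    (ip_le_n2 (rd _) (rd _)).trans (mul_le_mul e3 e5 n2_nonneg (by positivity))
  have key : V (v t - u) - 4 * (e - En lam (v 0)) * t ^ 2
      = (V (v t) - V (v 0) - t * W (v 0) - t ^ 2 * (4 * e - 8 * V (v 0)))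
        - 2 * (ip (v t) (Q (v 0)) - ip (v 0) (Q (v 0)) - (t * (W (v 0) / 2) + t ^ 2 * (β / 2)))
        - 2 * (t * ip (v t - u : Sch d) (Q h)) - t ^ 2 * (2 * (ip h (-(J (A (v 0))) : Sch d) - (2 * En lam (v 0) - 4 * V (v 0)))
          + ip (fun x => h x - rho lam (v 0) 0 x) (Q h)) := by
    have : β = 2 * ip h (-(J (A (v 0))) : Sch d) + ip (fun x => h x - rho lam (v 0) 0 x) (Q h) - V h := by linarith
    rw [this]
    linear_combination (-1) * f2 - f1
  rw [key]
  generalize V (v t) - V (v 0) - t * W (v 0) - t ^ 2 * (4 * e - 8 * V (v 0)) = q1 at *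
  generalize ip (v t) (Q (v 0)) - ip (v 0) (Q (v 0)) - (t * (W (v 0) / 2) + t ^ 2 * (β / 2)) = q2 at *
  generalize ip (v t - u : Sch d) (Q h) = q3 at *
  generalize (ip h (-(J (A (v 0))) : Sch d) - (2 * En lam (v 0) - 4 * V (v 0))) = q4 at *
  generalize ip (fun x => h x - rho lam (v 0) 0 x) (Q h) = q5 at *
  generalize n2 (fun x => (Φ x : ℂ)) = N at *
  clear f1 f2 f3 key
  clear_value u β
  have t2 : t ^ 2 ≤ t1 ^ 2 := pow_le_pow_left₀ ht0 ht 2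
  have p1 : |q1| ≤ C1 * (t1 ^ 2 * η) := by
    refine e1.trans (mul_le_mul_of_nonneg_left ?_ hC10)
    have := mul_le_mul t2 htη ht0 (sq_nonneg t1)
    linarith
  have p2 : |q2| ≤ C4 * (t1 ^ 2 * η) := by
    refine m.trans ?_
    have := mul_le_mul_of_nonneg_left ht (by positivity : 0 ≤ C4 * (t1 * η))
    linarith
  have p3 : t * |q3| ≤ C3 * C5 * (t1 ^ 2 * η) := by
    have := mul_le_mul ht f5 (abs_nonneg _) ht10.le
    linarith
  have p4 : t ^ 2 * |q4| ≤ C2 * (t1 ^ 2 * η) := by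
    have := mul_le_mul t2 (e2.trans (mul_le_mul_of_nonneg_left hη2 hC20)) (abs_nonneg _) (sq_nonneg t1)
    linarith
  have p5 : t ^ 2 * |q5| ≤ N * C5 * (t1 ^ 2 * η) := by
    have := mul_le_mul t2 f4 (abs_nonneg _) (sq_nonneg t1)
    linarith
  rw [show q1 - 2 * q2 - 2 * (t * q3) - t ^ 2 * (2 * q4 + q5) = q1 + (-(2 * q2) + (-(2 * (t * q3)) + (-(2 * (t ^ 2 * q4)) + -(t ^ 2 * q5)))) by ring]
  refine (abs_add_le _ _).trans ?_
  refine (add_le_add le_rfl ((abs_add_le _ _).trans (add_le_add le_rfl ((abs_add_le _ _).trans (add_le_add le_rfl (abs_add_le _ _)))))).trans ?_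
  simp only [abs_neg, abs_mul, abs_two, abs_of_nonneg ht0, abs_of_nonneg (sq_nonneg t)]
  linarith
end HS

namespace HS
open Complex ComplexConjugate
variable {d : ℕ} {lam : ℝ} {v : ℝ → Sch d} {a b S0 e : ℝ} {u0 : Sch d} {Φ : Ed d → ℝ} {Ca : ℝ}

theorem Zbd (hd : 1 ≤ d) (hv : IsSol lam v) (hb : 0 < b) (hS : ∀ τ ∈ Set.Icc 0 b, S2 (v τ) ≤ S0) (hB : BH lam (v 0) Φ Ca)
    (hE : ∀ τ ∈ Set.Ioc 0 b, En lam (v τ) = e) :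
    ∃ C, 0 ≤ C ∧ ∀ (t1 η : ℝ) (h : Sch d) (t : ℝ), ADM lam (v 0) Φ Ca t1 η h → t1 ≤ b → 0 < t → t ≤ t1 →
      Zq t (v t - uf (v 0) h 0 t) ≤ C * (t1 ^ 2 * η) ∧ V (v t - uf (v 0) h 0 t) ≤ C * t1 ^ 2 := by
  obtain ⟨C3, hC30, hC3⟩ := L3 hd hv hb hS hB hE
  obtain ⟨C4, hC40, hC4⟩ := L4 hd hv hb hS hB hE
  obtain ⟨C5, hC50, hC5⟩ := L5 hd hv hb hS hB hE
  refine ⟨C5 + C4 + 4 * C3 + 4 * |e - En lam (v 0)|, by positivity, fun t1 η h t hA htb ht0 ht => ?_⟩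
  have e3 := hC3 t1 η h t hA htb ht0 ht
  have e4 := hC4 t1 η h t hA htb ht0.le ht
  have e5 := (abs_le.1 (hC5 t1 η h t hA htb ht0.le ht)).2
  have hη0 := hA.e0
  have hη1 := hA.e1
  have ht10 := hA.t0
  unfold Zq
  generalize v t - uf (v 0) h 0 t = w at *
  generalize e - En lam (v 0) = κ at *
  have t2 : t ^ 2 ≤ t1 ^ 2 := pow_le_pow_left₀ ht0.le ht 2
  have g1 := mul_le_mul_of_nonneg_left e4 ht0.le
  have g2 := mul_le_mul_of_nonneg_left e3 (sq_nonneg t)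
  have g3 : t * (C4 * (t1 * η)) ≤ t1 * (C4 * (t1 * η)) := mul_le_mul_of_nonneg_right ht (by positivity)
  have g4 : t ^ 2 * (C3 * η) ≤ t1 ^ 2 * (C3 * η) := mul_le_mul_of_nonneg_right t2 (by positivity)
  have g5 : 0 ≤ 4 * |κ| * (t1 ^ 2 * η) := by positivity
  have g6 : κ * t ^ 2 ≤ |κ| * t1 ^ 2 := mul_le_mul (le_abs_self _) t2 (sq_nonneg _) (abs_nonneg _)
  have g7 : C5 * (t1 ^ 2 * η) ≤ C5 * t1 ^ 2 := mul_le_mul_of_nonneg_left (mul_le_of_le_one_right (sq_nonneg _) hη1) hC50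
  have g8 : 0 ≤ (C4 + 4 * C3) * t1 ^ 2 := by positivity
  constructor
  · linarith
  · linarith

set_option maxHeartbeats 800000 in
theorem ST5 (hd : 1 ≤ d) (hv : IsSol lam v) (hb : 0 < b) (hS : ∀ τ ∈ Set.Icc 0 b, S2 (v τ) ≤ S0) (hB : BH lam (v 0) Φ Ca)
    (hE : ∀ τ ∈ Set.Ioc 0 b, En lam (v τ) = e) :
    ∃ C, 0 ≤ C ∧ ∀ (t1 η : ℝ) (h : Sch d) (n : ℕ), ADM lam (v 0) Φ Ca t1 η h → t1 ≤ b →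
      (∫ x, th (n:ℝ) x ^ 2 * ‖(v t1 - uf (v 0) h 0 t1 : Sch d) x‖ ^ 2) / t1 ^ 2
        ≤ (∫ x, th (n:ℝ) x ^ 2 * ‖(v (t1/2) - uf (v 0) h 0 (t1/2) : Sch d) x‖ ^ 2) / (t1/2) ^ 2 + C * √η := by
  obtain ⟨C1, hC10, hC1⟩ := Zbd hd hv hb hS hB hE
  obtain ⟨C2, hC20, hC2⟩ := L2b hd hv hb hS hB
  obtain ⟨C3, hC30, hC3⟩ := L1 hB
  refine ⟨16 * C1 + 8 * (|lam| * C2 + √C1 * C3), by positivity, fun t1 η h n hA htb => ?_⟩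
  have ht10 := hA.t0
  have hη0 := hA.e0
  have hη1 := hA.e1
  have hη2 : η ^ 2 ≤ √η := by
    refine Real.le_sqrt_of_sq_le ?_
    calc (η ^ 2) ^ 2 = η * η ^ 3 := by ring
      _ ≤ η * 1 := mul_le_mul_of_nonneg_left (pow_le_one₀ hη0.le hη1) hη0.le
      _ = η := mul_one _
  set q : ℝ → ℝ := fun t => ∫ x, th (n:ℝ) x ^ 2 * ‖(v t - uf (v 0) h 0 t : Sch d) x‖ ^ 2 with hq
  set F : ℝ → ℝ := fun t => ∫ x, th (n:ℝ) x * ∑ i, lineDeriv ℝ (th (n:ℝ)) x (stdBasis i) *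
        (conj ((v t - uf (v 0) h 0 t : Sch d) x) * pd (v t - uf (v 0) h 0 t : Sch d) i x).im with hF
  set G : ℝ → ℝ := fun t => ∫ x, th (n:ℝ) x ^ 2 * (conj ((v t - uf (v 0) h 0 t : Sch d) x) * Ff lam (uf (v 0) h 0 t) (v t) h x).re with hG
  have hder : ∀ t, HasDerivAt q (4 * F t + 2 * G t) t := fun t => LW hv (v 0) h 0 (th_lip (n:ℝ)) (th_supp _) t
  have hd2 : ∀ t, 0 < t → HasDerivAt (fun t => q t / t ^ 2) (((4 * F t + 2 * G t) * t ^ 2 - q t * ((2:ℕ) * t ^ (2-1))) / (t ^ 2) ^ 2) t := fun t ht =>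
    (hder t).div (hasDerivAt_pow 2 t) (by positivity)
  have hlt : t1 / 2 < t1 := by linarith
  obtain ⟨c, hc, hc2⟩ := exists_hasDerivAt_eq_slope (fun t => q t / t ^ 2) _ hlt
    (fun t ht => (hd2 t (by have := ht.1; linarith)).continuousAt.continuousWithinAt) (fun t ht => hd2 t (by have := ht.1; linarith))
  have hc0 : 0 < c := by have := hc.1; linarith
  have hct := hc.2.le
  have e1 := hC1 t1 η h c hA htb hc0 hct
  have e2 := (hC2 t1 η h c hA htb hc0.le hct).1
  have e3 := (hC3 t1 η h c hA hc0.le hct).2.2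
  have hFc : 2 * c * F c ≤ q c + √(q c) * √(Zq c (v c - uf (v 0) h 0 c)) := FLZ (n:ℝ) c (v c - uf (v 0) h 0 c)
  have hGc : |G c| ≤ |lam| * NLf (th (n:ℝ)) (uf (v 0) h 0 c) (v c) + √(q c) * √(∫ x, th (n:ℝ) x ^ 2 * ‖rho lam (uf (v 0) h 0 c) h x‖ ^ 2) :=
    LWb (lam := lam) (uf (v 0) h 0 c) (v c) h (th_cont _) (th_supp _)
  have hN : NLf (th (n:ℝ)) (uf (v 0) h 0 c) (v c) ≤ C2 * (t1 * η ^ 2) := by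
    refine le_trans ?_ e2
    have hr : RD (fun x => ‖uf (v 0) h 0 c x‖ * |‖v c x‖ ^ sg d - ‖uf (v 0) h 0 c x‖ ^ sg d| * ‖(v c - uf (v 0) h 0 c : Sch d) x‖) := by
      have h1 := ((rd (uf (v 0) h 0 c)).norm.mul ((powsg_rd hd (rd (v c))).sub (powsg_rd hd (rd (uf (v 0) h 0 c)))).norm.pg).mul (rd (v c - uf (v 0) h 0 c : Sch d)).norm.pg
      exact h1
    have hi := ((PG.nrm.pow 2).rmul hr).integrable
    refine integral_mono (hi.mono (((th_cont _).pow 2).mul hr.cont).aestronglyMeasurable (ae_of_all _ fun x => ?_)) hi (fun x => ?_)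
    · rw [norm_mul, norm_mul (‖x‖ ^ 2)]
      refine mul_le_mul_of_nonneg_right ?_ (norm_nonneg _)
      rw [norm_pow, norm_pow, Real.norm_of_nonneg (th_nonneg _ _), norm_norm]
      exact pow_le_pow_left₀ (th_nonneg _ _) (th_le _ _) 2
    · refine mul_le_mul_of_nonneg_right (pow_le_pow_left₀ (th_nonneg _ _) (th_le _ _) 2) (by positivity)
  have hr := (th_n2_le n (rho_rd lam (uf (v 0) h 0 c) h)).trans e3
  have hqV : √(q c) ≤ √C1 * t1 := by
    refine (th_n2_le n (rd (v c - uf (v 0) h 0 c : Sch d))).trans ?_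
    rw [← Real.sqrt_sq ht10.le, ← Real.sqrt_mul hC10]
    exact Real.sqrt_le_sqrt e1.2
  have hZ : √(Zq c (v c - uf (v 0) h 0 c)) ≤ √C1 * t1 * √η := by
    rw [mul_assoc, ← Real.sqrt_sq (show 0 ≤ t1 from ht10.le), ← Real.sqrt_mul (sq_nonneg _), ← Real.sqrt_mul hC10]
    exact Real.sqrt_le_sqrt e1.1
  have k1 : √(q c) * √(Zq c (v c - uf (v 0) h 0 c)) ≤ C1 * t1 ^ 2 * √η := by
    refine (mul_le_mul hqV hZ (Real.sqrt_nonneg _) (by positivity)).trans (le_of_eq ?_)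
    calc _ = (√C1 * √C1) * t1 ^ 2 * √η := by ring
      _ = _ := by rw [Real.mul_self_sqrt hC10]
  have k2 : |G c| ≤ (|lam| * C2 + √C1 * C3) * t1 * √η := by
    have a1 := mul_le_mul_of_nonneg_left hN (abs_nonneg lam)
    have a2 := mul_le_mul hqV hr (Real.sqrt_nonneg _) (by positivity)
    have a3 : (|lam| * C2 + √C1 * C3) * t1 * η ^ 2 ≤ (|lam| * C2 + √C1 * C3) * t1 * √η := mul_le_mul_of_nonneg_left hη2 (by positivity)
    linarith
  have k2' := (le_abs_self _).trans k2
  -- slope bound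
  have hslope : ((4 * F c + 2 * G c) * c ^ 2 - q c * ((2:ℕ) * c ^ (2-1))) / (c ^ 2) ^ 2 ≤ 2 * ((16 * C1 + 8 * (|lam| * C2 + √C1 * C3)) * √η) / t1 := by
    have b1 : (4 * F c + 2 * G c) * c ^ 2 - q c * ((2:ℕ) * c ^ (2-1)) ≤ 2 * c * (C1 * t1 ^ 2 * √η) + 2 * c ^ 2 * ((|lam| * C2 + √C1 * C3) * t1 * √η) := by
      have b2 := mul_le_mul_of_nonneg_left hFc (by positivity : 0 ≤ 2 * c)
      have b3 := mul_le_mul_of_nonneg_left k1 (by positivity : 0 ≤ 2 * c)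
      have b4 := mul_le_mul_of_nonneg_left k2' (by positivity : 0 ≤ 2 * c ^ 2)
      norm_num
      linarith
    set P := |lam| * C2 + √C1 * C3 with hP
    have hP0 : 0 ≤ P := by positivity
    have hs0 := Real.sqrt_nonneg η
    have hcc : t1 ≤ 2 * c := by have := hc.1; linarith
    rw [div_le_div_iff₀ (by positivity) ht10]
    have c2 : t1 ^ 2 ≤ 4 * c ^ 2 := by nlinarith
    have c3 : t1 ^ 3 ≤ 8 * c ^ 3 := by
      have := pow_le_pow_left₀ ht10.le hcc 3
      linarith
    have d1 := mul_le_mul_of_nonneg_right b1 ht10.le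
    have d2 := mul_le_mul_of_nonneg_left c3 (by positivity : 0 ≤ 2 * c * C1 * √η)
    have d3 := mul_le_mul_of_nonneg_left c2 (by positivity : 0 ≤ 2 * c ^ 2 * P * √η)
    have d4 : 0 ≤ C1 * √η * c ^ 4 := by positivity
    have d5 : 0 ≤ P * √η * c ^ 4 := by positivity
    linarith
  rw [hc2] at hslope
  rw [show t1 - t1/2 = t1/2 by ring, div_le_iff₀ (by positivity)] at hslope
  have : 2 * ((16 * C1 + 8 * (|lam| * C2 + √C1 * C3)) * √η) / t1 * (t1 / 2) = (16 * C1 + 8 * (|lam| * C2 + √C1 * C3)) * √η := by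
    field_simp
  rw [this] at hslope
  linarith

/-- dyadic iteration -/
theorem dyad {g : ℝ → ℝ} {C γ τ0 : ℝ} (hγ : 0 < γ) (hC : 0 ≤ C) (h : ∀ τ, 0 < τ → τ ≤ τ0 → g τ ≤ g (τ/2) + C * τ ^ γ)
    (hl : Tendsto g (nhdsWithin 0 (Set.Ioi 0)) (nhds 0)) : ∃ K, K = C / (1 - 2 ^ (-γ)) ∧ 0 ≤ K ∧ ∀ τ, 0 < τ → τ ≤ τ0 → g τ ≤ K * τ ^ γ := by
  have hr1 : (2:ℝ) ^ (-γ) < 1 := Real.rpow_lt_one_of_one_lt_of_neg (by norm_num) (by linarith)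
  have hr : 0 < 1 - (2:ℝ) ^ (-γ) := by linarith
  set K := C / (1 - 2 ^ (-γ)) with hK
  have hK0 : 0 ≤ K := by positivity
  have hKC : K - K * 2 ^ (-γ) = C := by rw [hK]; field_simp
  refine ⟨K, rfl, hK0, fun τ hτ0 hτ => ?_⟩
  have hstep : ∀ k : ℕ, g τ - K * τ ^ γ ≤ g (τ / 2 ^ k) - K * (τ / 2 ^ k) ^ γ := by
    intro k
    induction k with
    | zero => simp
    | succ k ih =>
      refine ih.trans ?_
      have hp : 0 < τ / 2 ^ k := by positivity
      have hle : τ / 2 ^ k ≤ τ0 := (div_le_self hτ0.le (one_le_pow₀ (by norm_num))).trans hτ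
      have h1 := h _ hp hle
      have h2 : τ / 2 ^ (k+1) = τ / 2 ^ k / 2 := by rw [pow_succ, div_div]
      rw [h2]
      have h3 : (τ / 2 ^ k / 2) ^ γ = (τ / 2 ^ k) ^ γ * 2 ^ (-γ) := by
        rw [Real.div_rpow hp.le (by norm_num), Real.rpow_neg (by norm_num), div_eq_mul_inv]
      rw [h3]
      have h4 : K * (τ / 2 ^ k) ^ γ - K * ((τ / 2 ^ k) ^ γ * 2 ^ (-γ)) = C * (τ / 2 ^ k) ^ γ := by rw [← hKC]; ring
      linarith
  have hlim : Tendsto (fun k : ℕ => τ / 2 ^ k) atTop (nhdsWithin 0 (Set.Ioi 0)) := by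
    refine tendsto_nhdsWithin_iff.2 ⟨?_, Eventually.of_forall fun k => by show 0 < τ / 2 ^ k; positivity⟩
    exact tendsto_const_nhds.div_atTop (tendsto_pow_atTop_atTop_of_one_lt (by norm_num))
  have h5 := ge_of_tendsto (x := atTop) (hl.comp hlim) (b := g τ - K * τ ^ γ) (Eventually.of_forall fun k => by
    have := hstep k
    have h6 : 0 ≤ K * (τ / 2 ^ k) ^ γ := by positivity
    show _ ≤ g (τ / 2 ^ k)
    linarith)
  linarith

theorem rho0_deriv (hv : IsSol lam v) (t : ℝ) (x : Ed d) : deriv (fun s => v s x) t = rho lam (v t) 0 x := by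
  rw [sol_form hv]
  unfold rho
  rw [Hop_eq, sub_apply, Q_apply, Lap_apply, zero_apply]
  unfold fN
  push_cast
  ring

end HS

namespace HS
open Complex ComplexConjugate
variable {d : ℕ} {lam : ℝ} {v : ℝ → Sch d} {a b S0 e : ℝ} {u0 : Sch d} {Φ : Ed d → ℝ} {Ca : ℝ}

/-- weighted difference quotient -/
def gq (lam : ℝ) (v : ℝ → Sch d) (n : ℕ) (τ : ℝ) : ℝ :=
  (∫ x, th (n:ℝ) x ^ 2 * ‖v τ x - v 0 x - (τ : ℂ) * rho lam (v 0) 0 x‖ ^ 2) / τ ^ 2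

theorem time_lip (hv : IsSol lam v) (r : ℝ) : ∃ M, 0 ≤ M ∧ ∀ τ ∈ Set.Icc (0:ℝ) 1, ∀ x : Ed d, ‖x‖ ≤ r → ‖v τ x - v 0 x‖ ≤ M * τ := by
  set f : ℝ × Ed d → ℂ := fun p => v p.1 p.2 with hf
  have hs : ContDiff ℝ (⊤ : ℕ∞) f := hv.smooth
  have hdc : Continuous (fderiv ℝ f) := hs.continuous_fderiv (by simp)
  obtain ⟨M, hM⟩ := ((isCompact_Icc (a := (0:ℝ)) (b := 1)).prod (isCompact_closedBall (0 : Ed d) r)).exists_bound_of_continuousOn hdc.continuousOn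
  refine ⟨max M 0, le_max_right _ _, fun τ hτ x hx => ?_⟩
  have hconv : Convex ℝ (Set.Icc (0:ℝ) 1 ×ˢ Metric.closedBall (0 : Ed d) r) := (convex_Icc _ _).prod (convex_closedBall _ _)
  have h1 := hconv.norm_image_sub_le_of_norm_fderiv_le (f := f) (C := max M 0) (x := ((0:ℝ), x)) (y := (τ, x))
    (fun p _ => hs.differentiable (by simp) p) (fun p hp => (hM p hp).trans (le_max_left _ _))
    ⟨⟨le_rfl, zero_le_one⟩, by simpa using hx⟩ ⟨hτ, by simpa using hx⟩
  refine h1.trans (le_of_eq ?_)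
  simp [Prod.norm_def, abs_of_nonneg hτ.1]
  exact Or.inl hτ.1

theorem gq_tendsto (hv : IsSol lam v) (n : ℕ) : Tendsto (gq lam v n) (nhdsWithin 0 (Set.Ioi 0)) (nhds 0) := by
  obtain ⟨M, hM0, hM⟩ := time_lip hv (2 * n)
  obtain ⟨B, hB0, hB⟩ := (rho_rd lam (v 0) 0).bdd
  have e0 : ∀ τ, gq lam v n τ = ∫ x, th (n:ℝ) x ^ 2 * ‖v τ x - v 0 x - (τ : ℂ) * rho lam (v 0) 0 x‖ ^ 2 / τ ^ 2 := fun τ => by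
    unfold gq; rw [← integral_div]
  have h : Tendsto (fun τ => ∫ x, th (n:ℝ) x ^ 2 * ‖v τ x - v 0 x - (τ : ℂ) * rho lam (v 0) 0 x‖ ^ 2 / τ ^ 2) (nhdsWithin 0 (Set.Ioi 0)) (nhds (∫ x : Ed d, (0:ℝ))) := by
    refine tendsto_integral_filter_of_dominated_convergence (fun x => th (n:ℝ) x ^ 2 * (M + B) ^ 2) (Eventually.of_forall fun τ => ?_) ?_ ?_ (ae_of_all _ fun x => ?_)
    · have hc : Continuous (fun x => v τ x - v 0 x - (τ : ℂ) * rho lam (v 0) 0 x) :=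
        ((rd _).cont.sub (rd _).cont).sub (continuous_const.mul (rho_rd lam (v 0) 0).cont)
      exact ((((th_cont _).pow 2).mul (hc.norm.pow 2)).div_const _).aestronglyMeasurable
    · have : Set.Ioo (0:ℝ) 1 ∈ nhdsWithin (0:ℝ) (Set.Ioi 0) := Ioo_mem_nhdsGT one_pos
      filter_upwards [this] with τ hτ
      refine ae_of_all _ fun x => ?_
      have hτ0 := hτ.1
      rw [Real.norm_of_nonneg (by positivity), mul_div_assoc]
      rcases le_total ‖x‖ (2 * n) with hx | hx
      · refine mul_le_mul_of_nonneg_left ?_ (sq_nonneg _)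
        rw [← div_pow]
        refine pow_le_pow_left₀ (by positivity) ?_ 2
        rw [div_le_iff₀ hτ0]
        refine (norm_sub_le _ _).trans ?_
        rw [norm_mul, Complex.norm_real, Real.norm_of_nonneg hτ0.le]
        have h1 := hM τ ⟨hτ.1.le, hτ.2.le⟩ x hx
        have h2 := mul_le_mul_of_nonneg_left (hB x) hτ0.le
        linarith
      · rw [th_zero hx]; simp
    · refine Continuous.integrable_of_hasCompactSupport (((th_cont _).pow 2).mul continuous_const) ?_
      have : HasCompactSupport (fun x : Ed d => th (n:ℝ) x ^ 2) := (th_supp _).comp_left (g := fun y : ℝ => y ^ 2) (by simp)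
      exact this.mul_right
    · have hdv := time_hasDerivAt (w := fun s x => v s x) hv.smooth 0 x
      rw [rho0_deriv hv] at hdv
      have h1 := (hasDerivAt_iff_tendsto_slope.1 hdv).mono_left (nhdsWithin_mono 0 (fun τ (hτ : 0 < τ) => ne_of_gt hτ) : nhdsWithin (0:ℝ) (Set.Ioi 0) ≤ _)
      have h2 : Tendsto (fun τ => th (n:ℝ) x ^ 2 * ‖slope (fun s => v s x) 0 τ - rho lam (v 0) 0 x‖ ^ 2) (nhdsWithin 0 (Set.Ioi 0)) (nhds (th (n:ℝ) x ^ 2 * ‖rho lam (v 0) 0 x - rho lam (v 0) 0 x‖ ^ 2)) :=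
        ((h1.sub_const _).norm.pow 2).const_mul _
      rw [sub_self, norm_zero, zero_pow two_ne_zero, mul_zero] at h2
      refine h2.congr' ?_
      filter_upwards [self_mem_nhdsWithin] with τ hτ
      have hτ0 : (0:ℝ) < τ := hτ
      have hτc : (τ : ℂ) ≠ 0 := by exact_mod_cast hτ0.ne'
      rw [mul_div_assoc, ← div_pow]
      congr 2
      have : slope (fun s => v s x) 0 τ - rho lam (v 0) 0 x = (v τ x - v 0 x - (τ : ℂ) * rho lam (v 0) 0 x) / (τ : ℂ) := by
        rw [slope_def_module, sub_zero, Complex.real_smul, Complex.ofReal_inv, sub_div, mul_div_cancel_left₀ _ hτc]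
        congr 1
        rw [div_eq_inv_mul]
      rw [this, norm_div, Complex.norm_real, Real.norm_of_nonneg hτ0.le]
  rw [integral_zero] at h
  exact h.congr fun τ => (e0 τ).symm

theorem pn_eq (n : ℕ) (f : Ed d → ℂ) : √(∫ x, th (n:ℝ) x ^ 2 * ‖f x‖ ^ 2) = n2 (fun x => (th (n:ℝ) x : ℂ) * f x) := by
  unfold n2
  congr 1
  refine integral_congr_ae (Eventually.of_forall fun x => ?_)
  simp only []
  rw [norm_mul, Complex.norm_real, mul_pow, Real.norm_eq_abs, sq_abs]

theorem th_rd (n : ℕ) {f : Ed d → ℂ} (hf : RD f) : RD (fun x => (th (n:ℝ) x : ℂ) * f x) := by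
  refine (PG.nrm.ofReal.rmul hf).of_le ((continuous_ofReal.comp (th_cont _)).mul hf.cont) (fun x => ?_)
  rw [norm_mul, norm_mul, Complex.norm_real, Complex.norm_real, norm_norm, Real.norm_of_nonneg (th_nonneg _ _)]
  exact mul_le_mul_of_nonneg_right (th_le _ _) (norm_nonneg _)

theorem pn_add (n : ℕ) {f g : Ed d → ℂ} (hf : RD f) (hg : RD g) :
    √(∫ x, th (n:ℝ) x ^ 2 * ‖f x + g x‖ ^ 2) ≤ √(∫ x, th (n:ℝ) x ^ 2 * ‖f x‖ ^ 2) + √(∫ x, th (n:ℝ) x ^ 2 * ‖g x‖ ^ 2) := by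
  rw [pn_eq, pn_eq, pn_eq]
  have := n2_add_le (th_rd n hf) (th_rd n hg)
  simpa only [mul_add] using this

theorem gq_cmp (hB : BH lam (v 0) Φ Ca) : ∃ N, 0 ≤ N ∧ ∀ (t1 η : ℝ) (h : Sch d) (n : ℕ) (t : ℝ), ADM lam (v 0) Φ Ca t1 η h → 0 < t →
    |√(∫ x, th (n:ℝ) x ^ 2 * ‖(v t - uf (v 0) h 0 t : Sch d) x‖ ^ 2) / t - √(gq lam v n t)| ≤ N * η ^ 2 := by
  have hΨ : RD (fun x => ‖x‖ * Φ x) := PG.nrm.rmul hB.rd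
  refine ⟨n2 (fun x => ((‖x‖ * Φ x : ℝ) : ℂ)), n2_nonneg, fun t1 η h n t hA ht0 => ?_⟩
  set N := n2 (fun x => ((‖x‖ * Φ x : ℝ) : ℂ)) with hN
  set f1 : Ed d → ℂ := ⇑(v t - uf (v 0) h 0 t : Sch d) with hf1
  set f2 : Ed d → ℂ := fun x => v t x - v 0 x - (t : ℂ) * rho lam (v 0) 0 x with hf2
  set f3 : Ed d → ℂ := fun x => (t : ℂ) * (h x - rho lam (v 0) 0 x) with hf3
  have r1 : RD f1 := rd _
  have r2 : RD f2 := ((rd _).sub (rd _)).sub ((rho_rd _ _ _).cmul _)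
  have r3 : RD f3 := ((rd _).sub (rho_rd _ _ _)).cmul _
  have e12 : ∀ x, f2 x = f1 x + f3 x := fun x => by
    simp only [hf1, hf2, hf3]
    rw [sub_apply, uf0, add_apply, smul_apply']; ring
  have e21 : ∀ x, f1 x = f2 x + -f3 x := fun x => by rw [e12]; ring
  have b3 : √(∫ x, th (n:ℝ) x ^ 2 * ‖f3 x‖ ^ 2) ≤ N * η ^ 2 * t := by
    refine (th_n2_le n r3).trans ?_
    rw [nx_eq]
    have := n2_Phi (f := fun x => (‖x‖ : ℂ) * f3 x) (c := η ^ 2 * t) hΨ (fun x => by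
      rw [norm_mul, Complex.norm_real, norm_norm, hf3]
      beta_reduce
      rw [norm_mul, Complex.norm_real, Real.norm_of_nonneg ht0.le]
      have := mul_le_mul_of_nonneg_left (hA.ap.sub x) (by positivity : 0 ≤ ‖x‖ * t)
      linarith)
    rw [abs_of_nonneg (by positivity)] at this
    linarith
  have a1 := pn_add n r1 r3
  have a2 := pn_add n r2 r3.neg
  simp only [← e12] at a1
  simp only [← e21, norm_neg] at a2
  have hg : √(gq lam v n t) = √(∫ x, th (n:ℝ) x ^ 2 * ‖f2 x‖ ^ 2) / t := by
    unfold gq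
    rw [Real.sqrt_div' _ (sq_nonneg t), Real.sqrt_sq ht0.le]
  rw [hg, ← sub_div, abs_div, abs_of_pos ht0, div_le_iff₀ ht0]
  exact abs_le.2 ⟨by linarith, by linarith⟩

set_option maxHeartbeats 800000 in
theorem U1 (hd : 1 ≤ d) (hv : IsSol lam v) (hb : 0 < b) (hS : ∀ τ ∈ Set.Icc 0 b, S2 (v τ) ≤ S0)
    (hE : ∀ τ ∈ Set.Ioc 0 b, En lam (v τ) = e) : e ≤ En lam (v 0) := by
  obtain ⟨Φ, Ca, δ, hΦ, hΦu, hΦh, hCa, hδ0, hδ8, hδs, hap⟩ := PKG hd lam (v 0)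
  have hB : BH lam (v 0) Φ Ca := ⟨hΦ, hΦu, hΦh, hCa⟩
  have hadm : ∀ t1 : ℝ, 0 < t1 → t1 ≤ 1 → ∃ h, ADM lam (v 0) Φ Ca t1 (t1 ^ δ) h := fun t1 h0 h1 => by
    obtain ⟨h, hh⟩ := hap t1 h0 h1
    have e2 : (t1 ^ δ) ^ 2 = t1 ^ (2 * δ) := by
      rw [← Real.rpow_natCast, ← Real.rpow_mul h0.le]; congr 1; push_cast; ring
    refine ⟨h, h0, h1, by positivity, Real.rpow_le_one h0.le h1 hδ0.le, ?_, ?_, ?_, hh⟩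
    · rw [e2]
      calc t1 = t1 ^ (1:ℝ) := (Real.rpow_one _).symm
        _ ≤ _ := Real.rpow_le_rpow_of_exponent_ge h0 h1 (by linarith)
    · rw [e2]; exact Real.rpow_le_rpow_of_exponent_ge h0 h1 (by linarith)
    · exact Real.rpow_le_rpow_of_exponent_ge h0 h1 hδs
  obtain ⟨C1, hC10, hC1⟩ := ST5 hd hv hb hS hB hE
  obtain ⟨N, hN0, hN⟩ := gq_cmp (v := v) hB
  obtain ⟨C2, hC20, hC2⟩ := Zbd hd hv hb hS hB hE
  obtain ⟨C3, hC30, hC3⟩ := L5 hd hv hb hS hB hE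
  set τ0 := min b 1 with hτ0
  have hτ00 : 0 < τ0 := lt_min hb one_pos
  set γ := δ / 2 with hγ
  have hγ0 : 0 < γ := by positivity
  set Y := √C2 with hY
  have hY0 : 0 ≤ Y := Real.sqrt_nonneg _
  have hsq : ∀ t : ℝ, 0 < t → √(t ^ δ) = t ^ γ := fun t ht => by
    rw [Real.sqrt_eq_rpow, ← Real.rpow_mul ht.le]; congr 1; rw [hγ]; ring
  have hη2 : ∀ t : ℝ, 0 < t → t ≤ 1 → (t ^ δ) ^ 2 ≤ t ^ γ := fun t h0 h1 => by
    have e2 : (t ^ δ) ^ 2 = t ^ (2 * δ) := by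
      rw [← Real.rpow_natCast, ← Real.rpow_mul h0.le]; congr 1; push_cast; ring
    rw [e2]; exact Real.rpow_le_rpow_of_exponent_ge h0 h1 (by rw [hγ]; linarith)
  have gnn : ∀ n τ, 0 ≤ gq lam v n τ := fun n τ => div_nonneg (integral_nonneg fun x => by positivity) (sq_nonneg _)
  -- the basic quantity
  have hq : ∀ (t1 : ℝ) (h : Sch d) (n : ℕ) (t : ℝ), ADM lam (v 0) Φ Ca t1 (t1 ^ δ) h → t1 ≤ b → 0 < t → t ≤ t1 → t1 ≤ 2 * t →
      √(∫ x, th (n:ℝ) x ^ 2 * ‖(v t - uf (v 0) h 0 t : Sch d) x‖ ^ 2) / t ≤ 2 * Y := fun t1 h n t hA hb1 ht0 ht ht2 => by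
    rw [div_le_iff₀ ht0]
    refine (th_n2_le n (rd (v t - uf (v 0) h 0 t : Sch d))).trans ?_
    have h1 := Real.sqrt_le_sqrt (hC2 t1 _ h t hA hb1 ht0 ht).2
    rw [Real.sqrt_mul hC20, Real.sqrt_sq hA.t0.le] at h1
    refine h1.trans ?_
    have := mul_le_mul_of_nonneg_left ht2 hY0
    linarith
  set K1 := C1 + 2 * (N * (4 * Y + N)) with hK1
  have hK10 : 0 ≤ K1 := by positivity
  have hit : ∀ n : ℕ, ∀ τ : ℝ, 0 < τ → τ ≤ τ0 → gq lam v n τ ≤ gq lam v n (τ/2) + K1 * τ ^ γ := fun n τ h0 h1 => by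
    have hb1 : τ ≤ b := h1.trans (min_le_left _ _)
    have h11 : τ ≤ 1 := h1.trans (min_le_right _ _)
    obtain ⟨h, hA⟩ := hadm τ h0 h11
    have s1 := hC1 τ _ h n hA hb1
    have c1 := hN τ _ h n τ hA h0
    have c2 := hN τ _ h n (τ/2) hA (by positivity)
    have q1 := hq τ h n τ hA hb1 h0 le_rfl (by linarith)
    have q2 := hq τ h n (τ/2) hA hb1 (by positivity) (by linarith) (by linarith)
    have hh := hη2 τ h0 h11
    have hh1 : (τ ^ δ) ^ 2 ≤ 1 := pow_le_one₀ (by positivity) (Real.rpow_le_one h0.le h11 hδ0.le)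
    rw [hsq τ h0] at s1
    have i1 : ∀ t : ℝ, 0 < t → ∀ I : ℝ, 0 ≤ I → I / t ^ 2 = (√I / t) ^ 2 := fun t ht I hI => by rw [div_pow, Real.sq_sqrt hI]
    rw [i1 τ h0 _ (integral_nonneg fun x => by positivity), i1 (τ/2) (by positivity) _ (integral_nonneg fun x => by positivity)] at s1
    have p1 : 0 ≤ √(∫ x, th (n:ℝ) x ^ 2 * ‖(v τ - uf (v 0) h 0 τ : Sch d) x‖ ^ 2) / τ := by positivity
    have p2 : 0 ≤ √(∫ x, th (n:ℝ) x ^ 2 * ‖(v (τ/2) - uf (v 0) h 0 (τ/2) : Sch d) x‖ ^ 2) / (τ/2) := by positivity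
    rw [← Real.sq_sqrt (gnn n τ), ← Real.sq_sqrt (gnn n (τ/2))]
    generalize √(∫ x, th (n:ℝ) x ^ 2 * ‖(v τ - uf (v 0) h 0 τ : Sch d) x‖ ^ 2) / τ = y1 at *
    generalize √(∫ x, th (n:ℝ) x ^ 2 * ‖(v (τ/2) - uf (v 0) h 0 (τ/2) : Sch d) x‖ ^ 2) / (τ/2) = y2 at *
    have z1 := Real.sqrt_nonneg (gq lam v n τ)
    have z2 := Real.sqrt_nonneg (gq lam v n (τ/2))
    generalize √(gq lam v n τ) = x1 at *
    generalize √(gq lam v n (τ/2)) = x2 at *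
    have dif : ∀ x y : ℝ, 0 ≤ x → 0 ≤ y → y ≤ 2 * Y → |y - x| ≤ N * (τ ^ δ) ^ 2 → |y ^ 2 - x ^ 2| ≤ N * (4 * Y + N) * τ ^ γ := fun x y hx hy hyY hxy => by
      rw [show y ^ 2 - x ^ 2 = (y - x) * (y + x) by ring, abs_mul, abs_of_nonneg (by positivity : 0 ≤ y + x)]
      have w1 : |y - x| ≤ N * τ ^ γ := hxy.trans (mul_le_mul_of_nonneg_left hh hN0)
      have w2 : |y - x| ≤ N := hxy.trans (mul_le_of_le_one_right hN0 hh1)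
      have w3 : y + x ≤ 4 * Y + N := by have := (abs_le.1 w2).1; linarith
      calc _ ≤ N * τ ^ γ * (4 * Y + N) := mul_le_mul w1 w3 (by positivity) (by positivity)
        _ = _ := by ring
    have d1 := (abs_le.1 (dif x1 y1 z1 p1 q1 c1)).1
    have d2 := (abs_le.1 (dif x2 y2 z2 p2 q2 c2)).2
    have : K1 * τ ^ γ = C1 * τ ^ γ + 2 * (N * (4 * Y + N) * τ ^ γ) := by rw [hK1]; ring
    linarith
  have hdy : ∀ n : ℕ, ∀ τ : ℝ, 0 < τ → τ ≤ τ0 → gq lam v n τ ≤ K1 / (1 - 2 ^ (-γ)) * τ ^ γ := fun n => by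
    obtain ⟨K, hK, _, h⟩ := dyad hγ0 hK10 (hit n) (gq_tendsto hv n)
    rwa [hK] at h
  set K := K1 / (1 - 2 ^ (-γ)) with hK
  have hVb : ∀ τ : ℝ, 0 < τ → τ ≤ τ0 → 4 * (e - En lam (v 0)) ≤ (2 * K + 2 * N ^ 2 + C3) * τ ^ γ := fun τ h0 h1 => by
    have hb1 : τ ≤ b := h1.trans (min_le_left _ _)
    have h11 : τ ≤ 1 := h1.trans (min_le_right _ _)
    obtain ⟨h, hA⟩ := hadm τ h0 h11
    have hh := hη2 τ h0 h11
    have hh0 : 0 ≤ (τ ^ δ) ^ 2 := by positivity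
    have hh1 : (τ ^ δ) ^ 2 ≤ 1 := pow_le_one₀ (by positivity) (Real.rpow_le_one h0.le h11 hδ0.le)
    have h5 := (abs_le.1 (hC3 τ _ h τ hA hb1 h0.le le_rfl)).1
    have hn : ∀ n : ℕ, (∫ x, th (n:ℝ) x ^ 2 * ‖(v τ - uf (v 0) h 0 τ : Sch d) x‖ ^ 2) ≤ (2 * K + 2 * N ^ 2) * τ ^ γ * τ ^ 2 := fun n => by
      have c1 := (abs_le.1 (hN τ _ h n τ hA h0)).2
      have c2 := hdy n τ h0 h1
      have hI : 0 ≤ ∫ x, th (n:ℝ) x ^ 2 * ‖(v τ - uf (v 0) h 0 τ : Sch d) x‖ ^ 2 := integral_nonneg fun x => by positivity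
      have c3 : (∫ x, th (n:ℝ) x ^ 2 * ‖(v τ - uf (v 0) h 0 τ : Sch d) x‖ ^ 2) = (√(∫ x, th (n:ℝ) x ^ 2 * ‖(v τ - uf (v 0) h 0 τ : Sch d) x‖ ^ 2) / τ) ^ 2 * τ ^ 2 := by
        rw [div_pow, Real.sq_sqrt hI]; field_simp
      rw [c3]
      refine mul_le_mul_of_nonneg_right ?_ (sq_nonneg τ)
      have p1 : 0 ≤ √(∫ x, th (n:ℝ) x ^ 2 * ‖(v τ - uf (v 0) h 0 τ : Sch d) x‖ ^ 2) / τ := by positivity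
      generalize √(∫ x, th (n:ℝ) x ^ 2 * ‖(v τ - uf (v 0) h 0 τ : Sch d) x‖ ^ 2) / τ = y at *
      rw [← Real.sq_sqrt (gnn n τ)] at c2
      have z1 := Real.sqrt_nonneg (gq lam v n τ)
      generalize √(gq lam v n τ) = x at *
      have w1 : y ≤ x + N * (τ ^ δ) ^ 2 := by linarith
      have w2 : y ^ 2 ≤ (x + N * (τ ^ δ) ^ 2) ^ 2 := pow_le_pow_left₀ p1 w1 2
      have w3 : (x + N * (τ ^ δ) ^ 2) ^ 2 ≤ 2 * x ^ 2 + 2 * (N * (τ ^ δ) ^ 2) ^ 2 := by nlinarith [sq_nonneg (x - N * (τ ^ δ) ^ 2)]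
      have w4 : (N * (τ ^ δ) ^ 2) ^ 2 ≤ N ^ 2 * τ ^ γ := by
        rw [mul_pow]
        refine mul_le_mul_of_nonneg_left ?_ (sq_nonneg N)
        calc ((τ ^ δ) ^ 2) ^ 2 = (τ ^ δ) ^ 2 * (τ ^ δ) ^ 2 := by ring
          _ ≤ (τ ^ δ) ^ 2 * 1 := mul_le_mul_of_nonneg_left hh1 hh0
          _ ≤ _ := by rw [mul_one]; exact hh
      linarith
    have hV : V (v τ - uf (v 0) h 0 τ) ≤ (2 * K + 2 * N ^ 2) * τ ^ γ * τ ^ 2 :=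
      le_of_tendsto (th_tendsto (rd (v τ - uf (v 0) h 0 τ : Sch d))) (Eventually.of_forall hn)
    have hδγ : τ ^ δ ≤ τ ^ γ := Real.rpow_le_rpow_of_exponent_ge h0 h11 (by rw [hγ]; linarith)
    have h6 : C3 * (τ ^ 2 * τ ^ δ) ≤ C3 * (τ ^ 2 * τ ^ γ) := by gcongr
    have h7 : 4 * (e - En lam (v 0)) * τ ^ 2 ≤ (2 * K + 2 * N ^ 2 + C3) * τ ^ γ * τ ^ 2 := by linarith
    exact le_of_mul_le_mul_right h7 (by positivity)
  have hl : Tendsto (fun τ : ℝ => (2 * K + 2 * N ^ 2 + C3) * τ ^ γ) (nhdsWithin 0 (Set.Ioi 0)) (nhds ((2 * K + 2 * N ^ 2 + C3) * 0 ^ γ)) :=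
    (((Real.continuous_rpow_const hγ0.le).tendsto 0).mono_left nhdsWithin_le_nhds).const_mul _
  rw [Real.zero_rpow hγ0.ne', mul_zero] at hl
  have hmem : Set.Ioo 0 τ0 ∈ nhdsWithin (0:ℝ) (Set.Ioi 0) := Ioo_mem_nhdsGT hτ00
  have := ge_of_tendsto hl (by filter_upwards [hmem] with τ hτ using hVb τ hτ.1 hτ.2.le)
  linarith

theorem U0 (hd : 1 ≤ d) (hv : IsSol lam v) (hb : 0 < b) (hS : ∀ τ ∈ Set.Icc 0 b, S2 (v τ) ≤ S0)
    (hE : ∀ τ ∈ Set.Ioo 0 b, En lam (v τ) = e) : En lam (v 0) = e := by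
  refine le_antisymm (En_le_of_const hd hv hb hS hE (Set.left_mem_Icc.2 hb.le)) ?_
  refine U1 hd hv (half_pos hb) (fun τ hτ => hS τ ⟨hτ.1, by linarith [hτ.2]⟩) (fun τ hτ => hE τ ⟨hτ.1, by linarith [hτ.2]⟩)
end HS

namespace HS
open Complex ComplexConjugate
variable {d : ℕ} {lam : ℝ} {v : ℝ → Sch d} {a b S0 e : ℝ}

theorem IsSol.shift (hv : IsSol lam v) (c : ℝ) : IsSol lam (fun t => v (t + c)) := by
  refine ⟨?_, fun t x => ?_⟩
  · exact ContDiff.comp (g := fun p : ℝ × Ed d => v p.1 p.2) (f := fun p : ℝ × Ed d => (p.1 + c, p.2)) hv.smooth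
      ((contDiff_fst.add contDiff_const).prodMk contDiff_snd)
  · rw [deriv_comp_add_const (f := fun s => v s x)]
    exact hv.eq _ _

/-- complex conjugate of a Schwartz function -/
def cj (u : Sch d) : Sch d := u.postcompCLM (conjCLE : ℂ →L[ℝ] ℂ)
theorem cj_apply (u : Sch d) (x : Ed d) : cj u x = conj (u x) := rfl
theorem D_cj (i : Fin d) (u : Sch d) : D i (cj u) = cj (D i u) := by
  ext x
  rw [cj_apply, D_apply, D_apply]
  unfold pd
  have h : HasFDerivAt (u : Ed d → ℂ) (fderiv ℝ u x) x := (u.differentiableAt).hasFDerivAt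
  have h2 := ((conjCLE : ℂ →L[ℝ] ℂ).hasFDerivAt (x := u x)).comp (f := u) x h
  have h3 : HasFDerivAt (cj u : Ed d → ℂ) ((conjCLE : ℂ →L[ℝ] ℂ).comp (fderiv ℝ u x)) x := h2
  rw [h3.fderiv]
  rfl

theorem lap_cj (u : Sch d) (x : Ed d) : lap (cj u) x = conj (lap u x) := by
  unfold lap
  rw [map_sum]
  refine Finset.sum_congr rfl fun i _ => ?_
  rw [← D_coe, ← D_apply, D_cj, D_cj, cj_apply, D_apply, D_coe]

theorem S2_cj (u : Sch d) : S2 (cj u) = S2 u := by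
  rw [S2_eq, S2_eq]
  simp only [D_cj, cj_apply, norm_conj]
theorem En_cj (u : Sch d) : En lam (cj u) = En lam u := by
  unfold En
  rw [S2_cj]
  unfold V PP
  simp only [cj_apply, norm_conj]

theorem IsSol.rev (hv : IsSol lam v) : IsSol lam (fun t => cj (v (-t))) := by
  refine ⟨?_, fun t x => ?_⟩
  · have h1 := ContDiff.comp (g := fun p : ℝ × Ed d => v p.1 p.2) (f := fun p : ℝ × Ed d => (-p.1, p.2)) hv.smooth
      ((contDiff_fst.neg).prodMk contDiff_snd)
    exact (conjCLE : ℂ →L[ℝ] ℂ).contDiff.comp h1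
  · have h1 := time_hasDerivAt (w := fun s x => v s x) hv.smooth (-t) x
    have h2 := HasDerivAt.scomp (g₁ := fun s => v s x) t h1 (hasDerivAt_neg t)
    have h3 := (conjCLE : ℂ →L[ℝ] ℂ).hasFDerivAt.comp_hasDerivAt t h2
    have h4 : HasDerivAt (fun s => cj (v (-s)) x) (conj ((-1 : ℝ) • deriv (fun s => v s x) (-t))) t := h3
    rw [h4.deriv, hv.eq, lap_cj, cj_apply, norm_conj]
    simp only [real_smul, map_mul, map_add, map_sub, conj_I, conj_ofReal]
    push_cast
    ring

/-- energy at both ends of a closed gap -/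
theorem UE (hd : 1 ≤ d) (hv : IsSol lam v) (hab : a < b) (hS : ∀ τ ∈ Set.Icc a b, S2 (v τ) ≤ S0)
    (hE : ∀ τ ∈ Set.Ioo a b, En lam (v τ) = e) : ∀ τ ∈ Set.Icc a b, En lam (v τ) = e := by
  have hl : En lam (v a) = e := by
    have := U0 (b := b - a) (S0 := S0) (e := e) hd (hv.shift a) (by linarith) (fun τ hτ => hS _ ⟨by linarith [hτ.1], by linarith [hτ.2]⟩)
      (fun τ hτ => hE _ ⟨by linarith [hτ.1], by linarith [hτ.2]⟩)
    simpa using this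
  have hr : En lam (v b) = e := by
    have := U0 (b := b - a) (S0 := S0) (e := e) hd (hv.rev.shift (-b)) (by linarith)
      (fun τ hτ => by rw [S2_cj]; exact hS _ ⟨by linarith [hτ.2], by linarith [hτ.1]⟩)
      (fun τ hτ => by rw [En_cj]; exact hE _ ⟨by linarith [hτ.2], by linarith [hτ.1]⟩)
    rw [En_cj] at this
    simpa using this
  intro τ hτ
  rcases hτ.1.eq_or_lt with h | h
  · rw [← h]; exact hl
  rcases hτ.2.eq_or_lt with h' | h'
  · rw [h']; exact hr
  exact hE τ ⟨h, h'⟩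

/-- Baire category in locally closed subsets of the line -/
theorem baire_line {K U : Set ℝ} (hK : IsClosed K) (hU : IsOpen U) (hne : (K ∩ U).Nonempty) {F : ℕ → Set ℝ}
    (hF : ∀ n, IsClosed (F n)) (hc : K ∩ U ⊆ ⋃ n, F n) {ρ : ℕ → ℝ} (hρ : ∀ n, 0 < ρ n) :
    ∃ n, ∃ c ∈ K, ∃ r, 0 < r ∧ r ≤ ρ n ∧ Set.Icc (c - r) (c + r) ⊆ U ∧ K ∩ Set.Icc (c - r) (c + r) ⊆ F n := by
  have : Nonempty (K ∩ U : Set ℝ) := hne.to_subtype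
  have : LocallyCompactSpace (K ∩ U : Set ℝ) := (hK.isLocallyClosed.inter hU.isLocallyClosed).locallyCompactSpace
  obtain ⟨n, ⟨c, hcU⟩, hcn⟩ := nonempty_interior_of_iUnion_of_closed (X := (K ∩ U : Set ℝ)) (f := fun n => Subtype.val ⁻¹' F n)
    (fun n => (hF n).preimage continuous_subtype_val) (by
      ext ⟨x, hx⟩
      obtain ⟨n, hn⟩ := Set.mem_iUnion.1 (hc hx)
      simp only [Set.mem_iUnion, Set.mem_univ, iff_true]
      exact ⟨n, hn⟩)
  have h1 := mem_interior_iff_mem_nhds.1 hcn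
  obtain ⟨W, hW, hWF⟩ := (mem_nhds_subtype _ _ _).1 h1
  obtain ⟨r, hr, hrb⟩ := Metric.mem_nhds_iff.1 (inter_mem hW (hU.mem_nhds hcU.2))
  set r' := min (r / 2) (ρ n)
  have hr' : 0 < r' := lt_min (by linarith) (hρ n)
  have hsub : ∀ x ∈ Set.Icc (c - r') (c + r'), x ∈ W ∩ U := fun x hx => hrb (by
    have : r' ≤ r / 2 := min_le_left _ _
    rw [Metric.mem_ball, Real.dist_eq, abs_lt]; constructor <;> linarith [hx.1, hx.2])
  exact ⟨n, c, hcU.1, r', hr', min_le_right _ _, fun x hx => (hsub x hx).2, fun x hx => hWF (a := ⟨x, hx.1, (hsub x hx.2).2⟩) (hsub x hx.2).1⟩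

theorem dini_mono {E : ℝ → ℝ} (hc : ContinuousOn E (Set.Icc a b))
    (hD : ∀ s ∈ Set.Icc a b, ∀ ε > 0, ∀ᶠ t in nhdsWithin s (Set.Icc a b), E s - ε * |t - s| ≤ E t) :
    ∀ x ∈ Set.Icc a b, E a ≤ E x := by
  intro x hx
  have := image_le_of_liminf_slope_right_le_deriv_boundary (f := fun t => -E t) (a := a) (b := b) hc.neg
    (B := fun _ => -E a) (B' := fun _ => 0) le_rfl continuousOn_const (fun x _ => hasDerivWithinAt_const _ _ _)
    (fun s hs r hr => by
      refine Eventually.frequently ?_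
      have hm : Set.Icc a b ∈ nhdsWithin s (Set.Ioi s) := mem_of_superset (Ioo_mem_nhdsGT hs.2) fun y hy => ⟨hs.1.trans hy.1.le, hy.2.le⟩
      have h1 := (hD s ⟨hs.1, hs.2.le⟩ (r/2) (by positivity)).filter_mono (le_inf nhdsWithin_le_nhds (le_principal_iff.2 hm) : nhdsWithin s (Set.Ioi s) ≤ _)
      filter_upwards [h1, self_mem_nhdsWithin] with t h2 h3
      have h4 : 0 < t - s := sub_pos.2 h3
      rw [abs_of_pos h4] at h2
      rw [slope_def_field, div_lt_iff₀ h4]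
      have := mul_pos hr h4
      linarith) hx
  linarith

theorem dini_const {E : ℝ → ℝ} (hc : ContinuousOn E (Set.Icc a b))
    (hD : ∀ s ∈ Set.Icc a b, ∀ ε > 0, ∀ᶠ t in nhdsWithin s (Set.Icc a b), E s - ε * |t - s| ≤ E t) :
    ∀ x ∈ Set.Icc a b, E x = E a := by
  intro x hx
  refine le_antisymm ?_ (dini_mono hc hD x hx)
  have hcn : ContinuousOn (fun t => E (-t)) (Set.Icc (-x) (-a)) :=
    hc.comp continuous_neg.continuousOn fun t ht => ⟨by linarith [ht.2], by linarith [ht.1, hx.2]⟩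
  have := dini_mono (E := fun t => E (-t)) hcn (fun s hs ε hε => by
    have hm : Set.MapsTo (fun t : ℝ => -t) (Set.Icc (-x) (-a)) (Set.Icc a b) := fun t ht => ⟨by linarith [ht.2], by linarith [ht.1, hx.2]⟩
    have ht : Tendsto (fun t : ℝ => -t) (nhdsWithin s (Set.Icc (-x) (-a))) (nhdsWithin (-s) (Set.Icc a b)) :=
      (continuous_neg.continuousWithinAt (s := Set.Icc (-x) (-a)) (x := s)).tendsto_nhdsWithin hm
    filter_upwards [ht.eventually (hD (-s) (hm hs) ε hε)] with t h2
    rwa [show -t - -s = -(t - s) by ring, abs_neg] at h2) (-a) ⟨by linarith [hx.1], le_rfl⟩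
  simpa using this

/-- good times -/
def good (lam : ℝ) (v : ℝ → Sch d) (t : ℝ) : Prop :=
  ∃ r, 0 < r ∧ (∃ S0, ∀ τ ∈ Set.Icc (t - r) (t + r), S2 (v τ) ≤ S0) ∧ ∃ e, ∀ τ ∈ Set.Icc (t - r) (t + r), En lam (v τ) = e

theorem good_open : IsOpen {t | good lam v t} := by
  rw [Metric.isOpen_iff]
  rintro t ⟨r, hr, ⟨S0, hS⟩, e, he⟩
  refine ⟨r / 2, by positivity, fun s hs => ?_⟩
  rw [Metric.mem_ball, Real.dist_eq, abs_lt] at hs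
  have hsub : ∀ τ ∈ Set.Icc (s - r/2) (s + r/2), τ ∈ Set.Icc (t - r) (t + r) := fun τ hτ => ⟨by linarith [hτ.1], by linarith [hτ.2]⟩
  exact ⟨r / 2, by positivity, ⟨S0, fun τ hτ => hS τ (hsub τ hτ)⟩, e, fun τ hτ => he τ (hsub τ hτ)⟩

theorem good_bdd (h : ∀ τ ∈ Set.Icc a b, good lam v τ) : ∃ S0, ∀ τ ∈ Set.Icc a b, S2 (v τ) ≤ S0 := by
  refine isCompact_Icc.induction_on (p := fun s => ∃ S0, ∀ τ ∈ s, S2 (v τ) ≤ S0) ⟨0, by simp⟩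
    (fun s t hst ⟨S0, h⟩ => ⟨S0, fun τ hτ => h τ (hst hτ)⟩) (fun s t ⟨S1, h1⟩ ⟨S2, h2⟩ => ⟨max S1 S2, fun τ hτ => ?_⟩) (fun t ht => ?_)
  · rcases hτ with hτ | hτ
    · exact (h1 τ hτ).trans (le_max_left _ _)
    · exact (h2 τ hτ).trans (le_max_right _ _)
  · obtain ⟨r, hr, hS, _⟩ := h t ht
    exact ⟨_, mem_nhdsWithin_of_mem_nhds (Icc_mem_nhds (by linarith) (by linarith)), hS⟩

theorem GAP (hd : 1 ≤ d) (hv : IsSol lam v) (hab : a < b) (h : ∀ τ ∈ Set.Ioo a b, good lam v τ) :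
    (∀ a' b', a < a' → b' < b → ∃ S0, ∀ τ ∈ Set.Icc a' b', S2 (v τ) ≤ S0) ∧ (∃ S0, ∀ τ ∈ Set.Icc a b, S2 (v τ) ≤ S0) ∧
      ∃ e, ∀ τ ∈ Set.Icc a b, En lam (v τ) = e := by
  have h1 : ∀ a' b', a < a' → b' < b → ∃ S0, ∀ τ ∈ Set.Icc a' b', S2 (v τ) ≤ S0 := fun a' b' ha hb =>
    good_bdd fun τ hτ => h τ ⟨ha.trans_le hτ.1, hτ.2.trans_lt hb⟩
  have hder : ∀ τ ∈ Set.Ioo a b, HasDerivAt (fun t => En lam (v t)) 0 τ := fun τ hτ => by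
    obtain ⟨r, hr, _, e, he⟩ := h τ hτ
    refine (hasDerivAt_const τ e).congr_of_eventuallyEq ?_
    filter_upwards [Icc_mem_nhds (show τ - r < τ by linarith) (show τ < τ + r by linarith)] with t ht using he t ht
  have h2 : ∀ τ ∈ Set.Ioo a b, En lam (v τ) = En lam (v ((a+b)/2)) := fun τ hτ => by
    exact isOpen_Ioo.is_const_of_deriv_eq_zero isPreconnected_Ioo (fun s hs => (hder s hs).differentiableAt.differentiableWithinAt)
      (fun s hs => (hder s hs).deriv) hτ ⟨by linarith, by linarith⟩
  obtain ⟨S0, hS⟩ := GLB hd hv hab h1 h2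
  exact ⟨h1, ⟨S0, hS⟩, _, UE hd hv hab hS h2⟩

/-- the first point of a closed set in an interval -/
theorem first_pt {K : Set ℝ} (hK : IsClosed K) {c : ℝ} (hc : c ∈ K ∩ Set.Icc a b) :
    ∃ p ∈ K, a ≤ p ∧ p ≤ c ∧ ∀ τ ∈ Set.Ico a p, τ ∉ K := by
  obtain ⟨p, hp, hl⟩ := ((isCompact_Icc (a := a) (b := b)).inter_left hK).exists_isLeast ⟨c, hc⟩
  exact ⟨p, hp.1, hp.2.1, hl hc, fun τ hτ hτK => absurd (hl ⟨hτK, hτ.1, hτ.2.le.trans hp.2.2⟩) (not_le.2 hτ.2)⟩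

theorem last_pt {K : Set ℝ} (hK : IsClosed K) {c : ℝ} (hc : c ∈ K ∩ Set.Icc a b) :
    ∃ p ∈ K, p ≤ b ∧ c ≤ p ∧ ∀ τ ∈ Set.Ioc p b, τ ∉ K := by
  obtain ⟨p, hp, hl⟩ := ((isCompact_Icc (a := a) (b := b)).inter_left hK).exists_isGreatest ⟨c, hc⟩
  exact ⟨p, hp.1, hp.2.2, hl hc, fun τ hτ hτK => absurd (hl ⟨hτK, hp.2.1.trans hτ.1.le, hτ.2⟩) (not_le.2 hτ.1)⟩

theorem all_good (hd : 1 ≤ d) (hv : IsSol lam v) (t : ℝ) : good lam v t := by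
  by_contra hbad
  set K : Set ℝ := {t | good lam v t}ᶜ with hKd
  have hK : IsClosed K := good_open.isClosed_compl
  have hKn : ∀ {τ}, τ ∉ K → good lam v τ := fun {τ} h => by simpa [hKd] using h
  have htK : t ∈ K := hbad
  -- first category argument
  obtain ⟨n, c, hcK, r, hr, hr8, -, hF⟩ := baire_line hK isOpen_univ ⟨t, htK, trivial⟩ (F := fun n : ℕ => {t | BD (n:ℝ) (v t)})
    (fun n => BD_closed hv.smooth n) (fun s _ => Set.mem_iUnion.2 (BD_exists (v s))) (ρ := fun _ => 1/8) (fun _ => by norm_num)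
  obtain ⟨Sm, hSm⟩ := PROP1 hd hv (c - r) (c + r) n
  have hcI : c ∈ K ∩ Set.Icc (c - r) (c + r) := ⟨hcK, by linarith, by linarith⟩
  obtain ⟨q, hqK, hqa, hqc, hq⟩ := first_pt hK hcI
  obtain ⟨p, hpK, hpb, hcp, hp⟩ := last_pt hK hcI
  have hKS : ∀ τ ∈ K, τ ∈ Set.Icc (c - r) (c + r) → S2 (v τ) ≤ n := fun τ h1 h2 => (hF ⟨h1, h2⟩).2.2.1
  have hL : ∃ Sl, ∀ τ ∈ Set.Ico (c - r) q, S2 (v τ) ≤ Sl := by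
    rcases hqa.eq_or_lt with h | h
    · exact ⟨0, fun τ hτ => absurd (hτ.1.trans_lt hτ.2) (by rw [h]; exact lt_irrefl _)⟩
    · obtain ⟨-, ⟨Sl, hSl⟩, -⟩ := GAP hd hv h fun τ hτ => hKn (hq τ ⟨hτ.1.le, hτ.2⟩)
      exact ⟨Sl, fun τ hτ => hSl τ ⟨hτ.1, hτ.2.le⟩⟩
  have hR : ∃ Sr, ∀ τ ∈ Set.Ioc p (c + r), S2 (v τ) ≤ Sr := by
    rcases hpb.eq_or_lt with h | h
    · exact ⟨0, fun τ hτ => absurd (hτ.1.trans_le hτ.2) (by rw [h]; exact lt_irrefl _)⟩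
    · obtain ⟨-, ⟨Sl, hSl⟩, -⟩ := GAP hd hv h fun τ hτ => hKn (hp τ ⟨hτ.1, hτ.2.le⟩)
      exact ⟨Sl, fun τ hτ => hSl τ ⟨hτ.1.le, hτ.2⟩⟩
  obtain ⟨Sl, hSl⟩ := hL
  obtain ⟨Sr, hSr⟩ := hR
  set S0 := max (max Sl Sr) (max (n:ℝ) Sm) with hS0
  have hS : ∀ τ ∈ Set.Icc (c - r) (c + r), S2 (v τ) ≤ S0 := fun τ hτ => by
    rcases lt_or_ge τ q with h1 | h1
    · exact (hSl τ ⟨hτ.1, h1⟩).trans ((le_max_left _ _).trans (le_max_left _ _))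
    rcases lt_or_ge p τ with h2 | h2
    · exact (hSr τ ⟨h2, hτ.2⟩).trans ((le_max_right _ _).trans (le_max_left _ _))
    by_cases hτK : τ ∈ K
    · exact (hKS τ hτK hτ).trans ((le_max_left _ _).trans (le_max_right _ _))
    obtain ⟨x, hxK, hxτ, hqx, hx⟩ := last_pt hK (a := q) (b := τ) ⟨hqK, le_rfl, h1⟩
    obtain ⟨y, hyK, hyτ, hyp, hy⟩ := first_pt hK (a := τ) (b := p) ⟨hpK, h2, le_rfl⟩
    have hxτ' : x < τ := hxτ.lt_of_ne fun h => hτK (h ▸ hxK)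
    have hyτ' : τ < y := hyτ.lt_of_ne fun h => hτK (h ▸ hyK)
    obtain ⟨g1, -, e, he⟩ := GAP hd hv (hxτ'.trans hyτ') fun s hs => hKn (by
      rcases le_total s τ with h | h
      · exact hx s ⟨hs.1, h⟩
      · exact hy s ⟨h, hs.2⟩)
    exact (hSm x y e (by linarith) (hxτ'.trans hyτ') (by linarith) (by linarith) (hF ⟨hxK, by linarith, by linarith⟩)
      (hF ⟨hyK, by linarith, by linarith⟩) g1 (fun s hs => he s ⟨hs.1.le, hs.2.le⟩) τ ⟨hxτ, hyτ⟩).trans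
      ((le_max_right _ _).trans (le_max_right _ _))
  clear_value S0
  -- second category argument
  set I := Set.Icc (c - r) (c + r) with hI
  have hcl : ∀ n : ℕ, IsClosed {x | x ∈ I ∧ ∀ y ∈ I, |y - x| < 1 / ((n:ℝ) + 1) → En lam (v x) - |y - x| ≤ En lam (v y)} := fun n => by
    refine IsSeqClosed.isClosed fun s x hs hsx => ?_
    have hxI : x ∈ I := isClosed_Icc.mem_of_tendsto hsx (Eventually.of_forall fun k => (hs k).1)
    refine ⟨hxI, fun y hy hyx => le_of_forall_pos_le_add fun ε hε => ?_⟩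
    have hsw : Tendsto s atTop (nhdsWithin x I) := tendsto_nhdsWithin_iff.2 ⟨hsx, Eventually.of_forall fun k => (hs k).1⟩
    have e1 := hsw.eventually (En_lsc hd hv hS hxI (half_pos hε))
    have t1 : Tendsto (fun k => |y - s k|) atTop (nhds |y - x|) := (hsx.const_sub y).abs
    have e2 := t1.eventually (gt_mem_nhds hyx)
    have e3 := t1.eventually (gt_mem_nhds (show |y - x| < |y - x| + ε / 2 by linarith))
    obtain ⟨k, h1, h2, h3⟩ := (e1.and (e2.and e3)).exists
    have h4 := (hs k).2 y hy h2
    linarith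
  obtain ⟨n2, c2, hc2K, r2, hr2, hr2n, hsub, hF2⟩ := baire_line hK (isOpen_Ioo (a := c - r) (b := c + r)) ⟨c, hcK, by linarith, by linarith⟩ hcl
    (fun x hx => by
      have hxI : x ∈ I := Set.Ioo_subset_Icc_self hx.2
      have h1 := C7 hd hv hS hxI one_pos
      obtain ⟨δ, hδ, h2⟩ := Metric.mem_nhdsWithin_iff.1 h1
      obtain ⟨m, hm⟩ := exists_nat_one_div_lt hδ
      refine Set.mem_iUnion.2 ⟨m, hxI, fun y hy hyx => ?_⟩
      have := h2 ⟨by rw [Metric.mem_ball, Real.dist_eq]; exact hyx.trans hm, hy⟩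
      simpa using this) (ρ := fun n => 1 / (4 * ((n:ℝ) + 1))) (fun n => by positivity)
  have hsubI : Set.Icc (c2 - r2) (c2 + r2) ⊆ I := hsub.trans Set.Ioo_subset_Icc_self
  have hr2n' : 2 * r2 < 1 / ((n2:ℝ) + 1) := by
    have h1 : (1:ℝ) / (4 * ((n2:ℝ) + 1)) = 1 / ((n2:ℝ) + 1) / 4 := by rw [div_div, mul_comm]
    have h2 : 0 < 1 / ((n2:ℝ) + 1) := by positivity
    rw [h1] at hr2n
    linarith
  have hKK : ∀ x ∈ K, ∀ y ∈ K, x ∈ Set.Icc (c2 - r2) (c2 + r2) → y ∈ Set.Icc (c2 - r2) (c2 + r2) →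
      |En lam (v y) - En lam (v x)| ≤ |y - x| := fun x hxK y hyK hx hy => by
    have h0 : |y - x| < 1 / ((n2:ℝ) + 1) := lt_of_le_of_lt (abs_le.2 ⟨by linarith [hx.1, hx.2, hy.1, hy.2], by linarith [hx.1, hx.2, hy.1, hy.2]⟩) hr2n'
    have h1 := (hF2 ⟨hxK, hx⟩).2 y (hsubI hy) h0
    have h2 := (hF2 ⟨hyK, hy⟩).2 x (hsubI hx) (by rwa [abs_sub_comm])
    rw [abs_sub_comm] at h2
    exact abs_le.2 ⟨by linarith, by linarith⟩
  have hG : ∀ x y : ℝ, x ≤ y → (∀ τ ∈ Set.Ioo x y, τ ∉ K) → En lam (v y) = En lam (v x) := fun x y hxy h => by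
    rcases hxy.eq_or_lt with h1 | h1
    · rw [h1]
    · obtain ⟨-, -, e, he⟩ := GAP hd hv h1 fun τ hτ => hKn (h τ hτ)
      rw [he x ⟨le_rfl, hxy⟩, he y ⟨hxy, le_rfl⟩]
  have hlip : ∀ x ∈ Set.Icc (c2 - r2) (c2 + r2), ∀ y ∈ Set.Icc (c2 - r2) (c2 + r2), x ≤ y →
      |En lam (v y) - En lam (v x)| ≤ |y - x| := fun x hx y hy hxy => by
    by_cases hne : (K ∩ Set.Icc x y).Nonempty
    · obtain ⟨z, hz⟩ := hne
      obtain ⟨q, hqK, hqa, hqc, hq⟩ := first_pt hK hz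
      obtain ⟨p, hpK, hpb, hcp, hp⟩ := last_pt hK hz
      rw [hG p y hpb fun τ hτ => hp τ ⟨hτ.1, hτ.2.le⟩, ← hG x q hqa fun τ hτ => hq τ ⟨hτ.1.le, hτ.2⟩]
      refine (hKK q hqK p hpK ⟨by linarith [hx.1], by linarith [hy.2]⟩ ⟨by linarith [hx.1], by linarith [hy.2]⟩).trans ?_
      rw [abs_of_nonneg (by linarith), abs_of_nonneg (by linarith)]
      linarith
    · rw [hG x y hxy fun τ hτ hτK => hne ⟨τ, hτK, hτ.1.le, hτ.2.le⟩, sub_self, abs_zero]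
      exact abs_nonneg _
  have hcont : ContinuousOn (fun t => En lam (v t)) (Set.Icc (c2 - r2) (c2 + r2)) := by
    have : LipschitzOnWith 1 (fun t => En lam (v t)) (Set.Icc (c2 - r2) (c2 + r2)) := LipschitzOnWith.of_dist_le_mul fun x hx y hy => by
      rw [NNReal.coe_one, one_mul, Real.dist_eq, Real.dist_eq]
      rcases le_total x y with h | h
      · rw [abs_sub_comm, abs_sub_comm x]; exact hlip x hx y hy h
      · exact hlip y hy x hx h
    exact this.continuousOn
  have hconst := dini_const hcont fun s hs ε hε => C7 hd hv (fun τ hτ => hS τ (hsubI hτ)) hs hε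
  exact hc2K ⟨r2, hr2, ⟨S0, fun τ hτ => hS τ (hsubI hτ)⟩, _, hconst⟩

theorem S2_bdd (hd : 1 ≤ d) (hv : IsSol lam v) (a b : ℝ) : ∃ S0, ∀ τ ∈ Set.Icc a b, S2 (v τ) ≤ S0 :=
  good_bdd fun τ _ => all_good hd hv τ
end HS

namespace HS
open Complex ComplexConjugate
variable {d : ℕ} {lam : ℝ} {v : ℝ → Sch d}

/-- the separating weight -/
def sw (A : Set (Ed d)) (D : ℝ) (x : Ed d) : ℝ := min 1 (Metric.infDist x A / D)

theorem sw_lip (A : Set (Ed d)) {D : ℝ} (hD : 0 < D) (x y : Ed d) : |sw A D x - sw A D y| ≤ 1 / D * dist x y := by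
  unfold sw
  have h1 : |Metric.infDist x A - Metric.infDist y A| ≤ dist x y := by
    have := (Metric.lipschitz_infDist_pt A).dist_le_mul x y
    rwa [NNReal.coe_one, one_mul, Real.dist_eq] at this
  refine (abs_min_sub_min_le_max _ _ _ _).trans ?_
  rw [sub_self, abs_zero, ← sub_div, abs_div, abs_of_pos hD, max_eq_right (by positivity), div_mul_eq_mul_div, one_mul]
  gcongr

theorem sw_nonneg (A : Set (Ed d)) {D : ℝ} (hD : 0 < D) (x : Ed d) : 0 ≤ sw A D x :=
  le_min zero_le_one (div_nonneg Metric.infDist_nonneg hD.le)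
theorem sw_le (A : Set (Ed d)) (D : ℝ) (x : Ed d) : sw A D x ≤ 1 := min_le_left _ _
theorem sw_cont (A : Set (Ed d)) (D : ℝ) : Continuous (sw A D) :=
  continuous_const.min ((Metric.continuous_infDist_pt A).div_const D)

theorem sw_ct_lip (A : Set (Ed d)) {D : ℝ} (hD : 0 < D) {R : ℝ} (hR : 0 < R) :
    LipschitzWith (Real.toNNReal (1 / D + 1 / R)) (fun x => sw A D x * ct R x) := by
  refine LipschitzWith.of_dist_le_mul fun x y => ?_
  rw [Real.coe_toNNReal _ (by positivity), Real.dist_eq]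
  have h1 := sw_lip A hD x y
  have h2 := (ct_lip (d := d) hR).dist_le_mul x y
  rw [Real.coe_toNNReal _ (by positivity), Real.dist_eq] at h2
  have e : sw A D x * ct R x - sw A D y * ct R y = (sw A D x - sw A D y) * ct R x + sw A D y * (ct R x - ct R y) := by ring
  rw [e]
  refine (abs_add_le _ _).trans ?_
  rw [abs_mul, abs_mul, abs_of_nonneg (ct_nonneg R x), abs_of_nonneg (sw_nonneg A hD y)]
  have h3 := mul_le_mul_of_nonneg_left (ct_le_one hR x) (abs_nonneg (sw A D x - sw A D y))
  have h4 := mul_le_mul_of_nonneg_right (sw_le A D y) (abs_nonneg (ct R x - ct R y))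
  rw [add_mul]
  linarith

theorem sw_rd (A : Set (Ed d)) {D : ℝ} (hD : 0 < D) (u : Sch d) : RD (fun x => sw A D x ^ 2 * ‖u x‖ ^ 2) := by
  refine ((rd u).norm.pow two_ne_zero).of_le (((sw_cont A D).pow 2).mul ((rd u).cont.norm.pow 2)) fun x => ?_
  rw [norm_mul, norm_pow, Real.norm_of_nonneg (sw_nonneg A hD x)]
  exact mul_le_of_le_one_left (norm_nonneg _) (pow_le_one₀ (sw_nonneg A hD x) (sw_le A D x))

theorem sw_tendsto (A : Set (Ed d)) {D : ℝ} (hD : 0 < D) (u : Sch d) :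
    Tendsto (fun n : ℕ => √(∫ x, (sw A D x * ct (n+1:ℝ) x) ^ 2 * ‖u x‖ ^ 2)) atTop (nhds √(∫ x, sw A D x ^ 2 * ‖u x‖ ^ 2)) := by
  refine Tendsto.sqrt ?_
  rw [tendsto_iff_norm_sub_tendsto_zero]
  set g : Ed d → ℝ := fun x => sw A D x ^ 2 * ‖u x‖ ^ 2 with hg
  have h0 : Tendsto (fun n : ℕ => 2 / ((n:ℝ)+1) * ∫ x, ‖x‖ * |g x|) atTop (nhds (0 * ∫ x, ‖x‖ * |g x|)) := by
    exact (Tendsto.div_atTop tendsto_const_nhds (tendsto_atTop_add_const_right _ _ tendsto_natCast_atTop_atTop)).mul_const _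
  rw [zero_mul] at h0
  refine squeeze_zero (fun n => norm_nonneg _) (fun n => ?_) h0
  have := ct_int (R := (n:ℝ)+1) (by positivity) (sw_rd A hD u)
  rw [Real.norm_eq_abs]
  refine le_of_eq_of_le ?_ this
  congr 3
  funext x
  ring

theorem weighted (hv : IsSol lam v) (A : Set (Ed d)) {D : ℝ} (hD : 0 < D) {t S : ℝ} (ht : 0 ≤ t)
    (hS : ∀ τ ∈ Set.Icc 0 t, √(S2 (v τ)) ≤ S) :
    √(∫ x, sw A D x ^ 2 * ‖v t x‖ ^ 2) ≤ 2 * t * S / D + √(∫ x, sw A D x ^ 2 * ‖v 0 x‖ ^ 2) := by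
  have h1 : ∀ n : ℕ, √(∫ x, (sw A D x * ct (n+1:ℝ) x) ^ 2 * ‖v t x‖ ^ 2) ≤
      2 * (1 / D + 1 / ((n:ℝ) + 1)) * S * (t - 0) + √(∫ x, (sw A D x * ct (n+1:ℝ) x) ^ 2 * ‖v 0 x‖ ^ 2) := fun n => by
    have hn : (0:ℝ) < n + 1 := by positivity
    have h := TL hv (sw_ct_lip A hD hn) ((ct_supp hn).mul_left) ht hS
    rw [Real.coe_toNNReal _ (by positivity)] at h
    have := (abs_le.1 h).2
    linarith
  have h2 : Tendsto (fun n : ℕ => 2 * (1 / D + 1 / ((n:ℝ) + 1)) * S * (t - 0)) atTop (nhds (2 * (1 / D + 0) * S * (t - 0))) :=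
    ((((tendsto_one_div_add_atTop_nhds_zero_nat (𝕜 := ℝ)).const_add _).const_mul _).mul_const _).mul_const _
  have h3 := le_of_tendsto_of_tendsto' (sw_tendsto A hD (v t)) (h2.add (sw_tendsto A hD (v 0))) h1
  refine h3.trans (le_of_eq ?_)
  ring
end HS

/-- Finite speed of disturbance for the Schrödinger equation with harmonic
potential: if `v` is a Schwartz solution of `i vₜ + Δv − |x|²v + λ|v|^{4/d}v = 0` and
`A, B` are nonempty sets with `dist(A,B) > 0`, then for all `t ≥ 0`,
`‖v(t)‖_{L²(B)} ≤ 2 t sup_{s∈[0,t]}‖∇v(s)‖₂ / dist(A,B) + ‖v(0)‖_{L²(ℝ^d∖A)}`. -/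
theorem disturbance_estimate_harmonic
    {d : ℕ} (hd : 1 ≤ d) (lam : ℝ)
    (v : ℝ → SchwartzMap (Ed d) ℂ)
    (hsmooth : ContDiff ℝ (⊤ : ℕ∞) (fun p : ℝ × Ed d => v p.1 p.2))
    (heq : ∀ t x, deriv (fun s => v s x) t =
      Complex.I * (lap (v t) x - ((‖x‖ ^ 2 : ℝ) : ℂ) * v t x +
        ((lam * ‖v t x‖ ^ ((4 : ℝ) / d) : ℝ) : ℂ) * v t x))
    (A B : Set (Ed d)) (hA : A.Nonempty) (hB : B.Nonempty)
    (hAB : 0 < setDist A B)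
    (t : ℝ) (ht : 0 ≤ t) :
    L2On B (fun x => v t x) ≤
      2 * t * sSup ((fun s => gradL2 (fun x => v s x)) '' Set.Icc 0 t) / setDist A B +
        L2On Aᶜ (fun x => v 0 x) := by
  have hv : HS.IsSol lam v := ⟨hsmooth, heq⟩
  obtain ⟨S0, hS0⟩ := HS.S2_bdd hd hv 0 t
  have hgr : ∀ s, gradL2 (fun x => v s x) = √(HS.S2 (v s)) := fun s => by
    unfold gradL2 HS.S2
    rw [← Real.sqrt_eq_rpow]
  have hS : ∀ τ ∈ Set.Icc 0 t, √(HS.S2 (v τ)) ≤ sSup ((fun s => gradL2 (fun x => v s x)) '' Set.Icc 0 t) := fun τ hτ => by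
    refine le_csSup ⟨√S0, ?_⟩ ⟨τ, hτ, hgr τ⟩
    rintro _ ⟨s, hs, rfl⟩
    beta_reduce
    rw [hgr]
    exact Real.sqrt_le_sqrt (hS0 s hs)
  have key := HS.weighted hv A hAB ht hS
  unfold L2On
  rw [← Real.sqrt_eq_rpow, ← Real.sqrt_eq_rpow]
  have hBd : ∀ x ∈ closure B, HS.sw A (setDist A B) x = 1 := by
    have hcl : IsClosed {x | HS.sw A (setDist A B) x = 1} := isClosed_eq (HS.sw_cont A _) continuous_const
    refine closure_minimal (fun x hx => ?_) hcl
    refine min_eq_left ?_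
    rw [one_le_div hAB, Metric.le_infDist hA]
    intro y hy
    rw [dist_comm]
    exact csInf_le ⟨0, by rintro _ ⟨p, -, q, -, rfl⟩; exact dist_nonneg⟩ ⟨y, hy, x, hx, rfl⟩
  have hAd : ∀ x ∈ closure A, HS.sw A (setDist A B) x = 0 := fun x hx => by
    unfold HS.sw
    rw [Metric.infDist_zero_of_mem_closure hx, zero_div]
    exact min_eq_right zero_le_one
  have i1 := HS.int_sq (v t)
  have i0 := HS.int_sq (v 0)
  have j1 := (HS.sw_rd A hAB (v t)).integrable
  have j0 := (HS.sw_rd A hAB (v 0)).integrable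
  have b1 : ∫ x in B, ‖v t x‖ ^ 2 ≤ ∫ x, HS.sw A (setDist A B) x ^ 2 * ‖v t x‖ ^ 2 := by
    calc ∫ x in B, ‖v t x‖ ^ 2 ≤ ∫ x in closure B, ‖v t x‖ ^ 2 :=
          setIntegral_mono_set i1.integrableOn (ae_of_all _ fun x => by positivity) (HasSubset.Subset.eventuallyLE subset_closure)
      _ = ∫ x in closure B, HS.sw A (setDist A B) x ^ 2 * ‖v t x‖ ^ 2 :=
          setIntegral_congr_fun isClosed_closure.measurableSet fun x hx => by
            rw [hBd x hx, one_pow, one_mul]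
      _ ≤ _ := setIntegral_le_integral j1 (ae_of_all _ fun x => by positivity)
  have b0 : ∫ x, HS.sw A (setDist A B) x ^ 2 * ‖v 0 x‖ ^ 2 ≤ ∫ x in Aᶜ, ‖v 0 x‖ ^ 2 := by
    calc ∫ x, HS.sw A (setDist A B) x ^ 2 * ‖v 0 x‖ ^ 2 = ∫ x in (closure A)ᶜ, HS.sw A (setDist A B) x ^ 2 * ‖v 0 x‖ ^ 2 :=
          (setIntegral_eq_integral_of_forall_compl_eq_zero fun x hx => by
            rw [hAd x (by simpa using hx)]; simp).symm
      _ ≤ ∫ x in (closure A)ᶜ, ‖v 0 x‖ ^ 2 :=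
          setIntegral_mono j0.integrableOn i0.integrableOn fun x =>
            mul_le_of_le_one_left (by positivity) (pow_le_one₀ (HS.sw_nonneg A hAB x) (HS.sw_le A _ x))
      _ ≤ _ := setIntegral_mono_set i0.integrableOn (ae_of_all _ fun x => by positivity)
          (HasSubset.Subset.eventuallyLE (Set.compl_subset_compl.2 subset_closure))
  exact (Real.sqrt_le_sqrt b1).trans (key.trans (add_le_add le_rfl (Real.sqrt_le_sqrt b0)))
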